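/- For any integer n ≥ 3, the map induced on abelianizations by the stabilization homomorphism ι_n : Cr_n(ℂ) → Cr_{n+1}(ℂ) (i.e., the induced map H₁(Cr_n(ℂ); ℤ) → H₁(Cr_{n+1}(ℂ); ℤ)) is not surjective. -/

import Mathlib

/-!
For any integer `n ≥ 3`, the map induced on abelianizations (first integral homology) by the
stabilization homomorphism `ι_n : Cr_n(ℂ) → Cr_{n+1}(ℂ)` has a non-trivial kernel.

Here `Cr_n(K)` is the group of `K`-algebra automorphisms of the rational function field
`K(x₁, …, xₙ) = FractionRing (MvPolynomial (Fin n) K)`, and the stabilization homomorphism is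
characterized by: `ι_n σ` extends `σ` along the natural inclusion
`K(x₁, …, xₙ) ⊆ K(x₁, …, x_{n+1})` and fixes the last variable `x_{n+1}`.
-/

open MvPolynomial

noncomputable section

set_option maxHeartbeats 1000000
set_option synthInstance.maxHeartbeats 400000

/-- The rational function field `K(x₁, …, xₙ)`. -/
abbrev RatFun (K : Type) [Field K] (n : ℕ) : Type := FractionRing (MvPolynomial (Fin n) K)

/-- The natural inclusion `K(x₁, …, xₙ) ⊆ K(x₁, …, x_{n+1})`, induced by the
inclusion `Fin n ↪ Fin (n+1)` on polynomial variables. -/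
def stabAlg (K : Type) [Field K] (n : ℕ) : RatFun K n →ₐ[K] RatFun K (n+1) :=
  IsFractionRing.liftAlgHom (R := K)
    (g := (IsScalarTower.toAlgHom K (MvPolynomial (Fin (n+1)) K) (RatFun K (n+1))).comp
      (MvPolynomial.rename (Fin.castSucc : Fin n → Fin (n+1))))
    (by
      exact (IsFractionRing.injective (MvPolynomial (Fin (n+1)) K) (RatFun K (n+1))).comp
        (MvPolynomial.rename_injective _ (Fin.castSucc_injective n)))

/-- `τ ∈ Cr_{n+1}(K)` is the stabilization of `σ ∈ Cr_n(K)`: it extends `σ` along the natural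
inclusion `K(x₁, …, xₙ) ⊆ K(x₁, …, x_{n+1})` and fixes the last variable `x_{n+1}`. -/
def IsStabilizationOf {K : Type} [Field K] {n : ℕ}
    (τ : RatFun K (n+1) ≃ₐ[K] RatFun K (n+1)) (σ : RatFun K n ≃ₐ[K] RatFun K n) : Prop :=
  (∀ p : RatFun K n, τ (stabAlg K n p) = stabAlg K n (σ p)) ∧
  τ (algebraMap (MvPolynomial (Fin (n+1)) K) (RatFun K (n+1)) (X (Fin.last n))) =
    algebraMap (MvPolynomial (Fin (n+1)) K) (RatFun K (n+1)) (X (Fin.last n))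

namespace Cremona

universe u

/-- Five-periodic solutions of the Lyness recurrence with product `l`. -/
structure IsLyness {K : Type*} [Field K] (l : K) (x : ZMod 5 → K) : Prop where
  ne : ∀ k, x k ≠ 0
  rel : ∀ k, x (k + 1) * x (k - 1) = 1 + x k
  prod : x 0 * x 1 * x 2 * x 3 * x 4 = l

namespace IsLyness

variable {K : Type*} [Field K] {l : K} {x : ZMod 5 → K}

lemma rels (h : IsLyness l x) : x 1 * x 4 = 1 + x 0 ∧ x 2 * x 0 = 1 + x 1 ∧
    x 3 * x 1 = 1 + x 2 ∧ x 4 * x 2 = 1 + x 3 ∧ x 0 * x 3 = 1 + x 4 :=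
  ⟨h.rel 0, h.rel 1, h.rel 2, h.rel 3, h.rel 4⟩

lemma shift (h : IsLyness l x) (j : ZMod 5) : IsLyness l (fun k => x (k + j)) := by
  refine ⟨fun k => h.ne _, fun k => ?_, ?_⟩
  · have := h.rel (k + j)
    rw [show k + 1 + j = k + j + 1 by ring, show k - 1 + j = k + j - 1 by ring]
    exact this
  · have := h.prod
    fin_cases j <;> rw [← this]
    · show x 0 * x 1 * x 2 * x 3 * x 4 = _; ring
    · show x 1 * x 2 * x 3 * x 4 * x 0 = _; ring
    · show x 2 * x 3 * x 4 * x 0 * x 1 = _; ring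
    · show x 3 * x 4 * x 0 * x 1 * x 2 = _; ring
    · show x 4 * x 0 * x 1 * x 2 * x 3 = _; ring

lemma reflect (h : IsLyness l x) : IsLyness l (fun k => x (-k)) := by
  refine ⟨fun k => h.ne _, fun k => ?_, ?_⟩
  · have := h.rel (-k)
    rw [show -(k + 1) = -k - 1 by ring, show -(k - 1) = -k + 1 by ring, mul_comm]
    exact this
  · rw [← h.prod]
    show x 0 * x 4 * x 3 * x 2 * x 1 = _; ring

lemma map {L : Type*} [Field L] (h : IsLyness l x) (f : K →+* L) :
    IsLyness (f l) (fun k => f (x k)) :=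
  ⟨fun k => (map_ne_zero f).2 (h.ne k), fun k => by simp only [← map_mul, h.rel, map_add, map_one],
    by simp only [← map_mul, h.prod]⟩

lemma curve (h : IsLyness l x) : (1 + x 0) * (1 + x 1) * (1 + x 0 + x 1) = l * x 0 * x 1 := by
  obtain ⟨h0, h1, h2, h3, h4⟩ := h.rels
  have e3 : x 0 * x 3 * x 1 = 1 + x 0 + x 1 := by
    grind
  rw [← h.prod]
  grind

lemma quad (h : IsLyness l x) :
    (1 + x 0) * (x 1 + x 4) = l * x 0 - (1 + x 0) * (2 + x 0) := by
  have h0 := h.rels.1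
  have hc := h.curve
  apply mul_left_cancel₀ (h.ne 1)
  grind

lemma disc (h : IsLyness l x) :
    ((1 + x 0) * (x 1 - x 4)) ^ 2 =
      (l * x 0 - (1 + x 0) * (2 + x 0)) ^ 2 - 4 * (1 + x 0) ^ 3 := by
  rw [← h.quad]
  linear_combination -4 * (1 + x 0) ^ 2 * h.rels.1

/-- The difference between the two neighbours, the value on `x k` of the invariant derivation. -/
def flow (x : ZMod 5 → K) (k : ZMod 5) : K := (1 + x k) * (x (k + 1) - x (k - 1))

lemma sum_eq (h : IsLyness l x) : x 0 + x 1 + x 2 + x 3 + x 4 = l - 3 := by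
  obtain ⟨r0, r1, r2, r3, r4⟩ := h.rels
  apply mul_left_cancel₀ (h.ne 0)
  linear_combination h.quad + r1 + r4

lemma deriv_aux (h : IsLyness l x) (D : Derivation ℤ K K) (hl : D l = 0) :
    (1 + x 0) * (x 1 - x 4) * D (x 1) = (1 + x 1) * (x 2 - x 0) * D (x 0) := by
  have e0 := congrArg D h.rels.1
  have eq : D ((1 + x 0) * (x 1 + x 4)) = D (l * x 0 - (1 + x 0) * (1 + 1 + x 0)) := by
    rw [h.quad]; grind
  simp only [map_add, map_sub, Derivation.leibniz, smul_eq_mul, hl,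
    Derivation.map_one_eq_zero] at e0 eq
  obtain ⟨r0, r1, r2, r3, r4⟩ := h.rels
  linear_combination x 1 * eq - (1 + x 0) * e0 - D (x 0) * x 1 * h.sum_eq + D (x 0) * r2

/-- The Lyness relations force any derivation to be a multiple of the invariant one. -/
lemma deriv_cross (h : IsLyness l x) (D : Derivation ℤ K K) (hl : D l = 0) (k : ZMod 5) :
    flow x k * D (x (k + 1)) = flow x (k + 1) * D (x k) := by
  have := (h.shift k).deriv_aux D hl
  rw [show (4 : ZMod 5) = -1 from rfl, show (1 : ZMod 5) + k = k + 1 by ring,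
    show (2 : ZMod 5) + k = k + 1 + 1 by ring, show -1 + k = k - 1 by ring, zero_add] at this
  simpa only [flow, add_sub_cancel_right] using this

/-- Nonvanishing of the invariant derivation along the sequence. -/
lemma exists_flow_ne (h : IsLyness l x) (hd : l ^ 2 - 11 * l - 1 ≠ 0)
    (hn : ∀ k, 1 + x k ≠ 0) :
    ∃ k, flow x k ≠ 0 := by
  by_contra! hc
  have hk (k : ZMod 5) : x (k + 1) = x (k - 1) := by
    have := hc k
    simp only [flow, mul_eq_zero, hn k, false_or] at this
    grind
  have a1 : x 2 = x 0 := hk 1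
  have a2 : x 4 = x 2 := hk 3
  have a3 : x 1 = x 4 := hk 0
  have a4 : x 3 = x 1 := hk 2
  have e := h.rels.1
  have p := h.prod
  grind

end IsLyness

/-- `k` is algebraically closed in the ambient field. -/
def AlgClosedIn {K : Type*} [Field K] (k : Subfield K) : Prop := ∀ f : K, IsAlgebraic k f → f ∈ k

lemma AlgClosedIn.quad {K : Type*} [Field K] {k : Subfield K} (hk : AlgClosedIn k) {a b c f : K}
    (ha : a ∈ k) (hb : b ∈ k) (hc : c ∈ k) (h : a * f ^ 2 + b * f + c = 0)
    (hne : a ≠ 0 ∨ b ≠ 0 ∨ c ≠ 0) : f ∈ k := by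
  refine hk f ⟨Polynomial.C ⟨a, ha⟩ * Polynomial.X ^ 2 + Polynomial.C ⟨b, hb⟩ * Polynomial.X
    + Polynomial.C ⟨c, hc⟩, fun h0 => ?_, ?_⟩
  · have h2 := congrArg (fun p => Polynomial.coeff p 2) h0
    have h1 := congrArg (fun p => Polynomial.coeff p 1) h0
    have h0 := congrArg (fun p => Polynomial.coeff p 0) h0
    simp [Polynomial.coeff_X, Polynomial.coeff_C] at h0 h1 h2
    have h2' := congrArg Subtype.val h2
    have h1' := congrArg Subtype.val h1
    aesop
  · simpa [Algebra.algebraMap_ofSubsemiring_apply] using h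

lemma AlgClosedIn.of_pow {K : Type*} [Field K] {k : Subfield K} (hk : AlgClosedIn k) {f : K} {n : ℕ}
    (hn : n ≠ 0) (h : f ^ n ∈ k) : f ∈ k := by
  refine hk f (IsAlgebraic.of_pow (Nat.pos_of_ne_zero hn) ?_)
  exact isAlgebraic_algebraMap (⟨f ^ n, h⟩ : k)

namespace IsLyness

variable {K : Type*} [Field K] {l : K} {x : ZMod 5 → K}

lemma one_add_ne (h : IsLyness l x) (k : ZMod 5) : 1 + x k ≠ 0 := by
  rw [← h.rel]; exact mul_ne_zero (h.ne _) (h.ne _)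

lemma prod_ne (h : IsLyness l x) : l ≠ 0 := by
  rw [← h.prod]; simp [h.ne]

lemma mem_succ {k : Subfield K} (hk : AlgClosedIn k) (h : IsLyness l x) (hl : l ∈ k)
    {i : ZMod 5} (hx : x i ∈ k) : x (i + 1) ∈ k := by
  have hc := (h.shift i).curve
  simp only [zero_add] at hc
  rw [add_comm 1 i] at hc
  refine hk.quad (a := 1 + x i) (b := (1 + x i) * (2 + x i) - l * x i) (c := (1 + x i) ^ 2)
    (add_mem (one_mem _) hx) ?_ (pow_mem (add_mem (one_mem _) hx) 2) ?_ (.inl (h.one_add_ne i))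
  · aesop
  grind

lemma mem_all {k : Subfield K} (hk : AlgClosedIn k) (h : IsLyness l x) (hl : l ∈ k)
    {i : ZMod 5} (hx : x i ∈ k) (j : ZMod 5) : x j ∈ k := by
  have key (n : ℕ) : x (i + n) ∈ k := by
    induction n with
    | zero => aesop
    | succ n ih =>
      have := h.mem_succ hk hl ih
      rwa [Nat.cast_succ, ← add_assoc]
  have := key (j - i).val
  aesop

lemma flow_ne {k : Subfield K} (hk : AlgClosedIn k) (h : IsLyness l x) (hl : l ∈ k)
    {i : ZMod 5} (hx : x i ∉ k) (j : ZMod 5) : flow x j ≠ 0 := by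
  have hj : x j ∉ k := fun hj => hx (h.mem_all hk hl hj i)
  intro h0
  apply hj
  have hd := (h.shift j).disc
  have e : (1 + x j) * (x (1 + j) - x (4 + j)) = 0 := by
    rw [show (4 : ZMod 5) = -1 from rfl, add_comm 1 j, show -1 + j = j - 1 by ring]
    exact h0
  simp only [zero_add, e] at hd
  refine hk _ ⟨(Polynomial.C ⟨l, hl⟩ * Polynomial.X - (1 + Polynomial.X) * (2 + Polynomial.X)) ^ 2
    - 4 * (1 + Polynomial.X) ^ 3, fun hp => ?_, ?_⟩
  · have := congrArg (Polynomial.eval (-1)) hp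
    simp at this
    exact h.prod_ne (by simpa using congrArg Subtype.val this)
  · have h2 : Polynomial.aeval (x j) (2 : Polynomial k) = 2 := map_ofNat _ 2
    have h4 : Polynomial.aeval (x j) (4 : Polynomial k) = 4 := map_ofNat _ 4
    simp [Algebra.algebraMap_ofSubsemiring_apply, h2, h4]
    grind

lemma mem_subfield {S : Subfield K} (h : IsLyness l x) (h0 : x 0 ∈ S) (h1 : x 1 ∈ S)
    (k : ZMod 5) : x k ∈ S := by
  obtain ⟨r0, r1, r2, r3, r4⟩ := h.rels
  have h2 : x 2 ∈ S := by
    rw [eq_div_of_mul_eq (h.ne 0) r1]; aesop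
  have h3 : x 3 ∈ S := by
    rw [eq_div_of_mul_eq (h.ne 1) r2]; aesop
  have h4 : x 4 ∈ S := by
    rw [eq_div_of_mul_eq (h.ne 2) r3]; aesop
  fin_cases k <;> assumption

end IsLyness

open IsLyness

namespace IsLyness

variable {K : Type*} [Field K] {l : K} {x : ZMod 5 → K} {Γ : Type*}
  [LinearOrderedCommGroupWithZero Γ]

lemma val_of_big (h : IsLyness l x) (v : Valuation K Γ) (k : ZMod 5) (hk : 1 < v (x k)) :
    v (x (k + 1)) * v (x (k - 1)) = v (x k) := by
  rw [← map_mul, h.rel, add_comm]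
  exact Valuation.map_add_eq_of_lt_left v (by simpa using hk)

lemma pattern_aux (h : IsLyness l x) (v : Valuation K Γ) (hl : v l = 1)
    (hk : 1 < v (x 2)) (hmax : ∀ i, v (x i) ≤ v (x 2)) (h3 : 1 < v (x 3)) :
    ∃ g, 1 < g ∧ v (x 0) * g ^ 2 = 1 ∧ v (x 1) = 1 ∧ v (x 4) = 1 ∧ v (x 2) = g ∧ v (x 3) = g := by
  have p := congrArg v h.prod
  simp only [map_mul, hl] at p
  have e2 : v (x 3) * v (x 1) = v (x 2) := h.val_of_big v 2 hk
  have e3 : v (x 4) * v (x 2) = v (x 3) := h.val_of_big v 3 h3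
  have n (i) : 0 < v (x i) := zero_lt_iff.2 ((Valuation.ne_zero_iff v).2 (h.ne i))
  have h1 : v (x 1) = 1 := by
    by_contra hne
    have hge : 1 ≤ v (x 1) := by
      by_contra! hlt
      have : v (x 3) * v (x 1) < v (x 2) * 1 := by
        calc v (x 3) * v (x 1) < v (x 3) * 1 := by
              exact (mul_lt_mul_iff_right₀ (n 3)).2 hlt
          _ ≤ v (x 2) * 1 := by gcongr; exact hmax 3
      rw [e2, mul_one] at this
      exact lt_irrefl _ this
    have hgt : 1 < v (x 1) := lt_of_le_of_ne hge (Ne.symm hne)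
    have e1 : v (x 2) * v (x 0) = v (x 1) := h.val_of_big v 1 hgt
    have : v (x 2) = 1 := by
      calc v (x 2) = v (x 3) * v (x 1) := e2.symm
        _ = (v (x 4) * v (x 2)) * (v (x 2) * v (x 0)) := by rw [e3, e1]
        _ = (v (x 4) * v (x 2) * v (x 0)) * v (x 2) := by ac_rfl
        _ = (v (x 4) * v (x 2) * v (x 0)) * (v (x 3) * v (x 1)) := by rw [e2]
        _ = v (x 0) * v (x 1) * v (x 2) * v (x 3) * v (x 4) := by ac_rfl
        _ = 1 := p
    exact hk.ne' this
  have h32 : v (x 3) = v (x 2) := by rw [← e2, h1, mul_one]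
  have h4 : v (x 4) = 1 := by
    rw [h32] at e3
    exact mul_right_cancel₀ (n 2).ne' (by rw [e3, one_mul])
  refine ⟨v (x 2), hk, ?_, h1, h4, rfl, h32⟩
  rw [h1, h32, h4, mul_one, mul_one] at p
  rw [pow_two, ← mul_assoc, p]

/-- The value pattern of a Lyness sequence at a cusp `j`. -/
def Cusp (x : ZMod 5 → K) (v : Valuation K Γ) (j : ZMod 5) (g : Γ) : Prop :=
  1 < g ∧ v (x j) * g ^ 2 = 1 ∧ v (x (j + 1)) = 1 ∧ v (x (j - 1)) = 1 ∧ v (x (j + 2)) = g ∧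
    v (x (j - 2)) = g

lemma pattern (h : IsLyness l x) (v : Valuation K Γ) (hl : v l = 1) :
    (∀ i, v (x i) = 1) ∨ ∃ j g, Cusp x v j g := by
  by_cases hall : ∀ i, v (x i) ≤ 1
  · left
    have p := congrArg v h.prod
    simp only [map_mul, hl] at p
    have aux (y : ZMod 5 → K) (hy : IsLyness l y) (hall : ∀ i, v (y i) ≤ 1) : v (y 0) = 1 := by
      have p := congrArg v hy.prod
      simp only [map_mul, hl] at p
      refine le_antisymm (hall 0) ?_
      rw [← p]
      calc v (y 0) * v (y 1) * v (y 2) * v (y 3) * v (y 4)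
          ≤ v (y 0) * 1 * 1 * 1 * 1 := by gcongr <;> apply hall
        _ = _ := by simp
    intro i
    simpa using aux _ (h.shift i) (fun k => hall _)
  · right
    push Not at hall
    obtain ⟨k, -, hmax⟩ := Finset.exists_max_image Finset.univ (fun i => v (x i))
      ⟨0, Finset.mem_univ _⟩
    have hmax : ∀ i, v (x i) ≤ v (x k) := fun i => hmax i (Finset.mem_univ _)
    have hk : 1 < v (x k) := let ⟨i, hi⟩ := hall; hi.trans_le (hmax i)
    have hb := h.val_of_big v k hk
    have : 1 < v (x (k + 1)) ∨ 1 < v (x (k - 1)) := by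
      by_contra! hc
      have := mul_le_mul' hc.1 hc.2
      rw [hb, mul_one] at this
      exact absurd hk this.not_gt
    rcases this with h1 | h1
    · obtain ⟨g, hg, a⟩ := (h.shift (k - 2)).pattern_aux v hl
        (by simpa using hk) (fun i => by simpa using hmax _)
        (by rw [show 3 + (k - 2) = k + 1 by ring]; exact h1)
      refine ⟨k - 2, g, hg, ?_⟩
      rw [show k - 2 + 2 = 2 + (k - 2) by ring, show k - 2 - 2 = 3 + (k - 2) by
        rw [show (3 : ZMod 5) = - 2 from rfl]; ring, show k - 2 + 1 = 1 + (k - 2) by ring,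
        show k - 2 - 1 = 4 + (k - 2) by rw [show (4 : ZMod 5) = -1 from rfl]; ring]
      simpa using a
    · obtain ⟨g, hg, a⟩ := ((h.shift (k + 2)).reflect).pattern_aux v hl
        (by simpa using hk) (fun i => by simpa using hmax _)
        (by rw [show -3 + (k + 2) = k - 1 by ring]; exact h1)
      refine ⟨k + 2, g, hg, ?_⟩
      rw [show k + 2 + 2 = -3 + (k + 2) by rw [show (-3 : ZMod 5) = 2 from rfl]; ring,
        show k + 2 - 2 = -2 + (k + 2) by ring,
        show k + 2 + 1 = -4 + (k + 2) by rw [show (-4 : ZMod 5) = 1 from rfl]; ring,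
        show k + 2 - 1 = -1 + (k + 2) by ring]
      simp only [neg_zero, zero_add] at a
      tauto

/-- A function with divisor five times the difference of two cusps. -/
def hfun (x : ZMod 5 → K) : K := x 1 ^ 3 * x 4 / (x 0 ^ 3 * x 2)

lemma hfun_ne (h : IsLyness l x) : hfun x ≠ 0 := by
  simp [hfun, h.ne]

lemma val_hfun (h : IsLyness l x) (v : Valuation K Γ) (hl : v l = 1) :
    ∃ f : K, (f = 1 ∨ f = x 2 ∨ f = (x 3)⁻¹) ∧ v (hfun x) = v f ^ 5 := by
  have hH : v (hfun x) = v (x 1) ^ 3 * v (x 4) / (v (x 0) ^ 3 * v (x 2)) := by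
    simp [hfun]
  rcases h.pattern v hl with hp | ⟨j, g, hg, h1, h2, h3, h4, h5⟩
  · exact ⟨1, .inl rfl, by simp [hH, hp]⟩
  · have hg0 : g ≠ 0 := (zero_lt_one.trans hg).ne'
    have hj : v (x j) = (g ^ 2)⁻¹ := eq_inv_of_mul_eq_one_left h1
    fin_cases j
    · refine ⟨x 2, by simp, ?_⟩
      change v (x 0) = _ at hj; change v (x 1) = _ at h2; change v (x 4) = _ at h3
      change v (x 2) = _ at h4; change v (x 3) = _ at h5
      rw [hH, hj, h2, h3, h4]; field_simp
    · refine ⟨(x 3)⁻¹, by simp, ?_⟩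
      change v (x 1) = _ at hj; change v (x 2) = _ at h2; change v (x 0) = _ at h3
      change v (x 3) = _ at h4; change v (x 4) = _ at h5
      rw [hH, map_inv₀, hj, h2, h3, h4, h5]; field_simp
    · refine ⟨1, by simp, ?_⟩
      change v (x 2) = _ at hj; change v (x 3) = _ at h2; change v (x 1) = _ at h3
      change v (x 4) = _ at h4; change v (x 0) = _ at h5
      rw [hH, hj, h3, h4, h5]; simp; field_simp
    · refine ⟨1, by simp, ?_⟩
      change v (x 3) = _ at hj; change v (x 4) = _ at h2; change v (x 2) = _ at h3
      change v (x 0) = _ at h4; change v (x 1) = _ at h5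
      rw [hH, h2, h3, h4, h5]; simp [hg0]
    · refine ⟨1, by simp, ?_⟩
      change v (x 4) = _ at hj; change v (x 0) = _ at h2; change v (x 3) = _ at h3
      change v (x 1) = _ at h4; change v (x 2) = _ at h5
      rw [hH, hj, h2, h4, h5]; simp; field_simp

end IsLyness

section Chart

variable {K : Type*} [Field K]

/-- The smallest subring containing `S` and closed under inverses lying in `V`. -/
def locClosure (V : ValuationSubring K) (S : Set K) : Subring K :=
  sInf {W | S ⊆ W ∧ ∀ b ∈ W, b⁻¹ ∈ V → b⁻¹ ∈ W}

variable {V : ValuationSubring K} {S : Set K}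

lemma subset_locClosure : S ⊆ locClosure V S := fun _ hx =>
  Subring.mem_sInf.2 fun _ hW => hW.1 hx

lemma inv_mem_locClosure {b : K} (hb : b ∈ locClosure V S) (h : b⁻¹ ∈ V) :
    b⁻¹ ∈ locClosure V S :=
  Subring.mem_sInf.2 fun W hW => hW.2 b (Subring.mem_sInf.1 hb W hW) h

lemma locClosure_le {W : Subring K} (h : S ⊆ W) (hi : ∀ b ∈ W, b⁻¹ ∈ V → b⁻¹ ∈ W) :
    locClosure V S ≤ W := sInf_le ⟨h, hi⟩

lemma locClosure_le_valuationSubring (h : S ⊆ V) : locClosure V S ≤ V.toSubring :=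
  locClosure_le h fun _ _ hb => hb

lemma locClosure_mono {T : Set K} (h : S ⊆ T) : locClosure V S ≤ locClosure V T :=
  locClosure_le (h.trans subset_locClosure) fun _ => inv_mem_locClosure

lemma locClosure_le_subfield {N : Subfield K} (h : S ⊆ N) : locClosure V S ≤ N.toSubring :=
  locClosure_le h fun _ hb _ => N.inv_mem hb

/-- A local chart: the elements of `S` have residues in `k` and Taylor expansions in `π`. -/
structure Chart (k : Subfield K) (V : ValuationSubring K) (π : K) (S : Set K) : Prop where
  subset : (k : Set K) ⊆ S
  le : S ⊆ V
  mem : π ∈ S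
  inv_notMem : π⁻¹ ∉ V
  res : ∀ z ∈ S, ∃ ξ ∈ k, ∃ c ∈ locClosure V S, z = ξ + π * c

namespace Chart

variable {k : Subfield K} {π : K}

lemma ne_zero (h : Chart k V π S) : π ≠ 0 := by
  rintro rfl; exact h.inv_notMem (by aesop)

lemma field_mem (h : Chart k V π S) {a : K} (ha : a ∈ k) : a ∈ locClosure V S :=
  subset_locClosure (h.subset ha)

lemma mem_loc (h : Chart k V π S) : π ∈ locClosure V S := subset_locClosure h.mem

lemma loc_le (h : Chart k V π S) {a : K} (ha : a ∈ locClosure V S) : a ∈ V :=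
  locClosure_le_valuationSubring h.le ha

lemma val_lt (h : Chart k V π S) : V.valuation π < 1 := by
  have := h.inv_notMem
  rw [← V.valuation_le_one_iff, map_inv₀, not_le] at this
  exact (one_lt_inv₀ (zero_lt_iff.2 (by simpa using h.ne_zero))).1 this

lemma val_eq_one (h : Chart k V π S) {ξ c : K} (hξ : ξ ∈ k) (h0 : ξ ≠ 0) (hc : c ∈ V) :
    V.valuation (ξ + π * c) = 1 := by
  have h1 : V.valuation ξ = 1 := by
    refine le_antisymm ((V.valuation_le_one_iff _).2 (h.le (h.subset hξ))) ?_
    have := (V.valuation_le_one_iff _).2 (h.le (h.subset (k.inv_mem hξ)))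
    rw [map_inv₀] at this
    exact (inv_le_one₀ (zero_lt_iff.2 (by aesop))).1 this
  rw [Valuation.map_add_eq_of_lt_left, h1]
  rw [h1, map_mul]
  exact mul_lt_one_of_lt_of_le h.val_lt ((V.valuation_le_one_iff _).2 hc)

lemma inv_mem_of_ne (h : Chart k V π S) {ξ c : K} (hξ : ξ ∈ k) (h0 : ξ ≠ 0) (hc : c ∈ V) :
    (ξ + π * c)⁻¹ ∈ V := by
  rw [← V.valuation_le_one_iff, map_inv₀, h.val_eq_one hξ h0 hc, inv_one]

lemma inv_notMem_mul (h : Chart k V π S) {c : K} (hc : c ∈ V) (h0 : c ≠ 0) : (π * c)⁻¹ ∉ V := by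
  intro hh
  apply h.inv_notMem
  have := mul_mem hh hc
  grind

lemma exists_res (h : Chart k V π S) {b : K} (hb : b ∈ locClosure V S) :
    ∃ ξ ∈ k, ∃ c ∈ locClosure V S, b = ξ + π * c := by
  let W : Subring K :=
    { carrier := {b | b ∈ locClosure V S ∧ ∃ ξ ∈ k, ∃ c ∈ locClosure V S, b = ξ + π * c}
      mul_mem' := by
        rintro _ _ ⟨ha, ξ, hξ, c, hc, rfl⟩ ⟨hb, η, hη, d, hd, rfl⟩
        exact ⟨mul_mem ha hb, ξ * η, mul_mem hξ hη, c * (η + π * d) + ξ * d,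
          add_mem (mul_mem hc hb) (mul_mem (h.field_mem hξ) hd), by ring⟩
      one_mem' := ⟨one_mem _, 1, one_mem _, 0, zero_mem _, by simp⟩
      add_mem' := by
        rintro _ _ ⟨ha, ξ, hξ, c, hc, rfl⟩ ⟨hb, η, hη, d, hd, rfl⟩
        exact ⟨add_mem ha hb, ξ + η, add_mem hξ hη, c + d, add_mem hc hd, by ring⟩
      zero_mem' := ⟨zero_mem _, 0, zero_mem _, 0, zero_mem _, by simp⟩
      neg_mem' := by
        rintro _ ⟨ha, ξ, hξ, c, hc, rfl⟩
        exact ⟨neg_mem ha, -ξ, neg_mem hξ, -c, neg_mem hc, by ring⟩ }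
  refine (locClosure_le (W := W) (fun z hz => ⟨subset_locClosure hz, h.res z hz⟩) ?_ hb).2
  rintro _ ⟨hb, ξ, hξ, c, hc, rfl⟩ hi
  refine ⟨inv_mem_locClosure hb hi, ?_⟩
  by_cases hb0 : ξ + π * c = 0
  · grind
  have h0 : ξ ≠ 0 := by
    rintro rfl
    rw [zero_add] at hi hb0
    exact h.inv_notMem_mul (h.loc_le hc) (right_ne_zero_of_mul hb0) hi
  refine ⟨ξ⁻¹, k.inv_mem hξ, -(c * (ξ + π * c)⁻¹ * ξ⁻¹), neg_mem (mul_mem (mul_mem hc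
    (inv_mem_locClosure hb hi)) (h.field_mem (k.inv_mem hξ))), ?_⟩
  grind

lemma insert (h : Chart k V π S) {z ξ U c : K} (hz : z ∈ V) (hξ : ξ ∈ k)
    (hU : U ∈ locClosure V (insert z S)) (hc : c ∈ locClosure V (insert z S)) (h0 : U ≠ 0)
    (hUi : U⁻¹ ∈ V) (he : (z - ξ) * U = π * c) : Chart k V π (insert z S) := by
  refine ⟨h.subset.trans (Set.subset_insert _ _), Set.insert_subset hz h.le,
    Set.mem_insert_of_mem _ h.mem, h.inv_notMem, ?_⟩
  rintro y (rfl | hy)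
  · refine ⟨ξ, hξ, c * U⁻¹, mul_mem hc (inv_mem_locClosure hU hUi), ?_⟩
    grind
  · obtain ⟨ξ, hξ, c, hc, e⟩ := h.res y hy
    exact ⟨ξ, hξ, c, locClosure_mono (Set.subset_insert _ _) hc, e⟩

lemma base (hk : (k : Set K) ⊆ V) (hπ : π ∈ V) (hi : π⁻¹ ∉ V) :
    Chart k V π (Insert.insert π (k : Set K)) := by
  refine ⟨Set.subset_insert _ _, Set.insert_subset hπ hk, Set.mem_insert _ _, hi, ?_⟩
  rintro y (rfl | hy)
  · exact ⟨0, zero_mem _, 1, one_mem _, by simp⟩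
  · exact ⟨y, hy, 0, zero_mem _, by simp⟩

lemma pow_or (h : Chart k V π S) {b : K} (hb : b ∈ locClosure V S) (hb0 : b ≠ 0) (n : ℕ) :
    (∃ m : ℕ, ∃ u ∈ locClosure V S, u⁻¹ ∈ locClosure V S ∧ u ≠ 0 ∧ b = u * π ^ m) ∨
      ∃ c ∈ locClosure V S, b = c * π ^ n := by
  induction n with
  | zero => grind
  | succ n ih =>
    rcases ih with hh | ⟨c, hc, e⟩
    · grind
    obtain ⟨ξ, hξ, d, hd, e2⟩ := h.exists_res hc
    by_cases h0 : ξ = 0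
    · grind
    · left
      have hi := h.inv_mem_of_ne hξ h0 (h.loc_le hd)
      rw [← e2] at hi
      refine ⟨n, c, hc, inv_mem_locClosure hc hi, ?_, e⟩
      grind

lemma exists_pow_of_mem_adjoin (h : Chart k V π S) {r : K} (hr : r ∈ Algebra.adjoin k {π})
    (h0 : r ≠ 0) :
    ∃ m : ℕ, ∃ u, V.valuation u = 1 ∧ r = u * π ^ m := by
  rw [Algebra.adjoin_singleton_eq_range_aeval] at hr
  obtain ⟨P, rfl⟩ := hr
  have hP : P ≠ 0 := by
    grind
  obtain ⟨Q, hQ, hn⟩ := P.exists_eq_pow_rootMultiplicity_mul_and_not_dvd hP 0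
  have hQ0 : Q.coeff 0 ≠ 0 := fun h => hn (by simpa [Polynomial.X_dvd_iff] using h)
  refine ⟨P.rootMultiplicity 0, Polynomial.aeval π Q, ?_, ?_⟩
  · rw [← Q.divX_mul_X_add]
    simp only [map_add, map_mul, Polynomial.aeval_X, Polynomial.aeval_C]
    rw [mul_comm, add_comm]
    refine h.val_eq_one (Q.coeff 0).2 (by simpa using hQ0) ?_
    have : ∀ R : Polynomial k, Polynomial.aeval π R ∈ V := fun R => by
      rw [Polynomial.aeval_eq_sum_range]
      refine sum_mem fun i _ => ?_
      rw [Algebra.smul_def]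
      exact mul_mem (h.le (h.subset (R.coeff i).2)) (pow_mem (h.le h.mem) i)
    grind
  · conv_lhs => rw [hQ]
    simp [mul_comm]

lemma adjoin_le (h : Chart k V π S) {b : K} (hb : b ∈ locClosure V S) {t : K}
    (ht : t ∈ Algebra.adjoin (Algebra.adjoin k {π}) {b}) : t ∈ locClosure V S := by
  induction ht using Algebra.adjoin_induction with
  | mem x hx => grind
  | algebraMap r =>
    obtain ⟨r, hr⟩ := r
    change r ∈ _
    induction hr using Algebra.adjoin_induction with
    | mem x hx => rw [Set.mem_singleton_iff.1 hx]; exact h.mem_loc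
    | algebraMap r => exact h.field_mem r.2
    | add _ _ _ _ hx hy => aesop
    | mul _ _ _ _ hx hy => aesop
  | add _ _ _ _ hx hy => aesop
  | mul _ _ _ _ hx hy => aesop

lemma exists_pow (h : Chart k V π S) {b : K} (hb : b ∈ locClosure V S) (hb0 : b ≠ 0)
    (ha : IsAlgebraic (Algebra.adjoin k {π}) b) :
    ∃ m : ℕ, ∃ u ∈ locClosure V S, u⁻¹ ∈ locClosure V S ∧ u ≠ 0 ∧ b = u * π ^ m := by
  obtain ⟨t, ht, r, hr, e⟩ :=
    ha.exists_nonzero_eq_adjoin_mul (mem_nonZeroDivisors_of_ne_zero hb0)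
  obtain ⟨m, u, hu, e2⟩ := h.exists_pow_of_mem_adjoin r.2 (by aesop)
  refine (h.pow_or hb hb0 (m + 1)).resolve_right ?_
  rintro ⟨c, hc, e3⟩
  have e4 : u * π ^ m = c * π ^ (m + 1) * t := by aesop
  have e5 : u = π * (c * t) := by
    grind
  have : V.valuation u < 1 := by
    rw [e5, map_mul]
    exact mul_lt_one_of_lt_of_le h.val_lt ((V.valuation_le_one_iff _).2
      (h.loc_le (mul_mem hc (h.adjoin_le hb ht))))
  grind

end Chart

/-- `π` is a uniformizer of `N ∩ V`. -/
structure Unif (N : Subfield K) (V : ValuationSubring K) (π : K) : Prop where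
  memN : π ∈ N
  lt : V.valuation π < 1
  ne : π ≠ 0
  rep : ∀ f ∈ N, f ≠ 0 → ∃ n : ℤ, ∃ u ∈ N, V.valuation u = 1 ∧ f = u * π ^ n

namespace Chart
variable {k : Subfield K} {π : K}

lemma rep (h : Chart k V π S) (ha : ∀ b ∈ locClosure V S, IsAlgebraic (Algebra.adjoin k {π}) b)
    {f : K} (hf : f ∈ Subfield.closure S) (h0 : f ≠ 0) :
    ∃ n : ℤ, ∃ u ∈ locClosure V S, u⁻¹ ∈ locClosure V S ∧ u ≠ 0 ∧ f = u * π ^ n := by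
  obtain ⟨b, hb, c, hc, rfl⟩ := Subfield.mem_closure_iff.1 hf
  have hle : Subring.closure S ≤ locClosure V S := Subring.closure_le.2 subset_locClosure
  have hb0 : b ≠ 0 := by grind
  have hc0 : c ≠ 0 := by grind
  obtain ⟨m, u, hu, hui, hu0, rfl⟩ := h.exists_pow (hle hb) hb0 (ha _ (hle hb))
  obtain ⟨m', u', hu', hui', hu0', rfl⟩ := h.exists_pow (hle hc) hc0 (ha _ (hle hc))
  refine ⟨m - m', u * u'⁻¹, mul_mem hu hui', ?_, by grind, ?_⟩
  · rw [mul_inv, inv_inv]; exact mul_mem hui hu'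
  · rw [zpow_sub₀ h.ne_zero, zpow_natCast, zpow_natCast]
    field_simp

lemma val_unit (h : Chart k V π S) {u : K} (hu : u ∈ locClosure V S)
    (hi : u⁻¹ ∈ locClosure V S) (h0 : u ≠ 0) : V.valuation u = 1 := by
  refine le_antisymm ((V.valuation_le_one_iff _).2 (h.loc_le hu)) ?_
  have := (V.valuation_le_one_iff _).2 (h.loc_le hi)
  rw [map_inv₀] at this
  exact (inv_le_one₀ (zero_lt_iff.2 (by aesop))).1 this

lemma unif (h : Chart k V π S) (ha : ∀ b ∈ locClosure V S, IsAlgebraic (Algebra.adjoin k {π}) b) :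
    Unif (Subfield.closure S) V π := by
  refine ⟨Subfield.subset_closure h.mem, h.val_lt, h.ne_zero, fun f hf h0 => ?_⟩
  obtain ⟨n, u, hu, hui, hu0, e⟩ := h.rep ha hf h0
  exact ⟨n, u, locClosure_le_subfield Subfield.subset_closure hu, h.val_unit hu hui hu0, e⟩

lemma mem_of_mem (h : Chart k V π S)
    (ha : ∀ b ∈ locClosure V S, IsAlgebraic (Algebra.adjoin k {π}) b)
    {f : K} (hf : f ∈ Subfield.closure S) (hV : f ∈ V) : f ∈ locClosure V S := by
  by_cases h0 : f = 0
  · aesop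
  obtain ⟨n, u, hu, hui, hu0, e⟩ := h.rep ha hf h0
  have hn : 0 ≤ n := by
    by_contra! hn
    obtain ⟨m, rfl⟩ : ∃ m : ℕ, n = -(m + 1) := ⟨(-n - 1).toNat, by omega⟩
    have h1 := (V.valuation_le_one_iff _).2 hV
    rw [e, map_mul, h.val_unit hu hui hu0, one_mul, map_zpow₀, zpow_neg, inv_le_one₀
      (zpow_pos (zero_lt_iff.2 (by simpa using h.ne_zero)) _)] at h1
    have h2 : V.valuation π ^ ((m : ℤ) + 1) = V.valuation π ^ (m + 1) := by norm_cast
    rw [h2] at h1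
    exact absurd h1 (pow_lt_one₀ zero_le h.val_lt (by omega)).not_ge
  lift n to ℕ using hn
  rw [e, zpow_natCast]
  exact mul_mem hu (pow_mem h.mem_loc _)

lemma deriv_mem (h : Chart k V π S)
    (ha : ∀ b ∈ locClosure V S, IsAlgebraic (Algebra.adjoin k {π}) b)
    (D : Derivation ℤ K K) (hD : ∀ z ∈ S, D z ∈ V)
    {f : K} (hf : f ∈ Subfield.closure S) (hV : f ∈ V) : D f ∈ V := by
  let W : Subring K :=
    { carrier := {b | b ∈ V ∧ D b ∈ V}
      mul_mem' := by
        rintro a b ⟨ha, ha'⟩ ⟨hb, hb'⟩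
        exact ⟨mul_mem ha hb, by
          rw [D.leibniz]; exact add_mem (mul_mem ha hb') (mul_mem hb ha')⟩
      one_mem' := ⟨one_mem _, by aesop⟩
      add_mem' := by
        rintro a b ⟨ha, ha'⟩ ⟨hb, hb'⟩
        exact ⟨add_mem ha hb, by rw [map_add]; aesop⟩
      zero_mem' := ⟨V.zero_mem, by aesop⟩
      neg_mem' := by
        aesop}
  refine (locClosure_le (V := V) (W := W) (fun z hz => ⟨h.le hz, hD z hz⟩) ?_
    (h.mem_of_mem ha hf hV)).2
  rintro b ⟨hb, hb'⟩ hi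
  refine ⟨hi, ?_⟩
  rw [Derivation.leibniz_inv, neg_smul, smul_eq_mul]
  exact neg_mem (mul_mem (pow_mem hi 2) hb')

end Chart

end Chart

section Acl

variable {K : Type*} [Field K] [Algebra ℂ K]

open AlgebraicIndependent (matroid)

lemma mem_closure_iff_isAlgebraic {s : Set K} {y : K} :
    y ∈ (matroid ℂ K).closure s ↔ IsAlgebraic (Algebra.adjoin ℂ s) y := by
  rw [AlgebraicIndependent.matroid_closure_eq]; rfl

/-- The algebraic closure in `K` of the field generated by `s` over `ℂ`. -/
def acl (s : Set K) : Subfield K where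
  carrier := (matroid ℂ K).closure s
  mul_mem' ha hb := by
    rw [mem_closure_iff_isAlgebraic] at *; exact ha.mul hb
  one_mem' := by rw [mem_closure_iff_isAlgebraic]; exact isAlgebraic_one
  add_mem' ha hb := by
    rw [mem_closure_iff_isAlgebraic] at *; exact ha.add hb
  zero_mem' := by rw [mem_closure_iff_isAlgebraic]; exact isAlgebraic_zero
  neg_mem' ha := by
    rw [mem_closure_iff_isAlgebraic] at *; exact ha.neg
  inv_mem' _ ha := by
    rw [mem_closure_iff_isAlgebraic] at *; exact ha.inv

variable {s t : Set K} {x y : K}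

lemma mem_acl : y ∈ acl s ↔ IsAlgebraic (Algebra.adjoin ℂ s) y := mem_closure_iff_isAlgebraic

lemma coe_acl (s : Set K) : (acl s : Set K) = (matroid ℂ K).closure s := rfl

lemma subset_acl (s : Set K) : s ⊆ acl s := (matroid ℂ K).subset_closure s (Set.subset_univ _)

lemma acl_mono (h : s ⊆ t) : acl s ≤ acl t := (matroid ℂ K).closure_subset_closure h

lemma acl_le (h : s ⊆ acl t) : acl s ≤ acl t :=
  Matroid.closure_subset_closure_of_subset_closure h

lemma acl_exchange (h : x ∉ acl s) (h' : x ∈ acl (insert y s)) : y ∈ acl (insert x s) :=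
  Matroid.mem_closure_insert h h'

lemma algebraMap_mem_acl (c : ℂ) : algebraMap ℂ K c ∈ acl s :=
  mem_acl.2 (isAlgebraic_algebraMap (algebraMap ℂ (Algebra.adjoin ℂ s) c))

lemma mem_acl_of_isAlgebraic {R : Type*} [CommRing R] [Algebra R K]
    (hi : Function.Injective (algebraMap R K))
    (hR : ∀ r : R, algebraMap R K r ∈ acl s) (h : IsAlgebraic R y) : y ∈ acl s := by
  rw [← SetLike.mem_coe, coe_acl, ← Matroid.closure_closure, mem_closure_iff_isAlgebraic]
  refine IsAlgebraic.ringHom_of_comp_eq (R := R) (f := (algebraMap R K).codRestrict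
    (Algebra.adjoin ℂ ((matroid ℂ K).closure s)).toSubring
    fun r => Algebra.subset_adjoin (hR r)) (g := RingHom.id K) h ?_ rfl
  intro a b hab
  exact hi (congrArg Subtype.val hab)

lemma isAlgebraic_of_mem_acl {R : Type*} [CommRing R] [Algebra R K]
    (hi : Function.Injective (algebraMap R K))
    (hR : ∀ c : ℂ, algebraMap ℂ K c ∈ (algebraMap R K).range) (hs : s ⊆ (algebraMap R K).range)
    (h : y ∈ acl s) : IsAlgebraic R y := by
  have hle : ∀ a ∈ Algebra.adjoin ℂ s, a ∈ (algebraMap R K).range := fun a ha => by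
    induction ha using Algebra.adjoin_induction with
    | mem x hx => exact hs hx
    | algebraMap r => exact hR r
    | add _ _ _ _ hx hy => exact add_mem hx hy
    | mul _ _ _ _ hx hy => exact mul_mem hx hy
  let e := RingEquiv.ofBijective (algebraMap R K).rangeRestrict
    ⟨fun a b h => hi (congrArg Subtype.val h), (algebraMap R K).rangeRestrict_surjective⟩
  let f : Algebra.adjoin ℂ s →+* R := e.symm.toRingHom.comp
    (Subring.inclusion (S := (Algebra.adjoin ℂ s).toSubring) hle)
  refine IsAlgebraic.ringHom_of_comp_eq (f := f) (g := RingHom.id K) (mem_acl.1 h) ?_ ?_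
  · intro a b hab
    have h1 := congrArg Subtype.val (e.symm.injective hab)
    exact Subtype.ext h1
  · ext a
    exact congrArg Subtype.val (e.apply_symm_apply _)

lemma closure_le_acl (s : Set K) : Subfield.closure s ≤ acl s := Subfield.closure_le.2 (subset_acl s)

lemma acl_idem (s : Set K) : acl (acl s : Set K) = acl s :=
  le_antisymm (acl_le subset_rfl) (subset_acl _)

lemma algClosedIn_acl (s : Set K) : AlgClosedIn (acl s) := fun _ hf =>
  mem_acl_of_isAlgebraic Subtype.val_injective (fun r => r.2) hf

lemma AlgClosedIn.acl_le {k : Subfield K} (hk : AlgClosedIn k) (hC : ∀ c : ℂ, algebraMap ℂ K c ∈ k)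
    (h : s ⊆ k) : acl s ≤ k := fun _ hy =>
  hk _ (isAlgebraic_of_mem_acl Subtype.val_injective (fun c => ⟨⟨_, hC c⟩, rfl⟩)
    (fun a ha => ⟨⟨a, h ha⟩, rfl⟩) hy)

omit [Algebra ℂ K] in
lemma AlgClosedIn.isAlgClosed [IsAlgClosed K] {k : Subfield K} (hk : AlgClosedIn k) :
    IsAlgClosed k := by
  refine IsAlgClosed.of_exists_root k fun p hp hi => ?_
  obtain ⟨x, hx⟩ := IsAlgClosed.exists_aeval_eq_zero K p (Polynomial.degree_pos_of_irreducible hi).ne'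
  refine ⟨⟨x, hk x ⟨p, hp.ne_zero, hx⟩⟩, ?_⟩
  apply Subtype.ext
  rw [Polynomial.aeval_def, Polynomial.eval₂_eq_eval_map] at hx
  have := Polynomial.eval_map_apply (f := algebraMap k K) (p := p) ⟨x, hk x ⟨p, hp.ne_zero, by
    grind⟩⟩
  exact this.symm.trans hx

/-- Every non-constant element of `N ⊇ k` is a transcendence basis of `N / k`. -/
structure Dim1 (k N : Subfield K) : Prop where
  le : k ≤ N
  closed : AlgClosedIn k
  algebraMap_mem : ∀ c : ℂ, algebraMap ℂ K c ∈ k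
  dim : ∀ z ∈ N, z ∉ k → (N : Set K) ⊆ acl (insert z (k : Set K))

lemma Dim1.mono {k N N' : Subfield K} (h : Dim1 k N) (h1 : k ≤ N') (h2 : N' ≤ N) : Dim1 k N' :=
  ⟨h1, h.closed, h.algebraMap_mem, fun z hz hzk => le_trans h2 (h.dim z (h2 hz) hzk)⟩

lemma dim1_acl {k : Subfield K} (hk : AlgClosedIn k) (hC : ∀ c : ℂ, algebraMap ℂ K c ∈ k) (t : K) :
    Dim1 k (acl (insert t (k : Set K))) := by
  refine ⟨fun a ha => subset_acl _ (.inr ha), hk, hC, fun z hz hzk => ?_⟩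
  have : z ∉ acl (k : Set K) := fun h => hzk (hk.acl_le hC subset_rfl h)
  refine acl_le (Set.insert_subset (acl_exchange this hz) fun a ha => subset_acl _ (.inr ha))

lemma Dim1.isAlgebraic {k N : Subfield K} (h : Dim1 k N) {z y : K} (hz : z ∈ N) (hzk : z ∉ k)
    (hy : y ∈ N) : IsAlgebraic (Algebra.adjoin k {z}) y := by
  refine isAlgebraic_of_mem_acl Subtype.val_injective
    (fun c => ⟨⟨_, Subalgebra.algebraMap_mem _ (⟨_, h.algebraMap_mem c⟩ : k)⟩, rfl⟩)
    ?_ (h.dim z hz hzk hy)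
  rintro a (rfl | ha)
  · aesop
  · exact ⟨⟨a, Subalgebra.algebraMap_mem _ (⟨a, ha⟩ : k)⟩, rfl⟩

/-- Residues of a curve over an algebraically closed field are constants. -/
lemma Dim1.exists_residue [IsAlgClosed K] {k N : Subfield K} (h : Dim1 k N) {V : ValuationSubring K}
    (hk : (k : Set K) ⊆ V) (hN : ¬ (N : Set K) ⊆ V) {z : K} (hz : z ∈ N) (hzV : z ∈ V) :
    ∃ ξ ∈ k, V.valuation (z - ξ) < 1 := by
  by_cases hzk : z ∈ k
  · aesop
  obtain ⟨y, hy, hyV⟩ := Set.not_subset.1 hN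
  have hw : V.valuation y⁻¹ < 1 := by
    rw [map_inv₀]
    have : 1 < V.valuation y := by
      rw [← not_le, V.valuation_le_one_iff]; exact hyV
    exact inv_lt_one_of_one_lt₀ this
  have hy0 : y⁻¹ ≠ 0 := inv_ne_zero (by rintro rfl; aesop)
  obtain ⟨t, ht, ⟨r, hr⟩, hr0, e⟩ := (h.isAlgebraic hz hzk (N.inv_mem hy)).exists_nonzero_eq_adjoin_mul
    (mem_nonZeroDivisors_of_ne_zero hy0)
  have hBV : ∀ b ∈ Algebra.adjoin k {z}, b ∈ V := fun b hb => by
    induction hb using Algebra.adjoin_induction with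
    | mem x hx => grind
    | algebraMap r => exact hk r.2
    | add _ _ _ _ hx hy => exact add_mem hx hy
    | mul _ _ _ _ hx hy => exact mul_mem hx hy
  have htV : t ∈ V := by
    clear e
    induction ht using Algebra.adjoin_induction with
    | mem x hx =>
      rw [Set.mem_singleton_iff.1 hx, ← V.valuation_le_one_iff]; exact hw.le
    | algebraMap r => aesop
    | add _ _ _ _ hx hy => exact add_mem hx hy
    | mul _ _ _ _ hx hy => exact mul_mem hx hy
  have hrv : V.valuation r < 1 := by
    have : r = y⁻¹ * t := e.symm
    rw [this, map_mul]
    exact mul_lt_one_of_lt_of_le hw ((V.valuation_le_one_iff _).2 htV)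
  have hr0' : r ≠ 0 := fun h0 => hr0 (Subtype.ext h0)
  rw [Algebra.adjoin_singleton_eq_range_aeval] at hr
  obtain ⟨P, rfl⟩ := hr
  have hP : P ≠ 0 := by grind
  have := h.closed.isAlgClosed
  have hs := (IsAlgClosed.splits P).eq_prod_roots
  by_contra! hcon
  have key : 1 ≤ V.valuation (Polynomial.aeval z P) := by
    have e1 : Polynomial.aeval z P = (P.leadingCoeff : K) *
        (P.roots.map fun a : k => z - a).prod := by
      conv_lhs => rw [hs]
      simp [map_multiset_prod, Multiset.map_map]
      rfl
    have hval : ∀ a ∈ k, a ≠ 0 → V.valuation a = 1 := fun a ha h0 => by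
      refine le_antisymm ((V.valuation_le_one_iff _).2 (hk ha)) ?_
      have := (V.valuation_le_one_iff _).2 (hk (k.inv_mem ha))
      rw [map_inv₀] at this
      exact (inv_le_one₀ (zero_lt_iff.2 (by simpa using h0))).1 this
    rw [e1, map_mul, hval _ (Subtype.coe_prop _) (by simpa using hP), one_mul, map_multiset_prod,
      Multiset.map_map]
    refine Multiset.one_le_prod_of_one_le fun a ha => ?_
    obtain ⟨b, hb, rfl⟩ := Multiset.mem_map.1 ha
    grind
  exact absurd hrv key.not_gt

end Acl

section Smooth


variable {K : Type*} [Field K] {V : ValuationSubring K} {k : Subfield K}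

lemma val_eq_one_of_mem (hk : (k : Set K) ⊆ V) {a : K} (ha : a ∈ k) (h0 : a ≠ 0) :
    V.valuation a = 1 := by
  refine le_antisymm ((V.valuation_le_one_iff _).2 (hk ha)) ?_
  have := (V.valuation_le_one_iff _).2 (hk (k.inv_mem ha))
  rw [map_inv₀] at this
  exact (inv_le_one₀ (zero_lt_iff.2 (by aesop))).1 this

lemma eq_zero_of_val_lt (hk : (k : Set K) ⊆ V) {a : K} (ha : a ∈ k) (h : V.valuation a < 1) :
    a = 0 := by
  by_contra h0
  exact h.ne (val_eq_one_of_mem hk ha h0)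

lemma val_lt_mul_left {a b : K} (ha : a ∈ V) (hb : V.valuation b < 1) : V.valuation (a * b) < 1 := by
  rw [mul_comm, map_mul]; exact mul_lt_one_of_lt_of_le hb ((V.valuation_le_one_iff _).2 ha)

lemma val_lt_add {a b : K} (ha : V.valuation a < 1) (hb : V.valuation b < 1) :
    V.valuation (a + b) < 1 := (V.valuation.map_add a b).trans_lt (max_lt ha hb)

lemma val_lt_sub {a b : K} (ha : V.valuation a < 1) (hb : V.valuation b < 1) :
    V.valuation (a - b) < 1 := (V.valuation.map_sub a b).trans_lt (max_lt ha hb)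

lemma val_lt_mul_sub {a b c d : K} (ha : a ∈ V) (hd : d ∈ V) (hab : V.valuation (a - c) < 1)
    (hbd : V.valuation (b - d) < 1) : V.valuation (a * b - c * d) < 1 := by
  have : a * b - c * d = a * (b - d) + d * (a - c) := by ring
  rw [this]
  exact val_lt_add (val_lt_mul_left ha hbd) (val_lt_mul_left hd hab)

lemma val_eq_one_of_sub {a c : K} (hc : V.valuation c = 1) (h : V.valuation (a - c) < 1) :
    V.valuation a = 1 := by
  rw [← hc] at h
  rw [Valuation.map_eq_of_sub_lt _ h, hc]

lemma mem_of_val_eq_one {a : K} (h : V.valuation a = 1) : a ∈ V :=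
  (V.valuation_le_one_iff _).1 h.le

/-- A chart for `k(x)` adapted to the flow derivation. -/
structure FlowChart (k : Subfield K) (V : ValuationSubring K) (x : ZMod 5 → K)
    (δ : Derivation ℤ K K) (π : K) (S : Set K) : Prop where
  chart : Chart k V π S
  closure_eq : Subfield.closure S = Subfield.closure (k ∪ Set.range x)
  flow_mem : ∀ z ∈ S, δ z ∈ V
  flow_unit : V.valuation (δ π) = 1
  deriv_mem : ∀ D : Derivation ℤ K K, (∀ a ∈ k, D a ∈ k) → (∀ i, D (x i) = 0) → ∀ z ∈ S, D z ∈ V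

lemma FlowChart.of_shift {x : ZMod 5 → K} {δ : Derivation ℤ K K} {π : K} {S : Set K} {j : ZMod 5}
    (h : FlowChart k V (fun i => x (i + j)) δ π S) : FlowChart k V x δ π S := by
  refine ⟨h.chart, ?_, h.flow_mem, h.flow_unit, fun D h1 h2 => h.deriv_mem D h1 fun i => h2 _⟩
  have : Set.range (fun i => x (i + j)) = Set.range x :=
    (Equiv.addRight j).surjective.range_comp x
  rw [h.closure_eq, this]

variable {l : K} {x : ZMod 5 → K} {δ : Derivation ℤ K K}

lemma val_sub_inv_ne (hk : (k : Set K) ⊆ V) {a b ξ η : K} (hξ : ξ ∈ k) (hη : η ∈ k)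
    (ha : V.valuation (a - ξ) < 1) (hb : V.valuation (b - η) < 1) (hne : ξ ≠ η) :
    V.valuation (a - b) = 1 := by
  refine val_eq_one_of_sub (val_eq_one_of_mem hk (sub_mem hξ hη) (sub_ne_zero.2 hne)) ?_
  have : a - b - (ξ - η) = (a - ξ) - (b - η) := by ring
  rw [this]; exact val_lt_sub ha hb

lemma inv_mem_of_val_eq_one {a : K} (h : V.valuation a = 1) : a⁻¹ ∈ V := by
  rw [← V.valuation_le_one_iff, map_inv₀, h, inv_one]

lemma closure_range_eq (h : IsLyness l x) : Subfield.closure (k ∪ Set.range x) =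
    Subfield.closure (insert (x 1) (insert (x 0) (k : Set K))) := by
  apply le_antisymm
  · refine Subfield.closure_le.2 (Set.union_subset ?_ ?_)
    · exact fun a ha => Subfield.subset_closure (.inr (.inr ha))
    · rintro _ ⟨i, rfl⟩
      exact h.mem_subfield (Subfield.subset_closure (.inr (.inl rfl)))
        (Subfield.subset_closure (.inl rfl)) i
  · apply Subfield.closure_mono
    grind

/-- The chart at a place where all `x i` are units. -/
lemma flowChart_of_unit (h : IsLyness l x) (hk : (k : Set K) ⊆ V) (hlk : l ∈ k)
    (h0 : x 0 ∉ k) (hv : ∀ i, V.valuation (x i) = 1) {ξ : ZMod 5 → K} (hξ : IsLyness l ξ)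
    (hξk : ∀ i, ξ i ∈ k) (hr : ∀ i, V.valuation (x i - ξ i) < 1) (hf : flow ξ 0 ≠ 0)
    (hδ : ∀ a ∈ k, δ a = 0) (hδx : ∀ i, δ (x i) = flow x i) :
    ∃ π S, FlowChart k V x δ π S := by
  have hV : ∀ i, x i ∈ V := fun i => mem_of_val_eq_one (hv i)
  have hξV : ∀ i, ξ i ∈ V := fun i => hk (hξk i)
  have hπ0 : x 0 - ξ 0 ≠ 0 := fun h => h0 (by grind)
  have hπi : (x 0 - ξ 0)⁻¹ ∉ V := by
    rw [← V.valuation_le_one_iff, map_inv₀, not_le]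
    exact (one_lt_inv₀ (zero_lt_iff.2 (by aesop))).2 (hr 0)
  have hch := Chart.base hk (sub_mem (hV 0) (hξV 0)) hπi
  have h14 : ξ 1 ≠ ξ 4 := by
    intro h; apply hf; simp only [flow]
    have : (0 - 1 : ZMod 5) = 4 := rfl
    aesop
  have hU : V.valuation (x 1 - ξ 4) = 1 :=
    val_sub_inv_ne hk (hξk 1) (hξk 4) (hr 1) (by simp) h14
  have h1x : V.valuation (1 + x 0) = 1 := by rw [← h.rels.1, map_mul, hv, hv, mul_one]
  set S' : Set K := insert (x 0 - ξ 0) (k : Set K) with hS'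
  have hkS : (k : Set K) ⊆ insert (x 1) S' := fun a ha => .inr (.inr ha)
  have hkL : ∀ a ∈ k, a ∈ locClosure V (insert (x 1) S') := fun a ha => subset_locClosure (hkS ha)
  have hx0L : x 0 ∈ locClosure V (insert (x 1) S') := by
    have := add_mem (subset_locClosure (V := V) (S := insert (x 1) S') (.inr (.inl rfl))) (hkL _ (hξk 0))
    grind
  have hx1L : x 1 ∈ locClosure V (insert (x 1) S') := subset_locClosure (.inl rfl)
  have hch2 : Chart k V (x 0 - ξ 0) (insert (x 1) S') := by
    refine hch.insert (U := x 1 - ξ 4) (ξ := ξ 1)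
      (c := (l * (1 + x 0)⁻¹ * (1 + ξ 0)⁻¹ - 1) * x 1 - 1) (hV 1) (hξk 1)
      (sub_mem hx1L (hkL _ (hξk 4))) ?_ ?_ (inv_mem_of_val_eq_one hU) ?_
    · refine sub_mem (mul_mem (sub_mem (mul_mem (mul_mem (hkL _ hlk) ?_) (hkL _ ?_)) (one_mem _))
        hx1L) (one_mem _)
      · exact inv_mem_locClosure (add_mem (one_mem _) hx0L) (inv_mem_of_val_eq_one h1x)
      · exact k.inv_mem (add_mem (one_mem _) (hξk 0))
    · rw [← V.valuation.ne_zero_iff, hU]; aesop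
    · have e1 := h.one_add_ne 0
      have e2 := hξ.one_add_ne 0
      have q1 := h.quad
      have q2 := hξ.quad
      have r1 := h.rels.1
      have r2 := hξ.rels.1
      grind
  have hflow : ∀ i, flow x i ∈ V := fun i =>
    mul_mem (add_mem (one_mem _) (hV i)) (sub_mem (hV _) (hV _))
  have hD1 : ∀ D : Derivation ℤ K K, (∀ a ∈ k, D a ∈ k) → (∀ i, D (x i) ∈ V) →
      ∀ z ∈ insert (x 1) S', D z ∈ V := by
    rintro D h1 h2 z (rfl | rfl | hz)
    · exact h2 1
    · rw [map_sub]; exact sub_mem (h2 0) (hk (h1 _ (hξk 0)))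
    · exact hk (h1 _ hz)
  refine ⟨x 0 - ξ 0, insert (x 1) S', hch2, ?_, ?_, ?_, ?_⟩
  · rw [closure_range_eq h]
    apply le_antisymm <;> refine Subfield.closure_le.2 ?_
    · rintro a (rfl | rfl | ha)
      · exact Subfield.subset_closure (.inl rfl)
      · exact sub_mem (Subfield.subset_closure (.inr (.inl rfl)))
          (Subfield.subset_closure (.inr (.inr (hξk 0))))
      · exact Subfield.subset_closure (.inr (.inr ha))
    · rintro a (rfl | rfl | ha)
      · exact Subfield.subset_closure (.inl rfl)
      · have := add_mem (Subfield.subset_closure (s := insert (x 1) S') (.inr (.inl rfl)))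
          (Subfield.subset_closure (s := insert (x 1) S') (.inr (.inr (hξk 0))))
        aesop
      · exact Subfield.subset_closure (.inr (.inr ha))
  · aesop
  · rw [map_sub, hδ _ (hξk 0), sub_zero, hδx]
    refine val_eq_one_of_sub (val_eq_one_of_mem hk (mul_mem (add_mem (one_mem _) (hξk _))
      (sub_mem (hξk _) (hξk _))) hf) ?_
    refine val_lt_mul_sub (add_mem (one_mem _) (hV _)) (sub_mem (hξV _) (hξV _)) ?_ ?_
    · grind
    · have : ∀ a b c d : K, a - b - (c - d) = (a - c) - (b - d) := by grind
      rw [this]; exact val_lt_sub (hr _) (hr _)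
  aesop

/-- The chart at a cusp. -/
lemma flowChart_of_cusp (h : IsLyness l x) (hk : (k : Set K) ⊆ V) (hlk : l ∈ k)
    {g : V.ValueGroup} (hc : Cusp x V.valuation 0 g)
    (hδ : ∀ a ∈ k, δ a = 0) (hδx : ∀ i, δ (x i) = flow x i) :
    FlowChart k V x δ (1 + x 1) (insert (x 2)⁻¹ (insert (1 + x 1) (k : Set K))) := by
  obtain ⟨hg, c0, c1, c4, c2, c3⟩ := hc
  simp only [zero_add] at c1 c2
  have hg0 : g ≠ 0 := (zero_lt_one.trans hg).ne'
  have n := h.ne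
  have r := h.rels
  have vl := val_eq_one_of_mem hk hlk h.prod_ne
  set π := 1 + x 1 with hπ
  set e := (x 2)⁻¹ with he
  have ve : V.valuation e = g⁻¹ := by aesop
  have vπ : V.valuation π = g⁻¹ := by
    have hm : V.valuation (x 2 * x 0) * g = 1 := by rw [map_mul, c2, ← c0, mul_comm g, mul_assoc, sq]
    rw [← r.2.1]; exact eq_inv_of_mul_eq_one_left hm
  have hlt : g⁻¹ < 1 := inv_lt_one_of_one_lt₀ hg
  have he0 : e ≠ 0 := inv_ne_zero (n 2)
  have hπ0 : π ≠ 0 := by grind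
  have hx0 : x 0 = π * e := by
    grind
  have hx2 : x 2 = e⁻¹ := by grind
  have hx1 : x 1 = π - 1 := by grind
  have hpe : V.valuation (π * e) < 1 := by
    rw [map_mul, vπ, ve]; exact mul_lt_one_of_lt_of_le hlt hlt.le
  have v1e : V.valuation (1 + e) = 1 :=
    val_eq_one_of_sub (map_one _) (by grind)
  have v1π : V.valuation (1 + π * e) = 1 :=
    val_eq_one_of_sub (map_one _) (by grind)
  have n1e : 1 + e ≠ 0 := by grind
  have n1π : 1 + π * e ≠ 0 := by grind
  have hx3 : x 3 = (1 + e) / (e * x 1) := by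
    grind
  have hx4 : x 4 = (1 + π * e) / x 1 := by
    grind
  have rel : π * ((1 + e) * (1 + π * e)) = l * e * (π - 1) := by
    have hp := h.prod
    grind
  have hπi : π⁻¹ ∉ V := by
    rw [← V.valuation_le_one_iff, map_inv₀, vπ, inv_inv, not_le]; exact hg
  have hπV : π ∈ V := by rw [← V.valuation_le_one_iff, vπ]; grind
  have heV : e ∈ V := by rw [← V.valuation_le_one_iff, ve]; grind
  have hch := Chart.base hk hπV hπi
  set S' : Set K := insert π (k : Set K) with hS'
  have hkS : (k : Set K) ⊆ insert e S' := fun a ha => .inr (.inr ha)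
  have hkL : ∀ a ∈ k, a ∈ locClosure V (insert e S') := fun a ha => subset_locClosure (hkS ha)
  have hπL : π ∈ locClosure V (insert e S') := subset_locClosure (.inr (.inl rfl))
  have heL : e ∈ locClosure V (insert e S') := subset_locClosure (.inl rfl)
  have hch2 : Chart k V π (insert e S') := by
    refine hch.insert (U := l) (ξ := 0) (c := l * e - (1 + e) * (1 + π * e)) heV (zero_mem _)
      (hkL _ hlk) ?_ h.prod_ne (inv_mem_of_val_eq_one vl) ?_
    · exact sub_mem (mul_mem (hkL _ hlk) heL) (mul_mem (add_mem (one_mem _) heL)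
        (add_mem (one_mem _) (mul_mem hπL heL)))
    grind
  have hδπ : δ π = l * (π - 1) * (1 + e)⁻¹ * (1 + π * e)⁻¹ - π * (π * e) := by
    rw [hπ, map_add, Derivation.map_one_eq_zero, zero_add, hδx, flow, ← hπ]
    have i1 : (1 + 1 : ZMod 5) = 2 := rfl
    have i2 : (1 - 1 : ZMod 5) = 0 := rfl
    grind
  have hδe : δ e = -((1 + e) * ((1 + e) * (x 1)⁻¹ - e * x 1)) := by
    rw [he, Derivation.leibniz_inv, hδx, flow]
    have i1 : (2 + 1 : ZMod 5) = 3 := rfl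
    have i2 : (2 - 1 : ZMod 5) = 1 := rfl
    have n1 := n 1
    rw [i1, i2, hx3, ← he, hx2, smul_eq_mul]
    grind
  have x1V : x 1 ∈ V := mem_of_val_eq_one c1
  refine ⟨hch2, ?_, ?_, ?_, ?_⟩
  · rw [closure_range_eq h]
    have ha : insert e S' ⊆ Subfield.closure (insert e S') := Subfield.subset_closure
    have hb : insert (x 1) (insert (x 0) (k : Set K)) ⊆
      Subfield.closure (insert (x 1) (insert (x 0) (k : Set K))) := Subfield.subset_closure
    apply le_antisymm <;> refine Subfield.closure_le.2 ?_
    · have h1 := add_mem (one_mem _) (hb (.inl rfl))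
      rintro a (rfl | rfl | ha)
      · have : e = x 0 / (1 + x 1) := by grind
        rw [this]
        exact div_mem (hb (.inr (.inl rfl))) h1
      · exact h1
      grind
    · rintro a (rfl | rfl | ha')
      · rw [hx1]; exact sub_mem (ha (.inr (.inl rfl))) (one_mem _)
      · rw [hx0]; exact mul_mem (ha (.inr (.inl rfl))) (ha (.inl rfl))
      grind
  · rintro z (rfl | rfl | hz)
    · rw [hδe]
      exact neg_mem (mul_mem (add_mem (one_mem _) heV) (sub_mem (mul_mem (add_mem (one_mem _) heV)
        (inv_mem_of_val_eq_one c1)) (mul_mem heV x1V)))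
    · rw [hδπ]
      exact sub_mem (mul_mem (mul_mem (mul_mem (hk hlk) (sub_mem hπV (one_mem _)))
        (inv_mem_of_val_eq_one v1e)) (inv_mem_of_val_eq_one v1π)) (mul_mem hπV (mul_mem hπV heV))
    · rw [hδ _ hz]; exact V.zero_mem
  · refine val_eq_one_of_sub (c := l * (π - 1) * (1 + e)⁻¹ * (1 + π * e)⁻¹) ?_ ?_
    · rw [← hx1, map_mul, map_mul, map_mul, map_inv₀, map_inv₀, vl, c1, v1e, v1π]; simp
    · rw [hδπ, sub_sub_cancel_left, Valuation.map_neg]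
      exact val_lt_mul_left hπV hpe
  · rintro D h1 h2 z (rfl | rfl | hz)
    · rw [he, Derivation.leibniz_inv, h2, smul_zero]; exact V.zero_mem
    · rw [hπ, map_add, Derivation.map_one_eq_zero, h2, add_zero]; exact V.zero_mem
    · exact hk (h1 _ hz)

lemma IsLyness.of_residue (h : IsLyness l x) (hk : (k : Set K) ⊆ V) (hlk : l ∈ k)
    (hv : ∀ i, V.valuation (x i) = 1) {ξ : ZMod 5 → K}
    (hξk : ∀ i, ξ i ∈ k) (hr : ∀ i, V.valuation (x i - ξ i) < 1) : IsLyness l ξ := by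
  have hV : ∀ i, x i ∈ V := fun i => mem_of_val_eq_one (hv i)
  have hξV : ∀ i, ξ i ∈ V := fun i => hk (hξk i)
  refine ⟨fun i h0 => ?_, fun i => ?_, ?_⟩
  · grind
  · refine sub_eq_zero.1 (eq_zero_of_val_lt hk (sub_mem (mul_mem (hξk _) (hξk _))
      (add_mem (one_mem _) (hξk _))) ?_)
    have := val_lt_sub (hr i) (val_lt_mul_sub (hV _) (hξV _) (hr (i + 1)) (hr (i - 1)))
    rw [h.rel] at this
    convert this using 2
    ring
  · refine sub_eq_zero.1 (eq_zero_of_val_lt hk (sub_mem (mul_mem (mul_mem (mul_mem (mul_mem (hξk _)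
      (hξk _)) (hξk _)) (hξk _)) (hξk _)) hlk) ?_)
    have h1 := val_lt_mul_sub (hV _) (hξV _) (hr 0) (hr 1)
    have h2 := val_lt_mul_sub (mul_mem (hV 0) (hV 1)) (hξV _) h1 (hr 2)
    have h3 := val_lt_mul_sub (mul_mem (mul_mem (hV 0) (hV 1)) (hV 2)) (hξV _) h2 (hr 3)
    have h4 := val_lt_mul_sub (mul_mem (mul_mem (mul_mem (hV 0) (hV 1)) (hV 2)) (hV 3)) (hξV _) h3
      (hr 4)
    rw [h.prod, ← Valuation.map_neg, neg_sub] at h4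
    exact h4

variable [IsAlgClosed K] [Algebra ℂ K] {N : Subfield K}

omit [IsAlgClosed K] [Algebra ℂ K] in
lemma Cusp.shift {j : ZMod 5} {g : V.ValueGroup} (hc : Cusp x V.valuation j g) :
    Cusp (fun i => x (i + j)) V.valuation 0 g := by
  obtain ⟨hg, c0, c1, c4, c2, c3⟩ := hc
  refine ⟨hg, ?_, ?_, ?_, ?_, ?_⟩ <;> simp only [zero_add, zero_sub, neg_add_eq_sub]
  · exact c0
  · rw [add_comm]; exact c1
  · exact c4
  · rw [add_comm]; exact c2
  · exact c3

lemma exists_flowChart (h : IsLyness l x) (hd : l ^ 2 - 11 * l - 1 ≠ 0) (hN : Dim1 k N)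
    (hx : ∀ i, x i ∈ N) (hk : (k : Set K) ⊆ V) (hlk : l ∈ k) (hNV : ¬ (N : Set K) ⊆ V)
    (h0 : x 0 ∉ k) (hδ : ∀ a ∈ k, δ a = 0) (hδx : ∀ i, δ (x i) = flow x i) :
    ∃ π S, FlowChart k V x δ π S := by
  have vl := val_eq_one_of_mem hk hlk h.prod_ne
  have hδs : ∀ j i : ZMod 5, δ (x (i + j)) = flow (fun i => x (i + j)) i := fun j i => by
    rw [hδx]; simp only [flow]
    rw [add_right_comm i j 1, sub_add_eq_add_sub]
  rcases h.pattern V.valuation vl with hv | ⟨j, g, hc⟩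
  · have hV : ∀ i, x i ∈ V := fun i => mem_of_val_eq_one (hv i)
    choose ξ hξk hr using fun i => hN.exists_residue hk hNV (hx i) (hV i)
    have hξ := h.of_residue hk hlk hv hξk hr
    have : CharZero K := charZero_of_injective_algebraMap (algebraMap ℂ K).injective
    obtain ⟨j, hj⟩ := hξ.exists_flow_ne hd fun i => hξ.one_add_ne i
    obtain ⟨π, S, H⟩ := flowChart_of_unit (δ := δ) (h.shift j) hk hlk (fun hh => h0 (h.mem_all hN.closed hlk hh 0))
      (fun i => hv _) (hξ.shift j) (fun i => hξk _) (fun i => hr _)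
      (by simpa only [flow, zero_add, add_comm 1 j, zero_sub, neg_add_eq_sub] using hj) hδ (hδs j)
    exact ⟨π, S, H.of_shift⟩
  · have hc' := Cusp.shift hc
    exact ⟨_, _, (flowChart_of_cusp (δ := δ) (h.shift j) hk hlk hc' hδ (hδs j)).of_shift⟩

/-- `N ∩ V` is a discrete valuation ring stable under the derivations that matter. -/
structure FlowDVR (k N : Subfield K) (V : ValuationSubring K) (x : ZMod 5 → K) (h : K)
    (δ : Derivation ℤ K K) (π : K) : Prop where
  unif : Unif N V π
  flow_mem : ∀ f ∈ N, f ∈ V → δ f ∈ V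
  flow_unit : V.valuation (δ π) = 1
  deriv_mem : ∀ D : Derivation ℤ K K, (∀ a ∈ k, D a ∈ k) → (∀ i, D (x i) = 0) → D h = 0 →
    ∀ f ∈ N, f ∈ V → D f ∈ V

omit [IsAlgClosed K] in
lemma FlowChart.algebraic {S : Set K} {π : K} (H : FlowChart k V x δ π S)
    (hx : ∀ i, x i ∈ N) (hN : Dim1 k N) {T : Set K} (hT : T ⊆ N) (b : K)
    (hk : (k : Set K) ⊆ V) (hb : b ∈ locClosure V T) : IsAlgebraic (Algebra.adjoin k {π}) b := by
  have hle : Subfield.closure S ≤ N := by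
    rw [H.closure_eq]
    refine Subfield.closure_le.2 (Set.union_subset hN.le ?_)
    rintro _ ⟨i, rfl⟩
    exact hx i
  refine hN.isAlgebraic (hle (Subfield.subset_closure H.chart.mem)) (fun hπ => ?_) (locClosure_le_subfield hT hb)
  exact H.chart.val_lt.ne (val_eq_one_of_mem hk hπ H.chart.ne_zero)

lemma exists_flowDVR (h : IsLyness l x) (hd : l ^ 2 - 11 * l - 1 ≠ 0) (hN : Dim1 k N)
    (hx : ∀ i, x i ∈ N) (hk : (k : Set K) ⊆ V) (hlk : l ∈ k) (hNV : ¬ (N : Set K) ⊆ V)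
    (h0 : x 0 ∉ k) (hδ : ∀ a ∈ k, δ a = 0) (hδx : ∀ i, δ (x i) = flow x i)
    (hN' : N = Subfield.closure (k ∪ Set.range x)) :
    ∃ π, FlowDVR k N V x 0 δ π := by
  obtain ⟨π, S, H⟩ := exists_flowChart h hd hN hx hk hlk hNV h0 hδ hδx
  have ha := fun b hb => H.algebraic hx hN (T := S)
    (by rw [hN', ← H.closure_eq]; aesop) b hk hb
  rw [← H.closure_eq] at hN'
  subst hN'
  exact ⟨π, H.chart.unif ha, fun f => H.chart.deriv_mem ha _ H.flow_mem, H.flow_unit,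
    fun D h1 h2 _ f => H.chart.deriv_mem ha D (H.deriv_mem D h1 h2)⟩

lemma exists_flowDVR_root (h : IsLyness l x) (hd : l ^ 2 - 11 * l - 1 ≠ 0) (hN : Dim1 k N)
    (hx : ∀ i, x i ∈ N) (hk : (k : Set K) ⊆ V) (hlk : l ∈ k) (hNV : ¬ (N : Set K) ⊆ V)
    (h0 : x 0 ∉ k) (hδ : ∀ a ∈ k, δ a = 0) (hδx : ∀ i, δ (x i) = flow x i)
    {s : K} (hs : s ^ 5 = hfun x) (hsN : s ∈ N)
    (hN' : N = Subfield.closure (insert s (k ∪ Set.range x))) :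
    ∃ π, FlowDVR k N V x s δ π := by
  have : CharZero K := charZero_of_injective_algebraMap (algebraMap ℂ K).injective
  obtain ⟨π, S, H⟩ := exists_flowChart h hd hN hx hk hlk hNV h0 hδ hδx
  have hS : Subfield.closure S ≤ N := by
    rw [H.closure_eq]
    exact Subfield.closure_le.2 (Set.union_subset hN.le fun y ⟨i, hi⟩ => hi ▸ hx i)
  have ha := fun b hb => H.algebraic hx hN (T := S) (Subfield.subset_closure.trans hS) b hk hb
  have vl := val_eq_one_of_mem hk hlk h.prod_ne
  have hxS : ∀ i, x i ∈ Subfield.closure S := fun i => by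
    rw [H.closure_eq]; exact Subfield.subset_closure (.inr ⟨i, rfl⟩)
  have hu := H.chart.unif ha
  have hval : ∃ e : ℤ, V.valuation (hfun x) = V.valuation (π ^ e) ^ 5 := by
    obtain ⟨f, hf, hff⟩ := h.val_hfun V.valuation vl
    have : f ∈ Subfield.closure S ∧ f ≠ 0 := by
      rcases hf with rfl | rfl | rfl
      · aesop
      · exact ⟨hxS _, h.ne _⟩
      · exact ⟨inv_mem (hxS _), inv_ne_zero (h.ne _)⟩
    obtain ⟨n, u, -, hu, rfl⟩ := hu.rep f this.1 this.2
    grind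
  obtain ⟨e, he⟩ := hval
  have hp : π ^ e ≠ 0 := zpow_ne_zero _ hu.ne
  have hs0 : s ≠ 0 := by rintro rfl; exact h.hfun_ne (by grind)
  set E := hfun x / (π ^ e) ^ 5 with hE
  have vE : V.valuation E = 1 := by
    rw [hE, map_div₀, he, map_pow, div_self]
    exact pow_ne_zero _ ((V.valuation.ne_zero_iff).2 hp)
  have hES : E ∈ Subfield.closure S := by
    have : π ∈ Subfield.closure S := Subfield.subset_closure H.chart.mem
    refine div_mem (div_mem (mul_mem (pow_mem (hxS _) _) (hxS _)) (mul_mem (pow_mem (hxS _) _)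
      (hxS _))) (pow_mem (zpow_mem this _) _)
  have hEL : E ∈ locClosure V S := H.chart.mem_of_mem ha hES (mem_of_val_eq_one vE)
  set t := s / π ^ e with ht
  have htE : t ^ 5 = E := by grind
  have vt : V.valuation t = 1 := by
    have := vE
    rw [← htE, map_pow] at this
    aesop
  have htN : t ∈ N := div_mem hsN (zpow_mem (hS hu.memN) _)
  obtain ⟨χ, hχ, hr⟩ := hN.exists_residue hk hNV htN (mem_of_val_eq_one vt)
  have hχ0 : χ ≠ 0 := by grind
  have tV := mem_of_val_eq_one vt
  have χV : χ ∈ V := hk hχ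
  obtain ⟨η, hη, c, hc, hEη⟩ := H.chart.exists_res hEL
  have hηχ : χ ^ 5 = η := by
    refine sub_eq_zero.1 (eq_zero_of_val_lt hk (sub_mem (pow_mem hχ 5) hη) ?_)
    have : χ ^ 5 - η = π * c - (t ^ 4 + t ^ 3 * χ + t ^ 2 * χ ^ 2 + t * χ ^ 3 + χ ^ 4) * (t - χ) := by
      grind
    rw [this]
    refine val_lt_sub ?_ (val_lt_mul_left ?_ hr)
    · rw [mul_comm]; exact val_lt_mul_left (H.chart.loc_le hc) hu.lt
    · exact add_mem (add_mem (add_mem (add_mem (pow_mem tV _) (mul_mem (pow_mem tV _) χV))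
        (mul_mem (pow_mem tV _) (pow_mem χV _))) (mul_mem tV (pow_mem χV _))) (pow_mem χV _)
  have hSt : locClosure V S ≤ locClosure V (insert t S) := locClosure_mono (Set.subset_insert _ _)
  have htL : t ∈ locClosure V (insert t S) := subset_locClosure (.inl rfl)
  have hχL : χ ∈ locClosure V (insert t S) := hSt (H.chart.field_mem hχ)
  have hch : Chart k V π (insert t S) := by
    have vU : V.valuation (t ^ 4 + t ^ 3 * χ + t ^ 2 * χ ^ 2 + t * χ ^ 3 + χ ^ 4) = 1 := by
      refine val_eq_one_of_sub (c := 5 * χ ^ 4) (val_eq_one_of_mem hk (mul_mem (ofNat_mem k 5)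
        (pow_mem hχ 4)) (mul_ne_zero (by norm_num) (pow_ne_zero _ hχ0))) ?_
      have : t ^ 4 + t ^ 3 * χ + t ^ 2 * χ ^ 2 + t * χ ^ 3 + χ ^ 4 - 5 * χ ^ 4 =
        (t ^ 3 + 2 * (t ^ 2 * χ) + 3 * (t * χ ^ 2) + 4 * χ ^ 3) * (t - χ) := by ring
      rw [this]
      refine val_lt_mul_left ?_ hr
      have h2 : (2 : K) ∈ V := ofNat_mem V 2
      have h3 : (3 : K) ∈ V := ofNat_mem V 3
      have h4 : (4 : K) ∈ V := ofNat_mem V 4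
      exact add_mem (add_mem (add_mem (pow_mem tV _) (mul_mem h2 (mul_mem (pow_mem tV _) χV)))
        (mul_mem h3 (mul_mem tV (pow_mem χV _)))) (mul_mem h4 (pow_mem χV _))
    refine H.chart.insert (ξ := χ)
      (U := t ^ 4 + t ^ 3 * χ + t ^ 2 * χ ^ 2 + t * χ ^ 3 + χ ^ 4) (c := c) tV hχ ?_ (hSt hc) ?_
      (inv_mem_of_val_eq_one vU) ?_
    · exact add_mem (add_mem (add_mem (add_mem (pow_mem htL _) (mul_mem (pow_mem htL _) hχL))
        (mul_mem (pow_mem htL _) (pow_mem hχL _))) (mul_mem htL (pow_mem hχL _))) (pow_mem hχL _)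
    · rw [← V.valuation.ne_zero_iff, vU]; aesop
    grind
  have hcl : Subfield.closure (insert t S) = N := by
    apply le_antisymm
    · exact Subfield.closure_le.2 (Set.insert_subset htN (Subfield.subset_closure.trans hS))
    · have h1 : Subfield.closure S ≤ Subfield.closure (insert t S) :=
        Subfield.closure_mono (Set.subset_insert _ _)
      rw [hN']
      refine Subfield.closure_le.2 (Set.insert_subset ?_ ?_)
      · have : s = t * π ^ e := by grind
        rw [this]
        exact mul_mem (Subfield.subset_closure (.inl rfl)) (zpow_mem (h1 hu.memN) _)
      · refine Subfield.subset_closure.trans ?_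
        rw [← H.closure_eq]
        exact h1
  have ha' := fun b hb => H.algebraic hx hN (T := insert t S)
    (by rw [← hcl]; exact Subfield.subset_closure) b hk hb
  have hDt : ∀ D : Derivation ℤ K K, D E ∈ V → D t ∈ V := fun D hD => by
    have h5 : 5 * t ^ 4 * D t = D E := by
      rw [← htE, Derivation.leibniz_pow]
      simp [mul_assoc]
    have v5 : V.valuation (5 * t ^ 4) = 1 := by
      rw [map_mul, map_pow, vt, one_pow, mul_one]
      exact val_eq_one_of_mem hk (ofNat_mem k 5) (by norm_num)
    rw [← V.valuation_le_one_iff, ← h5, map_mul, v5, one_mul, V.valuation_le_one_iff] at hD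
    exact hD
  have hEV := H.chart.loc_le hEL
  rw [← hcl]
  refine ⟨π, hch.unif ha', fun f => hch.deriv_mem ha' _ ?_, H.flow_unit,
    fun D h1 h2 _ f => hch.deriv_mem ha' D ?_⟩
  · rintro z (rfl | hz)
    · exact hDt δ (H.chart.deriv_mem ha δ H.flow_mem hES hEV)
    · exact H.flow_mem z hz
  · rintro z (rfl | hz)
    · exact hDt D (H.chart.deriv_mem ha D (H.deriv_mem D h1 h2) hES hEV)
    · exact H.deriv_mem D h1 h2 z hz

end Smooth

section Derivations

open TensorProduct

lemma exists_derivation_of_isTranscendenceBasis {F K ι : Type*} [Field F] [Field K] [CharZero F]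
    [Algebra F K] {b : ι → K} (hb : IsTranscendenceBasis F b) (c : ι → K) :
    ∃ D : Derivation F K K, ∀ i, D (b i) = c i := by
  let _ : Algebra (MvPolynomial ι F) K := (aeval b).toAlgebra
  have hinj : Function.Injective (algebraMap (MvPolynomial ι F) K) := hb.1
  have : FaithfulSMul (MvPolynomial ι F) K := (faithfulSMul_iff_algebraMap_injective _ _).2 hinj
  have : IsScalarTower F (MvPolynomial ι F) K := .of_algHom (aeval b)
  let _ : Algebra (FractionRing (MvPolynomial ι F)) K := FractionRing.liftAlgebra _ K
  have : IsScalarTower (MvPolynomial ι F) (FractionRing (MvPolynomial ι F)) K :=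
    FractionRing.isScalarTower_liftAlgebra _ _
  have hK : Algebra.IsAlgebraic (FractionRing (MvPolynomial ι F)) K := by
    have := hb.isAlgebraic
    refine ⟨fun x => ?_⟩
    have hx := this.isAlgebraic x
    have hA : IsAlgebraic (MvPolynomial ι F) x := by
      refine IsAlgebraic.ringHom_of_comp_eq (f := (hb.1.aevalEquiv.symm : _ →+* MvPolynomial ι F))
        (g := RingHom.id K) hx (RingEquiv.injective _) ?_
      ext y
      obtain ⟨y, rfl⟩ := hb.1.aevalEquiv.surjective y
      simp [RingHom.algebraMap_toAlgebra]
    exact hA.extendScalars (IsFractionRing.injective _ _)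
  have e1 : Algebra.FormallyEtale (MvPolynomial ι F) (FractionRing (MvPolynomial ι F)) :=
    .of_isLocalization (nonZeroDivisors _)
  have e2 : Algebra.FormallyEtale (FractionRing (MvPolynomial ι F)) K := .of_isSeparable _ _
  have e3 : Algebra.FormallyEtale (MvPolynomial ι F) K :=
    .comp _ (FractionRing (MvPolynomial ι F)) _
  let d : Derivation F (MvPolynomial ι F) K := mkDerivation F c
  let e := KaehlerDifferential.tensorKaehlerEquivOfFormallyEtale F (MvPolynomial ι F) K
  let L : K ⊗[MvPolynomial ι F] (Ω[MvPolynomial ι F⁄F]) →ₗ[K] K :=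
    LinearMap.liftBaseChange K d.liftKaehlerDifferential
  refine ⟨(L ∘ₗ e.symm.toLinearMap).compDer (KaehlerDifferential.D F K), fun i => ?_⟩
  have hi : b i = algebraMap (MvPolynomial ι F) K (X i) := (aeval_X b i).symm
  rw [hi]
  change L (e.symm (KaehlerDifferential.D F K _)) = _
  rw [KaehlerDifferential.tensorKaehlerEquivOfFormallyEtale_symm_D_algebraMap]
  simp [L, d, mkDerivation_X]

lemma exists_derivation {K ι : Type*} [Field K] [CharZero K] (k : Subfield K) {b : ι → K}
    (hb : AlgebraicIndependent k b) (c : ι → K) :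
    ∃ D : Derivation ℤ K K, (∀ a ∈ k, D a = 0) ∧ ∀ i, D (b i) = c i := by
  have hr := hb.to_subtype_range
  obtain ⟨s, hs, hbs⟩ := exists_isTranscendenceBasis_superset hr
  classical
  have hi := hb.injective
  obtain ⟨D, hD⟩ := exists_derivation_of_isTranscendenceBasis hbs
    (fun y => if h : ∃ i, b i = y then c h.choose else 0)
  refine ⟨D.restrictScalars ℤ, fun a ha => D.map_algebraMap ⟨a, ha⟩, fun i => ?_⟩
  have := hD ⟨b i, hs ⟨i, rfl⟩⟩
  have he : ∃ j, b j = b i := ⟨i, rfl⟩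
  simp only [he, dif_pos] at this
  rw [hi he.choose_spec] at this
  exact this

/-- A derivation preserves a field `N` as soon as it maps a subfield over which `N` is algebraic
into `N`. -/
lemma derivation_mem_of_isAlgebraic {K : Type*} [Field K] [CharZero K] {k N : Subfield K}
    (hkN : k ≤ N) (D : Derivation ℤ K K) (hD : ∀ a ∈ k, D a ∈ N) {y : K} (hy : y ∈ N)
    (h : IsAlgebraic k y) : D y ∈ N := by
  have hi := h.isIntegral
  have hmin : ∀ p : Polynomial k, D (p.aeval y) - (p.derivative.aeval y) * D y ∈ N := fun p => by
    induction p using Polynomial.induction_on' with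
    | add p q hp hq =>
      have := add_mem hp hq
      simp only [map_add, add_mul]
      convert this using 1; ring
    | monomial n a =>
      simp only [Polynomial.aeval_monomial, Derivation.leibniz, Polynomial.derivative_monomial,
        Derivation.leibniz_pow, smul_eq_mul, map_mul, map_natCast, nsmul_eq_mul]
      have : y ^ n * D (algebraMap k K a) ∈ N := mul_mem (pow_mem hy _) (hD _ a.2)
      convert this using 1; ring
  have h0 : (minpoly k y).derivative.aeval y ≠ 0 :=
    (minpoly.irreducible hi).separable.aeval_derivative_ne_zero (minpoly.aeval k y)
  have h1 := hmin (minpoly k y)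
  rw [minpoly.aeval, map_zero, zero_sub, neg_mem_iff] at h1
  have h2 : (minpoly k y).derivative.aeval y ∈ N := by
    rw [Polynomial.aeval_eq_sum_range]
    exact sum_mem fun i _ => mul_mem (hkN (SetLike.coe_mem _)) (pow_mem hy _)
  have := div_mem h1 h2
  rwa [mul_div_cancel_left₀ _ h0] at this

/-- Algebraic independence over `k` in terms of algebraic closures. -/
lemma algebraicIndependent_of_notMem {K ι : Type*} [Field K] [Algebra ℂ K] {k : Subfield K}
    {b : ι → K} (h : ∀ i, b i ∉ acl ((k : Set K) ∪ b '' {i}ᶜ)) : AlgebraicIndependent k b := by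
  refine algebraicIndependent_of_finite_type' Subtype.val_injective fun t _ _ i hi halg => ?_
  refine h i (mem_acl_of_isAlgebraic (R := Algebra.adjoin k (b '' t)) Subtype.val_injective
    (fun r => ?_) halg)
  have : Algebra.adjoin k (b '' t) ≤
      (⟨(acl ((k : Set K) ∪ b '' {i}ᶜ)).toSubring.toSubsemiring, fun r =>
        subset_acl _ (.inl r.2)⟩ : Subalgebra k K) := by
    refine Algebra.adjoin_le ?_
    rintro _ ⟨j, hj, rfl⟩
    exact subset_acl _ (.inr ⟨j, fun hji => hi (hji ▸ hj), rfl⟩)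
  exact this r.2

end Derivations

section LocalBound

variable {K : Type*} [Field K] {V : ValuationSubring K} {k N : Subfield K} {ι : Type*} [Fintype ι]
  [DecidableEq ι]

lemma det_div_mem {π : K} (n : ι → ℕ) (M : Matrix ι ι K)
    (h : ∀ i j, M i j / π ^ n j ∈ V) : M.det / π ^ (∑ j, n j) ∈ V := by
  rw [Matrix.det_apply, Finset.sum_div]
  refine sum_mem fun σ _ => ?_
  rw [smul_div_assoc, ← Finset.prod_pow_eq_pow_sum, ← Finset.prod_div_distrib]
  exact V.toSubring.zsmul_mem (prod_mem fun i _ => h _ _) _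

/-- The determinant of a matrix of derivatives of functions `f` vanishes along the divisors of the
`f ^ 5 - 1`, up to one order. -/
lemma Unif.local_bound [CharZero K] {π : K} (H : Unif N V π) (h5 : V.valuation (5 : K) = 1)
    (D : ι → Derivation ℤ K K) (hD : ∀ i, ∀ a ∈ N, a ∈ V → D i a ∈ V) {i₀ : ι}
    (hi₀ : V.valuation (D i₀ π) = 1) (n : ι → ℕ) (M : Matrix ι ι K)
    (hM : ∀ j, (n j = 0 ∧ ∀ i, M i j ∈ V) ∨ ∃ f ∈ N, f ∈ V ∧ (∃ u ∈ N, V.valuation u = 1 ∧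
      f ^ 5 - 1 = u * π ^ n j) ∧ ∀ i, M i j = D i f) :
    M.det * π / π ^ (∑ j, n j) ∈ V := by
  have hπV : π ∈ V := (V.valuation_le_one_iff _).1 H.lt.le
  have hπ := H.ne
  have hgen : ∀ E : Derivation ℤ K K, (∀ a ∈ N, a ∈ V → E a ∈ V) → ∀ j, ∀ f ∈ N, f ∈ V →
      (∃ u ∈ N, V.valuation u = 1 ∧ f ^ 5 - 1 = u * π ^ n j) →
      π * E f / π ^ n j ∈ V ∧ (E π = 0 → E f / π ^ n j ∈ V) := fun E hE j f hfN hfV hn => by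
    have hEf := hE _ hfN hfV
    obtain ⟨u, huN, hu, huf⟩ := hn
    have huV := mem_of_val_eq_one hu
    rcases Nat.eq_zero_or_pos (n j) with h0 | h0
    · rw [h0, pow_zero, div_one, div_one]
      exact ⟨mul_mem hπV hEf, fun _ => hEf⟩
    obtain ⟨r, hr⟩ := Nat.exists_eq_succ_of_ne_zero h0.ne'
    have hf1 : V.valuation f = 1 := by
      have : V.valuation (f ^ 5) = 1 := by
        refine val_eq_one_of_sub (map_one _) ?_
        rw [huf, hr, pow_succ, ← mul_assoc]
        exact val_lt_mul_left (mul_mem huV (pow_mem hπV _)) H.lt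
      rw [map_pow] at this
      exact (pow_eq_one_iff_of_nonneg zero_le (by norm_num)).1 this
    have e : 5 * f ^ 4 * E f = π ^ n j * E u + n j * u * π ^ r * E π := by
      have := congrArg E huf
      rw [map_sub, Derivation.map_one_eq_zero, sub_zero, Derivation.leibniz, Derivation.leibniz_pow,
        Derivation.leibniz_pow] at this
      simp only [smul_eq_mul, nsmul_eq_mul, hr, Nat.succ_eq_add_one, Nat.add_sub_cancel] at this
      rw [hr, Nat.succ_eq_add_one]
      push_cast at this ⊢
      linear_combination this
    have v5 : V.valuation (5 * f ^ 4) = 1 := by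
      rw [map_mul, map_pow, hf1, one_pow, mul_one, h5]
    have n5 : 5 * f ^ 4 ≠ 0 := by rw [← V.valuation.ne_zero_iff, v5]; exact one_ne_zero
    have hpn : π ^ n j ≠ 0 := pow_ne_zero _ hπ
    have hEu := hE u huN huV
    constructor
    · have : π * E f / π ^ n j = (5 * f ^ 4)⁻¹ * (π * E u + n j * u * E π) := by
        rw [eq_inv_mul_iff_mul_eq₀ n5, ← mul_div_assoc, div_eq_iff hpn]
        have hp : π ^ n j = π ^ r * π := by rw [hr, pow_succ]
        rw [hp] at e ⊢
        linear_combination π * e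
      rw [this]
      refine mul_mem (inv_mem_of_val_eq_one v5) (add_mem (mul_mem hπV hEu)
        (mul_mem (mul_mem (natCast_mem _ _) huV) (hE _ H.memN hπV)))
    · intro hEπ
      have : E f / π ^ n j = (5 * f ^ 4)⁻¹ * E u := by
        rw [hEπ, mul_zero, add_zero] at e
        rw [eq_inv_mul_iff_mul_eq₀ n5, ← mul_div_assoc, div_eq_iff hpn]
        linear_combination e
      rw [this]
      exact mul_mem (inv_mem_of_val_eq_one v5) hEu
  have nδ : D i₀ π ≠ 0 := by rw [← V.valuation.ne_zero_iff, hi₀]; exact one_ne_zero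
  set c : ι → K := fun i => if i = i₀ then 0 else D i π / D i₀ π with hc
  have hcV : ∀ i, c i ∈ V := fun i => by
    by_cases hi : i = i₀
    · simp [hc, hi]
    · simp only [hc, if_neg hi, div_eq_mul_inv]
      exact mul_mem (hD _ _ H.memN hπV) (inv_mem_of_val_eq_one hi₀)
  set B : Matrix ι ι K := Matrix.of fun i j => M i j - c i * M i₀ j with hB
  have hdet : M.det = B.det :=
    Matrix.det_eq_of_forall_row_eq_smul_add_const c i₀ (by simp [hc]) fun i j => by simp [hB, hc]
  set w : ι → K := fun i => if i = i₀ then π else 1 with hw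
  have hscale : (Matrix.of fun i j => w i * B i j).det = M.det * π := by
    rw [Matrix.det_mul_column, hdet]
    simp [hw, mul_comm]
  rw [← hscale]
  refine det_div_mem n _ fun i j => ?_
  rcases hM j with ⟨hn, hMV⟩ | ⟨f, hfN, hfV, hf, e⟩
  · rw [hn, pow_zero, div_one]
    refine mul_mem ?_ (sub_mem (hMV _) (mul_mem (hcV _) (hMV _)))
    by_cases hi : i = i₀ <;> simp [hw, hi, hπV, one_mem]
  · by_cases hi : i = i₀
    · have := (hgen (D i₀) (hD i₀) j f hfN hfV hf).1
      simpa [hw, hB, hc, e, hi] using this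
    · have := (hgen (D i - c i • D i₀) (fun a h1 h2 => ?_) j f hfN hfV hf).2 ?_
      · simpa [hw, hB, e, hi] using this
      · exact sub_mem (hD _ a h1 h2) (mul_mem (hcV _) (hD _ a h1 h2))
      · simp only [Derivation.sub_apply, Derivation.smul_apply, smul_eq_mul, hc, if_neg hi]
        rw [div_mul_cancel₀ _ nδ, sub_self]

end LocalBound

variable {K : Type*} [Field K] [Algebra ℂ K] {ι : Type*} [Fintype ι]

/-- The generators `T`, `X`, `ρ` of the residue fields of type `a`. -/
structure IsTuple (a : ℤ) (T : ι → K) (X : ZMod 5 → K) (ρ : K) : Prop where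
  lyness : IsLyness 1 X
  notMem : X 0 ∉ acl (∅ : Set K)
  pow_ne : ∀ i, T i ^ 5 - 1 ≠ 0
  root : ρ ^ 5 = (∏ i, (T i ^ 5 - 1)) ^ a * hfun X

/-- The Jacobian matrix of `T` and of the invariant differential of the curve of `X`. -/
def jacobian (D : Option ι → Derivation ℤ K K) (T : ι → K) (X : ZMod 5 → K) :
    Matrix (Option ι) (Option ι) K :=
  Matrix.of fun i j => j.elim (D i (X 0) / flow X 0) fun j => D i (T j)

lemma IsLyness.div_flow_eq {X : ZMod 5 → K} (h : IsLyness 1 X) (h0 : X 0 ∉ acl (∅ : Set K))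
    (D : Derivation ℤ K K) (j : ZMod 5) : D (X j) / flow X j = D (X 0) / flow X 0 := by
  have hf := h.flow_ne (algClosedIn_acl _) (one_mem _) h0
  have key : ∀ n : ℕ, D (X n) / flow X n = D (X 0) / flow X 0 := fun n => by
    induction n with
    | zero => simp
    | succ n ih =>
      rw [← ih]
      have := h.deriv_cross D (by simp) n
      grind
  have := key j.val
  aesop

variable {V : ValuationSubring K} {k N : Subfield K}

omit [Algebra ℂ K] in
lemma Unif.pos {π : K} (h : Unif N V π) : 0 < V.valuation π := zero_lt_iff.2 (by simpa using h.ne)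

omit [Algebra ℂ K] in
lemma Unif.exists_val {π f : K} (h : Unif N V π) (hf : f ∈ N) (h0 : f ≠ 0) :
    ∃ n : ℤ, V.valuation f = V.valuation π ^ n := by
  obtain ⟨n, u, -, hu, rfl⟩ := h.rep f hf h0
  aesop

omit [Algebra ℂ K] in
lemma Unif.pow_eq_pow {π : K} (h : Unif N V π) {m n : ℤ} (e : V.valuation π ^ m = V.valuation π ^ n) : m = n :=
  zpow_right_injective₀ h.pos h.lt.ne e


lemma IsLyness.exists_flow_unit [IsAlgClosed K] {l : K} {X : ZMod 5 → K} (h : IsLyness l X)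
    (hd : l ^ 2 - 11 * l - 1 ≠ 0) (hN : Dim1 k N) (hX : ∀ i, X i ∈ N) (hk : (k : Set K) ⊆ V)
    (hlk : l ∈ k) (hNV : ¬ (N : Set K) ⊆ V) : ∃ j, X j ∈ V ∧ V.valuation (flow X j) = 1 := by
  have vl := val_eq_one_of_mem hk hlk h.prod_ne
  rcases h.pattern V.valuation vl with hv | ⟨j, g, hc⟩
  · have hV : ∀ i, X i ∈ V := fun i => mem_of_val_eq_one (hv i)
    choose ξ hξk hr using fun i => hN.exists_residue hk hNV (hX i) (hV i)
    have hξ := h.of_residue hk hlk hv hξk hr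
    have : CharZero K := charZero_of_injective_algebraMap (algebraMap ℂ K).injective
    obtain ⟨j, hj⟩ := hξ.exists_flow_ne hd fun i => hξ.one_add_ne i
    refine ⟨j, hV j, val_eq_one_of_sub (val_eq_one_of_mem hk (mul_mem (add_mem (one_mem _) (hξk _))
      (sub_mem (hξk _) (hξk _))) hj) ?_⟩
    refine val_lt_mul_sub (add_mem (one_mem _) (hV _)) (sub_mem (hk (hξk _)) (hk (hξk _))) ?_ ?_
    · aesop
    · have : ∀ a b c d : K, a - b - (c - d) = (a - c) - (b - d) := by grind
      rw [this]; exact val_lt_sub (hr _) (hr _)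
  · obtain ⟨hg, c0, c1, c4, c2, c3⟩ := hc
    refine ⟨j + 1, mem_of_val_eq_one c1, ?_⟩
    have hg0 : g ≠ 0 := (zero_lt_one.trans hg).ne'
    have i1 : j + 1 + 1 = j + 2 := by ring
    have i2 : j + 1 - 1 = j := by ring
    have h0 : V.valuation (X j) < 1 := by
      by_contra! hge
      have := one_lt_mul_of_le_of_lt hge (one_lt_pow₀ hg two_ne_zero)
      grind
    rw [flow, ← h.rel, i1, i2, map_mul, map_mul, c2]
    have : V.valuation (X (j + 2) - X j) = g := by
      rw [Valuation.map_sub_eq_of_lt_left, c2]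
      grind
    rw [this, ← c0]
    ring_nf
    rw [mul_assoc, mul_comm, mul_assoc, sq]

omit [Algebra ℂ K] in
lemma mem_of_forall_valuationSubring {k : Subfield K} (hk : AlgClosedIn k) {z : K}
    (h : ∀ V : ValuationSubring K, (k : Set K) ⊆ V → z ∈ V) : z ∈ k := by
  have h1 : z ∈ ⨅ V : {V : ValuationSubring K // (k : Set K) ⊆ V.toSubring}, V.1.toSubring := by
    simp only [Subring.mem_iInf]
    exact fun V => h V.1 V.2
  rw [iInf_valuationSubring_superset (s := (k : Set K))] at h1
  have h2 : IsIntegral (Subring.closure (k : Set K)) z := h1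
  have hle : Subring.closure (k : Set K) ≤ k.toSubring := Subring.closure_le.2 subset_rfl
  refine hk z (IsIntegral.isAlgebraic ?_)
  obtain ⟨p, hp, hpz⟩ := h2
  refine ⟨p.map (Subring.inclusion hle), hp.map _, ?_⟩
  rw [Polynomial.eval₂_map]
  exact hpz

variable [DecidableEq ι]

/-- The local estimate for the Jacobian. -/
lemma Unif.theta_mem {π : K} (H : Unif N V π) (h5 : V.valuation (5 : K) = 1)
    (D : Option ι → Derivation ℤ K K) (hD : ∀ i, ∀ a ∈ N, a ∈ V → D i a ∈ V) {i₀ : Option ι}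
    (hi₀ : V.valuation (D i₀ π) = 1) {T : ι → K} (hTN : ∀ i, T i ∈ N) (hT : ∀ i, T i ^ 5 - 1 ≠ 0)
    {g : Option ι → K} (hgV : ∀ i, g i ∈ V) {y : K} (hy : y ∈ V)
    (hP : (∃ m : ℤ, V.valuation (∏ i, (T i ^ 5 - 1)) = V.valuation π ^ (5 * m)) ∨ y / π ^ 4 ∈ V) :
    (Matrix.of fun i (j : Option ι) => j.elim (g i) fun j => D i (T j)).det ^ 5 /
        (∏ i, (T i ^ 5 - 1)) ^ 4 * y ∈ V ∧
      ∀ i, (Matrix.of fun i (j : Option ι) => j.elim (g i) fun j => D i (T j)).det ^ 5 /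
        (∏ i, (T i ^ 5 - 1)) ^ 4 * y * T i ^ 5 ∈ V := by
  have hch : CharZero K := charZero_of_injective_algebraMap (algebraMap ℂ K).injective
  have hπV : π ∈ V := (V.valuation_le_one_iff _).1 H.lt.le
  have hπ := H.ne
  -- integral replacements for the `T i`
  have hrep : ∀ i, ∃ f e c : K, f ∈ N ∧ f ∈ V ∧ e ∈ N ∧ e ∈ V ∧ e ≠ 0 ∧ c ≠ 0 ∧
      f ^ 5 - 1 = e ^ 5 * (T i ^ 5 - 1) ∧ (∀ E : Derivation ℤ K K, E f = c * E (T i)) ∧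
      e ^ 20 / c ^ 5 ∈ V ∧ e ^ 20 / c ^ 5 * T i ^ 5 ∈ V := fun i => by
    by_cases hi : T i ∈ V
    · exact ⟨T i, 1, 1, hTN i, hi, one_mem _, one_mem _, one_ne_zero, one_ne_zero, by ring,
        fun E => by ring, by aesop, by simpa using pow_mem hi 5⟩
    · have hTi : T i ≠ 0 := fun h0 => hi (h0 ▸ zero_mem _)
      have hiV : (T i)⁻¹ ∈ V := (V.mem_or_inv_mem _).resolve_left hi
      have hiN := inv_mem (hTN i)
      refine ⟨(T i)⁻¹, -(T i)⁻¹, -(T i)⁻¹ ^ 2, hiN, hiV, neg_mem hiN, neg_mem hiV,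
        by simpa using hTi, by simpa using hTi, by field_simp; ring, fun E => ?_, ?_, ?_⟩
      · rw [Derivation.leibniz_inv]; simp
      · have : (-(T i)⁻¹) ^ 20 / (-(T i)⁻¹ ^ 2) ^ 5 = -(T i)⁻¹ ^ 10 := by field_simp
        rw [this]; exact neg_mem (pow_mem hiV _)
      · have : (-(T i)⁻¹) ^ 20 / (-(T i)⁻¹ ^ 2) ^ 5 * T i ^ 5 = -(T i)⁻¹ ^ 5 := by field_simp
        rw [this]; exact neg_mem (pow_mem hiV _)
  choose f e c hfN hfV heN heV he0 hc0 hfe hfc hec hecT using hrep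
  have hf0 : ∀ i, f i ^ 5 - 1 ≠ 0 := fun i => by
    grind
  have hn : ∀ i, ∃ n : ℕ, ∃ u ∈ N, V.valuation u = 1 ∧ f i ^ 5 - 1 = u * π ^ n := fun i => by
    obtain ⟨n, u, hu, hu1, h⟩ := H.rep _ (sub_mem (pow_mem (hfN i) 5) (one_mem _)) (hf0 i)
    have h1 : V.valuation (π ^ n) ≤ 1 := by
      have := (V.valuation_le_one_iff _).2 (sub_mem (pow_mem (hfV i) 5) (one_mem _))
      grind
    have hn0 : 0 ≤ n := by
      by_contra! hlt
      obtain ⟨r, hr⟩ := Int.exists_eq_neg_ofNat hlt.le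
      rw [hr, zpow_neg, zpow_natCast, map_inv₀, map_pow] at h1
      have hr0 : r ≠ 0 := by grind
      have hp : V.valuation π ^ r < 1 := pow_lt_one₀ zero_le H.lt hr0
      exact absurd h1 (not_le.2 ((one_lt_inv₀ (zero_lt_iff.2 (pow_ne_zero _
        (V.valuation.ne_zero_iff.2 hπ)))).2 hp))
    lift n to ℕ using hn0
    exact ⟨n, u, hu, hu1, by aesop⟩
  choose n hn using hn
  set J : Matrix (Option ι) (Option ι) K :=
    Matrix.of fun i (j : Option ι) => j.elim (g i) fun j => D i (T j) with hJ
  set M : Matrix (Option ι) (Option ι) K :=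
    Matrix.of fun i (j : Option ι) => j.elim (g i) fun j => D i (f j) with hM
  have hMJ : M.det = (∏ i, c i) * J.det := by
    have : M = Matrix.of fun i j => (j.elim 1 c) * J i j := by
      ext i (_ | j)
      · aesop
      aesop
    rw [this, Matrix.det_mul_row, Fintype.prod_option]
    simp
  have hb := H.local_bound h5 D hD hi₀ (fun j => j.elim 0 n) M (by
    rintro (_ | j)
    · aesop
    · exact .inr ⟨f j, hfN j, hfV j, hn j, fun i => rfl⟩)
  rw [Fintype.sum_option] at hb
  simp only [Option.elim, zero_add] at hb
  have hMV : M.det ∈ V := by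
    have := det_div_mem (V := V) (π := 1) (fun _ => 0) M ?_
    · aesop
    · rintro i (_ | j)
      · aesop
      · simpa [hM] using hD i _ (hfN j) (hfV j)
  choose u huN hu1 huf using hn
  set P := ∏ i, (T i ^ 5 - 1) with hPdef
  set S := ∑ i, n i with hS
  have hP0 : P ≠ 0 := Finset.prod_ne_zero_iff.2 fun i _ => hT i
  set eP := ∏ i, e i with heP
  have heP0 : eP ≠ 0 := Finset.prod_ne_zero_iff.2 fun i _ => he0 i
  set U := ∏ i, u i with hU
  have hU1 : V.valuation U = 1 := by aesop
  have hU0 : U ≠ 0 := by rw [← V.valuation.ne_zero_iff, hU1]; aesop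
  have hPU : eP ^ 5 * P = U * π ^ S := by
    rw [heP, hPdef, hU, hS, ← Finset.prod_pow, ← Finset.prod_mul_distrib, ← Finset.prod_pow_eq_pow_sum,
      ← Finset.prod_mul_distrib]
    grind
  have hUi : U⁻¹ ∈ V := inv_mem_of_val_eq_one hU1
  have hΘ : M.det ^ 5 / (eP ^ 5 * P) ^ 4 * y ∈ V := by
    rw [hPU]
    rcases Nat.eq_zero_or_pos S with h0 | hS0
    · rw [h0, pow_zero, mul_one, div_eq_mul_inv, ← inv_pow]
      exact mul_mem (mul_mem (pow_mem hMV _) (pow_mem hUi _)) hy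
    rcases hP with ⟨m, hm⟩ | hy4
    · obtain ⟨r, hr⟩ := H.exists_val (prod_mem fun i _ => heN i) heP0
      have h5S : 5 ∣ S := by
        have := congrArg V.valuation hPU
        rw [map_mul, map_mul, map_pow, map_pow, hU1, one_mul, hm, heP, hr, ← zpow_natCast,
          ← zpow_natCast, ← zpow_mul, ← zpow_add₀ H.pos.ne'] at this
        have := H.pow_eq_pow this
        grind
      obtain ⟨t, ht⟩ := h5S
      obtain ⟨t, rfl⟩ := Nat.exists_eq_succ_of_ne_zero (n := t) (by omega)
      have : M.det ^ 5 / (U * π ^ S) ^ 4 * y =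
          (M.det * π / π ^ S) ^ 5 * (π ^ (5 * t)) * U⁻¹ ^ 4 * y := by
        have : π ^ S = π ^ (5 * t) * π ^ 5 := by grind
        rw [this]
        field_simp
      rw [this]
      exact mul_mem (mul_mem (mul_mem (pow_mem hb _) (pow_mem hπV _)) (pow_mem hUi _)) hy
    · obtain ⟨t, ht⟩ := Nat.exists_eq_succ_of_ne_zero hS0.ne'
      have : M.det ^ 5 / (U * π ^ S) ^ 4 * y =
          (M.det * π / π ^ S) ^ 5 * π ^ t * U⁻¹ ^ 4 * (y / π ^ 4) := by
        have : π ^ S = π ^ t * π := by grind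
        rw [this]
        field_simp
      rw [this]
      exact mul_mem (mul_mem (mul_mem (pow_mem hb _) (pow_mem hπV _)) (pow_mem hUi _)) hy4
  have hcP : ∏ i, c i ≠ 0 := Finset.prod_ne_zero_iff.2 fun i _ => hc0 i
  have hfin : J.det ^ 5 / P ^ 4 * y =
      M.det ^ 5 / (eP ^ 5 * P) ^ 4 * y * ∏ i, (e i ^ 20 / c i ^ 5) := by
    rw [hMJ, Finset.prod_div_distrib, Finset.prod_pow, Finset.prod_pow, ← heP]
    field_simp
  refine ⟨?_, fun i => ?_⟩
  · rw [hfin]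
    exact mul_mem hΘ (prod_mem fun i _ => hec i)
  · have := mul_mem hΘ (mul_mem (hecT i) (prod_mem (t := Finset.univ.erase i) fun i _ => hec i))
    convert this using 1
    rw [hfin, ← Finset.mul_prod_erase _ _ (Finset.mem_univ i)]
    ring

omit [DecidableEq ι] in
/-- The order of `∏ (T i ^ 5 - 1)` is divisible by five at the places with value group `ℤ`. -/
lemma IsTuple.val_prod {a : ℤ} {T : ι → K} {X : ZMod 5 → K} {ρ : K} (hT : IsTuple a T X ρ)
    (ha : IsCoprime a 5) {π : K} (H : Unif N V π) (hTN : ∀ i, T i ∈ N) (hXN : ∀ i, X i ∈ N)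
    (hρN : ρ ∈ N) : ∃ m : ℤ, V.valuation (∏ i, (T i ^ 5 - 1)) = V.valuation π ^ (5 * m) := by
  have hP0 : ∏ i, (T i ^ 5 - 1) ≠ 0 := Finset.prod_ne_zero_iff.2 fun i _ => hT.pow_ne i
  obtain ⟨q, hq, hqH⟩ := hT.lyness.val_hfun V.valuation (map_one _)
  have hqN : q ∈ N ∧ q ≠ 0 := by
    rcases hq with rfl | rfl | rfl
    · aesop
    · exact ⟨hXN _, hT.lyness.ne _⟩
    · exact ⟨inv_mem (hXN _), inv_ne_zero (hT.lyness.ne _)⟩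
  have hρ0 : ρ ≠ 0 := by
    rintro rfl
    have := hT.root
    rw [zero_pow (by norm_num)] at this
    exact mul_ne_zero (zpow_ne_zero _ hP0) hT.lyness.hfun_ne this.symm
  obtain ⟨m, hm⟩ := H.exists_val (div_mem hρN hqN.1) (div_ne_zero hρ0 hqN.2)
  obtain ⟨r, hr⟩ := H.exists_val (prod_mem fun i _ => sub_mem (pow_mem (hTN i) 5) (one_mem _)) hP0
  have hv : V.valuation π ^ (m * 5) = V.valuation π ^ (r * a) := by
    rw [zpow_mul, ← hm, zpow_mul, ← hr, zpow_ofNat, ← map_pow, div_pow, hT.root, map_div₀, map_mul,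
      hqH, map_pow, mul_div_cancel_right₀ _ (pow_ne_zero _ (V.valuation.ne_zero_iff.2 hqN.2)),
      map_zpow₀]
  have e3 := H.pow_eq_pow hv
  obtain ⟨t, rfl⟩ : (5 : ℤ) ∣ r := ha.symm.dvd_of_dvd_mul_right ⟨m, by grind⟩
  grind

/-- The local estimate for the Jacobian of a tuple over a curve. -/
lemma FlowDVR.theta_mem [IsAlgClosed K] (hN : Dim1 k N) {x : ZMod 5 → K} {s π : K}
    {δ : Derivation ℤ K K} (hk : (k : Set K) ⊆ V) (hNV : ¬ (N : Set K) ⊆ V)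
    (H : FlowDVR k N V x s δ π) (D : Option ι → Derivation ℤ K K) (hD0 : D none = δ)
    (hDk : ∀ i, ∀ a ∈ k, D (some i) a ∈ k) (hDx : ∀ i j, D (some i) (x j) = 0)
    (hDs : ∀ i, D (some i) s = 0) {a : ℤ} (ha : IsCoprime a 5) {T : ι → K} {X : ZMod 5 → K} {ρ : K}
    (hT : IsTuple a T X ρ) (hTN : ∀ i, T i ∈ N) (hXN : ∀ i, X i ∈ N) (hρN : ρ ∈ N) :
    (jacobian D T X).det ^ 5 / (∏ i, (T i ^ 5 - 1)) ^ 4 ∈ V ∧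
      ∀ i, (jacobian D T X).det ^ 5 / (∏ i, (T i ^ 5 - 1)) ^ 4 * T i ^ 5 ∈ V := by
  have hch : CharZero K := charZero_of_injective_algebraMap (algebraMap ℂ K).injective
  have hD : ∀ i, ∀ a ∈ N, a ∈ V → D i a ∈ V := by
    rintro (_ | i)
    · rw [hD0]; exact H.flow_mem
    · exact H.deriv_mem _ (hDk i) (hDx i) (hDs i)
  obtain ⟨j, hjV, hj⟩ := hT.lyness.exists_flow_unit (by norm_num) hN hXN hk (one_mem _) hNV
  have hgV : ∀ i, D i (X 0) / flow X 0 ∈ V := fun i => by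
    rw [← hT.lyness.div_flow_eq hT.notMem _ j, div_eq_mul_inv]
    exact mul_mem (hD _ _ (hXN j) hjV) (inv_mem_of_val_eq_one hj)
  have h5 : V.valuation (5 : K) = 1 := val_eq_one_of_mem hk (ofNat_mem k 5) (by norm_num)
  have := H.unif.theta_mem h5 D hD (i₀ := none) (by rw [hD0]; exact H.flow_unit) hTN hT.pow_ne hgV
    (one_mem _) (.inl (hT.val_prod ha H.unif hTN hXN hρN))
  simpa only [mul_one, jacobian] using this

/-- A tuple defined over a curve with a vector field of this kind is constant. -/
lemma theta_mem [IsAlgClosed K] (hN : Dim1 k N) {x : ZMod 5 → K} {s : K}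
    {δ : Derivation ℤ K K} (H : ∀ V : ValuationSubring K, (k : Set K) ⊆ V → ¬ (N : Set K) ⊆ V →
      ∃ π, FlowDVR k N V x s δ π) (hδN : ∀ a ∈ N, δ a ∈ N)
    (hkN : ∀ D : Derivation ℤ K K, (∀ a ∈ k, D a ∈ k) → (∀ i, D (x i) = 0) → D s = 0 →
      ∀ a ∈ N, D a ∈ N)
    (D : Option ι → Derivation ℤ K K) (hD0 : D none = δ)
    (hDk : ∀ i, ∀ a ∈ k, D (some i) a ∈ k) (hDx : ∀ i j, D (some i) (x j) = 0)
    (hDs : ∀ i, D (some i) s = 0) {a : ℤ} (ha : IsCoprime a 5) {T : ι → K} {X : ZMod 5 → K} {ρ : K}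
    (hT : IsTuple a T X ρ) (hTN : ∀ i, T i ∈ N) (hXN : ∀ i, X i ∈ N) (hρN : ρ ∈ N) :
    (jacobian D T X).det ^ 5 / (∏ i, (T i ^ 5 - 1)) ^ 4 ∈ k ∧
      ∀ i, (jacobian D T X).det ^ 5 / (∏ i, (T i ^ 5 - 1)) ^ 4 * T i ^ 5 ∈ k := by
  have hD : ∀ i, ∀ a ∈ N, D i a ∈ N := by
    rintro (_ | i)
    · grind
    grind
  have hJ : (jacobian D T X).det ∈ N := by
    rw [Matrix.det_apply]
    refine sum_mem fun σ _ => ?_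
    rw [Units.smul_def]
    refine zsmul_mem (prod_mem fun i _ => ?_) _
    rcases i with _ | i
    · exact div_mem (hD _ _ (hXN 0)) (mul_mem (add_mem (one_mem _) (hXN _))
        (sub_mem (hXN _) (hXN _)))
    · exact hD _ _ (hTN i)
  have hΘ : (jacobian D T X).det ^ 5 / (∏ i, (T i ^ 5 - 1)) ^ 4 ∈ N :=
    div_mem (pow_mem hJ _) (pow_mem (prod_mem fun i _ => sub_mem (pow_mem (hTN i) _) (one_mem _)) _)
  have main : ∀ V : ValuationSubring K, (k : Set K) ⊆ V →
      (jacobian D T X).det ^ 5 / (∏ i, (T i ^ 5 - 1)) ^ 4 ∈ V ∧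
      ∀ i, (jacobian D T X).det ^ 5 / (∏ i, (T i ^ 5 - 1)) ^ 4 * T i ^ 5 ∈ V := fun V hk => by
    by_cases hNV : (N : Set K) ⊆ V
    · aesop
    · obtain ⟨π, hπ⟩ := H V hk hNV
      exact FlowDVR.theta_mem hN hk hNV hπ D hD0 hDk hDx hDs ha hT hTN hXN hρN
  exact ⟨mem_of_forall_valuationSubring hN.closed fun V hk => (main V hk).1,
    fun i => mem_of_forall_valuationSubring hN.closed fun V hk => (main V hk).2 i⟩

section Der

variable {K : Type*} [Field K]

/-- The field of constants of a derivation. -/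
def constants (D : Derivation ℤ K K) : Subfield K where
  carrier := {a | D a = 0}
  mul_mem' {a b} (ha : D a = 0) (hb : D b = 0) := by aesop
  one_mem' := by simp
  add_mem' {a b} (ha : D a = 0) (hb : D b = 0) := by grind
  zero_mem' := by simp
  neg_mem' {a} (ha : D a = 0) := by simp [ha]
  inv_mem' a (ha : D a = 0) := by simp [Derivation.leibniz_inv, ha]

lemma mem_constants {D : Derivation ℤ K K} {a : K} : a ∈ constants D ↔ D a = 0 := Iff.rfl

lemma algClosedIn_constants [CharZero K] (D : Derivation ℤ K K) : AlgClosedIn (constants D) := by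
  intro y h
  have hi := h.isIntegral
  have hmin : ∀ p : Polynomial (constants D), D (p.aeval y) = (p.derivative.aeval y) * D y :=
    fun p => by
    induction p using Polynomial.induction_on' with
    | add p q hp hq => grind
    | monomial n a =>
      simp only [Polynomial.aeval_monomial, Derivation.leibniz, Polynomial.derivative_monomial,
        Derivation.leibniz_pow, smul_eq_mul, map_mul, map_natCast, nsmul_eq_mul]
      have : D (algebraMap (constants D) K a) = 0 := a.2
      grind
  have h0 : (minpoly (constants D) y).derivative.aeval y ≠ 0 :=
    (minpoly.irreducible hi).separable.aeval_derivative_ne_zero (minpoly.aeval _ y)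
  have h1 := hmin (minpoly _ y)
  rw [minpoly.aeval, map_zero] at h1
  exact (mul_eq_zero.1 h1.symm).resolve_left h0

lemma derivation_mem_closure {s : Set K} {N : Subfield K} (hs : s ⊆ N) (D : Derivation ℤ K K)
    (h : ∀ a ∈ s, D a ∈ N) : ∀ a ∈ Subfield.closure s, D a ∈ N := fun a ha => by
  have hle : Subfield.closure s ≤ N := Subfield.closure_le.2 hs
  induction ha using Subfield.closure_induction with
  | mem x hx => grind
  | one => aesop
  | add x y _ _ hx hy => rw [map_add]; exact add_mem hx hy
  | neg x _ hx => aesop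
  | inv x hx' hx =>
    rw [Derivation.leibniz_inv]
    exact mul_mem (neg_mem (pow_mem (inv_mem (hle hx')) _)) hx
  | mul x y hx' hy' hx hy =>
    rw [Derivation.leibniz]
    exact add_mem (mul_mem (hle hx') hy) (mul_mem (hle hy') hx)

variable [Algebra ℂ K] {s : Set K}

omit [Algebra ℂ K] in
lemma charZero_of_algebra (K : Type*) [Field K] [Algebra ℂ K] : CharZero K :=
  charZero_of_injective_algebraMap (algebraMap ℂ K).injective

lemma isAlgebraic_closure {y : K} (hy : y ∈ acl s) :
    IsAlgebraic (Subfield.closure (Set.range (algebraMap ℂ K) ∪ s)) y :=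
  isAlgebraic_of_mem_acl Subtype.val_injective
    (fun c => ⟨⟨_, Subfield.subset_closure (.inl ⟨c, rfl⟩)⟩, rfl⟩)
    (fun a ha => ⟨⟨a, Subfield.subset_closure (.inr ha)⟩, rfl⟩) hy

lemma derivation_eq_zero_of_mem_acl {D : Derivation ℤ K K} (hC : ∀ c : ℂ, D (algebraMap ℂ K c) = 0)
    (hs : ∀ a ∈ s, D a = 0) {y : K} (hy : y ∈ acl s) : D y = 0 := by
  have := charZero_of_algebra K
  exact (algClosedIn_constants D).acl_le hC hs hy

lemma derivation_mem_acl {D : Derivation ℤ K K} (hC : ∀ c : ℂ, D (algebraMap ℂ K c) = 0)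
    (hs : ∀ a ∈ s, D a ∈ acl s) {y : K} (hy : y ∈ acl s) : D y ∈ acl s := by
  have := charZero_of_algebra K
  have hsub : Set.range (algebraMap ℂ K) ∪ s ⊆ acl s :=
    Set.union_subset (by rintro _ ⟨c, rfl⟩; exact algebraMap_mem_acl c) (subset_acl s)
  refine derivation_mem_of_isAlgebraic (Subfield.closure_le.2 hsub) D
    (derivation_mem_closure hsub D ?_) hy (isAlgebraic_closure hy)
  rintro _ (⟨c, rfl⟩ | ha)
  · aesop
  grind

lemma exists_derivation_acl {e : K} (he : e ∉ acl s) (c : K) :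
    ∃ D : Derivation ℤ K K, (∀ a ∈ acl s, D a = 0) ∧ D e = c := by
  have := charZero_of_algebra K
  obtain ⟨D, h1, h2⟩ := exists_derivation (acl s) (b := fun _ : Unit => e)
    (algebraicIndependent_of_notMem fun i => by
      have : (fun _ : Unit => e) '' {i}ᶜ = ∅ := by ext; simp
      rw [this, Set.union_empty, acl_idem]; exact he) fun _ => c
  exact ⟨D, h1, h2 ()⟩

end Der

/-- `b` is a family of algebraically independent elements. -/
def Free {K ι : Type*} [Field K] [Algebra ℂ K] (b : ι → K) : Prop := ∀ i, b i ∉ acl (b '' {i}ᶜ)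

section Ratio

variable {K : Type*} [Field K] {k : Subfield K} {s : K}

lemma exists_ratio_of_mem_closure {y : K} (hy : y ∈ Subfield.closure (insert s (k : Set K))) :
    ∃ P Q : Polynomial k, Q.aeval s ≠ 0 ∧ y = P.aeval s / Q.aeval s := by
  have hle : Subfield.closure (insert s (k : Set K)) ≤ (IntermediateField.adjoin k {s}).toSubfield := by
    refine Subfield.closure_le.2 (Set.insert_subset ?_ fun a ha => ?_)
    · exact IntermediateField.mem_adjoin_simple_self k s
    · exact (IntermediateField.adjoin k {s}).algebraMap_mem ⟨a, ha⟩
  obtain ⟨P, Q, h⟩ := (IntermediateField.mem_adjoin_simple_iff k y).1 (hle hy)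
  by_cases hQ : Q.aeval s = 0
  · exact ⟨0, 1, by simp, by grind⟩
  grind

lemma AlgClosedIn.eq_zero_of_aeval (hk : AlgClosedIn k) (hs : s ∉ k) {P : Polynomial k}
    (h : P.aeval s = 0) : P = 0 := by
  by_contra hP
  exact hs (hk s ⟨P, hP, h⟩)

/-- The curve of Lyness cycles of product one is not rational over the line of one coordinate. -/
lemma IsLyness.flow_notMem [CharZero K] (hk : AlgClosedIn k) {x : ZMod 5 → K} (h : IsLyness 1 x)
    (hs : x 0 ∉ k) : flow x 0 ∉ Subfield.closure (insert (x 0) (k : Set K)) := by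
  intro hf
  obtain ⟨P, Q, hQ, he⟩ := exists_ratio_of_mem_closure hf
  have hd := h.disc
  have hfl : flow x 0 = (1 + x 0) * (x 1 - x 4) := rfl
  rw [← hfl, he, div_pow, div_eq_iff (pow_ne_zero _ hQ)] at hd
  set R : Polynomial k := .X ^ 3 - 4 * .X - 4 with hR
  have e : P ^ 2 = Polynomial.X * (R * Q ^ 2) := by
    rw [← sub_eq_zero]
    refine hk.eq_zero_of_aeval hs ?_
    simp only [map_sub, map_pow, map_mul, hR, Polynomial.aeval_X, map_ofNat]
    grind
  have hQ0 : Q ≠ 0 := by grind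
  have hR0 : R.eval 0 ≠ 0 := by simp [hR]
  have hR' : R ≠ 0 := by rintro h0; simp [h0] at hR0
  have hP0 : P ≠ 0 := by
    rintro rfl
    aesop
  have := congrArg (Polynomial.rootMultiplicity 0) e
  have hX : Polynomial.rootMultiplicity 0 (.X : Polynomial k) = 1 := by
    simpa using Polynomial.rootMultiplicity_X_sub_C_self (R := k) (x := 0)
  have hRm : Polynomial.rootMultiplicity 0 R = 0 := Polynomial.rootMultiplicity_eq_zero hR0
  rw [sq, Polynomial.rootMultiplicity_mul (mul_ne_zero hP0 hP0), Polynomial.rootMultiplicity_mul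
    (mul_ne_zero Polynomial.X_ne_zero (mul_ne_zero hR' (pow_ne_zero 2 hQ0))),
    Polynomial.rootMultiplicity_mul (mul_ne_zero hR' (pow_ne_zero 2 hQ0)), sq,
    Polynomial.rootMultiplicity_mul (mul_ne_zero hQ0 hQ0), hX, hRm] at this
  omega

end Ratio

lemma IsLyness.exists_of_zero {K : Type*} [Field K] [IsAlgClosed K] {s l : K} (hs : s ≠ 0)
    (hs1 : 1 + s ≠ 0) (hl : l ≠ 0) : ∃ x : ZMod 5 → K, IsLyness l x ∧ x 0 = s := by
  set b := (l * s - (1 + s) * (2 + s)) / (1 + s) with hb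
  obtain ⟨r, hr⟩ := IsAlgClosed.exists_aeval_eq_zero K
    (.X ^ 2 - .C b * .X + .C (1 + s) : Polynomial K) (by
      have : (Polynomial.X ^ 2 - .C b * .X + .C (1 + s) : Polynomial K).degree = 2 := by
        compute_degree!
      aesop)
  have hr : r ^ 2 - b * r + (1 + s) = 0 := by aesop
  have hb' : b * (1 + s) = l * s - (1 + s) * (2 + s) := by grind
  have hr0 : r ≠ 0 := by grind
  let x : ZMod 5 → K := ![s, r, (1 + r) / s, (1 + (b - r)) / s, b - r]
  have e1 : r * (b - r) = 1 + s := by grind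
  have hrel : ∀ k, x (k + 1) * x (k - 1) = 1 + x k := by
    intro k
    fin_cases k
    · change r * (b - r) = 1 + s
      exact e1
    · change (1 + r) / s * s = 1 + r
      field_simp
    · change (1 + (b - r)) / s * r = 1 + (1 + r) / s
      grind
    · change (b - r) * ((1 + r) / s) = 1 + (1 + (b - r)) / s
      grind
    · change s * ((1 + (b - r)) / s) = 1 + (b - r)
      field_simp
  have hprod : x 0 * x 1 * x 2 * x 3 * x 4 = l := by
    change s * r * ((1 + r) / s) * ((1 + (b - r)) / s) * (b - r) = l
    grind
  refine ⟨x, ⟨fun i => ?_, hrel, hprod⟩, rfl⟩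
  intro h0
  apply hl
  rw [← hprod]
  fin_cases i <;> (simp only [Fin.zero_eta, Fin.mk_one, Fin.reduceFinMk] at h0)
  · rw [show x 0 = 0 from h0]; ring
  · rw [show x 1 = 0 from h0]; ring
  · rw [show x 2 = 0 from h0]; ring
  · rw [show x 3 = 0 from h0]; ring
  · rw [show x 4 = 0 from h0]; ring


section Jacobian

variable {K : Type*} [Field K] [Algebra ℂ K] {ι : Type*} [Fintype ι] [DecidableEq ι]

open AlgebraicIndependent (matroid)

/-- The derivations of `acl (insert s t)` are spanned by those preserving `acl t` and killing `s`,
and by `δ`. -/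
lemma derivation_mem_span {t : Set K} (ht : t.Finite) {s : K} (hs : s ∉ acl t)
    {δ : Derivation ℤ K K} (hδ : ∀ a ∈ acl t, δ a = 0) (hδs : δ s ≠ 0)
    {M : Type*} [AddCommGroup M] [Module K M] (v : Derivation ℤ K K →ₗ[K] M)
    (hv : ∀ D : Derivation ℤ K K, (∀ a ∈ acl (insert s t), D a = 0) → v D = 0)
    (E : Derivation ℤ K K) (hE : ∀ c : ℂ, E (algebraMap ℂ K c) = 0) :
    v E ∈ Submodule.span K (insert (v δ)
      (v '' {D | (∀ a ∈ acl t, D a ∈ acl t) ∧ D s = 0})) := by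
  obtain ⟨I, hI⟩ := (matroid ℂ K).exists_isBasis t (Set.subset_univ _)
  have hIt : acl I = acl t := SetLike.coe_injective hI.closure_eq_closure
  have hsI : s ∉ I := fun h => hs (hIt ▸ subset_acl I h)
  have hins : (matroid ℂ K).Indep (insert s I) := by
    rw [hI.indep.insert_indep_iff]
    left
    exact ⟨Set.mem_univ _, fun h => hs (hIt ▸ h)⟩
  have hne : ∀ e ∈ I, e ∉ acl (insert s I \ {e}) := fun e he =>
    hins.notMem_closure_sdiff_of_mem (.inr he)
  choose! D hD hDe using fun e (he : e ∈ I) => exists_derivation_acl (hne e he) 1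
  have hDs : ∀ e ∈ I, D e s = 0 := fun e he =>
    hD e he s (subset_acl _ ⟨.inl rfl, fun h => hsI (h ▸ he)⟩)
  have hDC : ∀ e ∈ I, ∀ c : ℂ, D e (algebraMap ℂ K c) = 0 := fun e he c =>
    hD e he _ (algebraMap_mem_acl c)
  have hDI : ∀ e ∈ I, ∀ e' ∈ I, e' ≠ e → D e e' = 0 := fun e he e' he' hn =>
    hD e he _ (subset_acl _ ⟨.inr he', hn⟩)
  have hDk : ∀ e ∈ I, ∀ a ∈ acl t, D e a ∈ acl t := fun e he a ha => by
    rw [← hIt] at ha ⊢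
    refine derivation_mem_acl (hDC e he) (fun b hb => ?_) ha
    by_cases hbe : b = e
    · aesop
    aesop
  have hIfin : I.Finite := ht.subset hI.subset
  set E' : Derivation ℤ K K := (E s / δ s) • δ + ∑ e ∈ hIfin.toFinset, E e • D e with hE'
  have hsum : ∀ a, E' a = E s / δ s * δ a + ∑ e ∈ hIfin.toFinset, E e * D e a := fun a => by
    rw [hE', Derivation.add_apply, Derivation.smul_apply, smul_eq_mul]
    congr 1
    rw [← Derivation.coeFnAddMonoidHom_apply, map_sum, Finset.sum_apply]
    rfl
  have hEE : v E = v E' := by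
    rw [← sub_eq_zero, ← map_sub]
    refine hv _ fun a ha => ?_
    have hI' : acl (insert s t) ≤ acl (insert s I) := by
      refine acl_le (Set.insert_subset (subset_acl _ (.inl rfl)) fun b hb => ?_)
      exact acl_mono (Set.subset_insert _ _) (hIt ▸ subset_acl t hb)
    refine derivation_eq_zero_of_mem_acl (s := insert s I) (fun c => ?_) ?_ (hI' ha)
    · rw [Derivation.sub_apply, hE, hsum, hδ _ (algebraMap_mem_acl c), Finset.sum_eq_zero]
      · simp
      aesop
    · rintro b (rfl | hb)
      · rw [Derivation.sub_apply, hsum, div_mul_cancel₀ _ hδs, Finset.sum_eq_zero]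
        · simp
        aesop
      · rw [Derivation.sub_apply, hsum, hδ b (by rw [← hIt]; exact subset_acl I hb), Finset.sum_eq_single b]
        · grind
        · intro e he hn; rw [hDI e (hIfin.mem_toFinset.1 he) b hb hn.symm]; simp
        aesop
  rw [hEE, hE', map_add, map_smul, map_sum]
  refine add_mem (Submodule.smul_mem _ _ (Submodule.subset_span (.inl rfl)))
    (sum_mem fun e he => ?_)
  have he' := hIfin.mem_toFinset.1 he
  rw [map_smul]
  exact Submodule.smul_mem _ _ (Submodule.subset_span (.inr ⟨D e, ⟨hDk e he', hDs e he'⟩, rfl⟩))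

lemma exists_jacobian_ne_zero {t : Set K} (ht : t.Finite) {s : K} (hs : s ∉ acl t)
    {δ : Derivation ℤ K K} (hδ : ∀ a ∈ acl t, δ a = 0) (hδs : δ s ≠ 0) {T : ι → K} {X : ZMod 5 → K}
    (hX : IsLyness 1 X)
    (hf : Free (fun i : Option ι => i.elim (X 0) T)) (h0 : X 0 ∈ acl (insert s t))
    (hT : ∀ i, T i ∈ acl (insert s t)) (hn : ¬ (X 0 ∈ acl t ∧ ∀ i, T i ∈ acl t)) :
    ∃ D : Option ι → Derivation ℤ K K, D none = δ ∧
      (∀ i, (∀ a ∈ acl t, D (some i) a ∈ acl t) ∧ D (some i) s = 0) ∧ (jacobian D T X).det ≠ 0 := by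
  have hch := charZero_of_algebra K
  set f : Option ι → K := fun i : Option ι => i.elim (X 0) T with hfdef
  have hX0 : X 0 ∉ acl (∅ : Set K) := fun h => hf none (acl_mono (Set.empty_subset _) h)
  have hfl : flow X 0 ≠ 0 := hX.flow_ne (algClosedIn_acl _) (one_mem _) hX0 0
  let v : Derivation ℤ K K →ₗ[K] (Option ι → K) :=
    { toFun := fun D j => j.elim (D (X 0) / flow X 0) fun j => D (T j)
      map_add' := fun D D' => by
        ext (_ | j)
        · simp [add_div]
        · simp
      map_smul' := fun c D => by
        ext (_ | j)
        · simp [mul_div_assoc]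
        · simp }
  have hf' : ∀ i, f i ∈ acl (insert s t) := by
    rintro (_ | i)
    exacts [h0, hT i]
  have hv0 : ∀ D : Derivation ℤ K K, (∀ i, D (f i) = 0) → v D = 0 := fun D h => by
    ext (_ | j)
    · change D (X 0) / flow X 0 = 0
      rw [show D (X 0) = 0 from h none, zero_div]
    · exact h (some j)
  have hspan := fun E hE => derivation_mem_span ht hs hδ hδs v
    (fun D hD => hv0 D fun i => hD _ (hf' i)) E hE
  have htop : ∀ w, w ∈ Submodule.span K (insert (v δ)
      (v '' {D | (∀ a ∈ acl t, D a ∈ acl t) ∧ D s = 0})) := by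
    have hsingle : ∀ i : Option ι, Pi.single i (1 : K) ∈ Submodule.span K (insert (v δ)
      (v '' {D | (∀ a ∈ acl t, D a ∈ acl t) ∧ D s = 0})) := fun i => by
      obtain ⟨E, hE, hEi⟩ := exists_derivation_acl (hf i) (i.elim (flow X 0) fun _ => 1)
      have hEj : ∀ j, j ≠ i → E (f j) = 0 := fun j hj => hE _ (subset_acl _ ⟨j, hj, rfl⟩)
      have : v E = Pi.single i 1 := by
        ext j
        by_cases hj : j = i
        · subst hj
          rw [Pi.single_eq_same]
          rcases j with _ | j
          · change E (X 0) / flow X 0 = 1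
            grind
          · exact hEi
        · rw [Pi.single_eq_of_ne hj]
          rcases j with _ | j
          · change E (X 0) / flow X 0 = 0
            rw [show E (X 0) = 0 from hEj none hj, zero_div]
          · exact hEj _ hj
      rw [← this]
      exact hspan E fun c => hE _ (algebraMap_mem_acl c)
    intro w
    rw [pi_eq_sum_univ w]
    refine sum_mem fun i _ => Submodule.smul_mem _ _ ?_
    convert hsingle i using 1
    grind
  have hvδ : v δ ≠ 0 := by
    intro h
    apply hn
    have key : ∀ y ∈ acl (insert s t), δ y = 0 → y ∈ acl t := fun y hy hy0 => by
      by_contra hyt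
      have := acl_exchange hyt hy
      refine hδs (derivation_eq_zero_of_mem_acl (fun c => hδ _ (algebraMap_mem_acl c)) ?_ this)
      rintro a (rfl | ha)
      exacts [hy0, hδ _ (subset_acl _ ha)]
    refine ⟨key _ h0 ?_, fun i => key _ (hT i) (congrFun h (some i))⟩
    exact (div_eq_zero_iff.1 (congrFun h none)).resolve_right hfl
  have hli : LinearIndepOn K id ({v δ} : Set (Option ι → K)) := by
    aesop
  obtain ⟨b, hbt, hsb, htb, hb⟩ := exists_linearIndepOn_id_extension hli
    (Set.singleton_subset_iff.2 (Set.mem_insert (v δ)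
      (v '' {D | (∀ a ∈ acl t, D a ∈ acl t) ∧ D s = 0})))
  have hb : LinearIndependent K ((↑) : b → Option ι → K) := hb
  have hbspan : ⊤ ≤ Submodule.span K (Set.range ((↑) : b → Option ι → K)) := fun w _ => by
    rw [Subtype.range_coe]
    exact Submodule.span_le.2 htb (htop w)
  let B : Module.Basis b K (Option ι → K) := Module.Basis.mk hb hbspan
  have : Fintype b := FiniteDimensional.fintypeBasisIndex B
  classical
  have hcard : Fintype.card (Option ι) = Fintype.card b := by
    rw [← Module.finrank_eq_card_basis B, Module.finrank_pi]
  let e0 : Option ι ≃ b := Fintype.equivOfCardEq hcard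
  let p : b := ⟨v δ, hsb rfl⟩
  let e : Option ι ≃ b := e0.trans (Equiv.swap (e0 none) p)
  have hen : e none = p := by simp [e]
  have hes : ∀ i, ∃ D : Derivation ℤ K K, ((∀ a ∈ acl t, D a ∈ acl t) ∧ D s = 0) ∧
      v D = e (some i) := fun i => by
    rcases hbt (e (some i)).2 with h | ⟨D, hD, h⟩
    · have : e (some i) = e none := by grind
      simp at this
    grind
  choose D hD hDe using hes
  refine ⟨fun i => i.elim δ D, rfl, hD, ?_⟩
  have hrow : (jacobian (fun i : Option ι => i.elim δ D) T X).row = fun i => (e i : Option ι → K) := by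
    ext i j
    rcases i with _ | i
    · rw [hen]; rfl
    · rw [← hDe]; rfl
  have hli2 : LinearIndependent K (jacobian (fun i : Option ι => i.elim δ D) T X).row := by
    rw [hrow]
    exact hb.comp e e.injective
  rw [Matrix.linearIndependent_rows_iff_isUnit, Matrix.isUnit_iff_isUnit_det] at hli2
  aesop

omit [Algebra ℂ K] [DecidableEq ι] in
lemma IsLyness.derivation_eq {l : K} {x : ZMod 5 → K} (h : IsLyness l x) {D : Derivation ℤ K K}
    (hl : D l = 0) (hf : ∀ i, flow x i ≠ 0) {c : K} (h0 : D (x 0) = c * flow x 0) (j : ZMod 5) :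
    D (x j) = c * flow x j := by
  have key : ∀ n : ℕ, D (x n) = c * flow x n := fun n => by
    induction n with
    | zero => grind
    | succ n ih =>
      have := h.deriv_cross D hl n
      grind
  have := key j.val
  aesop

omit [Algebra ℂ K] in
lemma det_mem {M : Matrix ι ι K} {S : Subfield K} (h : ∀ i j, M i j ∈ S) : M.det ∈ S := by
  rw [Matrix.det_apply]
  refine sum_mem fun σ _ => ?_
  rw [Units.smul_def]
  exact zsmul_mem (prod_mem fun i _ => h _ _) _

omit [Fintype ι] [DecidableEq ι] in
lemma Free.notMem_empty {b : ι → K} (hf : Free b) (i : ι) : b i ∉ acl (∅ : Set K) :=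
  fun h => hf i (acl_mono (Set.empty_subset _) h)

/-- A tuple in a rational function field `k(s)` is constant. -/
lemma IsTuple.mem_of_mem_simple [IsAlgClosed K] {t : Set K} (ht : t.Finite) {s : K}
    (hs : s ∉ acl t) {a : ℤ} (ha : IsCoprime a 5) {T : ι → K} {X : ZMod 5 → K} {ρ : K}
    (h : IsTuple a T X ρ) (hf : Free (fun i : Option ι => i.elim (X 0) T))
    (hT : ∀ i, T i ∈ Subfield.closure (insert s (acl t : Set K)))
    (hX : ∀ i, X i ∈ Subfield.closure (insert s (acl t : Set K)))
    (hρ : ρ ∈ Subfield.closure (insert s (acl t : Set K))) : X 0 ∈ acl t ∧ ∀ i, T i ∈ acl t := by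
  by_contra hn
  have hch := charZero_of_algebra K
  have hk := algClosedIn_acl t
  obtain ⟨x, hx, rfl⟩ := IsLyness.exists_of_zero (s := s) (l := (1 : K))
    (fun h0 => hs (h0 ▸ zero_mem _))
    (fun h0 => hs (by rw [eq_neg_of_add_eq_zero_right h0]; aesop)) one_ne_zero
  have hfl := hx.flow_ne hk (one_mem _) hs
  obtain ⟨δ, hδ, hδ0⟩ := exists_derivation_acl hs (flow x 0)
  have hδx : ∀ i, δ (x i) = flow x i := fun i => by
    simpa using hx.derivation_eq (c := 1) (by simp) hfl (by grind) i
  have hle : Subfield.closure (insert (x 0) (acl t : Set K)) ≤ acl (insert (x 0) t) :=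
    Subfield.closure_le.2 (Set.insert_subset (subset_acl _ (.inl rfl)) (acl_mono (Set.subset_insert _ _)))
  obtain ⟨D, hD0, hD, hJ⟩ := exists_jacobian_ne_zero ht hs hδ (by grind) h.lyness hf
    (hle (hX 0)) (fun i => hle (hT i)) hn
  have hDx : ∀ i j, D (some i) (x j) = 0 := fun i j => by
    simpa using hx.derivation_eq (c := 0) (by simp) hfl (by grind) j
  set N := Subfield.closure ((acl t : Set K) ∪ Set.range x) with hN
  have hxN : ∀ i, x i ∈ N := fun i => Subfield.subset_closure (.inr ⟨i, rfl⟩)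
  have hkN : acl t ≤ N := fun a ha => Subfield.subset_closure (.inl ha)
  have hdim : Dim1 (acl t) N := by
    refine (dim1_acl hk (fun c => algebraMap_mem_acl c) (x 0)).mono hkN
      (Subfield.closure_le.2 (Set.union_subset (fun a ha => subset_acl _ (.inr ha)) ?_))
    rintro _ ⟨i, rfl⟩
    exact hx.mem_all (algClosedIn_acl _) (one_mem _) (i := 0) (subset_acl _ (.inl rfl)) i
  have hsN : Subfield.closure (insert (x 0) (acl t : Set K)) ≤ N :=
    Subfield.closure_le.2 (Set.insert_subset (hxN 0) hkN)
  obtain ⟨hΘ, -⟩ := Cremona.theta_mem (k := acl t) (s := 0) (x := x) (δ := δ) hdim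
    (fun V hkV hNV => exists_flowDVR hx (by norm_num) hdim hxN hkV (one_mem _) hNV hs hδ hδx hN)
    (derivation_mem_closure (Set.union_subset hkN (by rintro _ ⟨i, rfl⟩; exact hxN i)) δ (by
      rintro _ (ha | ⟨i, rfl⟩)
      · aesop
      · rw [hδx]
        exact mul_mem (add_mem (one_mem _) (hxN _)) (sub_mem (hxN _) (hxN _))))
    (fun D hDk hDx _ =>
      derivation_mem_closure (Set.union_subset hkN (by rintro _ ⟨i, rfl⟩; exact hxN i)) D (by
        rintro _ (ha | ⟨i, rfl⟩)
        · exact hkN (hDk _ ha)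
        aesop))
    D hD0 (fun i => (hD i).1) hDx (fun i => map_zero _) ha h (fun i => hsN (hT i))
    (fun i => hsN (hX i)) (hsN hρ)
  set S := Subfield.closure (insert (x 0) (acl t : Set K)) with hS
  have hkS : acl t ≤ S := fun a ha => Subfield.subset_closure (.inr ha)
  have hx0S : x 0 ∈ S := Subfield.subset_closure (.inl rfl)
  have hsub : insert (x 0) (acl t : Set K) ⊆ S := Subfield.subset_closure
  set D' : Option ι → Derivation ℤ K K := fun i => i.elim ((flow x 0)⁻¹ • δ) fun i => D (some i)
    with hD'
  have hD'S : ∀ i, ∀ a ∈ S, D' i a ∈ S := by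
    rintro (_ | i)
    · refine derivation_mem_closure hsub _ ?_
      aesop
    · refine derivation_mem_closure hsub _ ?_
      rintro b (rfl | hb)
      · aesop
      · exact hkS ((hD i).1 _ hb)
  have hJS : (jacobian D' T X).det ∈ S := det_mem fun i j => by
    rcases j with _ | j
    · exact div_mem (hD'S _ _ (hX 0)) (mul_mem (add_mem (one_mem _) (hX _)) (sub_mem (hX _) (hX _)))
    · exact hD'S _ _ (hT j)
  have hJJ : (jacobian D T X).det = flow x 0 * (jacobian D' T X).det := by
    have : jacobian D T X =
        Matrix.of fun i j => (i.elim (flow x 0) fun _ => 1) * jacobian D' T X i j := by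
      have hfl0 := hfl 0
      ext i j
      rcases i with _ | i
      · have e : ∀ y, δ y = flow x 0 * ((flow x 0)⁻¹ * δ y) := fun y => by field_simp
        rcases j with _ | j
        · change D none (X 0) / flow X 0 = flow x 0 * ((flow x 0)⁻¹ * δ (X 0) / flow X 0)
          grind
        · change D none (T j) = flow x 0 * ((flow x 0)⁻¹ * δ (T j))
          grind
      · rcases j with _ | j <;> simp [jacobian, hD']
    rw [this, Matrix.det_mul_column, Fintype.prod_option]
    simp
  have hJ' : (jacobian D' T X).det ≠ 0 := fun h0 => hJ (by grind)
  have hP : ∏ i, (T i ^ 5 - 1) ∈ S := prod_mem fun i _ => sub_mem (pow_mem (hT i) _) (one_mem _)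
  have hP0 : ∏ i, (T i ^ 5 - 1) ≠ 0 := Finset.prod_ne_zero_iff.2 fun i _ => h.pow_ne i
  refine hx.flow_notMem hk hs ?_
  rw [← hS]
  have h5 : flow x 0 ^ 5 ∈ S := by
    have : flow x 0 ^ 5 = (jacobian D T X).det ^ 5 / (∏ i, (T i ^ 5 - 1)) ^ 4 *
        (∏ i, (T i ^ 5 - 1)) ^ 4 / (jacobian D' T X).det ^ 5 := by
      grind
    rw [this]
    exact div_mem (mul_mem (hkS hΘ) (pow_mem hP _)) (pow_mem hJS _)
  have h2 : flow x 0 ^ 2 ∈ S := by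
    have hd := hx.disc
    have hfl' : flow x 0 = (1 + x 0) * (x 1 - x 4) := rfl
    rw [hfl', hd]
    have c : ∀ n : ℕ, (n : K) ∈ S := fun n => natCast_mem S n
    refine sub_mem (pow_mem (sub_mem (mul_mem (one_mem _) hx0S) (mul_mem (add_mem (one_mem _) hx0S)
      (add_mem ?_ hx0S))) _) (mul_mem ?_ (pow_mem (add_mem (one_mem _) hx0S) _))
    · aesop
    aesop
  have : flow x 0 = flow x 0 ^ 5 / (flow x 0 ^ 2) ^ 2 := by
    grind
  rw [this]
  exact div_mem h5 (pow_mem h2 _)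

end Jacobian

section Count

variable {K : Type*} [Field K] [Algebra ℂ K] {ι : Type*}

open AlgebraicIndependent (matroid)

lemma Free.injective {b : ι → K} (h : Free b) : Function.Injective b := fun i j hij => by
  by_contra hne
  exact h i (subset_acl _ ⟨j, fun hji => hne hji.symm, hij.symm⟩)

lemma Free.indep {b : ι → K} (h : Free b) : (matroid ℂ K).Indep (Set.range b) := by
  rw [Matroid.indep_iff_forall_notMem_closure_sdiff]
  rintro _ ⟨i, rfl⟩ hi
  refine h i (acl_mono ?_ hi)
  grind

lemma Free.card_le [Fintype ι] {b : ι → K} (h : Free b) {t : Set K} (ht : ∀ i, b i ∈ acl t) :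
    (Fintype.card ι : ℕ∞) ≤ t.encard := by
  have h1 : (matroid ℂ K).eRk (Set.range b) = (Set.range b).encard := h.indep.eRk_eq_encard
  have h2 : (matroid ℂ K).eRk (Set.range b) ≤ (matroid ℂ K).eRk t := by
    rw [← (matroid ℂ K).eRk_closure_eq t]
    exact (matroid ℂ K).eRk_mono (by rintro _ ⟨i, rfl⟩; exact ht i)
  have h3 := (matroid ℂ K).eRk_le_encard t
  have h4 : (Set.range b).encard = Fintype.card ι := by
    rw [← Set.image_univ, h.injective.encard_image, Set.encard_univ, ENat.card_eq_coe_fintype_card]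
  grind

lemma Free.comp {κ : Type*} {b : ι → K} (h : Free b) {f : κ → ι} (hf : Function.Injective f) :
    Free (b ∘ f) := fun i hi => h (f i) (acl_mono (by
      grind) hi)

/-- A subfield `k` is algebraically closed in `k(s)` for `s` transcendental. -/
lemma mem_of_mem_acl {k : Subfield K} {t : Set K} (hk : (k : Set K) ⊆ acl t) {s y : K}
    (hs : s ∉ acl t) (hy : y ∈ Subfield.closure (insert s (k : Set K))) (hyt : y ∈ acl t) :
    y ∈ k := by
  obtain ⟨P, Q, hQ, rfl⟩ := exists_ratio_of_mem_closure hy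
  set y := P.aeval s / Q.aeval s with hydef
  set f : k →+* acl t := Subfield.inclusion hk with hf
  have key : P.map f - .C ⟨y, hyt⟩ * Q.map f = 0 := by
    refine (algClosedIn_acl t).eq_zero_of_aeval hs ?_
    have e : ∀ R : Polynomial k, (R.map f).aeval s = R.aeval s := fun R => by
      rw [Polynomial.aeval_def, Polynomial.eval₂_map]; rfl
    rw [map_sub, map_mul, e, e, Polynomial.aeval_C]
    change P.aeval s - y * Q.aeval s = 0
    grind
  have hQ0 : Q ≠ 0 := by grind
  have hc := congrArg (fun R => ((R.coeff Q.natDegree : acl t) : K)) key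
  simp only [Polynomial.coeff_sub, Polynomial.coeff_map, Polynomial.coeff_C_mul,
    Polynomial.coeff_zero] at hc
  have hl : ((Q.coeff Q.natDegree : k) : K) ≠ 0 := by
    aesop
  have : y = (P.coeff Q.natDegree : k) / (Q.coeff Q.natDegree : k) := by
    rw [eq_div_iff hl]
    exact (sub_eq_zero.1 hc).symm
  rw [this]
  exact div_mem (SetLike.coe_mem _) (SetLike.coe_mem _)

end Count

section Plane

variable {K : Type*} [Field K] [Algebra ℂ K] {ι : Type*} [Fintype ι]

lemma IsTuple.mem_all {a : ℤ} {T : ι → K} {X : ZMod 5 → K} {ρ : K} (h : IsTuple a T X ρ)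
    {k : Subfield K} (hk : AlgClosedIn k) (h0 : X 0 ∈ k) (hT : ∀ i, T i ∈ k) :
    (∀ j, X j ∈ k) ∧ ρ ∈ k := by
  have hX := h.lyness.mem_all hk (one_mem _) h0
  refine ⟨hX, hk.of_pow (n := 5) (by norm_num) ?_⟩
  rw [h.root]
  exact mul_mem (zpow_mem (prod_mem fun i _ => sub_mem (pow_mem (hT i) _) (one_mem _)) _)
    (div_mem (mul_mem (pow_mem (hX _) _) (hX _)) (mul_mem (pow_mem (hX _) _) (hX _)))

/-- A tuple is not defined over a purely transcendental extension of degree two. -/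
lemma IsTuple.not_mem_plane [IsAlgClosed K] {t : Set K} (ht : t.encard ≤ Fintype.card ι) {α β : K}
    {a : ℤ} (ha : IsCoprime a 5) {T : ι → K} {X : ZMod 5 → K} {ρ : K} {s : K}
    (h : IsTuple a T X ρ) (hf : Free (fun i : Option (Option ι) => i.elim s fun i => i.elim (X 0) T))
    (hL : ∀ y ∈ insert s (insert ρ (Set.range T ∪ Set.range X)),
      y ∈ Subfield.closure (insert β (insert α (acl t : Set K)))) : False := by
  classical
  have htf : t.Finite := Set.finite_of_encard_le_coe ht
  have hf' : Free (fun i : Option ι => i.elim (X 0) T) := hf.comp (Option.some_injective _)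
  have hs : s ∈ Subfield.closure (insert β (insert α (acl t : Set K))) := hL _ (.inl rfl)
  have hρ : ρ ∈ Subfield.closure (insert β (insert α (acl t : Set K))) := hL _ (.inr (.inl rfl))
  have hT : ∀ i, T i ∈ Subfield.closure (insert β (insert α (acl t : Set K))) :=
    fun i => hL _ (.inr (.inr (.inl ⟨i, rfl⟩)))
  have hX : ∀ i, X i ∈ Subfield.closure (insert β (insert α (acl t : Set K))) :=
    fun i => hL _ (.inr (.inr (.inr ⟨i, rfl⟩)))
  -- the transcendence degree is at most the size of a generating set
  have count : ∀ t' : Set K, insert β (insert α (acl t : Set K)) ⊆ acl t' →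
      ((Fintype.card ι + 2 : ℕ) : ℕ∞) ≤ t'.encard := fun t' ht' => by
    have := hf.card_le (t := t') fun i => by
      have hle := Subfield.closure_le.2 ht'
      rcases i with _ | _ | i
      exacts [hle hs, hle (hX 0), hle (hT i)]
    rwa [Fintype.card_option, Fintype.card_option] at this
  have hins : ∀ (γ : K) , (insert γ t).encard < ((Fintype.card ι + 2 : ℕ) : ℕ∞) := fun γ => by
    refine ((Set.encard_insert_le t γ).trans (add_le_add_left ht 1)).trans_lt ?_
    exact_mod_cast Nat.lt_succ_self (Fintype.card ι + 1)
  have hα : α ∉ acl t := fun hα => by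
    refine (count (insert β t) ?_).not_gt (hins β)
    refine Set.insert_subset (subset_acl _ (.inl rfl)) (Set.insert_subset ?_ ?_)
    · exact acl_mono (Set.subset_insert _ _) hα
    · exact acl_mono (Set.subset_insert _ _)
  have hβ : β ∉ acl (insert α t) := fun hβ => by
    refine (count (insert α t) ?_).not_gt (hins α)
    refine Set.insert_subset hβ (Set.insert_subset (subset_acl _ (.inl rfl)) ?_)
    exact acl_mono (Set.subset_insert _ _)
  have hsub : insert α (acl t : Set K) ⊆ acl (insert α t) :=
    Set.insert_subset (subset_acl _ (.inl rfl)) (acl_mono (Set.subset_insert _ _))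
  have hle : Subfield.closure (insert β (insert α (acl t : Set K))) ≤
      Subfield.closure (insert β (acl (insert α t) : Set K)) :=
    Subfield.closure_mono (Set.insert_subset_insert hsub)
  obtain ⟨h0, h1⟩ := h.mem_of_mem_simple (htf.insert α) hβ ha hf' (fun i => hle (hT i))
    (fun i => hle (hX i)) (hle hρ)
  obtain ⟨h2, h3⟩ := h.mem_all (algClosedIn_acl _) h0 h1
  have hle' : Subfield.closure (insert β (insert α (acl t : Set K))) ≤
      Subfield.closure (insert β (Subfield.closure (insert α (acl t : Set K)) : Set K)) :=
    Subfield.closure_mono (Set.insert_subset_insert Subfield.subset_closure)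
  have down : ∀ y ∈ Subfield.closure (insert β (insert α (acl t : Set K))), y ∈ acl (insert α t) →
      y ∈ Subfield.closure (insert α (acl t : Set K)) := fun y hy hy' =>
    mem_of_mem_acl (Subfield.closure_le.2 hsub) hβ (hle' hy) hy'
  obtain ⟨h4, h5⟩ := h.mem_of_mem_simple htf hα ha hf' (fun i => down _ (hT i) (h1 i))
    (fun i => down _ (hX i) (h2 i)) (down _ hρ h3)
  have := hf'.card_le (t := t) fun i => by
    rcases i with _ | i
    exacts [h4, h5 i]
  have h6 := this.trans ht
  rw [Fintype.card_option] at h6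
  exact absurd h6 (by exact_mod_cast Nat.not_succ_le_self _)

end Plane

section valuation

variable {K : Type*} [Field K] {V : ValuationSubring K} {N : Subfield K} {π f : K}

lemma Unif.val_le_of_lt (h : Unif N V π) (hf : f ∈ N) (hlt : V.valuation f < 1) :
    V.valuation f ≤ V.valuation π := by
  by_cases h0 : f = 0
  · simp [h0]
  obtain ⟨n, hn⟩ := h.exists_val hf h0
  have hn1 : 1 ≤ n := by
    by_contra! hlt'
    rw [hn] at hlt
    exact hlt.not_ge (one_le_zpow_of_nonpos₀ h.pos h.lt.le (by omega))
  rw [hn]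
  exact (zpow_le_zpow_right_of_le_one₀ h.pos h.lt.le hn1).trans (by simp)

lemma val_one_lt_iff : 1 < V.valuation f ↔ f ∉ V := by
  rw [← V.valuation_le_one_iff, not_le]

lemma Unif.exists_notMem (h : Unif N V π) : ¬ (N : Set K) ⊆ V := fun hh => by
  have := (V.valuation_le_one_iff _).2 (hh (N.inv_mem h.memN))
  rw [map_inv₀] at this
  exact absurd h.lt (not_lt.2 ((inv_le_one₀ h.pos).1 this))

variable {k : Subfield K} {x : ZMod 5 → K} {s : K} {δ : Derivation ℤ K K}

lemma FlowDVR.val_deriv [CharZero K] (H : FlowDVR k N V x s δ π) (hk : (k : Set K) ⊆ V) (hf : f ∈ N)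
    (h0 : f ≠ 0) (h1 : V.valuation f ≠ 1) : V.valuation (δ f) * V.valuation π = V.valuation f := by
  obtain ⟨n, u, huN, hu, rfl⟩ := H.unif.rep f hf h0
  have hn : (n : K) ≠ 0 := by
    rintro hn
    aesop
  have hp := H.unif.ne
  have e : δ (u * π ^ n) * π = u * π ^ n * (n * δ π + π * (δ u / u)) := by
    have hu0 : u ≠ 0 := by grind
    rw [Derivation.leibniz, Derivation.leibniz_zpow, smul_eq_mul, smul_eq_mul, smul_eq_mul,
      zpow_sub_one₀ hp, zsmul_eq_mul]
    field_simp
  rw [← map_mul, e, map_mul]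
  have h2 : V.valuation ((n : K) * δ π + π * (δ u / u)) = 1 := by
    have hv : V.valuation ((n : K) * δ π) = 1 := by
      rw [map_mul, H.flow_unit, mul_one, val_eq_one_of_mem hk (intCast_mem k n) hn]
    refine val_eq_one_of_sub hv ?_
    rw [add_sub_cancel_left, mul_comm]
    refine val_lt_mul_left ?_ H.unif.lt
    rw [← V.valuation_le_one_iff, map_div₀, hu, div_one, V.valuation_le_one_iff]
    exact H.flow_mem u huN (mem_of_val_eq_one hu)
  grind

end valuation

variable {K : Type*} [Field K] [Algebra ℂ K]

/-- The function field `N` over `k` of a smooth curve of Lyness sequences. -/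
structure IsCurve (k : Subfield K) (l : K) (x : ZMod 5 → K) (N : Subfield K) : Prop where
  lyness : IsLyness l x
  disc : l ^ 2 - 11 * l - 1 ≠ 0
  mem : l ∈ k
  closed : AlgClosedIn k
  algebraMap_mem : ∀ c : ℂ, algebraMap ℂ K c ∈ k
  notMem : x 0 ∉ k
  eq : N = Subfield.closure (k ∪ Set.range x)

namespace IsCurve

variable {k N : Subfield K} {l : K} {x : ZMod 5 → K} {V : ValuationSubring K}

lemma le (h : IsCurve k l x N) : k ≤ N := by
  rw [h.eq]; exact fun a ha => Subfield.subset_closure (.inl ha)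

lemma x_mem (h : IsCurve k l x N) (i : ZMod 5) : x i ∈ N := by
  rw [h.eq]; aesop

lemma dim1 (h : IsCurve k l x N) : Dim1 k N := by
  refine (dim1_acl h.closed h.algebraMap_mem (x 0)).mono h.le ?_
  rw [h.eq, closure_range_eq h.lyness]
  have hk : ∀ a ∈ k, a ∈ acl (insert (x 0) (k : Set K)) := fun a ha => subset_acl _ (.inr ha)
  have h0 : x 0 ∈ acl (insert (x 0) (k : Set K)) := subset_acl _ (.inl rfl)
  refine Subfield.closure_le.2 (Set.insert_subset ?_ (Set.insert_subset h0 hk))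
  exact h.lyness.mem_all (algClosedIn_acl _) (hk _ h.mem) h0 1

lemma notMem_all (h : IsCurve k l x N) (i : ZMod 5) : x i ∉ k := fun hi =>
  h.notMem (h.lyness.mem_all h.closed h.mem hi 0)

lemma flow_ne (h : IsCurve k l x N) (i : ZMod 5) : flow x i ≠ 0 :=
  h.lyness.flow_ne h.closed h.mem h.notMem i

lemma exists_flow (h : IsCurve k l x N) :
    ∃ δ : Derivation ℤ K K, (∀ a ∈ k, δ a = 0) ∧ ∀ i, δ (x i) = flow x i := by
  have h0 : x 0 ∉ acl (k : Set K) := fun hh =>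
    h.notMem (h.closed.acl_le h.algebraMap_mem subset_rfl hh)
  obtain ⟨δ, hδ, h1⟩ := exists_derivation_acl h0 (flow x 0)
  have hk : ∀ a ∈ k, δ a = 0 := fun a ha => hδ a (subset_acl _ ha)
  refine ⟨δ, hk, fun i => ?_⟩
  rw [h.lyness.derivation_eq (hk l h.mem) h.flow_ne (c := 1) (by grind), one_mul]

lemma deriv_mem (h : IsCurve k l x N) {δ : Derivation ℤ K K} (hδ : ∀ a ∈ k, δ a = 0)
    (hx : ∀ i, δ (x i) = flow x i) {f : K} (hf : f ∈ N) : δ f ∈ N := by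
  have hm := h.x_mem
  refine derivation_mem_closure (s := k ∪ Set.range x) (N := N) ?_ δ ?_ f (h.eq ▸ hf)
  · rintro _ (ha | ⟨i, rfl⟩)
    exacts [h.le ha, hm i]
  · rintro _ (ha | ⟨i, rfl⟩)
    · aesop
    · rw [hx]; exact mul_mem (add_mem (one_mem _) (hm _)) (sub_mem (hm _) (hm _))

variable [IsAlgClosed K]

lemma exists_dvr (h : IsCurve k l x N) {δ : Derivation ℤ K K} (hδ : ∀ a ∈ k, δ a = 0)
    (hx : ∀ i, δ (x i) = flow x i) (hk : (k : Set K) ⊆ V) (hNV : ¬ (N : Set K) ⊆ V) :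
    ∃ π, FlowDVR k N V x 0 δ π :=
  exists_flowDVR h.lyness h.disc h.dim1 h.x_mem hk h.mem hNV h.notMem hδ hx h.eq

lemma exists_unif (h : IsCurve k l x N) (hk : (k : Set K) ⊆ V) (hNV : ¬ (N : Set K) ⊆ V) :
    ∃ π, Unif N V π := by
  obtain ⟨δ, hδ, hx⟩ := h.exists_flow
  obtain ⟨π, H⟩ := h.exists_dvr hδ hx hk hNV
  exact ⟨π, H.unif⟩

/-- A function on an elliptic curve cannot have a single simple pole. -/
theorem not_single_pole (h : IsCurve k l x N) {f : K} (hf : f ∈ N) (hfk : f ∉ k)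
    (h1 : ∀ V : ValuationSubring K, (k : Set K) ⊆ V → f ∉ V → ∀ π, Unif N V π →
      V.valuation f * V.valuation π = 1)
    (h2 : ∀ V V' : ValuationSubring K, (k : Set K) ⊆ V → (k : Set K) ⊆ V' → f ∉ V → f ∉ V' →
      ∀ g ∈ N, g ∈ V → g ∈ V') : False := by
  have := charZero_of_algebra K
  obtain ⟨δ, hδ, hx⟩ := h.exists_flow
  obtain ⟨V, hkV, hfV⟩ : ∃ V : ValuationSubring K, (k : Set K) ⊆ V ∧ f ∉ V := by
    by_contra! hh
    exact hfk (mem_of_forall_valuationSubring h.closed hh)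
  have hNV : ¬ (N : Set K) ⊆ V := fun hh => hfV (hh hf)
  have hf0 : f ≠ 0 := fun h0 => hfk (h0 ▸ zero_mem _)
  obtain ⟨π, H⟩ := h.exists_dvr hδ hx hkV hNV
  have hv := h1 V hkV hfV π H.unif
  have hvf0 : V.valuation f ≠ 0 := by aesop
  have hδN : ∀ {g}, g ∈ N → δ g ∈ N := fun hg => h.deriv_mem hδ hx hg
  have hd : V.valuation (δ f / f ^ 2) = 1 := by
    have := H.val_deriv hkV hf hf0 (val_one_lt_iff.2 hfV).ne'
    rw [map_div₀, map_pow, div_eq_one_iff_eq (pow_ne_zero _ hvf0)]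
    have hp := H.unif.pos.ne'
    apply mul_right_cancel₀ hp
    rw [this, sq, mul_assoc, hv, mul_one]
  obtain ⟨a, hak, ha⟩ := h.dim1.exists_residue hkV hNV (div_mem (hδN hf) (pow_mem hf 2))
    (mem_of_val_eq_one hd)
  have ha0 : a ≠ 0 := by
    grind
  have hvi : V.valuation π = (V.valuation f)⁻¹ := eq_inv_of_mul_eq_one_right hv
  have haN := h.le hak
  have ha' := H.unif.val_le_of_lt (sub_mem (div_mem (hδN hf) (pow_mem hf 2)) haN) ha
  have hbV : δ f / f - a * f ∈ V := by
    rw [← V.valuation_le_one_iff]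
    have e : δ f / f - a * f = (δ f / f ^ 2 - a) * f := by field_simp
    rw [e, map_mul, ← hv, mul_comm (V.valuation f)]
    gcongr
  have hbN : δ f / f - a * f ∈ N := sub_mem (div_mem (hδN hf) hf) (mul_mem haN hf)
  obtain ⟨b, hbk, hb⟩ := h.dim1.exists_residue hkV hNV hbN hbV
  have hbN' := h.le hbk
  have hb' := H.unif.val_le_of_lt (sub_mem hbN hbN') hb
  set r := δ f - a * f ^ 2 - b * f with hr
  have hrN : r ∈ N := sub_mem (sub_mem (hδN hf) (mul_mem haN (pow_mem hf 2))) (mul_mem hbN' hf)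
  have hrV : r ∈ V := by
    rw [← V.valuation_le_one_iff]
    have e : r = (δ f / f - a * f - b) * f := by grind
    rw [e, map_mul, ← hv, mul_comm (V.valuation f)]
    gcongr
  have hrk : r ∈ k := by
    refine mem_of_forall_valuationSubring h.closed fun V' hk' => ?_
    by_cases hN' : (N : Set K) ⊆ V'
    · exact hN' hrN
    by_cases hfV' : f ∈ V'
    · obtain ⟨π', H'⟩ := h.exists_dvr hδ hx hk' hN'
      exact sub_mem (sub_mem (H'.flow_mem f hf hfV') (mul_mem (hk' hak) (pow_mem hfV' 2)))
        (mul_mem (hk' hbk) hfV')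
    grind
  -- a root of the quadratic polynomial
  obtain ⟨e, he⟩ : ∃ e : K, a * e ^ 2 + b * e + r = 0 := by
    obtain ⟨e, he⟩ := IsAlgClosed.exists_root
      (Polynomial.C a * Polynomial.X ^ 2 + Polynomial.C b * Polynomial.X + Polynomial.C r)
      (by rw [Polynomial.degree_quadratic ha0]; decide)
    exact ⟨e, by aesop⟩
  have hek : e ∈ k := h.closed.quad hak hbk hrk (by grind) (.inl ha0)
  have hfe : f - e ≠ 0 := fun h0 => hfk (by grind)
  have hfek : (f - e)⁻¹ ∉ k := fun hh => hfk (by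
    have := add_mem (inv_mem hh) hek
    grind)
  obtain ⟨W, hkW, hW⟩ : ∃ W : ValuationSubring K, (k : Set K) ⊆ W ∧ (f - e)⁻¹ ∉ W := by
    by_contra! hh
    exact hfek (mem_of_forall_valuationSubring h.closed hh)
  have hfeN : f - e ∈ N := sub_mem hf (h.le hek)
  have hNW : ¬ (N : Set K) ⊆ W := fun hh => hW (hh (inv_mem hfeN))
  obtain ⟨π', H'⟩ := h.exists_dvr hδ hx hkW hNW
  have hlt : W.valuation (f - e) < 1 := by
    rw [← val_one_lt_iff, map_inv₀] at hW
    exact (one_lt_inv₀ (zero_lt_iff.2 (by aesop))).1 hW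
  have h3 := H'.val_deriv hkW hfeN hfe hlt.ne
  have h4 : δ (f - e) = (f - e) * (a * (f + e) + b) := by
    grind
  have hfW : f ∈ W := by
    have := add_mem ((W.valuation_le_one_iff _).1 hlt.le) (hkW hek)
    grind
  have h5 : a * (f + e) + b ∈ W := add_mem (mul_mem (hkW hak) (add_mem hfW (hkW hek))) (hkW hbk)
  rw [h4, map_mul, mul_assoc] at h3
  have h6 : W.valuation (a * (f + e) + b) * W.valuation π' = 1 :=
    mul_left_cancel₀ (by aesop) (h3.trans (mul_one _).symm)
  rw [← map_mul] at h6
  exact (val_lt_mul_left h5 H'.unif.lt).ne h6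

end IsCurve

omit [Algebra ℂ K] in
/-- Two places with the same residues on a chart coincide. -/
lemma Chart.mem_of_mem_of_residue {k : Subfield K} {V V' : ValuationSubring K} {π : K} {S : Set K}
    (h : Chart k V π S) (ha : ∀ b ∈ locClosure V S, IsAlgebraic (Algebra.adjoin k {π}) b)
    (hk : (k : Set K) ⊆ V) (hk' : (k : Set K) ⊆ V')
    (hS : ∀ z ∈ S, ∃ ξ ∈ k, V.valuation (z - ξ) < 1 ∧ V'.valuation (z - ξ) < 1)
    {f : K} (hf : f ∈ Subfield.closure S) (hV : f ∈ V) : f ∈ V' := by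
  have hm : ∀ {V : ValuationSubring K} {b ξ : K}, (k : Set K) ⊆ V → ξ ∈ k →
      V.valuation (b - ξ) < 1 → b ∈ V := fun {V b ξ} hk hξ hb => by
    have := add_mem ((V.valuation_le_one_iff _).1 hb.le) (hk hξ)
    aesop
  let W : Subring K :=
    { carrier := {b | ∃ ξ ∈ k, V.valuation (b - ξ) < 1 ∧ V'.valuation (b - ξ) < 1}
      mul_mem' := by
        rintro a b ⟨ξ, hξ, h1, h2⟩ ⟨η, hη, h3, h4⟩
        exact ⟨ξ * η, mul_mem hξ hη, val_lt_mul_sub (hm hk hξ h1) (hk hη) h1 h3,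
          val_lt_mul_sub (hm hk' hξ h2) (hk' hη) h2 h4⟩
      one_mem' := ⟨1, one_mem _, by simp, by simp⟩
      add_mem' := by
        rintro a b ⟨ξ, hξ, h1, h2⟩ ⟨η, hη, h3, h4⟩
        exact ⟨ξ + η, add_mem hξ hη, by rw [add_sub_add_comm]; exact val_lt_add h1 h3,
          by rw [add_sub_add_comm]; exact val_lt_add h2 h4⟩
      zero_mem' := ⟨0, zero_mem _, by simp, by simp⟩
      neg_mem' := by
        rintro a ⟨ξ, hξ, h1, h2⟩
        exact ⟨-ξ, neg_mem hξ, by rwa [neg_sub_neg, Valuation.map_sub_swap],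
          by rwa [neg_sub_neg, Valuation.map_sub_swap]⟩ }
  have hle : locClosure V S ≤ W := by
    refine locClosure_le (fun z hz => hS z hz) ?_
    rintro b ⟨ξ, hξ, h1, h2⟩ hb
    by_cases hb0 : b = 0
    · aesop
    have hξ0 : ξ ≠ 0 := by
      rintro rfl
      rw [sub_zero] at h1
      exact absurd hb (by
        rw [← val_one_lt_iff, map_inv₀]
        exact (one_lt_inv₀ (zero_lt_iff.2 (by aesop))).2 h1)
    have key : ∀ {V : ValuationSubring K}, (k : Set K) ⊆ V → V.valuation (b - ξ) < 1 →
        V.valuation (b⁻¹ - ξ⁻¹) < 1 := fun {V} hk h1 => by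
      have v1 := val_eq_one_of_mem hk hξ hξ0
      have v2 := val_eq_one_of_sub v1 h1
      have hb0 : b ≠ 0 := by grind
      have : b⁻¹ - ξ⁻¹ = -(b - ξ) / (b * ξ) := by grind
      rw [this, map_div₀, Valuation.map_neg, map_mul, v1, v2]
      aesop
    exact ⟨ξ⁻¹, inv_mem hξ, key hk h1, key hk' h2⟩
  obtain ⟨ξ, hξ, -, h2⟩ := hle (h.mem_of_mem ha hf hV)
  grind

lemma Dim1.mem_of_mem_of_pole {k N : Subfield K} (hN : Dim1 k N) {w : K} (hw : w ∈ N)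
    (he : N = Subfield.closure (insert w (k : Set K))) {V V' : ValuationSubring K}
    (hk : (k : Set K) ⊆ V) (hk' : (k : Set K) ⊆ V') (hV : w ∉ V) (hV' : w ∉ V')
    {f : K} (hf : f ∈ N) (hfV : f ∈ V) : f ∈ V' := by
  have hlt : ∀ {V : ValuationSubring K}, w ∉ V → V.valuation w⁻¹ < 1 := fun {V} hV => by
    rw [← val_one_lt_iff] at hV
    rw [map_inv₀]; exact inv_lt_one_of_one_lt₀ hV
  have hc := Chart.base hk ((V.valuation_le_one_iff _).1 (hlt hV).le) (by grind)
  have he' : Subfield.closure (insert w⁻¹ (k : Set K)) = N := by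
    rw [he]
    apply le_antisymm <;> refine Subfield.closure_le.2 (Set.insert_subset ?_ fun a ha =>
      Subfield.subset_closure (.inr ha))
    · aesop
    · rw [← inv_inv w]; exact inv_mem (Subfield.subset_closure (.inl (by grind)))
  refine hc.mem_of_mem_of_residue (fun b hb => hN.isAlgebraic (inv_mem hw) ?_ ?_) hk hk' ?_
    (he' ▸ hf) hfV
  · intro hh
    refine hV (hk ?_)
    rw [← inv_inv w]; exact inv_mem hh
  · exact he' ▸ locClosure_le_subfield Subfield.subset_closure hb
  · rintro z (rfl | hz)
    · exact ⟨0, zero_mem _, by grind, by grind⟩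
    · exact ⟨z, hz, by simp, by simp⟩

namespace IsCurve

variable {k N : Subfield K} {l : K} {x : ZMod 5 → K} {V V' : ValuationSubring K}

omit [Field K] [Algebra ℂ K] in
lemma range_shift (j : ZMod 5) : Set.range (fun i => x (i + j)) = Set.range x :=
  (Equiv.addRight j).surjective.range_comp x

lemma shift (h : IsCurve k l x N) (j : ZMod 5) : IsCurve k l (fun i => x (i + j)) N :=
  ⟨h.lyness.shift j, h.disc, h.mem, h.closed, h.algebraMap_mem, h.notMem_all _,
    by rw [range_shift, h.eq]⟩

lemma reflect (h : IsCurve k l x N) : IsCurve k l (fun i => x (-i)) N :=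
  ⟨h.lyness.reflect, h.disc, h.mem, h.closed, h.algebraMap_mem, h.notMem_all _,
    by rw [h.eq, ← (Equiv.neg (ZMod 5)).surjective.range_comp x]; rfl⟩

lemma mem_of_mem_of_cusp (h : IsCurve k l x N) (hk : (k : Set K) ⊆ V) (hk' : (k : Set K) ⊆ V')
    {j : ZMod 5} {g : V.ValueGroup} {g' : V'.ValueGroup} (hc : Cusp x V.valuation j g)
    (hc' : Cusp x V'.valuation j g') {f : K} (hf : f ∈ N) (hV : f ∈ V) : f ∈ V' := by
  have hx := h.shift j
  obtain ⟨δ, hδ, hδx⟩ := hx.exists_flow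
  have H := flowChart_of_cusp hx.lyness hk hx.mem (Cusp.shift hc) hδ hδx
  have he := H.closure_eq.trans hx.eq.symm
  refine H.chart.mem_of_mem_of_residue (fun b hb => H.algebraic hx.x_mem hx.dim1
    (Subfield.subset_closure.trans he.le) b hk hb) hk hk' ?_ (he ▸ hf) hV
  have key : ∀ {V : ValuationSubring K} {g : V.ValueGroup}, (k : Set K) ⊆ V →
      Cusp x V.valuation j g → V.valuation (x (2 + j))⁻¹ < 1 ∧ V.valuation (1 + x (1 + j)) < 1 := by
    intro V g hk hc
    obtain ⟨hg, c0, c1, c4, c2, c3⟩ := Cusp.shift hc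
    have hg0 : g ≠ 0 := (zero_lt_one.trans hg).ne'
    simp only [zero_add] at c0 c1 c2
    refine ⟨by rw [map_inv₀, c2]; exact inv_lt_one_of_one_lt₀ hg, ?_⟩
    have r : x (2 + j) * x (0 + j) = 1 + x (1 + j) := hx.lyness.rels.2.1
    rw [← r, map_mul, c2, zero_add]
    refine (mul_lt_mul_iff_left₀ (zero_lt_one.trans hg)).1 ?_
    rw [one_mul, mul_comm g, mul_assoc, ← sq, c0]
    exact hg
  rintro z (rfl | rfl | hz)
  · exact ⟨0, zero_mem _, by grind, by grind⟩
  · exact ⟨0, zero_mem _, by simpa using (key hk hc).2, by simpa using (key hk' hc').2⟩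
  · exact ⟨z, hz, by simp, by simp⟩

end IsCurve

section

variable {K : Type*} [Field K] {l : K} {x : ZMod 5 → K} {Γ : Type*}
  [LinearOrderedCommGroupWithZero Γ]

lemma IsLyness.eq_of_eq {l' : K} {y : ZMod 5 → K} (h : IsLyness l x) (h' : IsLyness l' y)
    {i : ZMod 5} (h0 : x i = y i) (h1 : x (i + 1) = y (i + 1)) : x = y := by
  have key : ∀ n : ℕ, x (i + n) = y (i + n) ∧ x (i + n + 1) = y (i + n + 1) := fun n => by
    induction n with
    | zero => aesop
    | succ n ih =>
      obtain ⟨ih0, ih1⟩ := ih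
      push_cast
      rw [← add_assoc]
      refine ⟨ih1, ?_⟩
      have e := h.rel (i + n + 1)
      have e' := h'.rel (i + n + 1)
      rw [add_sub_cancel_right] at e e'
      apply mul_right_cancel₀ (h.ne (i + n))
      grind
  funext j
  have := (key (j - i).val).1
  aesop

/-- The values of the theta functions whose quotients are the `x k`. -/
lemma IsLyness.exists_theta (h : IsLyness l x) (v : Valuation K Γ) (hl : v l = 1) :
    ∃ u : ZMod 5 → Γ, (∀ k, u k ≠ 0) ∧ (∀ k, v (x k) * (u (k + 2) * u (k - 2)) = u k ^ 2) ∧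
      ((∀ k, u k = 1) ∨ ∃ j g, Cusp x v j g ∧ ∀ k, u k = if k = j then g⁻¹ else 1) := by
  rcases h.pattern v hl with hp | ⟨j, g, hc⟩
  · exact ⟨fun _ => 1, fun _ => one_ne_zero, fun k => by simp [hp], .inl fun _ => rfl⟩
  · have hc' := hc
    obtain ⟨hg, c0, c1, c4, c2, c3⟩ := hc
    have hg0 : g ≠ 0 := (zero_lt_one.trans hg).ne'
    refine ⟨fun k => if k = j then g⁻¹ else 1, fun k => ?_, fun k => ?_, .inr ⟨j, g, hc', fun _ => rfl⟩⟩
    · dsimp only; split_ifs <;> simp [hg0]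
    · obtain ⟨i, rfl⟩ : ∃ i, k = j + i := ⟨k - j, by ring⟩
      have e0 : ∀ i : ZMod 5, (j + i = j) = (i = 0) := fun i => by simp
      have e1 : j + i + 2 = j + (i + 2) := by ring
      have e2 : j + i - 2 = j + (i - 2) := by ring
      simp only [e1, e2, e0]
      fin_cases i
      · change v (x (j + 0)) * ((if (2 : ZMod 5) = 0 then _ else _) * (if (3 : ZMod 5) = 0 then _ else _))
          = (if (0 : ZMod 5) = 0 then _ else _) ^ 2
        rw [if_neg (by decide), if_neg (by decide), if_pos rfl, add_zero, inv_pow,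
          eq_inv_of_mul_eq_one_left c0]; simp
      · change v (x (j + 1)) * ((if (3 : ZMod 5) = 0 then _ else _) * (if (4 : ZMod 5) = 0 then _ else _))
          = (if (1 : ZMod 5) = 0 then _ else _) ^ 2
        rw [if_neg (by decide), if_neg (by decide), if_neg (by decide), c1]; simp
      · change v (x (j + 2)) * ((if (4 : ZMod 5) = 0 then _ else _) * (if (0 : ZMod 5) = 0 then _ else _))
          = (if (2 : ZMod 5) = 0 then _ else _) ^ 2
        rw [if_neg (by decide), if_pos rfl, if_neg (by decide), c2]; simp [hg0]
      · change v (x (j + 3)) * ((if (0 : ZMod 5) = 0 then _ else _) * (if (1 : ZMod 5) = 0 then _ else _))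
          = (if (3 : ZMod 5) = 0 then _ else _) ^ 2
        have : j + 3 = j - 2 := by grind
        rw [if_pos rfl, if_neg (by decide), if_neg (by decide), this, c3]; simp [hg0]
      · change v (x (j + 4)) * ((if (1 : ZMod 5) = 0 then _ else _) * (if (2 : ZMod 5) = 0 then _ else _))
          = (if (4 : ZMod 5) = 0 then _ else _) ^ 2
        have : j + 4 = j - 1 := by grind
        rw [if_neg (by decide), if_neg (by decide), if_neg (by decide), this, c4]; simp

lemma IsLyness.exists_theta_quotient (h : IsLyness l x) (v : Valuation K Γ) (hl : v l = 1) :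
    ∃ w : ZMod 5 → Γ, (∀ k, w k ≠ 0) ∧ w 0 = 1 ∧ w 1 ^ 5 = v (hfun x) ∧
      (∀ k, w (k + 1) * w (k - 1) = v (1 + (x k)⁻¹) * w k ^ 2) ∧
      (∀ k, v (x k) * (w (k + 2) * w (k - 2)) = w k ^ 2) ∧
      ((∀ k, w k ≤ 1) ∨ ∃ g, Cusp x v 0 g ∧ (∀ k, w k ≤ g) ∧ w 1 = g) := by
  obtain ⟨u, h0, hu, hc⟩ := h.exists_theta v hl
  have hx : ∀ k, v (x k) = u k ^ 2 / (u (k + 2) * u (k - 2)) := fun k =>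
    eq_div_of_mul_eq (mul_ne_zero (h0 _) (h0 _)) (hu k)
  refine ⟨fun k => u k / u 0, fun k => div_ne_zero (h0 _) (h0 _), div_self (h0 0), ?_,
    fun k => ?_, fun k => ?_, ?_⟩
  · have a0 : v (x 0) = u 0 ^ 2 / (u 2 * u 3) := hx 0
    have a1 : v (x 1) = u 1 ^ 2 / (u 3 * u 4) := hx 1
    have a2 : v (x 2) = u 2 ^ 2 / (u 4 * u 0) := hx 2
    have a4 : v (x 4) = u 4 ^ 2 / (u 1 * u 2) := hx 4
    have := h0 0; have := h0 1; have := h0 2; have := h0 3; have := h0 4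
    simp only [hfun, map_div₀, map_mul, map_pow, a0, a1, a2, a4]
    field_simp
  · have e : 1 + (x k)⁻¹ = x (k + 1) * x (k - 1) / x k := by
      rw [h.rel]; have := h.ne k; grind
    have i1 : k + 1 + 2 = k - 2 := by grind
    have i2 : k + 1 - 2 = k - 1 := by ring
    have i3 : k - 1 + 2 = k + 1 := by ring
    have i4 : k - 1 - 2 = k + 2 := by grind
    have := h0 0; have := h0 k; have := h0 (k + 1); have := h0 (k - 1); have := h0 (k + 2)
    have := h0 (k - 2)
    rw [e, map_div₀, map_mul, hx, hx, hx, i1, i2, i3, i4]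
    field_simp
  · have := h0 0; have := h0 k; have := h0 (k + 2); have := h0 (k - 2)
    rw [hx]
    field_simp
  · rcases hc with hc | ⟨j, g, hc, hu⟩
    · aesop
    · have hg := hc.1
      have hg0 : g ≠ 0 := (zero_lt_one.trans hg).ne'
      by_cases hj : j = 0
      · subst hj
        refine .inr ⟨g, hc, fun k => ?_, ?_⟩
        · dsimp only
          rw [hu, hu 0, if_pos rfl]
          split_ifs
          · rw [div_self (inv_ne_zero hg0)]; exact hg.le
          · simp
        · dsimp only
          rw [hu, hu 0, if_pos rfl, if_neg (by decide)]; simp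
      · refine .inl fun k => ?_
        dsimp only
        rw [hu 0, if_neg (Ne.symm hj), div_one, hu]
        split_ifs
        · exact (inv_lt_one_of_one_lt₀ hg).le
        grind

/-- A quadratic extension cannot interchange Lyness sequences with parameters `1` and `-1`. -/
lemma IsLyness.not_swap [CharZero K] [IsAlgClosed K] {z : ZMod 5 → K} (hx : IsLyness 1 x)
    (hz : IsLyness (-1) z) (M : Subfield K) (hm : ∀ i, x i * z i ∈ M) (ha : ∀ i, x i + z i ∈ M)
    {j : ZMod 5} (hj : x j ∉ M) : False := by
  let P : ZMod 5 → Polynomial M := fun i =>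
    .X ^ 2 - .C ⟨x i + z i, ha i⟩ * .X + .C ⟨x i * z i, hm i⟩
  have hP : ∀ i, (P i).Monic := fun i => by
    simp only [P]; monicity!
  have hPe : ∀ i (t : K), (P i).aeval t = (t - x i) * (t - z i) := fun i t => by
    simp only [P, map_add, map_sub, map_mul, map_pow, Polynomial.aeval_X, Polynomial.aeval_C]
    change t ^ 2 - (x i + z i) * t + x i * z i = _
    ring
  have hint : ∀ i, IsIntegral M (x i) := fun i => ⟨P i, hP i, by
    aesop⟩
  have hdeg : (P j).natDegree = 2 := by simp only [P]; compute_degree!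
  have hmin : minpoly M (x j) = P j := by
    refine (Polynomial.eq_of_monic_of_dvd_of_natDegree_le (minpoly.monic (hint j)) (hP j)
      (minpoly.dvd M (x j) (by grind)) ?_).symm
    rw [hdeg, minpoly.two_le_natDegree_iff (hint j)]
    rintro ⟨a, ha⟩
    aesop
  obtain ⟨σ, hσ⟩ := IntermediateField.exists_algHom_adjoin_of_splits_of_aeval (F := M) (K := K)
    (S := Set.range x) (x := x j) (y := z j) (by
      rintro _ ⟨i, rfl⟩
      exact ⟨hint i, IsAlgClosed.splits _⟩) (IntermediateField.subset_adjoin _ _ ⟨j, rfl⟩)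
    (by grind)
  have hmem : ∀ i, x i ∈ IntermediateField.adjoin M (Set.range x) := fun i =>
    IntermediateField.subset_adjoin _ _ ⟨i, rfl⟩
  have hx' : IsLyness 1 (fun i => (⟨x i, hmem i⟩ : IntermediateField.adjoin M (Set.range x))) :=
    ⟨fun i h => hx.ne i (congrArg Subtype.val h), fun i => Subtype.ext (hx.rel i),
      Subtype.ext hx.prod⟩
  have hy := hx'.map σ.toRingHom
  set y : ZMod 5 → K := fun i => σ ⟨x i, hmem i⟩ with hydef
  have hy : IsLyness 1 y := by aesop
  have hor : ∀ i, y i = x i ∨ y i = z i := fun i => by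
    have h1 : (P i).aeval (⟨x i, hmem i⟩ : IntermediateField.adjoin M (Set.range x)) = 0 := by
      apply Subtype.val_injective
      have := Polynomial.aeval_algHom_apply (IntermediateField.adjoin M (Set.range x)).val
        ⟨x i, hmem i⟩ (P i)
      aesop
    have h2 : (P i).aeval (y i) = 0 := by
      rw [hydef, Polynomial.aeval_algHom_apply, h1, map_zero]
    grind
  have hyz : y ≠ z := fun h => by
    have h1 := hy.prod
    rw [h, hz.prod] at h1
    grind
  have hyx : y ≠ x := fun h => by
    have h1 : y j = z j := hσ
    rw [h] at h1
    have h2 := ha j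
    rw [← h1] at h2
    refine hj ?_
    have := div_mem h2 (ofNat_mem M 2)
    grind
  obtain ⟨i, hi⟩ : ∃ i, y i = x i := by
    grind
  have h1 : y (i + 1) = z (i + 1) := (hor _).resolve_left fun h => hyx (hy.eq_of_eq hx hi h)
  have h2 : y (i - 1) = z (i - 1) := (hor _).resolve_left fun h =>
    hyx (hy.eq_of_eq hx h (by aesop))
  have h3 : y i = z i := by
    have := hy.rel i
    rw [h1, h2, hz.rel i] at this
    grind
  exact hyz (hy.eq_of_eq hz h3 h1)

end

section

variable {K : Type*} [Field K] [Algebra ℂ K] {k N : Subfield K} {l : K} {x : ZMod 5 → K}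
  {V V' : ValuationSubring K} {π f : K}

omit [Algebra ℂ K] in
lemma Unif.val_eq {π' : K} (h : Unif N V π) (h' : Unif N V π') : V.valuation π = V.valuation π' :=
  le_antisymm (h'.val_le_of_lt h.memN h.lt) (h.val_le_of_lt h'.memN h'.lt)

omit [Algebra ℂ K] in
lemma Unif.val_mul_eq_one (h : Unif N V π) (hf : f ∈ N) (hV : f ∉ V)
    (hle : V.valuation f * V.valuation π ≤ 1) : V.valuation f * V.valuation π = 1 := by
  refine le_antisymm hle ?_
  rw [← val_one_lt_iff] at hV
  have h0 : V.valuation f ≠ 0 := (zero_lt_one.trans hV).ne'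
  have := h.val_le_of_lt (inv_mem hf) (by rw [map_inv₀]; exact inv_lt_one_of_one_lt₀ hV)
  rw [map_inv₀] at this
  calc (1 : V.ValueGroup) = V.valuation f * (V.valuation f)⁻¹ := (mul_inv_cancel₀ h0).symm
    _ ≤ _ := mul_le_mul_right this _

/-- Poles in `P` belong to a single place of `N / k`. -/
def SamePlace (k N : Subfield K) (P : ValuationSubring K → Prop) : Prop :=
  ∀ V V' : ValuationSubring K, (k : Set K) ⊆ V → (k : Set K) ⊆ V' → P V → P V' →
    ∀ g ∈ N, g ∈ V → g ∈ V'

/-- All poles of `f` are simple and satisfy `P`. -/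
def SimplePoles (k N : Subfield K) (P : ValuationSubring K → Prop) (f : K) : Prop :=
  ∀ V : ValuationSubring K, (k : Set K) ⊆ V → f ∉ V →
    P V ∧ ∀ π, Unif N V π → V.valuation f * V.valuation π = 1

def CuspAt (x : ZMod 5 → K) (j : ZMod 5) (V : ValuationSubring K) : Prop :=
  ∃ g, Cusp x V.valuation j g

namespace IsCurve

lemma l_ne (h : IsCurve k l x N) : l ≠ 0 := by
  rw [← h.lyness.prod]
  simp [h.lyness.ne]

lemma val_l (h : IsCurve k l x N) (hk : (k : Set K) ⊆ V) : V.valuation l = 1 :=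
  val_eq_one_of_mem hk h.mem h.l_ne

lemma samePlace_cuspAt [IsAlgClosed K] (h : IsCurve k l x N) (j : ZMod 5) :
    SamePlace k N (CuspAt x j) :=
  fun _ _ hk hk' hc hc' _ hg hV => h.mem_of_mem_of_cusp hk hk' hc.choose_spec hc'.choose_spec hg hV

variable [IsAlgClosed K]

lemma cusp_val (h : IsCurve k l x N) (hk : (k : Set K) ⊆ V) {j : ZMod 5} {g : V.ValueGroup}
    (hc : Cusp x V.valuation j g) (hu : Unif N V π) : g * V.valuation π = 1 := by
  have := charZero_of_algebra K
  obtain ⟨hg, c0, c1, c4, c2, c3⟩ := hc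
  have hNV : ¬ (N : Set K) ⊆ V := hu.exists_notMem
  obtain ⟨δ, hδ, hx⟩ := h.exists_flow
  obtain ⟨π', H⟩ := h.exists_dvr hδ hx hk hNV
  have hd := H.val_deriv hk (h.x_mem (j + 2)) (h.lyness.ne _) (by rw [c2]; exact hg.ne')
  have e1 : V.valuation (1 + x (j + 2)) = g := by
    rw [Valuation.map_add_eq_of_lt_right _ (by rwa [map_one, c2]), c2]
  have e2 : V.valuation (x (j + 2 + 1) - x (j + 2 - 1)) = g := by
    rw [show j + 2 + 1 = j - 2 by rw [add_assoc, show (2 + 1 : ZMod 5) = -2 from rfl]; ring,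
      show j + 2 - 1 = j + 1 by ring, Valuation.map_sub_eq_of_lt_left _ (by grind), c3]
  rw [hx, flow, map_mul, e1, e2, c2, hu.val_eq H.unif |>.symm] at hd
  have hg0 : g ≠ 0 := (zero_lt_one.trans hg).ne'
  apply mul_left_cancel₀ hg0
  grind

/-- A function with a single simple pole is constant. -/
lemma mem_of_simplePoles (h : IsCurve k l x N) {P : ValuationSubring K → Prop}
    (hP : SamePlace k N P) (hf : f ∈ N) (hs : SimplePoles k N P f) : f ∈ k := by
  by_contra hfk
  exact h.not_single_pole hf hfk (fun V hk hV => (hs V hk hV).2)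
    fun V V' hk hk' hV hV' => hP V V' hk hk' (hs V hk hV).1 (hs V' hk' hV').1

omit [IsAlgClosed K] in
lemma exists_cuspAt_zero (h : IsCurve k l x N) :
    ∃ V : ValuationSubring K, (k : Set K) ⊆ V ∧ CuspAt x 0 V := by
  obtain ⟨V, hkV, hV⟩ : ∃ V : ValuationSubring K, (k : Set K) ⊆ V ∧ (x 0)⁻¹ ∉ V := by
    by_contra! hh
    exact h.notMem (inv_inv (x 0) ▸ inv_mem (mem_of_forall_valuationSubring h.closed hh))
  refine ⟨V, hkV, ?_⟩
  rw [← val_one_lt_iff, map_inv₀] at hV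
  have h0 : V.valuation (x 0) < 1 := by
    by_contra! hh
    exact absurd hV (not_lt.2 (inv_le_one_of_one_le₀ hh))
  rcases h.lyness.pattern _ (h.val_l hkV) with hp | ⟨j, g, hc⟩
  · grind
  · have hc' := hc
    obtain ⟨hg, -, c1, c4, c2, c3⟩ := hc
    obtain ⟨i, hi⟩ : ∃ i : ZMod 5, 0 = j + i := ⟨-j, by ring⟩
    rw [hi] at h0
    fin_cases i
    · have : j = 0 := by grind
      exact ⟨g, this ▸ hc'⟩
    · grind
    · grind
    · grind
    grind

/-- A constant multiple of `hfun x` is not a fifth power in the function field of the curve. -/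
theorem pow_ne (h : IsCurve k l x N) {c e : K} (hc : c ∈ k) (hc0 : c ≠ 0) (he : e ∈ N) :
    e ^ 5 ≠ c * hfun x := fun heq => by
  have hv : ∀ V : ValuationSubring K, (k : Set K) ⊆ V →
      V.valuation e ^ 5 = V.valuation (hfun x) := fun V hk => by
    rw [← map_pow, heq, map_mul, val_eq_one_of_mem hk hc hc0, one_mul]
  have hek : e ∈ k := h.mem_of_simplePoles (h.samePlace_cuspAt 0) he fun V hk heV => by
    obtain ⟨w, -, -, h1, -, -, hw⟩ := h.lyness.exists_theta_quotient V.valuation (h.val_l hk)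
    have hew : V.valuation e = w 1 := by
      rw [← hv V hk] at h1
      exact ((pow_left_inj₀ zero_le zero_le (by norm_num)).1 h1).symm
    rw [← val_one_lt_iff, hew] at heV
    rcases hw with hw | ⟨g, hg, -, hwg⟩
    · grind
    · exact ⟨⟨g, hg⟩, fun π hu => by rw [hew, hwg]; exact h.cusp_val hk hg hu⟩
  obtain ⟨V, hk, g, hg, c0, c1, c4, c2, c3⟩ := h.exists_cuspAt_zero
  have h5 := hv V hk
  have he0 : e ≠ 0 := by
    rintro rfl
    have := h.lyness.hfun_ne
    simp_all
  have hg0 : g ≠ 0 := (zero_lt_one.trans hg).ne'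
  rw [val_eq_one_of_mem hk hek he0, one_pow, hfun] at h5
  have d0 : V.valuation (x 0) = (g ^ 2)⁻¹ := eq_inv_of_mul_eq_one_left c0
  have d1 : V.valuation (x 1) = 1 := c1
  have d4 : V.valuation (x 4) = 1 := c4
  have d2 : V.valuation (x 2) = g := c2
  simp only [map_div₀, map_mul, map_pow, d0, d1, d4, d2] at h5
  have : (1 : V.ValueGroup) = g ^ 5 := by rw [h5]; field_simp
  exact absurd this (one_lt_pow₀ hg (by norm_num)).ne

/-- The functions with at most simple poles at two given places. -/
theorem mem_closure_of_simplePoles (h : IsCurve k l x N) {P Q : ValuationSubring K → Prop}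
    (hP : SamePlace k N P) (hQ : SamePlace k N Q) {m : K} (hf : f ∈ N) (hm : m ∈ N) (hmk : m ∉ k)
    (hfp : SimplePoles k N (fun V => P V ∨ Q V) f) (hmp : SimplePoles k N (fun V => P V ∨ Q V) m) :
    f ∈ Subfield.closure (insert m (k : Set K)) := by
  obtain ⟨V, hkV, hmV⟩ : ∃ V : ValuationSubring K, (k : Set K) ⊆ V ∧ m ∉ V := by
    by_contra! hh
    exact hmk (mem_of_forall_valuationSubring h.closed hh)
  wlog hPV : P V generalizing P Q
  · exact this hQ hP (fun V hk hV => (hfp V hk hV).imp_left Or.symm)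
      (fun V hk hV => (hmp V hk hV).imp_left Or.symm) ((hmp V hkV hmV).1.resolve_left hPV)
  have hNV : ¬ (N : Set K) ⊆ V := fun hh => hmV (hh hm)
  obtain ⟨π, hu⟩ := h.exists_unif hkV hNV
  have hm1 := (hmp V hkV hmV).2 π hu
  have hmV' := val_one_lt_iff.2 hmV
  have hm0 : m ≠ 0 := by rintro rfl; aesop
  have hfm : f / m ∈ V := by
    rw [← V.valuation_le_one_iff, map_div₀]
    refine div_le_one_of_le₀ ?_ zero_le
    by_cases hfV : f ∈ V
    · exact ((V.valuation_le_one_iff _).2 hfV).trans hmV'.le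
    · exact (mul_right_cancel₀ hu.pos.ne' (((hfp V hkV hfV).2 π hu).trans hm1.symm)).le
  obtain ⟨c, hc, hcl⟩ := h.dim1.exists_residue hkV hNV (div_mem hf hm) hfm
  have hgN : f - c * m ∈ N := sub_mem hf (mul_mem (h.le hc) hm)
  have hgV : f - c * m ∈ V := by
    by_contra hgV
    have e : f - c * m = (f / m - c) * m := by field_simp
    have hlt : V.valuation (f - c * m) * V.valuation π < 1 := by
      grind
    exact hlt.ne (hu.val_mul_eq_one hgN hgV hlt.le)
  have hgk : f - c * m ∈ k := h.mem_of_simplePoles hQ hgN fun V' hk' hV' => by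
    have hv := val_one_lt_iff.2 hV'
    have hor : (P V' ∨ Q V') ∧ ∀ π, Unif N V' π → V'.valuation (f - c * m) * V'.valuation π = 1 := by
      have hcV := (V'.valuation_le_one_iff _).2 (hk' hc)
      refine ⟨?_, fun π hu => hu.val_mul_eq_one hgN hV' ?_⟩
      · by_cases hfV : f ∈ V'
        · by_cases hmV : m ∈ V'
          · exact absurd (sub_mem hfV (mul_mem (hk' hc) hmV)) hV'
          · exact (hmp V' hk' hmV).1
        · exact (hfp V' hk' hfV).1
      · have key : ∀ {a : K}, SimplePoles k N (fun V => P V ∨ Q V) a →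
            V'.valuation a * V'.valuation π ≤ 1 := fun {a} ha => by
          by_cases haV : a ∈ V'
          · exact mul_le_one' ((V'.valuation_le_one_iff _).2 haV) hu.lt.le
          · exact ((ha V' hk' haV).2 π hu).le
        rw [← map_mul, sub_mul]
        refine V'.valuation.map_sub_le ?_ ?_
        · grind
        · rw [mul_assoc, map_mul, map_mul]
          exact mul_le_one' hcV (key hmp)
    exact ⟨hor.1.resolve_left fun hPV' => hV' (hP V V' hkV hk' hPV hPV' _ hgN hgV), hor.2⟩
  have := add_mem (Subfield.subset_closure (.inr hgk) : _ ∈ Subfield.closure (insert m (k : Set K)))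
    (mul_mem (Subfield.subset_closure (.inr hc)) (Subfield.subset_closure (.inl rfl)) :
      c * m ∈ Subfield.closure (insert m (k : Set K)))
  grind

/-- Curves with parameters `1` and `-1` whose functions `hfun` agree up to fifth powers do not have
the same function field. -/
theorem false_of_hfun_eq (hx : IsCurve k 1 x N) {z : ZMod 5 → K} (hz : IsCurve k (-1) z N) {c m : K}
    (hc : c ∈ k) (hc0 : c ≠ 0) (hm : m ∈ N) (hmh : m ^ 5 = c * (hfun x * hfun z))
    (hcusp : ∀ V : ValuationSubring K, (k : Set K) ⊆ V → CuspAt x 0 V → ¬ CuspAt z 0 V) : False := by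
  have := charZero_of_algebra K
  have hxk := hx.x_mem
  have hzk := hz.x_mem
  have hx0 := hx.lyness.ne
  have hz0 := hz.lyness.ne
  let R : ZMod 5 → K := fun i => (1 + (x i)⁻¹) * (1 + (z i)⁻¹)
  have hR : ∀ i, R i ∈ N := fun i => mul_mem (add_mem (one_mem _) (inv_mem (hxk i)))
    (add_mem (one_mem _) (inv_mem (hzk i)))
  let m2 := R 1 * m ^ 2 / 1
  let m3 := R 2 * m2 ^ 2 / m
  let m4 := R 3 * m3 ^ 2 / m2
  let M : ZMod 5 → K := ![1, m, m2, m3, m4]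
  have hm2 : m2 ∈ N := div_mem (mul_mem (hR 1) (pow_mem hm 2)) (one_mem _)
  have hm3 : m3 ∈ N := div_mem (mul_mem (hR 2) (pow_mem hm2 2)) hm
  have hm4 : m4 ∈ N := div_mem (mul_mem (hR 3) (pow_mem hm3 2)) hm2
  have hMN : ∀ i, M i ∈ N := fun i => by
    fin_cases i
    exacts [one_mem _, hm, hm2, hm3, hm4]
  have hval : ∀ V : ValuationSubring K, (k : Set K) ⊆ V → ∃ w w' : ZMod 5 → V.ValueGroup,
      (∀ i, w i ≠ 0) ∧ (∀ i, w' i ≠ 0) ∧ (∀ i, V.valuation (M i) = w i * w' i) ∧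
      (∀ i, V.valuation (x i) * (w (i + 2) * w (i - 2)) = w i ^ 2) ∧
      (∀ i, V.valuation (z i) * (w' (i + 2) * w' (i - 2)) = w' i ^ 2) ∧
      ((∀ i, w i ≤ 1) ∨ ∃ g, Cusp x V.valuation 0 g ∧ (∀ i, w i ≤ g)) ∧
      ((∀ i, w' i ≤ 1) ∨ ∃ g, Cusp z V.valuation 0 g ∧ (∀ i, w' i ≤ g)) := fun V hk => by
    obtain ⟨w, hw, h0, h1, h2, h3, h4⟩ :=
      hx.lyness.exists_theta_quotient V.valuation (hx.val_l hk)
    obtain ⟨w', hw', h0', h1', h2', h3', h4'⟩ :=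
      hz.lyness.exists_theta_quotient V.valuation (hz.val_l hk)
    have e1 : V.valuation m = w 1 * w' 1 := by
      have : V.valuation m ^ 5 = (w 1 * w' 1) ^ 5 := by
        rw [← map_pow, hmh, map_mul, map_mul, val_eq_one_of_mem hk hc hc0, ← h1, ← h1', one_mul,
          mul_pow]
      aesop
    have hRv : ∀ i, V.valuation (R i) * (w i * w' i) ^ 2 / (w (i - 1) * w' (i - 1)) =
        w (i + 1) * w' (i + 1) := fun i => by
      rw [div_eq_iff (mul_ne_zero (hw _) (hw' _)), map_mul]
      calc _ = (V.valuation (1 + (x i)⁻¹) * w i ^ 2) * (V.valuation (1 + (z i)⁻¹) * w' i ^ 2) := by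
              rw [mul_pow, mul_mul_mul_comm]
        _ = _ := by rw [← h2, ← h2', mul_mul_mul_comm]
    have e2 : V.valuation m2 = w 2 * w' 2 := by
      have := hRv 1
      rw [sub_self, h0, h0', mul_one, div_one] at this
      simp only [m2, div_one, map_mul, map_pow, e1]
      exact this
    have e3 : V.valuation m3 = w 3 * w' 3 := by
      simp only [m3, map_div₀, map_mul, map_pow, e1, e2]
      exact hRv 2
    have e4 : V.valuation m4 = w 4 * w' 4 := by
      simp only [m4, map_div₀, map_mul, map_pow, e2, e3]
      exact hRv 3
    refine ⟨w, w', hw, hw', fun i => ?_, h3, h3',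
      h4.imp_right fun ⟨g, a, b, _⟩ => ⟨g, a, b⟩, h4'.imp_right fun ⟨g, a, b, _⟩ => ⟨g, a, b⟩⟩
    fin_cases i
    · change V.valuation 1 = w 0 * w' 0
      aesop
    exacts [e1, e2, e3, e4]
  have hM0 : ∀ i, M i ≠ 0 := fun i h0 => by
    obtain ⟨V, hk, -⟩ := hx.exists_cuspAt_zero
    obtain ⟨w, w', hw, hw', h, -⟩ := hval V hk
    have := h i
    aesop
  have hpoles : ∀ i, SimplePoles k N (fun V => CuspAt x 0 V ∨ CuspAt z 0 V) (M i) := fun i V hk hV => by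
    obtain ⟨w, w', hw, hw', h, -, -, h1, h2⟩ := hval V hk
    have hgt := val_one_lt_iff.2 hV
    rcases h1 with h1 | ⟨g, hg, h1⟩ <;> rcases h2 with h2 | ⟨g', hg', h2⟩
    · rw [h] at hgt
      exact absurd (mul_le_one' (h1 i) (h2 i)) hgt.not_ge
    · refine ⟨.inr ⟨g', hg'⟩, fun π hu => hu.val_mul_eq_one (hMN i) hV ?_⟩
      rw [← hz.cusp_val hk hg' hu, h]
      exact mul_le_mul_left (mul_le_of_le_one_of_le (h1 i) (h2 i)) _
    · refine ⟨.inl ⟨g, hg⟩, fun π hu => hu.val_mul_eq_one (hMN i) hV ?_⟩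
      rw [← hx.cusp_val hk hg hu, h]
      exact mul_le_mul_left (mul_le_of_le_of_le_one (h1 i) (h2 i)) _
    · exact absurd ⟨g', hg'⟩ (hcusp V hk ⟨g, hg⟩)
  obtain ⟨L, hkL, hML, j, hj⟩ : ∃ L : Subfield K, k ≤ L ∧ (∀ i, M i ∈ L) ∧ ∃ j, x j ∉ L := by
    by_cases hall : ∀ i, M i ∈ k
    · exact ⟨k, le_rfl, hall, 0, hx.notMem⟩
    · push Not at hall
      obtain ⟨j, hj⟩ := hall
      have hkL : k ≤ Subfield.closure (insert (M j) (k : Set K)) :=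
        fun a ha => Subfield.subset_closure (.inr ha)
      refine ⟨_, hkL, fun i => hx.mem_closure_of_simplePoles (hx.samePlace_cuspAt 0)
        (hz.samePlace_cuspAt 0) (hMN i) (hMN j) hj (hpoles i) (hpoles j), ?_⟩
      by_contra! hall
      have hN : N = Subfield.closure (insert (M j) (k : Set K)) := by
        apply le_antisymm
        · rw [hx.eq]
          refine Subfield.closure_le.2 (Set.union_subset hkL ?_)
          rintro _ ⟨i, rfl⟩
          aesop
        · exact Subfield.closure_le.2 (Set.insert_subset (hMN j) hx.le)
      exact hx.not_single_pole (hMN j) hj (fun V hk hV => (hpoles j V hk hV).2)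
        fun V V' hk hk' hV hV' g hg hgV =>
          hx.dim1.mem_of_mem_of_pole (hMN j) hN hk hk' hV hV' hg hgV
  have hmul : ∀ i, x i * z i ∈ L := fun i => by
    have hU : x i * z i * (M (i + 2) * M (i - 2)) / M i ^ 2 ∈ k := by
      refine mem_of_forall_valuationSubring hx.closed fun V hk => ?_
      obtain ⟨w, w', hw, hw', h, h1, h2, -⟩ := hval V hk
      refine mem_of_val_eq_one ?_
      rw [map_div₀, map_mul, map_mul, map_mul, map_pow, h, h, h, mul_mul_mul_comm (w (i + 2)),
        mul_mul_mul_comm (V.valuation (x i)), h1, h2, mul_pow,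
        div_self (mul_ne_zero (pow_ne_zero _ (hw i)) (pow_ne_zero _ (hw' i)))]
    have := mul_mem (hkL hU) (div_mem (pow_mem (hML i) 2) (mul_mem (hML (i + 2)) (hML (i - 2))))
    have h0 := hM0 i; have h1 := hM0 (i + 2); have h2 := hM0 (i - 2)
    convert this using 1
    field_simp
  refine IsLyness.not_swap hx.lyness hz.lyness L hmul (fun i => ?_) hj
  have e := sub_mem (sub_mem (mul_mem (hmul (i + 1)) (hmul (i - 1))) (one_mem _)) (hmul i)
  convert e using 1
  linear_combination -(z (i + 1) * z (i - 1)) * hx.lyness.rel i - (1 + x i) * hz.lyness.rel i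

/-- The function field of a Lyness curve with parameter `1` does not carry functions `hfun` whose
classes modulo fifth powers and constants differ by a factor `-2`. -/
theorem hfun_mul_sq_ne (hx : IsCurve k 1 x N) {y : ZMod 5 → K} (hy : IsCurve k 1 y N) {c e : K}
    (hc : c ∈ k) (hc0 : c ≠ 0) (he : e ∈ N) : hfun y * hfun x ^ 2 * c ≠ e ^ 5 := fun heq => by
  have := charZero_of_algebra K
  have hy0 := hy.lyness.ne
  have h1y : ∀ i, 1 + y i ≠ 0 := hy.lyness.one_add_ne
  have hyr := hy.lyness.rel
  have hyp := hy.lyness.prod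
  have hxf := hx.lyness.hfun_ne
  have hyf := hy.lyness.hfun_ne
  have hxN := hx.x_mem
  have hyN := hy.x_mem
  have hxfN : hfun x ∈ N := div_mem (mul_mem (pow_mem (hxN 1) 3) (hxN 4))
    (mul_mem (pow_mem (hxN 0) 3) (hxN 2))
  let z : ZMod 5 → K := fun i => -y (3 * i) / (1 + y (3 * i))
  have hzne : ∀ i, z i ≠ 0 := fun i => div_ne_zero (neg_ne_zero.2 (hy0 _)) (h1y _)
  have r0 : y 1 * y 4 = 1 + y 0 := hyr 0
  have r1 : y 2 * y 0 = 1 + y 1 := hyr 1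
  have r2 : y 3 * y 1 = 1 + y 2 := hyr 2
  have r3 : y 4 * y 2 = 1 + y 3 := hyr 3
  have r4 : y 0 * y 3 = 1 + y 4 := hyr 4
  have n0 := hy0 0; have n1 := hy0 1; have n2 := hy0 2; have n3 := hy0 3; have n4 := hy0 4
  have z0 : z 0 = -y 0 / (y 1 * y 4) := by grind
  have z1 : z 1 = -y 3 / (y 4 * y 2) := by grind
  have z2 : z 2 = -y 1 / (y 2 * y 0) := by rw [r1]; rfl
  have z3 : z 3 = -y 4 / (y 0 * y 3) := by rw [r4]; rfl
  have z4 : z 4 = -y 2 / (y 3 * y 1) := by rw [r2]; rfl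
  have hz : IsLyness (-1) z := by
    refine ⟨hzne, fun i => ?_, ?_⟩
    · have a1 : 3 * (i + 1) = 3 * i - 2 := by grind
      have a2 : 3 * (i - 1) = 3 * i + 2 := by grind
      have b1 : 1 + y (3 * i - 2) = y (3 * i - 1) * y (3 * i + 2) := by
        rw [← hyr, show (3 * i - 2 + 1) = 3 * i - 1 by ring, show 3 * i - 2 - 1 = 3 * i + 2 by
          grind]
      have b2 : 1 + y (3 * i + 2) = y (3 * i - 2) * y (3 * i + 1) := by
        rw [← hyr, show (3 * i + 2 - 1) = 3 * i + 1 by ring, show 3 * i + 2 + 1 = 3 * i - 2 by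
          grind]
      have b3 := hyr (3 * i)
      have := h1y (3 * i)
      have := hy0 (3 * i + 1); have := hy0 (3 * i - 1); have := hy0 (3 * i + 2)
      have := hy0 (3 * i - 2)
      simp only [z]
      rw [a1, a2, b1, b2]
      field_simp
      grind
    grind
  have hzN : ∀ i, z i ∈ N := fun i => div_mem (neg_mem (hyN _)) (add_mem (one_mem _) (hyN _))
  have hyz : ∀ i, y i = -z (2 * i) / (1 + z (2 * i)) := fun i => by
    simp only [z]
    have h6 : 3 * (2 * i) = i := by grind
    rw [h6]
    have := h1y i
    have : 1 + -y i / (1 + y i) ≠ 0 := by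
      grind
    grind
  have hzc : IsCurve k (-1) z N := by
    refine ⟨hz, by norm_num, neg_mem (one_mem _), hy.closed, hy.algebraMap_mem, fun h0 => ?_, ?_⟩
    · apply hy.notMem
      have e : y 0 = -z 0 / (1 + z 0) := hyz 0
      rw [e]
      exact div_mem (neg_mem h0) (add_mem (one_mem _) h0)
    · apply le_antisymm
      · rw [hy.eq]
        refine Subfield.closure_le.2 (Set.union_subset (fun a ha => Subfield.subset_closure (.inl ha)) ?_)
        rintro _ ⟨i, rfl⟩
        rw [hyz i]
        have hi : z (2 * i) ∈ Subfield.closure (k ∪ Set.range z) :=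
          Subfield.subset_closure (.inr ⟨_, rfl⟩)
        exact div_mem (neg_mem hi) (add_mem (one_mem _) hi)
      · refine Subfield.closure_le.2 (Set.union_subset hy.le ?_)
        rintro _ ⟨i, rfl⟩
        exact hzN i
  have he0 : e ≠ 0 := by
    grind
  have hF : hfun z * hfun y ^ 2 = (y 1 / (y 0 ^ 2 * y 2)) ^ 5 := by
    simp only [hfun]
    rw [z0, z1, z2, z4]
    have hp : y 3 = 1 / (y 0 * y 1 * y 2 * y 4) := by
      rw [eq_div_iff (by positivity)]
      grind
    rw [hp]
    field_simp
  have hmain : (y 1 / (y 0 ^ 2 * y 2) * hfun x / e ^ 2) ^ 5 = (c ^ 2)⁻¹ * (hfun x * hfun z) := by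
    rw [div_pow, mul_pow, ← hF, ← pow_mul, mul_comm 2 5, pow_mul, ← heq]
    field_simp
  have hmN : y 1 / (y 0 ^ 2 * y 2) * hfun x / e ^ 2 ∈ N :=
    div_mem (mul_mem (div_mem (hyN 1) (mul_mem (pow_mem (hyN 0) 2) (hyN 2))) hxfN) (pow_mem he 2)
  by_cases hcusp : ∀ V : ValuationSubring K, (k : Set K) ⊆ V → CuspAt x 0 V → ¬ CuspAt z 0 V
  · exact hx.false_of_hfun_eq hzc (inv_mem (pow_mem hc 2)) (inv_ne_zero (pow_ne_zero 2 hc0)) hmN hmain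
      hcusp
  · push Not at hcusp
    obtain ⟨V, hk, hxV, hzV⟩ := hcusp
    refine hx.false_of_hfun_eq (hzc.shift 1) (c := -(c ^ 2)⁻¹)
      (m := y 1 / (y 0 ^ 2 * y 2) * hfun x / e ^ 2 * (z 2 * z 0 / z 1))
      (neg_mem (inv_mem (pow_mem hc 2))) (neg_ne_zero.2 (inv_ne_zero (pow_ne_zero 2 hc0)))
      (mul_mem hmN (div_mem (mul_mem (hzN 2) (hzN 0)) (hzN 1))) ?_ fun V' hk' hxV' hzV' => ?_
    · have e : hfun (fun i => z (i + 1)) = z 2 ^ 3 * z 0 / (z 1 ^ 3 * z 3) := rfl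
      have e' : hfun z = z 1 ^ 3 * z 4 / (z 0 ^ 3 * z 2) := rfl
      rw [mul_pow, hmain, e, e']
      clear_value z
      have hp := hz.prod
      have := hzne 0; have := hzne 1; have := hzne 2; have := hzne 3; have := hzne 4
      field_simp
      linear_combination hp
    · obtain ⟨g, hg, c0, -⟩ := hzV
      obtain ⟨g', hg', -, -, c4, -⟩ := hzV'
      have h0 : (z 0)⁻¹ ∈ V := hx.samePlace_cuspAt 0 V' V hk' hk hxV' hxV _ (inv_mem (hzN 0)) (by
        refine mem_of_val_eq_one ?_
        have : V'.valuation (z 0) = 1 := c4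
        rw [map_inv₀, this, inv_one])
      rw [← V.valuation_le_one_iff, map_inv₀, eq_inv_of_mul_eq_one_left c0, inv_inv] at h0
      exact absurd h0 (one_lt_pow₀ hg (by norm_num)).not_ge

end IsCurve

end

section Span

variable {K : Type*} [Field K] {k : Subfield K} {y : K}

lemma exists_sum_of_monic {d : ℕ} {P : Polynomial k} (hP : P.Monic) (h0 : P.aeval y = 0)
    (hd : P.natDegree = d) {f : K} (hf : f ∈ Subfield.closure (insert y (k : Set K))) :
    ∃ c : Fin d → K, (∀ j, c j ∈ k) ∧ f = ∑ j, c j * y ^ (j : ℕ) := by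
  have hint : IsIntegral k y := ⟨P, hP, by aesop⟩
  have hle : Subfield.closure (insert y (k : Set K)) ≤ (IntermediateField.adjoin k {y}).toSubfield := by
    refine Subfield.closure_le.2 (Set.insert_subset ?_ fun a ha => ?_)
    · exact IntermediateField.mem_adjoin_simple_self k y
    · exact (IntermediateField.adjoin k {y}).algebraMap_mem ⟨a, ha⟩
  have hf' : f ∈ (IntermediateField.adjoin k {y}).toSubalgebra := hle hf
  rw [IntermediateField.adjoin_simple_toSubalgebra_of_isAlgebraic hint.isAlgebraic,
    Algebra.adjoin_singleton_eq_range_aeval] at hf'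
  obtain ⟨R, hR⟩ := hf'
  by_cases hP1 : P = 1
  · grind
  refine ⟨fun j => (R %ₘ P).coeff j, fun j => SetLike.coe_mem _, ?_⟩
  have hdeg : (R %ₘ P).natDegree < d := hd ▸ Polynomial.natDegree_modByMonic_lt R hP hP1
  calc f = R.aeval y := hR.symm
    _ = (R %ₘ P).aeval y := by
        conv_lhs => rw [← Polynomial.modByMonic_add_div R P]
        simp [h0]
    _ = _ := by
        rw [Polynomial.aeval_eq_sum_range' hdeg, Finset.sum_range]
        rfl

end Span

section LI

variable {K : Type*} [Field K] [Algebra ℂ K] {k N : Subfield K} {l : K} {x : ZMod 5 → K}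

omit [Algebra ℂ K] in
lemma IsLyness.linearIndependent [CharZero K] (hk : AlgClosedIn k) (h : IsLyness 1 x)
    (h0 : x 0 ∉ k) :
    LinearIndependent (Subfield.closure (insert (x 0) (k : Set K))) fun j : Fin 2 => x 1 ^ (j : ℕ) := by
  set E := Subfield.closure (insert (x 0) (k : Set K)) with hE
  have hx0 : x 0 ∈ E := Subfield.subset_closure (.inl rfl)
  have hx1 : x 1 ∉ E := fun h1 => by
    refine h.flow_notMem hk h0 ?_
    exact mul_mem (add_mem (one_mem _) hx0) (sub_mem (h.mem_subfield hx0 h1 _)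
      (h.mem_subfield hx0 h1 _))
  rw [Fintype.linearIndependent_iff]
  intro g hg
  simp only [Fin.sum_univ_two, Fin.val_zero, pow_zero, Fin.val_one, pow_one, Subfield.smul_def,
    smul_eq_mul, mul_one] at hg
  have h1 : g 1 = 0 := by
    by_contra hne
    have hne' : (g 1 : K) ≠ 0 := by simp_all
    apply hx1
    have : x 1 = -g 0 / g 1 := by
      rw [eq_div_iff hne']; linear_combination hg
    rw [this]
    exact div_mem (neg_mem (SetLike.coe_mem _)) (SetLike.coe_mem _)
  simp_all

lemma IsCurve.linearIndependent [IsAlgClosed K] (h : IsCurve k l x N) {c s : K} (hc : c ∈ k) (hc0 : c ≠ 0)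
    (hs : s ^ 5 = c * hfun x) : LinearIndependent N fun j : Fin 5 => s ^ (j : ℕ) := by
  have hmem : c * hfun x ∈ N := by
    have := h.le hc
    have hx := h.x_mem
    simp only [hfun]
    exact mul_mem this (div_mem (mul_mem (pow_mem (hx _) _) (hx _))
      (mul_mem (pow_mem (hx _) _) (hx _)))
  have hirr : Irreducible (Polynomial.X ^ 5 - Polynomial.C (⟨_, hmem⟩ : N)) := by
    refine X_pow_sub_C_irreducible_of_prime (by norm_num) fun b hb => ?_
    refine h.pow_ne hc hc0 b.2 ?_
    simpa using congrArg Subtype.val hb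
  have hmin : minpoly N s = Polynomial.X ^ 5 - Polynomial.C (⟨_, hmem⟩ : N) := by
    refine (minpoly.eq_of_irreducible_of_monic hirr ?_ (Polynomial.monic_X_pow_sub_C _ (by norm_num))).symm
    rw [map_sub, map_pow, Polynomial.aeval_X, Polynomial.aeval_C, hs]
    exact sub_self _
  have hdeg : (minpoly N s).natDegree = 5 := by aesop
  have := linearIndependent_pow (K := N) s
  rw [hdeg] at this
  exact this

omit [Algebra ℂ K] in
lemma exists_sum_of_pow_five {y : K} (hy : y ^ 5 ∈ N) {f : K}
    (hf : f ∈ Subfield.closure (insert y (N : Set K))) :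
    ∃ c : Fin 5 → K, (∀ j, c j ∈ N) ∧ f = ∑ j, c j * y ^ (j : ℕ) := by
  refine exists_sum_of_monic (Polynomial.monic_X_pow_sub_C (⟨_, hy⟩ : N) (by norm_num)) ?_
    Polynomial.natDegree_X_pow_sub_C hf
  rw [map_sub, map_pow, Polynomial.aeval_X, Polynomial.aeval_C]
  exact sub_self _

omit [Algebra ℂ K] in
lemma IsLyness.exists_sum (h : IsLyness 1 x) (h0 : x 0 ∈ N) {f : K}
    (hf : f ∈ Subfield.closure (insert (x 1) (N : Set K))) :
    ∃ c : Fin 2 → K, (∀ j, c j ∈ N) ∧ f = ∑ j, c j * x 1 ^ (j : ℕ) := by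
  have h1 : 1 + x 0 ≠ 0 := h.one_add_ne 0
  have hb : x 1 + x 4 ∈ N := by
    have : x 1 + x 4 = (x 0 - (1 + x 0) * (2 + x 0)) / (1 + x 0) := by
      rw [eq_div_iff h1]; linear_combination h.quad
    rw [this]
    have h2 : (2 : K) ∈ N := by simp
    exact div_mem (sub_mem h0 (mul_mem (add_mem (one_mem _) h0) (add_mem h2 h0)))
      (add_mem (one_mem _) h0)
  have hc : 1 + x 0 ∈ N := add_mem (one_mem _) h0
  refine exists_sum_of_monic (P := .X ^ 2 + (.C (-⟨_, hb⟩ : N) * .X + .C (⟨_, hc⟩ : N))) ?_ ?_ ?_ hf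
  · exact Polynomial.monic_X_pow_add (by compute_degree!)
  · simp only [map_add, map_pow, map_mul, Polynomial.aeval_X, Polynomial.aeval_C]
    change x 1 ^ 2 + (-(x 1 + x 4) * x 1 + (1 + x 0)) = 0
    linear_combination -h.rels.1
  · rw [← add_assoc]; compute_degree!

end LI

/-- `π` is a uniformizer of `E ∩ V` whose residues lie in `E'`. -/
structure ResChart {K Ω : Type*} [Field K] [Field Ω] (V : ValuationSubring K) (φ : V →+* Ω)
    (E : Subfield K) (E' : Subfield Ω) (π : K) : Prop where
  unif : Unif E V π
  res : ∀ f : V, (f : K) ∈ E → φ f ∈ E'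

section Residue

variable {K Ω : Type*} [Field K] [Field Ω] {V : ValuationSubring K} {φ : V →+* Ω}
  {E : Subfield K} {E' : Subfield Ω} {π : K}

lemma map_ne_zero_iff_val [IsLocalHom φ] {f : V} : φ f ≠ 0 ↔ V.valuation (f : K) = 1 := by
  rw [← isUnit_iff_ne_zero, isUnit_map_iff, V.valuation_eq_one_iff]

lemma map_eq_zero_iff_val [IsLocalHom φ] {f : V} : φ f = 0 ↔ V.valuation (f : K) < 1 := by
  rw [← not_iff_not, ← ne_eq, map_ne_zero_iff_val, not_lt]
  exact ⟨fun h => h.ge, fun h => le_antisymm (V.valuation_le_one f) h⟩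

lemma ResChart.of_rep [IsLocalHom φ] {E₂ : Subfield K} {E₂' : Subfield Ω} (h : Unif E V π)
    (hE : E ≤ E₂)
    (hr : ∀ f ∈ E₂, f ≠ 0 → ∃ n : ℤ, ∃ u : V, (u : K) ∈ E₂ ∧ φ u ≠ 0 ∧ φ u ∈ E₂' ∧ f = u * π ^ n) :
    ResChart V φ E₂ E₂' π := by
  refine ⟨⟨hE h.memN, h.lt, h.ne, fun f hf h0 => ?_⟩, fun f hf => ?_⟩
  · obtain ⟨n, u, hu, hu0, -, e⟩ := hr f hf h0
    exact ⟨n, u, hu, map_ne_zero_iff_val.1 hu0, e⟩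
  · by_cases h0 : φ f = 0
    · aesop
    obtain ⟨n, u, hu, hu0, hu', e⟩ := hr f hf (by
      rintro hf0
      aesop)
    have hv := congrArg V.valuation e
    rw [map_mul, map_ne_zero_iff_val.1 hu0, map_ne_zero_iff_val.1 h0, one_mul, map_zpow₀] at hv
    have hn : n = 0 := h.pow_eq_pow (by aesop)
    aesop

lemma ResChart.exists_sum [IsLocalHom φ] (h : ResChart V φ E E' π) {J : Type*} [Fintype J]
    {b : J → V} (hb : LinearIndependent E' fun j => φ (b j)) {c : J → K} (hc : ∀ j, c j ∈ E)
    (hc0 : c ≠ 0) : ∃ n : ℤ, ∃ d : J → V, (∀ j, (d j : K) ∈ E) ∧ (∀ j, c j = d j * π ^ n) ∧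
      φ (∑ j, d j * b j) ≠ 0 := by
  obtain ⟨i, hi⟩ := Function.ne_iff.1 hc0
  obtain ⟨j, -, hj⟩ := Finset.exists_max_image Finset.univ (fun j => V.valuation (c j)) ⟨i, by simp⟩
  have hcj : c j ≠ 0 := by
    intro h0
    aesop
  obtain ⟨n, u, huE, hu, e⟩ := h.unif.rep _ (hc j) hcj
  have hp := zpow_ne_zero n h.unif.ne
  have hle : ∀ i, c i / π ^ n ∈ V := fun i => by
    rw [← V.valuation_le_one_iff, map_div₀]
    refine div_le_one_of_le₀ ((hj i (by simp)).trans ?_) zero_le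
    grind
  have hd : ∀ i, c i / π ^ n ∈ E := fun i => div_mem (hc i) (zpow_mem h.unif.memN _)
  refine ⟨n, fun i => ⟨_, hle i⟩, hd, fun i => (div_mul_cancel₀ _ hp).symm, fun h0 => ?_⟩
  rw [Fintype.linearIndependent_iff] at hb
  have := hb (fun i => ⟨_, h.res ⟨_, hle i⟩ (hd i)⟩) (by
    simpa [Subfield.smul_def] using h0) j
  have h1 : φ ⟨_, hle j⟩ = 0 := congrArg Subtype.val this
  refine map_ne_zero_iff_val.2 ?_ h1
  grind

lemma ResChart.of_span [IsLocalHom φ] (h : ResChart V φ E E' π) {E₂ : Subfield K}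
    {E₂' : Subfield Ω} (hE : E ≤ E₂) (hE' : E' ≤ E₂') {J : Type*} [Fintype J]
    {b : J → V} (hb : LinearIndependent E' fun j => φ (b j)) (hbE : ∀ j, (b j : K) ∈ E₂)
    (hbE' : ∀ j, φ (b j) ∈ E₂')
    (hspan : ∀ f ∈ E₂, ∃ c : J → K, (∀ j, c j ∈ E) ∧ f = ∑ j, c j * b j) :
    ResChart V φ E₂ E₂' π := by
  refine .of_rep h.unif hE fun f hf h0 => ?_
  obtain ⟨c, hc, rfl⟩ := hspan f hf
  obtain ⟨n, d, hd, e, hne⟩ := h.exists_sum hb hc (by rintro rfl; simp at h0)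
  refine ⟨n, _, ?_, hne, ?_, ?_⟩
  · push_cast
    exact sum_mem fun j _ => mul_mem (hE (hd j)) (hbE j)
  · rw [map_sum]
    exact sum_mem fun j _ => by rw [map_mul]; exact mul_mem (hE' (h.res _ (hd j))) (hbE' j)
  · push_cast
    rw [Finset.sum_mul]
    grind

lemma ResChart.of_powers [IsLocalHom φ] (h : ResChart V φ E E' π) {d : ℕ} {y : V}
    (hb : LinearIndependent E' fun j : Fin d => φ y ^ (j : ℕ))
    (hspan : ∀ f ∈ Subfield.closure (insert (y : K) (E : Set K)),
      ∃ c : Fin d → K, (∀ j, c j ∈ E) ∧ f = ∑ j, c j * (y : K) ^ (j : ℕ)) :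
    ResChart V φ (Subfield.closure (insert (y : K) (E : Set K)))
      (Subfield.closure (insert (φ y) (E' : Set Ω))) π := by
  refine h.of_span (b := fun j : Fin d => y ^ (j : ℕ))
    (fun a ha => Subfield.subset_closure (.inr ha))
    (fun a ha => Subfield.subset_closure (.inr ha)) (by grind)
    (fun j => ?_) (fun j => ?_) (by aesop)
  · push_cast
    aesop
  · rw [map_pow]
    aesop

/-- The Gauss extension. -/
lemma ResChart.of_transcendental [IsLocalHom φ] (h : ResChart V φ E E' π) (hk : AlgClosedIn E')
    {y : V} (hy : φ y ∉ E') :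
    ResChart V φ (Subfield.closure (insert (y : K) (E : Set K)))
      (Subfield.closure (insert (φ y) (E' : Set Ω))) π := by
  have hy1 : (y : K) ∈ Subfield.closure (insert (y : K) (E : Set K)) :=
    Subfield.subset_closure (.inl rfl)
  have hy2 : φ y ∈ Subfield.closure (insert (φ y) (E' : Set Ω)) :=
    Subfield.subset_closure (.inl rfl)
  have hle : E ≤ Subfield.closure (insert (y : K) (E : Set K)) :=
    fun a ha => Subfield.subset_closure (.inr ha)
  have hle' : E' ≤ Subfield.closure (insert (φ y) (E' : Set Ω)) :=
    fun a ha => Subfield.subset_closure (.inr ha)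
  have key : ∀ P : Polynomial E, P ≠ 0 → ∃ n : ℤ, ∃ u : V,
      (u : K) ∈ Subfield.closure (insert (y : K) (E : Set K)) ∧ φ u ≠ 0 ∧
      φ u ∈ Subfield.closure (insert (φ y) (E' : Set Ω)) ∧ P.aeval (y : K) = u * π ^ n := by
    intro P hP
    have hb : LinearIndependent E' fun j : Fin (P.natDegree + 1) => φ (y ^ (j : ℕ)) := by
      simp only [map_pow]
      rw [Fintype.linearIndependent_iff]
      intro g hg i
      have h0 : ∑ j : Fin (P.natDegree + 1), Polynomial.monomial (j : ℕ) (g j) = 0 :=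
        hk.eq_zero_of_aeval hy (by
          rw [map_sum, ← hg]
          exact Finset.sum_congr rfl fun j _ => by
            rw [Polynomial.aeval_monomial, Algebra.smul_def])
      have := congrArg (fun R => Polynomial.coeff R i) h0
      simpa [Polynomial.finsetSum_coeff, Polynomial.coeff_monomial, Fin.val_inj] using this
    obtain ⟨n, d, hd, e, hne⟩ := h.exists_sum hb
      (c := fun j => (P.coeff j : E)) (fun j => SetLike.coe_mem _) (fun h0 => hP (by
        rw [← Polynomial.leadingCoeff_eq_zero]
        have := congrFun h0 (Fin.last _)
        aesop))
    refine ⟨n, _, ?_, hne, ?_, ?_⟩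
    · push_cast
      exact sum_mem fun j _ => mul_mem (hle (hd j)) (pow_mem hy1 _)
    · rw [map_sum]
      exact sum_mem fun j _ => by
        rw [map_mul, map_pow]; exact mul_mem (hle' (h.res _ (hd j))) (pow_mem hy2 _)
    · push_cast
      rw [Finset.sum_mul, Polynomial.aeval_eq_sum_range, Finset.sum_range]
      refine Finset.sum_congr rfl fun j _ => ?_
      rw [Subfield.smul_def, smul_eq_mul, e j]; ring
  refine .of_rep h.unif hle fun f hf h0 => ?_
  obtain ⟨P, Q, hQ, rfl⟩ := exists_ratio_of_mem_closure hf
  obtain ⟨n, u, hu, hu0, hu', e⟩ := key P (by grind)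
  obtain ⟨m, w, hw, hw0, hw', e'⟩ := key Q (by grind)
  have hwu : IsUnit w := (isUnit_map_iff φ w).1 (isUnit_iff_ne_zero.2 hw0)
  obtain ⟨w', rfl⟩ := hwu
  have hi : φ (↑w'⁻¹ : V) = (φ w')⁻¹ := by
    aesop
  have hi' : ((↑w'⁻¹ : V) : K) = ((w' : V) : K)⁻¹ := by
    refine eq_inv_of_mul_eq_one_left ?_
    rw [← MulMemClass.coe_mul]
    simp
  refine ⟨n - m, u * ↑w'⁻¹, ?_, ?_, ?_, ?_⟩
  · rw [MulMemClass.coe_mul, hi']; exact mul_mem hu (inv_mem hw)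
  · grind
  · rw [map_mul, hi]; exact mul_mem hu' (inv_mem hw')
  · rw [MulMemClass.coe_mul, hi', e, e', zpow_sub₀ h.unif.ne]
    field_simp

/-- A totally ramified extension of degree five does not enlarge the residue field. -/
lemma ResChart.of_ramified [IsLocalHom φ] (h : ResChart V φ E E' π) {y : K} {a : ℤ}
    (ha : ¬ 5 ∣ a) (hy : V.valuation y ^ 5 = V.valuation π ^ a) {c : Fin 5 → K}
    (hc : ∀ j, c j ∈ E) {f : V} (hf : (f : K) = ∑ j, c j * y ^ (j : ℕ)) : φ f ∈ E' := by
  have hy0 : V.valuation y ≠ 0 := by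
    intro h0
    rw [h0, zero_pow (by norm_num)] at hy
    exact zpow_ne_zero _ h.unif.pos.ne' hy.symm
  have hval : ∀ j, c j ≠ 0 → ∃ n : ℤ,
      V.valuation (c j * y ^ (j : ℕ)) ^ 5 = V.valuation π ^ (5 * n + a * (j : ℕ)) := fun j hj => by
    obtain ⟨n, hn⟩ := h.unif.exists_val (hc j) hj
    refine ⟨n, ?_⟩
    rw [map_mul, map_pow, mul_pow, hn, ← pow_mul, mul_comm (j : ℕ), pow_mul, hy,
      zpow_add₀ h.unif.pos.ne', zpow_mul, zpow_mul, zpow_natCast, zpow_ofNat, ← zpow_ofNat, ← zpow_mul, ← zpow_ofNat, ← zpow_mul, mul_comm n]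
    
  have hdist : ∀ i j, c i ≠ 0 → c j ≠ 0 →
      V.valuation (c i * y ^ (i : ℕ)) = V.valuation (c j * y ^ (j : ℕ)) → i = j := by
    intro i j hi hj e
    obtain ⟨n, hn⟩ := hval i hi
    obtain ⟨m, hm⟩ := hval j hj
    rw [e, hm] at hn
    have := h.unif.pow_eq_pow hn
    have hd : (5 : ℤ) ∣ a * ((i : ℕ) - (j : ℕ) : ℤ) := ⟨m - n, by grind⟩
    have hp : Prime (5 : ℤ) := by norm_num
    have := (hp.dvd_or_dvd hd).resolve_left ha
    grind
  by_cases hall : ∀ j, c j = 0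
  · aesop
  push Not at hall
  obtain ⟨i, hi⟩ := hall
  obtain ⟨j, -, hj⟩ := Finset.exists_max_image Finset.univ
    (fun j => V.valuation (c j * y ^ (j : ℕ))) ⟨i, by simp⟩
  have hy00 : y ≠ 0 := by grind
  have hcj : c j ≠ 0 := by
    intro h0
    aesop
  have hlt : ∀ i ∈ Finset.univ \ {j}, V.valuation (c i * y ^ (i : ℕ)) <
      V.valuation (c j * y ^ (j : ℕ)) := fun i hij => by
    refine lt_of_le_of_ne (hj i (by simp)) fun e => ?_
    have hij : i ≠ j := by grind
    refine hij (hdist i j (fun h0 => ?_) hcj e)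
    aesop
  have hsum := Valuation.map_sum_eq_of_lt V.valuation (Finset.mem_univ j) hlt
  rw [← hf] at hsum
  by_cases h1 : V.valuation (f : K) < 1
  · rw [map_eq_zero_iff_val.2 h1]; aesop
  have hf1 : V.valuation (f : K) = 1 := le_antisymm (V.valuation_le_one f) (not_lt.1 h1)
  rw [hf1] at hsum
  have hj0 : j = 0 := by
    obtain ⟨n, hn⟩ := hval j hcj
    rw [← hsum, one_pow, ← zpow_zero (V.valuation π)] at hn
    have := h.unif.pow_eq_pow hn
    have hd : (5 : ℤ) ∣ a * ((j : ℕ) : ℤ) := ⟨-n, by grind⟩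
    have hp : Prime (5 : ℤ) := by norm_num
    have := (hp.dvd_or_dvd hd).resolve_left ha
    grind
  subst hj0
  simp only [Fin.val_zero, pow_zero, mul_one] at hsum hlt
  have hcV : c 0 ∈ V := mem_of_val_eq_one hsum.symm
  have : φ f = φ ⟨c 0, hcV⟩ := by
    rw [← sub_eq_zero, ← map_sub, map_eq_zero_iff_val]
    change V.valuation ((f : K) - c 0) < 1
    rw [hf, Finset.sum_eq_add_sum_sdiff_singleton_of_mem (Finset.mem_univ (0 : Fin 5))]
    simp only [Fin.val_zero, pow_zero, mul_one, add_sub_cancel_left]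
    exact Valuation.map_sum_lt _ one_ne_zero fun i hi => hsum ▸ hlt i hi
  rw [this]
  exact h.res _ (hc 0)

end Residue

section Place

/-- A prime of a domain is the center of a valuation. -/
lemma exists_valuationSubring {B K : Type*} [CommRing B] [Field K] {g : B →+* K}
    (hg : Function.Injective g) (P : Ideal B) [P.IsPrime] :
    ∃ V : ValuationSubring K, ∀ b, g b ∈ V ∧ (V.valuation (g b) = 1 ↔ b ∉ P) := by
  have hu : ∀ y : P.primeCompl, IsUnit (g y) := fun y => by
    refine isUnit_iff_ne_zero.2 fun h => y.2 ?_
    have : (y : B) = 0 := hg (by grind)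
    aesop
  set f : Localization.AtPrime P →+* K := IsLocalization.lift hu
  have hf : ∀ b, f (algebraMap B _ b) = g b := IsLocalization.lift_eq hu
  obtain ⟨V, h, hl⟩ := IsLocalRing.exists_factor_valuationRing f
  refine ⟨V, fun b => ⟨hf b ▸ h _, ?_⟩⟩
  have h1 := isUnit_map_iff (f.codRestrict V.toSubring h) (algebraMap B _ b)
  rw [IsLocalization.AtPrime.isUnit_to_map_iff _ P] at h1
  have h2 := V.valuation_eq_one_iff (f.codRestrict V.toSubring h (algebraMap B _ b))
  aesop

lemma exists_residueMap {K : Type u} [Field K] [Algebra ℂ K] (V : ValuationSubring K)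
    (hV : ∀ c : ℂ, algebraMap ℂ K c ∈ V) :
    ∃ (Ω : Type u) (_ : Field Ω) (_ : IsAlgClosed Ω) (_ : Algebra ℂ Ω) (φ : V →+* Ω),
      IsLocalHom φ ∧ ∀ c : ℂ, φ ⟨algebraMap ℂ K c, hV c⟩ = algebraMap ℂ Ω c := by
  set φ : V →+* AlgebraicClosure (IsLocalRing.ResidueField V) :=
    (algebraMap _ _).comp (IsLocalRing.residue V)
  refine ⟨_, inferInstance, inferInstance, (φ.comp ((algebraMap ℂ K).codRestrict V.toSubring hV)).toAlgebra,
    φ, ?_, fun c => rfl⟩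
  exact RingHom.isLocalHom_comp _ _

/-- The subfield generated by `s` over `ℂ`. -/
def cadj {K : Type*} [Field K] [Algebra ℂ K] (s : Set K) : Subfield K :=
  Subfield.closure (Set.range (algebraMap ℂ K) ∪ s)

variable {K : Type*} [Field K] [Algebra ℂ K] {ι : Type*} {s : Set K}

lemma algebraMap_mem_cadj (c : ℂ) : algebraMap ℂ K c ∈ cadj s :=
  Subfield.subset_closure (.inl ⟨c, rfl⟩)

lemma subset_cadj (s : Set K) : s ⊆ cadj s := fun _ h => Subfield.subset_closure (.inr h)

lemma cadj_le {F : Subfield K} (hC : ∀ c : ℂ, algebraMap ℂ K c ∈ F) (h : s ⊆ F) : cadj s ≤ F :=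
  Subfield.closure_le.2 (Set.union_subset (by rintro _ ⟨c, rfl⟩; exact hC c) h)

lemma cadj_mono {t : Set K} (h : s ⊆ t) : cadj s ≤ cadj t :=
  cadj_le algebraMap_mem_cadj (h.trans (subset_cadj t))

lemma cadj_le_acl : cadj s ≤ acl s := cadj_le algebraMap_mem_acl (subset_acl s)

lemma aeval_mem_cadj {T : ι → K} (hT : ∀ i, T i ∈ cadj s) (p : MvPolynomial ι ℂ) :
    aeval T p ∈ cadj s := by
  induction p using MvPolynomial.induction_on with
  | C a => rw [algHom_C]; exact algebraMap_mem_cadj a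
  | add p q hp hq => rw [map_add]; aesop
  | mul_X p i hp => rw [map_mul, aeval_X]; aesop

lemma exists_aeval_div {T : ι → K} {f : K} (hf : f ∈ cadj (Set.range T)) :
    ∃ p q : MvPolynomial ι ℂ, aeval T q ≠ 0 ∧ f = aeval T p / aeval T q := by
  have hle : Subring.closure (Set.range (algebraMap ℂ K) ∪ Set.range T) ≤
      (aeval (R := ℂ) T).range.toSubring := by
    refine Subring.closure_le.2 (Set.union_subset ?_ ?_)
    · rintro _ ⟨c, rfl⟩; exact ⟨C c, algHom_C _ _⟩
    · rintro _ ⟨i, rfl⟩; exact ⟨X i, aeval_X _ _⟩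
  obtain ⟨y, hy, z, hz, rfl⟩ := Subfield.mem_closure_iff.1 hf
  obtain ⟨p, rfl⟩ := hle hy
  obtain ⟨q, rfl⟩ := hle hz
  by_cases h0 : aeval T q = 0
  · exact ⟨0, 1, by simp, by simp [h0]⟩
  · exact ⟨p, q, h0, rfl⟩

lemma Free.algebraicIndependent {T : ι → K} (h : Free T) : AlgebraicIndependent ℂ T := by
  refine algebraicIndependent_of_finite_type' (algebraMap ℂ K).injective fun t _ _ i hi halg => ?_
  refine h i (mem_acl_of_isAlgebraic (R := Algebra.adjoin ℂ (T '' t)) Subtype.val_injective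
    (fun r => ?_) halg)
  have : Algebra.adjoin ℂ (T '' t) ≤
      { (acl (T '' {i}ᶜ)).toSubring with algebraMap_mem' := algebraMap_mem_acl } := by
    refine Algebra.adjoin_le ?_
    rintro _ ⟨j, hj, rfl⟩
    exact subset_acl (T '' {i}ᶜ) ⟨j, fun e => hi (e ▸ hj), rfl⟩
  exact this r.2

end Place

/-- An extension to a field, trivial on `s`, of the valuation of `ℂ(T)` attached to a prime. -/
structure GaussPlace {K Ω ι : Type*} [Field K] [Algebra ℂ K] [Field Ω] [Algebra ℂ Ω] (T : ι → K)
    (u : MvPolynomial ι ℂ) (s : K) (V : ValuationSubring K) (φ : V →+* Ω) (k : Subfield Ω) : Prop where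
  algebraMap_mem : ∀ c : ℂ, algebraMap ℂ K c ∈ V
  map_algebraMap : ∀ c : ℂ, φ ⟨algebraMap ℂ K c, algebraMap_mem c⟩ = algebraMap ℂ Ω c
  aeval_mem : ∀ p : MvPolynomial ι ℂ, aeval T p ∈ V
  val_eq : ∀ p : MvPolynomial ι ℂ, V.valuation (aeval T p) = 1 ↔ ¬ u ∣ p
  closed : AlgClosedIn k
  algebraMap_memk : ∀ c : ℂ, algebraMap ℂ Ω c ∈ k
  chart : ResChart V φ (cadj (Set.range T)) k (aeval T u)
  mem : s ∈ V
  notMem : φ ⟨s, mem⟩ ∉ k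

lemma exists_gaussPlace {K : Type u} {ι : Type*} [Finite ι] [Field K] [Algebra ℂ K] {T : ι → K} (hT : Free T) {s : K}
    (hs : s ∉ acl (Set.range T)) {u : MvPolynomial ι ℂ} (hu : Prime u) :
    ∃ (V : ValuationSubring K) (Ω : Type u) (_ : Field Ω) (_ : IsAlgClosed Ω) (_ : Algebra ℂ Ω)
      (φ : V →+* Ω) (k : Subfield Ω), IsLocalHom φ ∧ GaussPlace T u s V φ k := by
  have hai := hT.algebraicIndependent
  have hinj : Function.Injective (aeval (R := ℂ) T) := hai
  set g : Polynomial (MvPolynomial ι ℂ) →+* K :=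
    Polynomial.eval₂RingHom (aeval (R := ℂ) T).toRingHom s with hg
  have hgC : ∀ p, g (Polynomial.C p) = aeval T p := fun p => by simp [hg]
  have hginj : Function.Injective g := by
    rw [injective_iff_map_eq_zero]
    intro p hp
    set e : MvPolynomial ι ℂ →+* acl (Set.range T) := (aeval (R := ℂ) T).toRingHom.codRestrict _
      fun p => cadj_le_acl (aeval_mem_cadj (fun i => subset_cadj _ (Set.mem_range_self i)) p)
    have : p.map e = 0 := (algClosedIn_acl _).eq_zero_of_aeval hs (by
      rw [Polynomial.aeval_def, Polynomial.eval₂_map]; exact hp)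
    refine (Polynomial.map_eq_zero_iff fun a b hab => hinj ?_).1 this
    exact congrArg Subtype.val hab
  have hCu := Polynomial.prime_C_iff.2 hu
  have hprime : (Ideal.span {Polynomial.C u}).IsPrime :=
    (Ideal.span_singleton_prime hCu.ne_zero).2 hCu
  obtain ⟨V, hV⟩ := exists_valuationSubring hginj (Ideal.span {Polynomial.C u})
  have hCV : ∀ c : ℂ, algebraMap ℂ K c ∈ V := fun c => by
    have := (hV (Polynomial.C (C c))).1
    aesop
  have haev : ∀ p, aeval T p ∈ V := fun p => hgC p ▸ (hV (Polynomial.C p)).1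
  have hval : ∀ p, V.valuation (aeval T p) = 1 ↔ ¬ u ∣ p := fun p => by
    rw [← hgC, (hV _).2, Ideal.mem_span_singleton, Polynomial.C_dvd_iff_dvd_coeff]
    refine not_congr ⟨fun h => by simpa using h 0, fun h n => ?_⟩
    rw [Polynomial.coeff_C]; split_ifs
    · exact h
    aesop
  have hsV : s ∈ V := by simpa [hg] using (hV Polynomial.X).1
  obtain ⟨Ω, _, _, _, φ, hφ, hφC⟩ := exists_residueMap V hCV
  have hTV : ∀ i, T i ∈ V := fun i => by simpa using haev (X i)
  set T' : ι → Ω := fun i => φ ⟨T i, hTV i⟩ with hT'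
  have hφp : ∀ p, φ ⟨aeval T p, haev p⟩ = aeval T' p := fun p => by
    have : φ.comp ((aeval (R := ℂ) T).toRingHom.codRestrict V.toSubring haev) =
        (aeval (R := ℂ) T').toRingHom := by
      refine MvPolynomial.ringHom_ext (fun c => ?_) fun i => ?_
      · have : (aeval (R := ℂ) T').toRingHom (C c) = algebraMap ℂ Ω c := algHom_C _ _
        rw [this, ← hφC]
        exact congrArg φ (Subtype.ext (algHom_C _ _))
      · have : (aeval (R := ℂ) T').toRingHom (X i) = T' i := aeval_X _ _
        rw [this]
        exact congrArg φ (Subtype.ext (aeval_X _ _))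
    exact RingHom.congr_fun this p
  have hTk : ∀ p, aeval T' p ∈ acl (Set.range T') := fun p =>
    cadj_le_acl (aeval_mem_cadj (fun i => subset_cadj _ (Set.mem_range_self i)) p)
  have hπ0 : aeval T u ≠ 0 := (map_ne_zero_iff _ hinj).2 hu.ne_zero
  have hmult : ∀ p : MvPolynomial ι ℂ, p ≠ 0 → ∃ (n : ℕ) (q : MvPolynomial ι ℂ), ¬ u ∣ q ∧ p = u ^ n * q := fun p hp =>
    (WfDvdMonoid.max_power_factor hp hu.irreducible)
  have hrep : ∀ f ∈ cadj (Set.range T), f ≠ 0 → ∃ n : ℤ, ∃ w : V, (w : K) ∈ cadj (Set.range T) ∧ φ w ≠ 0 ∧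
      φ w ∈ acl (Set.range T') ∧ f = w * aeval T u ^ n := by
    intro f hf hf0
    obtain ⟨p, q, hq, rfl⟩ := exists_aeval_div hf
    have hp0 : p ≠ 0 := by grind
    have hq0 : q ≠ 0 := by grind
    obtain ⟨n, p, hp, rfl⟩ := hmult p hp0
    obtain ⟨m, q, hqu, rfl⟩ := hmult q hq0
    have hpv := (hval p).2 hp
    have hqv := (hval q).2 hqu
    have hw : aeval T p / aeval T q ∈ V := mem_of_val_eq_one (by rw [map_div₀, hpv, hqv, div_one])
    have hφw : φ ⟨_, hw⟩ = aeval T' p / aeval T' q := by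
      have hq' : aeval T' q ≠ 0 := by rw [← hφp, map_ne_zero_iff_val]; exact hqv
      rw [eq_div_iff hq', ← hφp, ← hφp, ← map_mul]
      aesop
    refine ⟨n - m, ⟨_, hw⟩, ?_, ?_, ?_, ?_⟩
    · exact div_mem (aeval_mem_cadj (fun i => subset_cadj _ (Set.mem_range_self i)) _)
        (aeval_mem_cadj (fun i => subset_cadj _ (Set.mem_range_self i)) _)
    · rw [map_ne_zero_iff_val]
      change V.valuation (_ / _) = 1
      rw [map_div₀, hpv, hqv, div_one]
    · rw [hφw]; exact div_mem (hTk _) (hTk _)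
    · rw [zpow_sub₀ hπ0]
      simp only [map_mul, map_pow, zpow_natCast]
      field_simp
  have hunif : Unif (cadj (Set.range T)) V (aeval T u) := by
    refine ⟨aeval_mem_cadj (fun i => subset_cadj _ (Set.mem_range_self i)) _, ?_, hπ0, fun f hf h0 => ?_⟩
    · exact lt_of_le_of_ne ((V.valuation_le_one_iff _).2 (haev u)) fun h => (hval u).1 h dvd_rfl
    · obtain ⟨n, w, hw, hw0, -, e⟩ := hrep f hf h0
      exact ⟨n, w, hw, map_ne_zero_iff_val.1 hw0, e⟩
  refine ⟨V, Ω, ‹_›, ‹_›, ‹_›, φ, acl (Set.range T'), hφ, hCV, hφC, haev, hval, algClosedIn_acl _,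
    algebraMap_mem_acl, .of_rep hunif le_rfl hrep, hsV, fun hmem => ?_⟩
  set R := (aeval (R := ℂ) T').toRingHom.range with hR
  have halg : IsAlgebraic R (φ ⟨s, hsV⟩) := by
    refine isAlgebraic_of_mem_acl (s := Set.range T') Subtype.val_injective (fun c => ?_) ?_ hmem
    · exact ⟨⟨_, C c, rfl⟩, algHom_C (aeval (R := ℂ) T') c⟩
    · rintro _ ⟨i, rfl⟩
      exact ⟨⟨_, X i, rfl⟩, aeval_X T' i⟩
  obtain ⟨Q, hQ0, hQ⟩ := halg
  obtain ⟨Q, rfl⟩ := Polynomial.map_surjective (aeval (R := ℂ) T').toRingHom.rangeRestrict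
    (RingHom.rangeRestrict_surjective _) Q
  have hφQ : φ ⟨g Q, (hV Q).1⟩ = 0 := by
    rw [← hQ, Polynomial.aeval_def, Polynomial.eval₂_map]
    have : φ.comp (g.codRestrict V.toSubring fun b => (hV b).1) =
        Polynomial.eval₂RingHom ((algebraMap R Ω).comp (aeval (R := ℂ) T').toRingHom.rangeRestrict)
          (φ ⟨s, hsV⟩) := by
      refine Polynomial.ringHom_ext (fun p => ?_) ?_
      · exact ((congrArg φ (Subtype.ext (hgC p))).trans (hφp p)).trans (Polynomial.eval₂_C _ _).symm
      · exact (congrArg φ (Subtype.ext (Polynomial.eval₂_X _ _))).trans (Polynomial.eval₂_X _ _).symm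
    exact RingHom.congr_fun this Q
  rw [map_eq_zero_iff_val] at hφQ
  refine hφQ.ne ((hV Q).2.2 fun hmemQ => hQ0 ?_)
  rw [Ideal.mem_span_singleton, Polynomial.C_dvd_iff_dvd_coeff] at hmemQ
  ext n
  rw [Polynomial.coeff_map, Polynomial.coeff_zero]
  refine (hφp _).symm.trans (map_eq_zero_iff_val.2 ?_)
  exact lt_of_le_of_ne ((V.valuation_le_one_iff _).2 (haev _)) fun h => (hval _).1 h (hmemQ n)

lemma closure_insert_closure {K : Type*} [Field K] (s t : Set K) :
    Subfield.closure (s ∪ (Subfield.closure t : Set K)) = Subfield.closure (s ∪ t) := by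
  refine le_antisymm (Subfield.closure_le.2 (Set.union_subset ?_ ?_))
    (Subfield.closure_mono (Set.union_subset_union_right _ Subfield.subset_closure))
  · exact Set.subset_union_left.trans Subfield.subset_closure
  · exact Subfield.closure_mono Set.subset_union_right

lemma closure_insert_insert {K : Type*} [Field K] (a b : K) (s : Set K) :
    Subfield.closure (insert a (Subfield.closure (insert b s) : Set K)) =
      Subfield.closure (insert a (insert b s)) := by
  simpa only [Set.singleton_union] using closure_insert_closure {a} (insert b s)

section Curve

variable {K Ω : Type*} [Field K] [Field Ω] {V : ValuationSubring K}
  {φ : V →+* Ω} [IsLocalHom φ] {E : Subfield K} {k N : Subfield Ω} {π : K} {X : ZMod 5 → K}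

omit [IsLocalHom φ] in
lemma IsLyness.map_residue {l : K} (h : IsLyness l X) (hX : ∀ i, X i ∈ V) (h0 : ∀ i, φ ⟨X i, hX i⟩ ≠ 0)
    (hl : l ∈ V) : IsLyness (φ ⟨l, hl⟩) fun i => φ ⟨X i, hX i⟩ := by
  refine ⟨h0, fun i => ?_, ?_⟩
  · simp only [← map_mul, ← map_one φ, ← map_add]
    exact congrArg φ (Subtype.ext (h.rel i))
  · simp only [← map_mul]
    exact congrArg φ (Subtype.ext h.prod)

/-- A Lyness cycle in a valuation ring which is not constant modulo the maximal ideal. -/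
lemma IsLyness.val_eq_one_of_notMem (h : IsLyness 1 X) (h0 : X 0 ∈ V) (h0k : φ ⟨X 0, h0⟩ ∉ k) (i : ZMod 5) :
    V.valuation (X i) = 1 := by
  have hv0 : V.valuation (X 0) = 1 := by
    have : φ ⟨X 0, h0⟩ ≠ 0 := fun e => h0k (e ▸ zero_mem _)
    exact map_ne_zero_iff_val.1 this
  rcases h.pattern V.valuation (map_one _) with hv | ⟨j, g, hg, hj, -, -, hj2, hj3⟩
  · exact hv i
  exfalso
  have hg0 : (0 : V.ValueGroup) < g := zero_lt_one.trans hg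
  have key : V.valuation (1 + X 0) = 1 := by
    by_contra hne
    apply h0k
    have h1 : V.valuation (1 + X 0) < 1 :=
      lt_of_le_of_ne ((V.valuation_le_one_iff _).2 (add_mem (one_mem _) h0)) hne
    have : φ (1 + ⟨X 0, h0⟩) = 0 := map_eq_zero_iff_val.2 h1
    rw [map_add, map_one] at this
    rw [← neg_eq_of_add_eq_zero_right this]
    exact neg_mem (one_mem _)
  have hX0 := congrArg V.valuation (h.rel 0)
  rw [map_mul, key] at hX0
  have e2 : V.valuation (X j) = (g ^ 2)⁻¹ := eq_inv_of_mul_eq_one_left hj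
  have hlt : V.valuation (X j) < 1 := by
    rw [e2]; exact inv_lt_one_of_one_lt₀ (one_lt_pow₀ hg two_ne_zero)
  have : j = 0 ∨ j + 2 = 0 ∨ j - 2 = 0 ∨ (j = 0 + 1 ∧ j - 2 = 0 - 1) ∨ (j = 0 - 1 ∧ j + 2 = 0 + 1) := by
    clear * -; revert j; decide
  rcases this with rfl | e | e | ⟨e, e'⟩ | ⟨e, e'⟩
  · exact hlt.ne hv0
  · rw [e, hv0] at hj2; exact hg.ne hj2
  · rw [e, hv0] at hj3; exact hg.ne hj3
  · rw [← e, ← e', e2, hj3, sq, mul_inv, inv_mul_cancel_right₀ hg0.ne'] at hX0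
    exact (inv_lt_one_of_one_lt₀ hg).ne hX0
  · rw [← e, ← e', e2, hj2, sq, mul_inv, ← mul_assoc, mul_inv_cancel₀ hg0.ne', one_mul] at hX0
    exact (inv_lt_one_of_one_lt₀ hg).ne hX0

variable [Algebra ℂ Ω] [IsAlgClosed Ω]

omit [IsAlgClosed Ω] in
lemma ResChart.curve (R : ResChart V φ E k π) (hk : AlgClosedIn k)
    (hC : ∀ c : ℂ, algebraMap ℂ Ω c ∈ k) (h : IsLyness 1 X) (h0 : X 0 ∈ V) (h0k : φ ⟨X 0, h0⟩ ∉ k) :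
    ∃ (hX : ∀ i, X i ∈ V) (x : ZMod 5 → Ω), (∀ i, φ ⟨X i, hX i⟩ = x i) ∧
      IsCurve k 1 x (Subfield.closure ((k : Set Ω) ∪ Set.range x)) ∧
      ResChart V φ (Subfield.closure ((E : Set K) ∪ Set.range X))
        (Subfield.closure ((k : Set Ω) ∪ Set.range x)) π := by
  have hch : CharZero Ω := charZero_of_injective_algebraMap (algebraMap ℂ Ω).injective
  have hv := fun i => h.val_eq_one_of_notMem h0 h0k i
  have hX : ∀ i, X i ∈ V := fun i => mem_of_val_eq_one (hv i)
  obtain ⟨x, hx⟩ : ∃ x, x = fun i => φ ⟨X i, hX i⟩ := ⟨_, rfl⟩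
  have hl : IsLyness 1 x := by
    have := h.map_residue (φ := φ) hX (fun i => map_ne_zero_iff_val.2 (hv i)) (one_mem _)
    have h1 : φ ⟨1, one_mem V⟩ = 1 := map_one φ
    rwa [h1, ← hx] at this
  have hx0 : φ ⟨X 0, h0⟩ = x 0 := by rw [hx]
  have hx1 : φ ⟨X 1, hX 1⟩ = x 1 := by rw [hx]
  have h0x := h0k
  rw [hx0] at h0x
  refine ⟨hX, x, fun i => by rw [hx], ⟨hl, by norm_num, one_mem _, hk, hC, h0x, rfl⟩, ?_⟩
  have R1 := R.of_transcendental hk h0k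
  have hb : LinearIndependent (Subfield.closure (insert (φ ⟨X 0, h0⟩) (k : Set Ω)))
      fun j : Fin 2 => φ ⟨X 1, hX 1⟩ ^ (j : ℕ) := by
    rw [hx0, hx1]
    exact hl.linearIndependent hk h0x
  have R2 := R1.of_powers (y := ⟨X 1, hX 1⟩) hb
    fun f hf => h.exists_sum (Subfield.subset_closure (.inl rfl)) hf
  rw [closure_range_eq h, closure_range_eq hl, ← closure_insert_insert, ← closure_insert_insert,
    ← hx0, ← hx1]
  exact R2

lemma val_hfun_eq_one (hv : ∀ i, V.valuation (X i) = 1) : V.valuation (hfun X) = 1 := by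
  simp [hfun, hv]

omit [IsLocalHom φ] [Algebra ℂ Ω] [IsAlgClosed Ω] in
lemma map_hfun (hX : ∀ i, X i ∈ V) {x : ZMod 5 → Ω} (hx : ∀ i, φ ⟨X i, hX i⟩ = x i)
    (h0 : ∀ i, x i ≠ 0) (hh : hfun X ∈ V) : φ ⟨hfun X, hh⟩ = hfun x := by
  have hX0 : ∀ i, X i ≠ 0 := fun i h => h0 i (by
    rw [← hx]; exact (congrArg φ (Subtype.ext h)).trans (map_zero φ))
  rw [show hfun x = x 1 ^ 3 * x 4 / (x 0 ^ 3 * x 2) from rfl, eq_div_iff (mul_ne_zero (pow_ne_zero _ (h0 0)) (h0 2))]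
  simp only [← hx, ← map_mul, ← map_pow]
  refine congrArg φ (Subtype.ext ?_)
  simp only [MulMemClass.coe_mul, SubmonoidClass.coe_pow, hfun]
  rw [div_mul_cancel₀]
  exact mul_ne_zero (pow_ne_zero _ (hX0 0)) (hX0 2)

lemma hfun_mem {F : Subfield K} (hX : ∀ i, X i ∈ F) : hfun X ∈ F :=
  div_mem (mul_mem (pow_mem (hX _) _) (hX _)) (mul_mem (pow_mem (hX _) _) (hX _))

variable {ρ c : K}

lemma ResChart.of_root (R : ResChart V φ E N π) (hN : ∀ i, X i ∈ E) (hX : ∀ i, X i ∈ V)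
    {x : ZMod 5 → Ω} (hx : ∀ i, φ ⟨X i, hX i⟩ = x i) (h : IsCurve k 1 x N)
    (hc : c ∈ E) (hcv : V.valuation c = 1)
    (hck : φ ⟨c, mem_of_val_eq_one hcv⟩ ∈ k) (hρ : ρ ^ 5 = c * hfun X) :
    ∃ hρV : ρ ∈ V, V.valuation ρ = 1 ∧ ResChart V φ (Subfield.closure (insert ρ (E : Set K)))
      (Subfield.closure (insert (φ ⟨ρ, hρV⟩) (N : Set Ω))) π := by
  have hv : ∀ i, V.valuation (X i) = 1 := fun i => by
    have := h.lyness.ne i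
    rw [← hx] at this
    exact map_ne_zero_iff_val.1 this
  have hρv : V.valuation ρ = 1 := by
    have := congrArg V.valuation hρ
    rw [map_mul, map_pow, hcv, val_hfun_eq_one hv, one_mul] at this
    exact (pow_eq_one_iff_of_nonneg zero_le (by norm_num)).1 this
  have hρV : ρ ∈ V := mem_of_val_eq_one hρv
  refine ⟨hρV, hρv, R.of_powers (y := ⟨ρ, hρV⟩) (d := 5) (h.linearIndependent hck ?_ ?_) fun f hf =>
    exists_sum_of_pow_five ?_ hf⟩
  · exact map_ne_zero_iff_val.2 hcv
  · have hh : hfun X ∈ V := mem_of_val_eq_one (val_hfun_eq_one hv)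
    rw [← map_hfun hX hx h.lyness.ne hh, ← map_pow, ← map_mul]
    exact congrArg φ (Subtype.ext hρ)
  · rw [hρ]; exact mul_mem hc (hfun_mem hN)

omit [Algebra ℂ Ω] [IsAlgClosed Ω] in
lemma ResChart.of_root_ramified (R : ResChart V φ E N π) (hN : ∀ i, X i ∈ E)
    (hv : V.valuation (hfun X) = 1) (hc : c ∈ E) {a : ℤ} (ha : ¬ 5 ∣ a)
    (hcv : V.valuation c = V.valuation π ^ a) (hρ : ρ ^ 5 = c * hfun X) {f : V}
    (hf : (f : K) ∈ Subfield.closure (insert ρ (E : Set K))) : φ f ∈ N := by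
  obtain ⟨d, hd, e⟩ := exists_sum_of_pow_five (by rw [hρ]; exact mul_mem hc (hfun_mem hN)) hf
  refine R.of_ramified ha ?_ hd e
  rw [← map_pow, hρ, map_mul, hv, hcv, mul_one]

end Curve

/-- Partial derivatives with respect to the algebraically independent elements `T`. -/
structure Partials {K ι : Type*} [Field K] [Algebra ℂ K] (T : ι → K)
    (D : Option ι → Derivation ℤ K K) : Prop where
  zero : D none = 0
  apply_aeval : ∀ i (p : MvPolynomial ι ℂ), D (some i) (aeval T p) = aeval T (pderiv i p)

section

variable {K : Type u} {ι : Type*} [Field K] [Algebra ℂ K] {T : ι → K}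

lemma Free.notMem_range {a : K} (hf : Free fun i : Option ι => i.elim a T) :
    a ∉ acl (Set.range T) := by
  have := hf none
  have e : (fun i : Option ι => i.elim a T) '' {none}ᶜ = Set.range T := by
    ext y; constructor
    · rintro ⟨_ | i, hi, rfl⟩
      exacts [absurd rfl hi, ⟨i, rfl⟩]
    · rintro ⟨i, rfl⟩
      exact ⟨some i, by simp, rfl⟩
  grind

lemma Free.exists_partials (hT : Free T) : ∃ D : Option ι → Derivation ℤ K K, Partials T D := by
  classical
  choose d hd hd1 using fun i => exists_derivation_acl (hT i) 1
  refine ⟨fun i => i.elim 0 d, rfl, fun i p => ?_⟩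
  change d i (aeval T p) = _
  induction p using MvPolynomial.induction_on with
  | C c => rw [algHom_C, hd _ _ (algebraMap_mem_acl c), pderiv_C, map_zero]
  | add p q hp hq => grind
  | mul_X p j hp =>
    rw [map_mul, Derivation.leibniz, hp, Derivation.leibniz, map_add, smul_eq_mul, smul_eq_mul,
      smul_eq_mul, smul_eq_mul, map_mul, map_mul, aeval_X, pderiv_X]
    congr 2
    by_cases h : j = i
    · grind
    · rw [hd i _ (subset_acl _ ⟨j, h, rfl⟩), Pi.single_eq_of_ne h, map_zero]

lemma Partials.apply_self [DecidableEq ι] {D : Option ι → Derivation ℤ K K} (hD : Partials T D) (i j : ι) :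
    D (some i) (T j) = if i = j then 1 else 0 := by
  have := hD.apply_aeval i (X j)
  rw [aeval_X, pderiv_X] at this
  grind

lemma exists_not_dvd_pderiv {u : MvPolynomial ι ℂ} (hu : Prime u) : ∃ i, ¬ u ∣ pderiv i u := by
  classical
  by_contra! hn
  have hz : ∀ i, pderiv i u = 0 := fun i => by
    by_contra hne
    obtain ⟨w, hw⟩ := hn i
    have h1 : degreeOf i (pderiv i u) = degreeOf i u + degreeOf i w := by
      conv_lhs => rw [hw]
      exact degreeOf_mul_eq hu.ne_zero fun h => hne (by grind)
    obtain ⟨m, hm, hmd⟩ : ∃ m ∈ (pderiv i u).support, m i = degreeOf i (pderiv i u) := by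
      rw [degreeOf_eq_sup]
      obtain ⟨m, hm, e⟩ := Finset.exists_mem_eq_sup (pderiv i u).support
        (MvPolynomial.support_nonempty.2 hne) fun m => m i
      grind
    rw [mem_support_iff, coeff_pderiv] at hm
    have hm' := le_degreeOf_of_mem_support i (mem_support_iff.2 (left_ne_zero_of_mul hm))
    aesop
  have hc : u = C (coeff 0 u) := by
    ext m
    rw [coeff_C]
    split_ifs with h
    · rw [h]
    · obtain ⟨i, hi⟩ : ∃ i, m i ≠ 0 := by
        grind
      have := congrArg (coeff (m - Finsupp.single i 1)) (hz i)
      rw [coeff_pderiv, coeff_zero, tsub_add_cancel_of_le (Finsupp.single_le_iff.2 (by omega))] at this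
      exact (mul_eq_zero.1 this).resolve_right (by norm_cast)
  refine hu.not_isUnit ?_
  rw [hc]
  refine (IsUnit.mk0 _ fun h => hu.ne_zero ?_).map C
  grind

lemma exists_reduced (f : K) (hf : f ∈ cadj (Set.range T)) :
    ∃ p q : MvPolynomial ι ℂ, aeval T q ≠ 0 ∧ f = aeval T p / aeval T q ∧ IsRelPrime p q := by
  obtain ⟨p, q, hq, rfl⟩ := exists_aeval_div hf
  obtain ⟨q', p', c, hr, rfl, rfl⟩ := UniqueFactorizationMonoid.exists_reduced_factors q
    (fun h => hq (by grind)) p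
  rw [map_mul] at hq
  refine ⟨p', q', right_ne_zero_of_mul hq, ?_, hr.symm⟩
  grind

section Gauss

variable {Ω : Type*} [Field Ω] [Algebra ℂ Ω] {u : MvPolynomial ι ℂ} {s : K} {V : ValuationSubring K}
  {φ : V →+* Ω} {k : Subfield Ω}

lemma GaussPlace.val_lt (G : GaussPlace T u s V φ k) {p : MvPolynomial ι ℂ} (h : u ∣ p) :
    V.valuation (aeval T p) < 1 :=
  lt_of_le_of_ne ((V.valuation_le_one_iff _).2 (G.aeval_mem p)) fun e => (G.val_eq p).1 e h

lemma GaussPlace.notMem_of_dvd (G : GaussPlace T u s V φ k) {p q : MvPolynomial ι ℂ}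
    (hq : aeval T q ≠ 0) (hu : u ∣ q) (hp : ¬ u ∣ p) : aeval T p / aeval T q ∉ V := by
  rw [← val_one_lt_iff, map_div₀, (G.val_eq p).2 hp, one_div]
  exact (one_lt_inv₀ (zero_lt_iff.2 ((map_ne_zero V.valuation).2 hq))).2 (G.val_lt hu)

lemma GaussPlace.val_algebraMap (G : GaussPlace T u s V φ k) (hu : Prime u) {c : ℂ} (hc : c ≠ 0) :
    V.valuation (algebraMap ℂ K c) = 1 := by
  rw [← algHom_C (aeval T) c, G.val_eq]
  exact fun h => hu.not_isUnit (isUnit_of_dvd_unit h ((IsUnit.mk0 c hc).map C))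

lemma GaussPlace.val_five (G : GaussPlace T u s V φ k) (hu : Prime u) : V.valuation (5 : K) = 1 := by
  rw [← map_ofNat (algebraMap ℂ K) 5]
  exact G.val_algebraMap hu (by norm_num)

lemma Partials.mem {D : Option ι → Derivation ℤ K K} (hD : Partials T D) (i : Option ι) {f : K}
    (hf : f ∈ cadj (Set.range T)) : D i f ∈ cadj (Set.range T) := by
  obtain ⟨p, q, hq, rfl⟩ := exists_aeval_div hf
  have hm := aeval_mem_cadj (K := K) (s := Set.range T) (fun i => subset_cadj _ (Set.mem_range_self i))
  cases i with
  | none => rw [hD.zero]; aesop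
  | some i =>
    rw [Derivation.leibniz_div, hD.apply_aeval, hD.apply_aeval]
    simp only [smul_eq_mul]
    exact mul_mem (pow_mem (inv_mem (hm _)) _) (sub_mem (mul_mem (hm _) (hm _)) (mul_mem (hm _) (hm _)))

lemma GaussPlace.partials_mem (G : GaussPlace T u s V φ k) (hu : Prime u)
    {D : Option ι → Derivation ℤ K K} (hD : Partials T D) (i : Option ι) {f : K}
    (hf : f ∈ cadj (Set.range T)) (hfV : f ∈ V) : D i f ∈ V := by
  obtain ⟨p, q, hq, rfl, hr⟩ := exists_reduced f hf
  cases i with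
  | none => rw [hD.zero]; aesop
  | some i =>
    have hv : V.valuation (aeval T q) = 1 := by
      rw [G.val_eq]
      intro h
      by_cases hp : u ∣ p
      · exact hu.not_isUnit (hr hp h)
      · exact G.notMem_of_dvd hq h hp hfV
    have hi := inv_mem_of_val_eq_one hv
    rw [Derivation.leibniz_div, hD.apply_aeval, hD.apply_aeval]
    simp only [smul_eq_mul, inv_pow]
    have hm := G.aeval_mem
    rw [← inv_pow]
    exact mul_mem (pow_mem hi _) (sub_mem (mul_mem (hm _) (hm _)) (mul_mem (hm _) (hm _)))

end Gauss

lemma exists_aeval_of_forall [Finite ι] (hT : Free T) {s : K} (hs : s ∉ acl (Set.range T)) {f : K}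
    (hf : f ∈ cadj (Set.range T)) (h : ∀ (u : MvPolynomial ι ℂ), Prime u →
      ∀ (V : ValuationSubring K) (Ω : Type u) [Field Ω] [IsAlgClosed Ω] [Algebra ℂ Ω] (φ : V →+* Ω)
        (k : Subfield Ω) [IsLocalHom φ], GaussPlace T u s V φ k → f ∈ V) :
    ∃ p : MvPolynomial ι ℂ, f = aeval T p := by
  obtain ⟨p, q, hq, rfl, hr⟩ := exists_reduced f hf
  have hq0 : q ≠ 0 := fun h => hq (by grind)
  by_cases hqu : IsUnit q
  · obtain ⟨q, rfl⟩ := hqu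
    refine ⟨p * ↑(q⁻¹), ?_⟩
    rw [div_eq_iff hq, ← map_mul, mul_assoc, Units.inv_mul, mul_one]
  · exfalso
    obtain ⟨u, hu, huq⟩ := WfDvdMonoid.exists_irreducible_factor hqu hq0
    have hup : ¬ u ∣ p := fun hp => hu.not_isUnit (hr hp huq)
    obtain ⟨V, Ω, _, _, _, φ, k, hφ, G⟩ := exists_gaussPlace hT hs hu.prime
    exact G.notMem_of_dvd hq huq hup (h u hu.prime V Ω φ k G)

variable [Fintype ι] [DecidableEq ι]

/-- The matrix of partial derivatives of `T'`, bordered by a trivial row and column. -/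
def partialMatrix (D : Option ι → Derivation ℤ K K) (T' : ι → K) : Matrix (Option ι) (Option ι) K :=
  Matrix.of fun i j => j.elim (if i = none then 1 else 0) fun j => D i (T' j)

/-- The function field of the variety attached to a tuple. -/
def tupleField (T : ι → K) (X : ZMod 5 → K) (ρ : K) : Subfield K :=
  Subfield.closure (insert ρ (Subfield.closure ((cadj (Set.range T) : Set K) ∪ Set.range X) : Set K))

omit [DecidableEq ι] in
lemma prod_mem_cadj (T : ι → K) (a : ℤ) : (∏ i, (T i ^ 5 - 1)) ^ a ∈ cadj (Set.range T) :=
  zpow_mem (prod_mem fun i _ =>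
    sub_mem (pow_mem (subset_cadj _ (Set.mem_range_self i)) _) (one_mem _)) _

theorem IsTuple.exists_aeval {a a' : ℤ} {T T' : ι → K} {X X' : ZMod 5 → K} {ρ ρ' : K}
    (h : IsTuple a T X ρ) (hf : Free fun i : Option ι => i.elim (X 0) T)
    (h' : IsTuple a' T' X' ρ') (ha' : IsCoprime a' 5) (hT' : ∀ i, T' i ∈ cadj (Set.range T))
    (hX' : ∀ i, X' i ∈ tupleField T X ρ) (hρ' : ρ' ∈ tupleField T X ρ)
    {D : Option ι → Derivation ℤ K K} (hD : Partials T D) :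
    ∃ p : MvPolynomial ι ℂ, (partialMatrix D T').det ^ 5 / (∏ i, (T' i ^ 5 - 1)) ^ 4 * (∏ i, (T i ^ 5 - 1)) ^ 4 =
      aeval T p := by
  have hfT : Free T := hf.comp (f := some) (Option.some_injective _)
  have hX0 := hf.notMem_range
  set P : MvPolynomial ι ℂ := ∏ i, (MvPolynomial.X i ^ 5 - 1) with hP
  have hPT : ∏ i, (T i ^ 5 - 1) = aeval T P := by simp [hP]
  have hmem : ∀ i, T i ∈ cadj (Set.range T) := fun i => subset_cadj _ (Set.mem_range_self i)
  refine exists_aeval_of_forall hfT hX0 ?_ ?_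
  · refine mul_mem (div_mem (pow_mem (det_mem ?_) _) ?_) ?_
    · rintro i (_ | j)
      · change (if i = none then (1 : K) else 0) ∈ _
        split_ifs
        exacts [one_mem _, zero_mem _]
      · exact hD.mem i (hT' j)
    · exact pow_mem (prod_mem fun i _ => sub_mem (pow_mem (hT' i) _) (one_mem _)) _
    · exact pow_mem (prod_mem fun i _ => sub_mem (pow_mem (hmem i) _) (one_mem _)) _
  intro u hu V Ω _ _ _ φ k _ G
  obtain ⟨i₀, hi₀⟩ := exists_not_dvd_pderiv hu
  refine (G.chart.unif.theta_mem (G.val_five hu) D (fun i f hf hfV => G.partials_mem hu hD i hf hfV)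
    (i₀ := some i₀) ?_ hT' h'.pow_ne (g := fun i => if i = none then 1 else 0) ?_ ?_ ?_).1
  · rw [hD.apply_aeval, G.val_eq]; exact hi₀
  · intro i; split_ifs
    exacts [one_mem _, zero_mem _]
  · rw [hPT]; exact pow_mem (G.aeval_mem _) _
  rw [hPT]
  by_cases huP : u ∣ P
  · right
    obtain ⟨w, hw⟩ := huP
    rw [← div_pow, hw, map_mul, mul_div_cancel_left₀ _ G.chart.unif.ne]
    exact pow_mem (G.aeval_mem _) _
  · left
    have hPa : aeval T P ^ a ∈ cadj (Set.range T) := hPT ▸ prod_mem_cadj T a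
    have hc : V.valuation (aeval T P ^ a) = 1 := by rw [map_zpow₀, (G.val_eq P).2 huP, one_zpow]
    obtain ⟨hX, x, hx, hcur, R⟩ := G.chart.curve G.closed G.algebraMap_memk h.lyness G.mem G.notMem
    obtain ⟨hρV, -, R'⟩ := R.of_root (c := aeval T P ^ a) (ρ := ρ)
      (fun i => Subfield.subset_closure (.inr ⟨i, rfl⟩)) hX hx hcur
      (Subfield.subset_closure (.inl hPa)) hc
      (G.chart.res _ hPa) (by rw [← hPT]; exact h.root)
    refine h'.val_prod ha' R'.unif (fun i => ?_) hX' hρ'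
    exact Subfield.subset_closure (.inr (Subfield.subset_closure (.inl (hT' i))))

end

section Degenerate

variable {K Ω : Type*} [Field K] [Field Ω] {V : ValuationSubring K} {φ : V →+* Ω} {k : Subfield Ω}

/-- The nonzero residue of `z` lies in `k`. -/
def ResidueIn (φ : V →+* Ω) (k : Subfield Ω) (z : K) : Prop := ∃ h : z ∈ V, φ ⟨z, h⟩ ≠ 0 ∧ φ ⟨z, h⟩ ∈ k

namespace ResidueIn

lemma mul {y z : K} : ResidueIn φ k y → ResidueIn φ k z → ResidueIn φ k (y * z) := by
  rintro ⟨h, h0, hk⟩ ⟨h', h0', hk'⟩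
  have e : φ ⟨y * z, mul_mem h h'⟩ = φ ⟨y, h⟩ * φ ⟨z, h'⟩ := by rw [← map_mul]; rfl
  exact ⟨mul_mem h h', e ▸ mul_ne_zero h0 h0', e ▸ mul_mem hk hk'⟩

lemma pow {z : K} (h : ResidueIn φ k z) (n : ℕ) : ResidueIn φ k (z ^ n) := by
  obtain ⟨h, h0, hk⟩ := h
  have e : φ ⟨z ^ n, pow_mem h n⟩ = φ ⟨z, h⟩ ^ n := by rw [← map_pow]; rfl
  exact ⟨pow_mem h n, e ▸ pow_ne_zero n h0, e ▸ pow_mem hk n⟩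

variable [IsLocalHom φ]

lemma of_val_add_one {z : K} (h : V.valuation (1 + z) < 1) : ResidueIn φ k z := by
  have hV : 1 + z ∈ V := (V.valuation_le_one_iff _).1 h.le
  have hz : z ∈ V := by simpa using sub_mem hV (one_mem V)
  have e : φ ⟨z, hz⟩ = -1 := by
    have : φ (1 + ⟨z, hz⟩) = 0 := map_eq_zero_iff_val.2 h
    grind
  exact ⟨hz, by aesop⟩

lemma inv {z : K} (h : ResidueIn φ k z) : ResidueIn φ k z⁻¹ := by
  obtain ⟨h, h0, hk⟩ := h
  have hv := map_ne_zero_iff_val.1 h0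
  have hz := inv_mem_of_val_eq_one hv
  have hz0 : z ≠ 0 := by rintro rfl; simp at hv
  have e : φ ⟨z⁻¹, hz⟩ = (φ ⟨z, h⟩)⁻¹ := by
    refine eq_inv_of_mul_eq_one_left ?_
    rw [← map_mul, ← map_one φ]
    exact congrArg φ (Subtype.ext (inv_mul_cancel₀ hz0))
  exact ⟨hz, e ▸ inv_ne_zero h0, e ▸ inv_mem hk⟩

end ResidueIn

/-- At a cusp, `hfun X` is a fifth power up to a unit with constant residue. -/
lemma Cusp.exists_residueIn [IsLocalHom φ] {X : ZMod 5 → K} (h : IsLyness 1 X) {j : ZMod 5} {g : V.ValueGroup}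
    (hc : Cusp X V.valuation j g) {F : Subfield K} (hF : ∀ i, X i ∈ F) :
    ∃ f ∈ F, f ≠ 0 ∧ ResidueIn φ k (hfun X / f ^ 5) := by
  obtain ⟨hg, hj, h1, h4, h2, h3⟩ := hc
  have hg0 : (0 : V.ValueGroup) < g := zero_lt_one.trans hg
  have hj' : V.valuation (X j) * g < 1 := by
    have : V.valuation (X j) * g = g⁻¹ := by
      refine eq_inv_of_mul_eq_one_left ?_
      rw [mul_assoc, ← sq, hj]
    rw [this]; exact inv_lt_one_of_one_lt₀ hg
  have ha : ResidueIn φ k (X (j + 1)) := .of_val_add_one (by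
    rw [← h.rel, map_mul, show j + 1 + 1 = j + 2 by ring, add_sub_cancel_right, h2, mul_comm]
    exact hj')
  have hb : ResidueIn φ k (X (j - 1)) := .of_val_add_one (by
    rw [← h.rel, map_mul, show j - 1 - 1 = j - 2 by ring, sub_add_cancel, h3]
    exact hj')
  have hne := h.ne
  have hr : ResidueIn φ k (X (j - 2) / X (j + 2)) := by
    have e : 1 + X (j - 2) * X (j + 1) / X (j + 2) * (-1) = - (X (j + 2))⁻¹ := by
      have := h.rel (j + 2)
      rw [show j + 2 + 1 = j - 2 by clear * -; revert j; decide,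
        show j + 2 - 1 = j + 1 by ring] at this
      rw [this]
      field_simp [hne]
      ring
    have hm : ResidueIn φ k (X (j - 2) * X (j + 1) / X (j + 2) * (-1)) := .of_val_add_one (by
      rw [e, Valuation.map_neg, map_inv₀, h2]; exact inv_lt_one_of_one_lt₀ hg)
    have hn : ResidueIn φ k (-1) := .of_val_add_one (by simp)
    have := (hm.mul hn).mul ha.inv
    convert this using 1
    field_simp [hne]
  have hp := (h.shift j).prod
  set a := X (j + 1) with ea
  set b := X (j - 1) with eb
  set g := X (j + 2) with eg
  set r := X (j - 2) / g with er
  have e3 : X (j - 2) = r * g := by rw [er, div_mul_cancel₀ _ (hne _)]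
  have e0 : X j = (a * b * r * g ^ 2)⁻¹ := by
    refine eq_inv_of_mul_eq_one_left ?_
    have e : X (0 + j) * X (1 + j) * X (2 + j) * X (3 + j) * X (4 + j) = 1 := hp
    rw [zero_add, add_comm 1, add_comm 2, show 3 + j = j - 2 by clear * -; revert j; decide,
      show 4 + j = j - 1 by grind] at e
    grind
  have ha0 : a ≠ 0 := hne _
  have hb0 : b ≠ 0 := hne _
  have hg0 : g ≠ 0 := hne _
  have hr0 : r ≠ 0 := div_ne_zero (hne _) hg0
  clear_value a b r
  have : j = 0 ∨ j = 1 ∨ j = 2 ∨ j = 3 ∨ j = 4 := by clear * -; revert j; decide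
  rcases this with rfl | rfl | rfl | rfl | rfl
  · refine ⟨g, hF _, hg0, ?_⟩
    convert ((ha.pow 6).mul (hb.pow 4)).mul (hr.pow 3) using 1
    change _ = X 1 at ea; change _ = X 4 at eb; change _ = X 2 at eg
    simp only [hfun, ← ea, ← eb, ← eg, e0]
    field_simp
  · refine ⟨g⁻¹, inv_mem (hF _), inv_ne_zero hg0, ?_⟩
    convert ((ha.pow 4).mul ((hb.pow 6).mul (hr.pow 2))).inv using 1
    change _ = X 2 at ea; change _ = X 0 at eb; change _ = X 3 at eg; change X 4 = _ at e3
    simp only [hfun, ← ea, ← eb, e3, e0]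
    field_simp
  · refine ⟨1, one_mem _, one_ne_zero, ?_⟩
    convert (hb.pow 4).mul (ha.mul (hr.pow 2).inv) using 1
    change _ = X 3 at ea; change _ = X 1 at eb; change _ = X 4 at eg; change X 0 = _ at e3
    simp only [hfun, ← eb, ← eg, e3, e0]
    field_simp
  · refine ⟨1, one_mem _, one_ne_zero, ?_⟩
    convert ha.mul ((hr.pow 3).mul hb.inv) using 1
    change _ = X 4 at ea; change _ = X 2 at eb; change _ = X 0 at eg; change X 1 = _ at e3
    simp only [hfun, ← ea, ← eb, ← eg, e3]
    field_simp
  · refine ⟨1, one_mem _, one_ne_zero, ?_⟩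
    convert ((ha.pow 4).mul (hb.mul (hr.pow 2))).inv using 1
    change _ = X 0 at ea; change _ = X 3 at eb; change _ = X 1 at eg; change X 2 = _ at e3
    simp only [hfun, ← ea, ← eg, e3, e0]
    field_simp

end Degenerate

section Core

variable {K : Type u} {ι : Type*} [Field K] [Algebra ℂ K] [Fintype ι] {T T' : ι → K}
  {D D' : Option ι → Derivation ℤ K K}

lemma Partials.chain_rule (hD : Partials T D) (hD' : Partials T' D') (i : ι) {f : K}
    (hf : f ∈ cadj (Set.range T')) :
    D (some i) f = ∑ j, D (some i) (T' j) * D' (some j) f := by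
  classical
  set E : Derivation ℤ K K := D (some i) - ∑ j, D (some i) (T' j) • D' (some j) with hE
  have hEf : ∀ f, E f = D (some i) f - ∑ j, D (some i) (T' j) * D' (some j) f := fun f => by
    rw [hE, Derivation.sub_apply, ← Derivation.coeFnAddMonoidHom_apply (∑ j, _), map_sum,
      Finset.sum_apply]
    rfl
  have hle : cadj (Set.range T') ≤ constants E := by
    refine cadj_le (fun c => ?_) ?_
    · change E _ = 0
      rw [hEf]
      have h1 : ∀ i, D (some i) (algebraMap ℂ K c) = 0 := fun i => by
        have := hD.apply_aeval i (C c); aesop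
      have h2 : ∀ i, D' (some i) (algebraMap ℂ K c) = 0 := fun i => by
        have := hD'.apply_aeval i (C c); aesop
      aesop
    · rintro _ ⟨l, rfl⟩
      change E _ = 0
      rw [hEf]
      simp [hD'.apply_self]
  have : E f = 0 := hle hf
  grind

variable [DecidableEq ι]

lemma partialMatrix_mul (hD : Partials T D) (hD' : Partials T' D')
    (hT : ∀ i, T i ∈ cadj (Set.range T')) : partialMatrix D T' * partialMatrix D' T = 1 := by
  ext i l
  rw [Matrix.mul_apply, Fintype.sum_option]
  simp only [partialMatrix, Matrix.of_apply, Option.elim]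
  rcases i with _ | i
  · rcases l with _ | l
    · simp
    · simp [hD.zero, hD'.zero]
  · rcases l with _ | l
    · simp
    · simp only [reduceCtorEq, if_false, zero_mul, zero_add]
      rw [← hD.chain_rule hD' i (hT l), hD.apply_self, Matrix.one_apply]
      simp

lemma Unif.val_prod_sub_one {V : ValuationSubring K} {E : Subfield K} {π : K} (H : Unif E V π)
    (h5 : V.valuation (5 : K) = 1) (hD0 : ∀ i, ∀ f ∈ E, f ∈ V → D i f ∈ V) {i₀ : Option ι}
    (hi₀ : V.valuation (D i₀ π) = 1) (hE : ∀ i, T' i ∈ E) (hV : ∀ i, T' i ∈ V)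
    (hne : ∀ i, T' i ^ 5 - 1 ≠ 0)
    (hJ : V.valuation (∏ i, (T' i ^ 5 - 1)) ^ 4 ≤
      V.valuation π ^ 4 * V.valuation (partialMatrix D T').det ^ 5) :
    V.valuation (∏ i, (T' i ^ 5 - 1)) = V.valuation π := by
  have := charZero_of_algebra K
  have hn : ∀ i, ∃ n : ℕ, ∃ u ∈ E, V.valuation u = 1 ∧ T' i ^ 5 - 1 = u * π ^ n := fun i => by
    obtain ⟨n, u, huE, hu, e⟩ := H.rep _ (sub_mem (pow_mem (hE i) 5) (one_mem _)) (hne i)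
    have hle : V.valuation (T' i ^ 5 - 1) ≤ 1 :=
      (V.valuation_le_one_iff _).2 (sub_mem (pow_mem (hV i) 5) (one_mem _))
    rw [e, map_mul, hu, one_mul, map_zpow₀] at hle
    have hn : 0 ≤ n := by
      by_contra hneg
      exact absurd hle (not_le.2 (one_lt_zpow_of_neg₀ H.pos H.lt (not_le.1 hneg)))
    obtain ⟨n, rfl⟩ := Int.eq_ofNat_of_zero_le hn
    exact ⟨n, u, huE, hu, by aesop⟩
  choose n u huE hu e using hn
  set M := partialMatrix D T' with hM
  have hMV : ∀ i j, M i j ∈ V := fun i j => by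
    rcases j with _ | j
    · change (if i = none then (1 : K) else 0) ∈ V
      split_ifs
      exacts [one_mem _, zero_mem _]
    · exact hD0 i _ (hE j) (hV j)
  have hb := H.local_bound h5 D hD0 hi₀ (fun j => j.elim 0 n) M (by
    rintro (_ | j)
    · grind
    · exact .inr ⟨T' j, hE j, hV j, ⟨u j, huE j, hu j, e j⟩, fun i => rfl⟩)
  rw [Fintype.sum_option] at hb
  simp only [Option.elim, zero_add] at hb
  have hP : V.valuation (∏ i, (T' i ^ 5 - 1)) = V.valuation π ^ (∑ i, n i) := by
    rw [map_prod, ← Finset.prod_pow_eq_pow_sum]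
    grind
  have hdet : V.valuation M.det ≤ 1 := by
    rw [V.valuation_le_one_iff, Matrix.det_apply]
    refine sum_mem fun σ _ => ?_
    rw [Units.smul_def]
    exact zsmul_mem (prod_mem fun i _ => hMV _ _) _
  have hpos := H.pos
  have hanti : ∀ {a b : ℕ}, V.valuation π ^ a ≤ V.valuation π ^ b → b ≤ a := fun h =>
    (pow_le_pow_iff_right_of_lt_one₀ hpos H.lt).1 h
  rw [hP] at hJ ⊢
  have h1 : 4 ≤ (∑ i, n i) * 4 := hanti (by
    rw [pow_mul]
    refine hJ.trans ?_
    exact mul_le_of_le_one_right zero_le (pow_le_one₀ zero_le hdet))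
  have h2 : V.valuation M.det * V.valuation π ≤ V.valuation π ^ (∑ i, n i) := by
    rw [← V.valuation_le_one_iff, map_div₀, map_mul, map_pow] at hb
    rwa [div_le_one₀ (pow_pos hpos _)] at hb
  have h3 : (∑ i, n i) * 5 ≤ (∑ i, n i) * 4 + 1 := hanti (by
    rw [pow_succ, pow_mul, pow_mul]
    calc _ ≤ V.valuation π ^ 4 * V.valuation M.det ^ 5 * V.valuation π := mul_le_mul_left hJ _
      _ = (V.valuation M.det * V.valuation π) ^ 5 := by
        rw [mul_pow, mul_right_comm, ← pow_succ, mul_comm]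
      _ ≤ _ := pow_le_pow_left₀ zero_le h2 5)
  have : ∑ i, n i = 1 := by omega
  aesop

omit [DecidableEq ι] in
/-- The members of a tuple can be inverted. -/
lemma IsTuple.exists_integral {a : ℤ} {X : ZMod 5 → K} {ρ : K} (h : IsTuple a T X ρ)
    (hf : Free fun i : Option ι => i.elim (X 0) T) (V : ValuationSubring K) :
    ∃ (T' : ι → K) (ρ' : K), (∀ i, T' i ∈ V) ∧ IsTuple a T' X ρ' ∧
      (Free fun i : Option ι => i.elim (X 0) T') ∧ cadj (Set.range T') = cadj (Set.range T) ∧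
      tupleField T' X ρ' = tupleField T X ρ := by
  classical
  have hT0 : ∀ i, T i ≠ 0 := fun i h0 => hf (some i) (by
    aesop)
  set T' : ι → K := fun i => if T i ∈ V then T i else (T i)⁻¹ with hT'
  set e : ι → K := fun i => if T i ∈ V then 1 else -(T i)⁻¹ with he
  have hT'T : ∀ i, T' i = T i ∨ T' i = (T i)⁻¹ := fun i => by
    grind
  have hTT' : ∀ i, T i = T' i ∨ T i = (T' i)⁻¹ := fun i => by
    grind
  have hV : ∀ i, T' i ∈ V := fun i => by
    simp only [hT']; split_ifs with h
    · exact h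
    · exact (V.mem_or_inv_mem _).resolve_left h
  have he5 : ∀ i, T' i ^ 5 - 1 = e i ^ 5 * (T i ^ 5 - 1) := fun i => by
    grind
  have he0 : ∀ i, e i ≠ 0 := fun i => by
    grind
  have heT : ∀ i, e i ∈ cadj (Set.range T) := fun i => by
    simp only [he]; split_ifs
    · aesop
    · exact neg_mem (inv_mem (subset_cadj _ ⟨i, rfl⟩))
  have hmem : ∀ (E : Subfield K) (i), T' i ∈ E ↔ T i ∈ E := fun E i => by
    rcases hT'T i with h | h <;> rw [h]
    aesop
  have hF : cadj (Set.range T') = cadj (Set.range T) := by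
    refine le_antisymm (cadj_le (fun c => algebraMap_mem_cadj c) ?_)
      (cadj_le (fun c => algebraMap_mem_cadj c) ?_)
    · rintro _ ⟨i, rfl⟩; exact (hmem _ i).2 (subset_cadj _ ⟨i, rfl⟩)
    · rintro _ ⟨i, rfl⟩; exact (hmem _ i).1 (subset_cadj _ ⟨i, rfl⟩)
  have hc : (∏ i, e i) ^ a ∈ cadj (Set.range T) := zpow_mem (prod_mem fun i _ => heT i) _
  have hc0 : (∏ i, e i) ^ a ≠ 0 := zpow_ne_zero _ (Finset.prod_ne_zero_iff.2 fun i _ => he0 i)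
  refine ⟨T', (∏ i, e i) ^ a * ρ, hV, ⟨h.lyness, h.notMem, fun i => ?_, ?_⟩, ?_, hF, ?_⟩
  · rw [he5]; exact mul_ne_zero (pow_ne_zero _ (he0 i)) (h.pow_ne i)
  · rw [mul_pow, h.root, Finset.prod_congr rfl fun i _ => he5 i, Finset.prod_mul_distrib,
      Finset.prod_pow, mul_zpow, mul_assoc]
    congr 1
    rw [← zpow_natCast, ← zpow_mul, ← zpow_natCast, ← zpow_mul, mul_comm]
  · have hset : ∀ S : Set (Option ι), acl ((fun i : Option ι => i.elim (X 0) T') '' S) ≤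
        acl ((fun i : Option ι => i.elim (X 0) T) '' S) := fun S => by
      refine (algClosedIn_acl _).acl_le (fun c => algebraMap_mem_acl c) ?_
      rintro _ ⟨i, hi, rfl⟩
      have : (i.elim (X 0) T) ∈ acl ((fun i : Option ι => i.elim (X 0) T) '' S) :=
        subset_acl _ ⟨i, hi, rfl⟩
      rcases i with _ | i
      · exact this
      aesop
    intro i hi
    refine hf i ?_
    have := hset _ hi
    rcases i with _ | i
    · exact this
    grind
  · unfold tupleField
    rw [hF]
    set E := Subfield.closure ((cadj (Set.range T) : Set K) ∪ Set.range X)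
    have hcE : (∏ i, e i) ^ a ∈ E := Subfield.subset_closure (.inl hc)
    refine le_antisymm (Subfield.closure_le.2 (Set.insert_subset ?_ ?_))
      (Subfield.closure_le.2 (Set.insert_subset ?_ ?_))
    · exact mul_mem (Subfield.subset_closure (.inr hcE)) (Subfield.subset_closure (.inl rfl))
    · exact fun y hy => Subfield.subset_closure (.inr hy)
    · have := mul_mem (inv_mem (Subfield.subset_closure (.inr hcE)))
        (Subfield.subset_closure (s := insert ((∏ i, e i) ^ a * ρ) (E : Set K)) (.inl rfl))
      aesop
    · exact fun y hy => Subfield.subset_closure (.inr hy)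

end Core

section Core

variable {K : Type u} {ι : Type*} [Field K] [Algebra ℂ K]

lemma prime_X_sub_one (i : ι) : Prime (X i - 1 : MvPolynomial ι ℂ) := by
  classical
  refine (irreducible_of_totalDegree_eq_one ?_ ?_).prime
  · rw [sub_eq_add_neg, totalDegree_add_eq_left_of_totalDegree_lt, totalDegree_X]
    aesop
  · intro x hx
    have := hx (Finsupp.single i 1)
    rw [coeff_sub, coeff_X, if_pos rfl, coeff_one, if_neg, sub_zero] at this
    · aesop
    · exact (Finsupp.single_ne_zero.2 one_ne_zero).symm

variable [Fintype ι] [DecidableEq ι]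

lemma exists_prod_eq (i : ι) : ∃ w : MvPolynomial ι ℂ, ∏ j, (X j ^ 5 - 1) = (X i - 1) * w ∧ ¬ (X i - 1) ∣ w := by
  refine ⟨(X i ^ 4 + X i ^ 3 + X i ^ 2 + X i + 1) * ∏ j ∈ Finset.univ.erase i, (X j ^ 5 - 1), ?_, ?_⟩
  · rw [← Finset.mul_prod_erase _ _ (Finset.mem_univ i)]
    ring
  · rintro ⟨w, hw⟩
    have := congrArg (eval fun j => if j = i then (1 : ℂ) else 0) hw
    simp only [map_mul, map_add, map_pow, map_sub, map_one, eval_X, if_true, map_prod, sub_self, zero_mul,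
      mul_eq_zero] at this
    rcases this with h | h
    · grind
    · obtain ⟨j, hj, e⟩ := Finset.prod_eq_zero_iff.1 h
      grind

variable {T T' : ι → K} {X X' : ZMod 5 → K} {ρ ρ' : K}

theorem IsTuple.tupleField_ne [Nonempty ι] (h : IsTuple 1 T X ρ) (h' : IsTuple (-2) T' X' ρ')
    (hf : Free fun i : Option ι => i.elim (X 0) T) (hf' : Free fun i : Option ι => i.elim (X' 0) T')
    (hF : cadj (Set.range T') = cadj (Set.range T)) :
    tupleField T' X' ρ' ≠ tupleField T X ρ := fun hκ => by
  obtain ⟨i₁⟩ := ‹Nonempty ι›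
  have hu := prime_X_sub_one i₁
  obtain ⟨w, hw, hwu⟩ := exists_prod_eq i₁
  have hfT : Free T := hf.comp (f := some) (Option.some_injective _)
  obtain ⟨V, Ω, _, _, _, φ, k, hφ, G⟩ := exists_gaussPlace hfT hf.notMem_range hu
  -- normalise the second tuple
  obtain ⟨T₂, ρ₂, hV, h₂, hf₂, hF₂, hκ₂⟩ := h'.exists_integral hf' V
  rw [← hκ₂] at hκ
  rw [← hF₂] at hF
  clear hκ₂ hF₂ h' hf'
  rename' T₂ => T', ρ₂ => ρ', h₂ => h', hf₂ => hf'
  have hfT' : Free T' := hf'.comp (f := some) (Option.some_injective _)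
  have hTF : ∀ i, T i ∈ cadj (Set.range T) := fun i => subset_cadj _ ⟨i, rfl⟩
  have hTF' : ∀ i, T' i ∈ cadj (Set.range T) := fun i => hF ▸ subset_cadj _ ⟨i, rfl⟩
  have hXκ : ∀ i, X i ∈ tupleField T X ρ := fun i =>
    Subfield.subset_closure (.inr (Subfield.subset_closure (.inr ⟨i, rfl⟩)))
  have hXκ' : ∀ i, X' i ∈ tupleField T X ρ := fun i => hκ ▸
    Subfield.subset_closure (.inr (Subfield.subset_closure (.inr ⟨i, rfl⟩)))
  have hρκ : ρ ∈ tupleField T X ρ := Subfield.subset_closure (.inl rfl)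
  have hρκ' : ρ' ∈ tupleField T X ρ := hκ ▸ Subfield.subset_closure (.inl rfl)
  have hFκ : ∀ f ∈ cadj (Set.range T), f ∈ tupleField T X ρ := fun f hf =>
    Subfield.subset_closure (.inr (Subfield.subset_closure (.inl hf)))
  set P := ∏ i, (T i ^ 5 - 1) with hP
  set P' := ∏ i, (T' i ^ 5 - 1) with hP'
  have hP0 : P ≠ 0 := Finset.prod_ne_zero_iff.2 fun i _ => h.pow_ne i
  have hP0' : P' ≠ 0 := Finset.prod_ne_zero_iff.2 fun i _ => h'.pow_ne i
  have hPF : P ∈ cadj (Set.range T) := by simpa using prod_mem_cadj T 1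
  have hPF' : P' ∈ cadj (Set.range T) := by simpa [hF] using prod_mem_cadj T' 1
  obtain ⟨D, hD⟩ := hfT.exists_partials
  obtain ⟨D', hD'⟩ := hfT'.exists_partials
  set π := aeval T (MvPolynomial.X i₁ - 1 : MvPolynomial ι ℂ) with hπ
  have hvP : V.valuation P = V.valuation π := by
    have : P = π * aeval T w := by
      rw [hπ, ← map_mul, ← hw]; simp [hP]
    rw [this, map_mul, (G.val_eq w).2 hwu, mul_one]
  have hvP' : V.valuation P' = V.valuation π := by
    obtain ⟨p, hp⟩ := h'.exists_aeval hf' h (by decide) (fun i => hF.symm ▸ hTF i) (fun i => hκ.symm ▸ hXκ i)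
      (hκ.symm ▸ hρκ) hD'
    have hpV : ∀ q : MvPolynomial ι ℂ, aeval T' q ∈ V := fun q => by
      induction q using MvPolynomial.induction_on with
      | C c => rw [algHom_C]; exact G.algebraMap_mem c
      | add p q hp hq => rw [map_add]; exact add_mem hp hq
      | mul_X p j hp => rw [map_mul, aeval_X]; exact mul_mem hp (hV j)
    have hle := (V.valuation_le_one_iff _).2 (hp ▸ hpV p)
    have hdet : (partialMatrix D T').det * (partialMatrix D' T).det = 1 := by
      rw [← Matrix.det_mul, partialMatrix_mul hD hD' fun i => hF.symm ▸ hTF i, Matrix.det_one]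
    obtain ⟨i₀, hi₀⟩ := exists_not_dvd_pderiv hu
    refine G.chart.unif.val_prod_sub_one (G.val_five hu) (D := D) (fun i f hf hfV => G.partials_mem hu hD i hf hfV)
      (i₀ := some i₀) (by rw [hD.apply_aeval, G.val_eq]; exact hi₀) hTF' hV h'.pow_ne ?_
    rw [eq_inv_of_mul_eq_one_left hdet, map_inv₀, ← hπ, ← hvP, inv_pow]
    have hd0 : 0 < V.valuation (partialMatrix D' T).det ^ 5 := pow_pos (zero_lt_iff.2
      ((map_ne_zero V.valuation).2 (right_ne_zero_of_mul (hdet.trans_ne one_ne_zero)))) _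
    have hPp : 0 < V.valuation P ^ 4 := pow_pos (zero_lt_iff.2 ((map_ne_zero V.valuation).2 hP0)) _
    rw [← div_eq_mul_inv, le_div_iff₀ hd0]
    rw [map_mul, map_div₀, map_pow, map_pow, map_pow, div_mul_eq_mul_div, div_le_one₀ hPp] at hle
    grind
  -- the curve of the first tuple
  have hEκ : ∀ f ∈ Subfield.closure ((cadj (Set.range T) : Set K) ∪ Set.range X), f ∈ tupleField T X ρ :=
    fun f hf => Subfield.subset_closure (.inr hf)
  obtain ⟨hX, x, hx, hcur, R⟩ := G.chart.curve G.closed G.algebraMap_memk h.lyness G.mem G.notMem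
  have hvX : ∀ i, V.valuation (X i) = 1 := fun i => h.lyness.val_eq_one_of_notMem G.mem G.notMem i
  have hres : ∀ f : V, (f : K) ∈ tupleField T X ρ → φ f ∈ Subfield.closure ((k : Set Ω) ∪ Set.range x) :=
    fun f hf => R.of_root_ramified (c := P) (a := 1) (fun i => Subfield.subset_closure (.inr ⟨i, rfl⟩))
      (val_hfun_eq_one hvX) (Subfield.subset_closure (.inl hPF)) (by decide)
      (by aesop) (by rw [h.root, zpow_one]) hf
  have hc : V.valuation (P ^ 2 / P' ^ 2) = 1 := by
    rw [map_div₀, map_pow, map_pow, hvP, hvP', div_self]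
    exact pow_ne_zero _ G.chart.unif.pos.ne'
  have hcQ : ResidueIn φ k (P ^ 2 / P' ^ 2) := ⟨mem_of_val_eq_one hc, map_ne_zero_iff_val.2 hc,
    G.chart.res _ (div_mem (pow_mem hPF _) (pow_mem hPF' _))⟩
  have hroot : (ρ' * ρ ^ 2) ^ 5 = P ^ 2 / P' ^ 2 * (hfun X' * hfun X ^ 2) := by
    have e := h.root; have e' := h'.root
    rw [← hP, zpow_one] at e
    rw [← hP', zpow_neg] at e'
    rw [mul_pow, ← pow_mul, mul_comm 2 5, pow_mul, e, e', div_eq_mul_inv, mul_pow]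
    norm_cast
    ring
  have hhX := val_hfun_eq_one hvX
  have hhφ := map_hfun hX hx hcur.lyness.ne (mem_of_val_eq_one hhX)
  -- the degenerate case
  have hdeg : ∀ f ∈ tupleField T X ρ, f ≠ 0 → ¬ ResidueIn φ k (hfun X' / f ^ 5) := by
    rintro f hf hf0 hQ
    obtain ⟨hm, hm0, hmk⟩ := hcQ.mul hQ
    have e : (ρ' * ρ ^ 2 / f) ^ 5 = P ^ 2 / P' ^ 2 * (hfun X' / f ^ 5) * hfun X ^ 2 := by
      grind
    have hw1 : V.valuation (ρ' * ρ ^ 2 / f) = 1 := by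
      have := congrArg V.valuation e
      rw [map_pow, map_mul, map_pow, hhX, one_pow, mul_one, map_ne_zero_iff_val.1 hm0] at this
      aesop
    have hwV := mem_of_val_eq_one hw1
    have hW := hres ⟨_, hwV⟩ (div_mem (mul_mem hρκ' (pow_mem hρκ 2)) hf)
    have eW : φ ⟨_, hwV⟩ ^ 5 = φ ⟨_, hm⟩ * hfun x ^ 2 := by
      rw [← hhφ, ← map_pow, ← map_pow, ← map_mul]
      aesop
    have hN : hfun x ∈ Subfield.closure ((k : Set Ω) ∪ Set.range x) := hfun_mem hcur.x_mem
    refine hcur.pow_ne (pow_mem hmk 3) (pow_ne_zero 3 hm0) (div_mem (pow_mem hW 3) hN) ?_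
    grind
  have hunit : (∀ i, V.valuation (X' i) = 1) := by
    rcases h'.lyness.pattern V.valuation (map_one _) with hv | ⟨j, g, hcusp⟩
    · exact hv
    · obtain ⟨f, hf, hf0, hQ⟩ := Cusp.exists_residueIn (φ := φ) (k := k) h'.lyness hcusp hXκ'
      grind
  have h0V := mem_of_val_eq_one (hunit 0)
  have h0k : φ ⟨X' 0, h0V⟩ ∉ k := fun hk0 => by
    have hX' := fun i => mem_of_val_eq_one (hunit i)
    obtain ⟨x', hx'⟩ : ∃ x' : ZMod 5 → Ω, ∀ i, φ ⟨X' i, hX' i⟩ = x' i := ⟨_, fun _ => rfl⟩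
    have hl : IsLyness 1 x' := by
      have := h'.lyness.map_residue (φ := φ) hX' (fun i => map_ne_zero_iff_val.2 (hunit i)) (one_mem _)
      simp only [hx'] at this
      rwa [show φ ⟨1, one_mem V⟩ = 1 from map_one φ] at this
    have hm := val_hfun_eq_one hunit
    refine hdeg 1 (one_mem _) one_ne_zero ?_
    rw [one_pow, div_one]
    refine ⟨mem_of_val_eq_one hm, map_ne_zero_iff_val.2 hm, ?_⟩
    rw [map_hfun hX' hx' hl.ne]
    exact hfun_mem fun i => hl.mem_all G.closed (one_mem _) (i := 0) (hx' 0 ▸ hk0) i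
  -- the generic case
  obtain ⟨hX', x', hx', hcur', R'⟩ := G.chart.curve G.closed G.algebraMap_memk h'.lyness h0V h0k
  have hres' : ∀ f : V, (f : K) ∈ tupleField T X ρ → φ f ∈ Subfield.closure ((k : Set Ω) ∪ Set.range x') :=
    fun f hf => R'.of_root_ramified (c := P' ^ (-2 : ℤ)) (a := -2)
      (fun i => Subfield.subset_closure (.inr ⟨i, rfl⟩))
      (val_hfun_eq_one hunit) (Subfield.subset_closure (.inl (zpow_mem hPF' _))) (by decide)
      (by aesop) h'.root (by
        have := hκ ▸ hf
        rwa [tupleField, hF] at this)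
  have hNN : Subfield.closure ((k : Set Ω) ∪ Set.range x') = Subfield.closure ((k : Set Ω) ∪ Set.range x) := by
    refine le_antisymm (Subfield.closure_le.2 (Set.union_subset hcur.le ?_))
      (Subfield.closure_le.2 (Set.union_subset hcur'.le ?_))
    · rintro _ ⟨i, rfl⟩; rw [← hx']; exact hres _ (hXκ' i)
    · rintro _ ⟨i, rfl⟩; rw [← hx]; exact hres' _ (hXκ i)
  rw [hNN] at hcur'
  obtain ⟨hm, hm0, hmk⟩ := hcQ
  have hhX' := val_hfun_eq_one hunit
  have hhφ' := map_hfun hX' hx' hcur'.lyness.ne (mem_of_val_eq_one hhX')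
  have hw1 : V.valuation (ρ' * ρ ^ 2) = 1 := by
    refine (pow_eq_one_iff_of_nonneg zero_le (n := 5) (by norm_num)).1 ?_
    rw [← map_pow, hroot, map_mul, hc, map_mul, map_pow V.valuation (hfun X), hhX, hhX', one_pow,
      mul_one, mul_one]
  have hwV := mem_of_val_eq_one hw1
  refine hcur.hfun_mul_sq_ne hcur' hmk hm0 (hres ⟨_, hwV⟩ (mul_mem hρκ' (pow_mem hρκ 2))) ?_
  rw [← hhφ, ← hhφ', ← map_pow, ← map_pow, ← map_mul, ← map_mul]
  refine congrArg φ (Subtype.ext ?_)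
  exact (mul_comm _ _).trans hroot.symm

end Core

section Full

variable {K : Type u} {ι : Type*} [Field K] [Algebra ℂ K]

lemma subset_tupleField {T : ι → K} {X : ZMod 5 → K} {ρ : K} :
    cadj (Set.range T) ≤ tupleField T X ρ ∧ (∀ i, T i ∈ tupleField T X ρ) ∧
      (∀ i, X i ∈ tupleField T X ρ) ∧ ρ ∈ tupleField T X ρ := by
  have h1 : ∀ y ∈ (cadj (Set.range T) : Set K) ∪ Set.range X, y ∈ tupleField T X ρ := fun y hy =>
    Subfield.subset_closure (.inr (Subfield.subset_closure hy))
  exact ⟨fun y hy => h1 y (.inl hy), fun i => h1 _ (.inl (subset_cadj _ ⟨i, rfl⟩)),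
    fun i => h1 _ (.inr ⟨i, rfl⟩), Subfield.subset_closure (.inl rfl)⟩

lemma tupleField_le {T : ι → K} {X : ZMod 5 → K} {ρ : K} {F : Subfield K}
    (hC : ∀ c : ℂ, algebraMap ℂ K c ∈ F) (hT : ∀ i, T i ∈ F) (hX : ∀ i, X i ∈ F) (hρ : ρ ∈ F) :
    tupleField T X ρ ≤ F := by
  refine Subfield.closure_le.2 (Set.insert_subset hρ (Subfield.closure_le.2 (Set.union_subset ?_ ?_)))
  · refine cadj_le hC ?_
    rintro _ ⟨i, rfl⟩; exact hT i
  · rintro _ ⟨i, rfl⟩; exact hX i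

variable [Fintype ι] [DecidableEq ι]

omit [DecidableEq ι] in
/-- An element of the field of a tuple which is algebraic over the parameters is a rational function of
the parameters. -/
lemma IsTuple.mem_cadj [IsAlgClosed K] {a : ℤ} {T : ι → K} {X : ZMod 5 → K} {ρ : K}
    (h : IsTuple a T X ρ) (hf : Free fun i : Option ι => i.elim (X 0) T) {f : K}
    (hf1 : f ∈ tupleField T X ρ) (hf2 : f ∈ acl (Set.range T)) : f ∈ cadj (Set.range T) := by
  have hch := charZero_of_algebra K
  set k := acl (Set.range T) with hkdef
  set F := cadj (Set.range T) with hF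
  have hFk : F ≤ k := fun y hy => cadj_le_acl hy
  have hX0 : X 0 ∉ k := hf.notMem_range
  have hk : AlgClosedIn k := algClosedIn_acl _
  set E := Subfield.closure (insert (X 0) (F : Set K)) with hE
  have hX0E : X 0 ∈ E := Subfield.subset_closure (.inl rfl)
  have hFE : F ≤ E := fun y hy => Subfield.subset_closure (.inr hy)
  set M := Subfield.closure (insert (X 1) (E : Set K)) with hM
  have hEM : E ≤ M := fun y hy => Subfield.subset_closure (.inr hy)
  have hXM : ∀ i, X i ∈ M := h.lyness.mem_subfield (hEM hX0E) (Subfield.subset_closure (.inl rfl))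
  have hP : (∏ i, (T i ^ 5 - 1)) ^ a ∈ F := prod_mem_cadj T a
  have hP0 : (∏ i, (T i ^ 5 - 1)) ^ a ≠ 0 :=
    zpow_ne_zero _ (Finset.prod_ne_zero_iff.2 fun i _ => h.pow_ne i)
  have hρ5 : ρ ^ 5 ∈ M := by
    rw [h.root]
    exact mul_mem (hEM (hFE hP)) (div_mem (mul_mem (pow_mem (hXM _) _) (hXM _))
      (mul_mem (pow_mem (hXM _) _) (hXM _)))
  have hf3 : f ∈ Subfield.closure (insert ρ (M : Set K)) := by
    refine tupleField_le (F := Subfield.closure (insert ρ (M : Set K))) ?_ ?_ ?_ ?_ hf1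
    · exact fun c => Subfield.subset_closure (.inr (hEM (hFE (algebraMap_mem_cadj c))))
    · exact fun i => Subfield.subset_closure (.inr (hEM (hFE (subset_cadj _ ⟨i, rfl⟩))))
    · exact fun i => Subfield.subset_closure (.inr (hXM i))
    · exact Subfield.subset_closure (.inl rfl)
  obtain ⟨c, hc, hfc⟩ := exists_sum_of_pow_five hρ5 hf3
  set N := Subfield.closure ((k : Set K) ∪ Set.range X) with hN
  have hcurve : IsCurve k 1 X N := ⟨h.lyness, by norm_num, one_mem _, hk, fun c => algebraMap_mem_acl c, hX0, rfl⟩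
  have hkN : k ≤ N := hcurve.le
  have hEN : E ≤ N := Subfield.closure_le.2
    (Set.insert_subset (hcurve.x_mem 0) fun y hy => hkN (hFk hy))
  have hMN : M ≤ N := Subfield.closure_le.2 (Set.insert_subset (hcurve.x_mem 1) hEN)
  have hL1 := hcurve.linearIndependent (hFk hP) hP0 h.root
  rw [Fintype.linearIndependent_iff] at hL1
  have e1 : c 0 - f = 0 := by
    have := hL1 (fun j => ⟨c j - if j = 0 then f else 0, sub_mem (hMN (hc j)) (by
      split_ifs
      exacts [hkN hf2, zero_mem _])⟩) (by
        simp only [Subfield.smul_def, smul_eq_mul]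
        simp only [sub_mul, Finset.sum_sub_distrib, ite_mul, zero_mul, Finset.sum_ite_eq',
          Finset.mem_univ, if_true]
        aesop) 0
    simpa using congrArg Subtype.val this
  have hfM : f ∈ M := by
    grind
  obtain ⟨d, hd, hfd⟩ := h.lyness.exists_sum hX0E hfM
  have hL2 := h.lyness.linearIndependent hk hX0
  rw [Fintype.linearIndependent_iff] at hL2
  have hle : E ≤ Subfield.closure (insert (X 0) (k : Set K)) :=
    Subfield.closure_mono (Set.insert_subset_insert hFk)
  have e2 : d 0 - f = 0 := by
    have := hL2 (fun j => ⟨d j - if j = 0 then f else 0, sub_mem (hle (hd j)) (by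
      split_ifs
      exacts [Subfield.subset_closure (.inr hf2), zero_mem _])⟩) (by
        simp only [Subfield.smul_def, smul_eq_mul]
        simp only [sub_mul, Finset.sum_sub_distrib, ite_mul, zero_mul, Finset.sum_ite_eq',
          Finset.mem_univ, if_true]
        aesop) 0
    simpa using congrArg Subtype.val this
  exact mem_of_mem_acl hFk hX0 (by grind) hf2

/-- The parameters of a tuple contained in the field of another tuple are algebraic over its
parameters. -/
lemma IsTuple.mem_acl_range [IsAlgClosed K] {a a' : ℤ} (ha' : IsCoprime a' 5) {T T' : ι → K}
    {X X' : ZMod 5 → K} {ρ ρ' : K} (h : IsTuple a T X ρ)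
    (hf : Free fun i : Option ι => i.elim (X 0) T) (h' : IsTuple a' T' X' ρ')
    (hf' : Free fun i : Option ι => i.elim (X' 0) T')
    (hT : ∀ i, T' i ∈ tupleField T X ρ) (hX : ∀ i, X' i ∈ tupleField T X ρ)
    (hρ : ρ' ∈ tupleField T X ρ) (j : ι) : T' j ∈ acl (Set.range T) := by
  by_cases hn : X' 0 ∈ acl (Set.range T) ∧ ∀ i, T' i ∈ acl (Set.range T)
  · grind
  have hch := charZero_of_algebra K
  set t := Set.range T with ht
  have htf : t.Finite := Set.finite_range T
  have hs : X 0 ∉ acl t := hf.notMem_range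
  have hk := algClosedIn_acl t
  have hx := h.lyness
  have hP0 : ∏ i, (T i ^ 5 - 1) ≠ 0 := Finset.prod_ne_zero_iff.2 fun i _ => h.pow_ne i
  have hTk : ∀ i, T i ∈ acl t := fun i => subset_acl _ ⟨i, rfl⟩
  have hPk : (∏ i, (T i ^ 5 - 1)) ^ a ∈ acl t :=
    zpow_mem (prod_mem fun i _ => sub_mem (pow_mem (hTk i) _) (one_mem _)) _
  obtain ⟨r, hr⟩ := IsAlgClosed.exists_pow_nat_eq ((∏ i, (T i ^ 5 - 1)) ^ a) (n := 5) (by norm_num)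
  have hrk : r ∈ acl t := hk.of_pow (n := 5) (by norm_num) (by grind)
  have hr0 : r ≠ 0 := by
    rintro rfl
    exact zpow_ne_zero a hP0 (by grind)
  obtain ⟨s, hsdef⟩ : ∃ s, s = ρ / r := ⟨_, rfl⟩
  have hs5 : s ^ 5 = hfun X := by
    rw [hsdef, div_pow, h.root, hr, mul_div_cancel_left₀ _ (zpow_ne_zero a hP0)]
  have hfl := hx.flow_ne hk (one_mem _) hs
  obtain ⟨δ, hδ, hδ0⟩ := exists_derivation_acl hs (flow X 0)
  have hδx : ∀ i, δ (X i) = flow X i := fun i => by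
    simpa using hx.derivation_eq (c := 1) (by simp) hfl (by grind) i
  have hXt : ∀ i, X i ∈ acl (insert (X 0) t) :=
    hx.mem_all (algClosedIn_acl _) (one_mem _) (i := 0) (subset_acl _ (.inl rfl))
  have hkt : acl t ≤ acl (insert (X 0) t) := acl_mono (Set.subset_insert _ _)
  have hst : s ∈ acl (insert (X 0) t) := (algClosedIn_acl _).of_pow (n := 5) (by norm_num) (by
    rw [hs5]
    exact div_mem (mul_mem (pow_mem (hXt _) _) (hXt _)) (mul_mem (pow_mem (hXt _) _) (hXt _)))
  have hρs : ρ = s * r := by grind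
  set N := Subfield.closure (insert s ((acl t : Set K) ∪ Set.range X)) with hN
  have hsN : s ∈ N := Subfield.subset_closure (.inl rfl)
  have hxN : ∀ i, X i ∈ N := fun i => Subfield.subset_closure (.inr (.inr ⟨i, rfl⟩))
  have hkN : acl t ≤ N := fun a ha => Subfield.subset_closure (.inr (.inl ha))
  have hNt : N ≤ acl (insert (X 0) t) := by
    refine Subfield.closure_le.2 (Set.insert_subset hst (Set.union_subset hkt ?_))
    rintro _ ⟨i, rfl⟩; exact hXt i
  have hκN : tupleField T X ρ ≤ N := tupleField_le (fun c => hkN (algebraMap_mem_acl c))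
    (fun i => hkN (hTk i)) hxN (by rw [hρs]; exact mul_mem hsN (hkN hrk))
  have hdim : Dim1 (acl t) N := by
    refine (dim1_acl hk (fun c => algebraMap_mem_acl c) (X 0)).mono hkN (hNt.trans ?_)
    exact acl_mono (Set.insert_subset_insert (subset_acl _))
  have hH : ∀ i, X i ≠ 0 := hx.ne
  have hDs : ∀ D : Derivation ℤ K K, (∀ i, D (X i) = 0) → D s = 0 := fun D hD => by
    refine (algClosedIn_constants D).of_pow (n := 5) (by norm_num) (f := s) ?_
    rw [hs5]
    have hX' : ∀ i, X i ∈ constants D := hD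
    exact div_mem (mul_mem (pow_mem (hX' _) _) (hX' _)) (mul_mem (pow_mem (hX' _) _) (hX' _))
  obtain ⟨D, hD0, hD, hJ⟩ := exists_jacobian_ne_zero htf hs hδ (by grind) h'.lyness hf'
    (hNt (hκN (hX 0))) (fun i => hNt (hκN (hT i))) hn
  have hDx : ∀ i j, D (some i) (X j) = 0 := fun i j => by
    simpa using hx.derivation_eq (c := 0) (by simp) hfl (by grind) j
  have hδs : δ s ∈ N := by
    have hs0 : s ≠ 0 := by
      rintro rfl
      refine hx.hfun_ne (hs5.symm.trans ?_)
      norm_num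
    set M := Subfield.closure (Set.range X) with hM
    have hXM : ∀ i, X i ∈ M := fun i => Subfield.subset_closure ⟨i, rfl⟩
    have hMN : M ≤ N := Subfield.closure_le.2 (by rintro _ ⟨i, rfl⟩; exact hxN i)
    have h1 : δ (hfun X) ∈ M := by
      refine derivation_mem_closure (s := Set.range X) Subfield.subset_closure δ ?_ _
        (div_mem (mul_mem (pow_mem (hXM _) _) (hXM _)) (mul_mem (pow_mem (hXM _) _) (hXM _)))
      rintro _ ⟨i, rfl⟩
      rw [hδx]
      exact mul_mem (add_mem (one_mem _) (hXM _)) (sub_mem (hXM _) (hXM _))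
    have h2 : δ s = δ (hfun X) / (5 * s ^ 4) := by
      rw [← hs5, Derivation.leibniz_pow, eq_div_iff (mul_ne_zero (by norm_num) (pow_ne_zero 4 hs0))]
      simp only [nsmul_eq_mul, smul_eq_mul]
      grind
    rw [h2]
    exact div_mem (hMN h1) (mul_mem (by simp) (pow_mem hsN _))
  obtain ⟨hΘ, hΘ'⟩ := Cremona.theta_mem (k := acl t) (s := s) (x := X) (δ := δ) hdim
    (fun V hkV hNV => exists_flowDVR_root hx (by norm_num) hdim hxN hkV (one_mem _) hNV hs hδ hδx hs5 hsN hN)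
    (derivation_mem_closure Subfield.subset_closure δ (by
      rintro _ (rfl | ha | ⟨i, rfl⟩)
      · exact hδs
      · rw [hδ _ ha]; exact zero_mem _
      · rw [hδx]
        exact mul_mem (add_mem (one_mem _) (hxN _)) (sub_mem (hxN _) (hxN _))))
    (fun D hDk hDx hDs =>
      derivation_mem_closure Subfield.subset_closure D (by
        rintro _ (rfl | ha | ⟨i, rfl⟩)
        · rw [hDs]; exact zero_mem _
        · exact hkN (hDk _ ha)
        · rw [hDx]; exact zero_mem _))
    D hD0 (fun i => (hD i).1) hDx (fun i => hDs _ (hDx i)) ha' h' (fun i => hκN (hT i))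
    (fun i => hκN (hX i)) (hκN hρ)
  have hP0' : ∏ i, (T' i ^ 5 - 1) ≠ 0 := Finset.prod_ne_zero_iff.2 fun i _ => h'.pow_ne i
  have hΘ0 := div_ne_zero (pow_ne_zero 5 hJ) (pow_ne_zero 4 hP0')
  refine hk.of_pow (n := 5) (by norm_num) ?_
  have := div_mem (hΘ' j) hΘ
  grind

lemma IsTuple.tupleField_le_of_eq [IsAlgClosed K] {a a' : ℤ} (ha' : IsCoprime a' 5) {T T' : ι → K}
    {X X' : ZMod 5 → K} {ρ ρ' s : K} (h : IsTuple a T X ρ)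
    (hf : Free fun i : Option (Option ι) => i.elim s fun i => i.elim (X 0) T)
    (h' : IsTuple a' T' X' ρ') (hf' : Free fun i : Option ι => i.elim (X' 0) T')
    (he : tupleField T' X' ρ' ≤ Subfield.closure (insert s (tupleField T X ρ : Set K))) :
    tupleField T' X' ρ' ≤ tupleField T X ρ := by
  set t := insert (X 0) (Set.range T) with ht
  have hs : s ∉ acl t := fun hs => hf none (acl_mono (by
    rintro _ (rfl | ⟨i, rfl⟩)
    exacts [⟨some none, by simp, rfl⟩, ⟨some (some i), by simp, rfl⟩]) hs)
  obtain ⟨hX, hρ⟩ := h.mem_all (algClosedIn_acl t) (subset_acl _ (.inl rfl))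
    (fun i => subset_acl _ (.inr ⟨i, rfl⟩))
  have hκ : tupleField T X ρ ≤ acl t := tupleField_le (fun c => algebraMap_mem_acl c)
    (fun i => subset_acl _ (.inr ⟨i, rfl⟩)) hX hρ
  have hκ' : Subfield.closure (insert s (tupleField T X ρ : Set K)) ≤
      Subfield.closure (insert s (acl t : Set K)) := Subfield.closure_mono (Set.insert_subset_insert hκ)
  obtain ⟨-, hT1, hX1, hρ1⟩ := subset_tupleField (T := T') (X := X') (ρ := ρ')
  obtain ⟨h0, hT2⟩ := h'.mem_of_mem_simple ((Set.finite_range T).insert _) hs ha' hf'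
    (fun i => hκ' (he (hT1 i))) (fun i => hκ' (he (hX1 i))) (hκ' (he hρ1))
  obtain ⟨hX2, hρ2⟩ := h'.mem_all (algClosedIn_acl t) h0 hT2
  refine tupleField_le (fun c => subset_tupleField.1 (algebraMap_mem_cadj c)) ?_ ?_ ?_
  · exact fun i => mem_of_mem_acl hκ hs (he (hT1 i)) (hT2 i)
  · exact fun i => mem_of_mem_acl hκ hs (he (hX1 i)) (hX2 i)
  · exact mem_of_mem_acl hκ hs (he hρ1) hρ2

/-- Tuples of type `1` and `-2` have non-isomorphic fields, even after adjoining one variable. -/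
theorem IsTuple.closure_ne [Nonempty ι] [IsAlgClosed K] {T T' : ι → K}
    {X X' : ZMod 5 → K} {ρ ρ' s s' : K} (h : IsTuple 1 T X ρ)
    (hf : Free fun i : Option (Option ι) => i.elim s fun i => i.elim (X 0) T)
    (h' : IsTuple (-2) T' X' ρ')
    (hf' : Free fun i : Option (Option ι) => i.elim s' fun i => i.elim (X' 0) T') :
    Subfield.closure (insert s' (tupleField T' X' ρ' : Set K)) ≠
      Subfield.closure (insert s (tupleField T X ρ : Set K)) := fun he => by
  have hg : Free fun i : Option ι => i.elim (X 0) T := hf.comp (f := some) (Option.some_injective _)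
  have hg' : Free fun i : Option ι => i.elim (X' 0) T' := hf'.comp (f := some) (Option.some_injective _)
  have c1 : IsCoprime (1 : ℤ) 5 := isCoprime_one_left
  have c2 : IsCoprime (-2 : ℤ) 5 := ⟨2, 1, by norm_num⟩
  have h1 := h.tupleField_le_of_eq c2 hf h' hg' (le_trans (fun y hy => Subfield.subset_closure (.inr hy)) he.le)
  have h2 := h'.tupleField_le_of_eq c1 hf' h hg (le_trans (fun y hy => Subfield.subset_closure (.inr hy)) he.ge)
  have hκ := le_antisymm h1 h2
  refine h.tupleField_ne h' hg hg' (le_antisymm ?_ ?_) hκ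
  · refine cadj_le (fun c => algebraMap_mem_cadj c) ?_
    rintro _ ⟨i, rfl⟩
    refine h.mem_cadj hg (h1 (subset_tupleField.2.1 i)) ?_
    exact h.mem_acl_range c2 hg h' hg' (fun i => h1 (subset_tupleField.2.1 i))
      (fun i => h1 (subset_tupleField.2.2.1 i)) (h1 subset_tupleField.2.2.2) i
  · refine cadj_le (fun c => algebraMap_mem_cadj c) ?_
    rintro _ ⟨i, rfl⟩
    refine h'.mem_cadj hg' (h2 (subset_tupleField.2.1 i)) ?_
    exact h'.mem_acl_range c1 hg' h hg (fun i => h2 (subset_tupleField.2.1 i))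
      (fun i => h2 (subset_tupleField.2.2.1 i)) (h2 subset_tupleField.2.2.2) i

end Full

section Independence

variable {K ι : Type*} [Field K] [Algebra ℂ K]

open AlgebraicIndependent (matroid)

lemma free_of_algebraicIndependent {b : ι → K} (h : AlgebraicIndependent ℂ b) : Free b := by
  have h1 : (matroid ℂ K).Indep (Set.range b) := AlgebraicIndependent.matroid_indep_iff.2 (AlgebraicIndependent.coe_range h)
  rw [Matroid.indep_iff_forall_notMem_closure_sdiff] at h1
  intro i hi
  refine h1 (Set.mem_range_self i) ((matroid ℂ K).closure_subset_closure ?_ hi)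
  rintro _ ⟨j, hj, rfl⟩
  exact ⟨Set.mem_range_self j, fun e => hj (h.injective e)⟩

lemma Free.elim {b : ι → K} (h : Free b) {a : K} (ha : a ∉ acl (Set.range b)) :
    Free fun i : Option ι => i.elim a b := by
  rintro (_ | i) hi
  · refine ha (acl_mono ?_ hi)
    rintro _ ⟨_ | j, hj, rfl⟩
    · grind
    grind
  · have h1 := acl_exchange (h i) (y := a) (acl_mono ?_ hi)
    · refine ha (acl_mono ?_ h1)
      grind
    · rintro _ ⟨_ | j, hj, rfl⟩
      · grind
      grind

/-- A family of rank at least `card - 1` is free or has a free subfamily of that size. -/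
lemma exists_free_ne [Fintype ι] {b : ι → K}
    (hc : ∀ t : Set K, (∀ i, b i ∈ acl t) → (Fintype.card ι : ℕ∞) ≤ t.encard + 1)
    (hb : ¬ Free b) :
    ∃ i, Free (fun j : {j // j ≠ i} => b j) ∧ b i ∈ acl (Set.range fun j : {j // j ≠ i} => b j) := by
  classical
  obtain ⟨i, hi⟩ : ∃ i, b i ∈ acl (b '' {i}ᶜ) := by simpa [Free] using hb
  have himg : b '' {i}ᶜ = Set.range fun j : {j // j ≠ i} => b j := by
    ext x; simp
  refine ⟨i, fun j hj => ?_, himg ▸ hi⟩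
  set S : Set K := (fun j : {j // j ≠ i} => b j) '' {j}ᶜ
  have hS : b '' {i}ᶜ ⊆ acl S := by
    rw [himg]
    rintro _ ⟨l, rfl⟩
    by_cases hl : l = j
    · aesop
    · exact subset_acl _ ⟨l, hl, rfl⟩
  have h1 := hc S fun l => by
    by_cases hl : l = i
    · rw [hl]; exact acl_le hS hi
    · exact hS ⟨l, hl, rfl⟩
  have h2 : S.encard ≤ (Fintype.card {l : {j // j ≠ i} // l ≠ j} : ℕ∞) := by
    have : S = Set.range fun l : {l : {j // j ≠ i} // l ≠ j} => b l := by
      ext x; simp [S]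
    rw [this, ← Set.image_univ]
    refine (Set.encard_image_le _ _).trans ?_
    aesop
  rw [Fintype.card_subtype_compl, Fintype.card_subtype_compl] at h2
  simp only [Fintype.card_subtype_eq] at h2
  have h3 : 2 ≤ Fintype.card ι :=
    Fintype.one_lt_card_iff.2 ⟨i, j, fun e => j.2 e.symm⟩
  have h4 := h1.trans (add_le_add_left h2 1)
  norm_cast at h4
  omega

end Independence

section Residue

variable {K Ω : Type*} [Field K] [Field Ω] {V : ValuationSubring K} {φ : V →+* Ω} {a b : K}

open Classical in
/-- The residue map of a place, extended by zero. -/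
def res (φ : V →+* Ω) (a : K) : Ω := if h : a ∈ V then φ ⟨a, h⟩ else 0

lemma res_of_mem (h : a ∈ V) : res φ a = φ ⟨a, h⟩ := dif_pos h

lemma mem_of_res_ne (h : res φ a ≠ 0) : a ∈ V := by
  by_contra h'; exact h (dif_neg h')

lemma res_zero : res φ 0 = 0 := by
  rw [res_of_mem V.zero_mem]; exact map_zero φ

lemma res_one : res φ 1 = 1 := by
  rw [res_of_mem V.one_mem]; exact map_one φ

lemma res_add (ha : a ∈ V) (hb : b ∈ V) : res φ (a + b) = res φ a + res φ b := by
  rw [res_of_mem ha, res_of_mem hb, ← map_add, res_of_mem (add_mem ha hb)]; rfl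

lemma res_sub (ha : a ∈ V) (hb : b ∈ V) : res φ (a - b) = res φ a - res φ b := by
  rw [res_of_mem ha, res_of_mem hb, ← map_sub, res_of_mem (sub_mem ha hb)]; rfl

lemma res_mul (ha : a ∈ V) (hb : b ∈ V) : res φ (a * b) = res φ a * res φ b := by
  rw [res_of_mem ha, res_of_mem hb, ← map_mul, res_of_mem (mul_mem ha hb)]; rfl

lemma res_pow (ha : a ∈ V) (n : ℕ) : res φ (a ^ n) = res φ a ^ n := by
  rw [res_of_mem ha, ← map_pow, res_of_mem (pow_mem ha n)]; rfl

lemma res_ne_zero_iff [IsLocalHom φ] : res φ a ≠ 0 ↔ V.valuation a = 1 := by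
  by_cases h : a ∈ V
  · rw [res_of_mem h, map_ne_zero_iff_val]
  · rw [res, dif_neg h]
    refine iff_of_false (by simp) fun h' => h ((V.valuation_le_one_iff a).1 h'.le)

lemma res_ne_zero [IsLocalHom φ] (ha : a ∈ V) (ha' : a⁻¹ ∈ V) (h0 : a ≠ 0) : res φ a ≠ 0 := fun h => by
  have := res_mul (φ := φ) ha ha'
  rw [mul_inv_cancel₀ h0, res_one, h, zero_mul] at this
  grind

lemma inv_mem_of_res [IsLocalHom φ] (h : res φ a ≠ 0) : a⁻¹ ∈ V := by
  rw [← V.valuation_le_one_iff, map_inv₀, res_ne_zero_iff.1 h, inv_one]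

lemma ne_zero_of_res (h : res φ a ≠ 0) : a ≠ 0 := by
  rintro rfl; exact h res_zero

lemma res_inv [IsLocalHom φ] (h : res φ a ≠ 0) : res φ a⁻¹ = (res φ a)⁻¹ := by
  refine eq_inv_of_mul_eq_one_left ?_
  rw [← res_mul (inv_mem_of_res h) (mem_of_res_ne h), inv_mul_cancel₀ (ne_zero_of_res h), res_one]

lemma div_mem_of_res [IsLocalHom φ] (ha : a ∈ V) (h : res φ b ≠ 0) : a / b ∈ V :=
  div_eq_mul_inv a b ▸ mul_mem ha (inv_mem_of_res h)

lemma res_div [IsLocalHom φ] (ha : a ∈ V) (h : res φ b ≠ 0) : res φ (a / b) = res φ a / res φ b := by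
  rw [div_eq_mul_inv, res_mul ha (inv_mem_of_res h), res_inv h, div_eq_mul_inv]

/-- A nonunit inverse. -/
lemma res_inv_of_notMem [IsLocalHom φ] (h : a ∉ V) : a⁻¹ ∈ V ∧ res φ a⁻¹ = 0 := by
  have h1 : a⁻¹ ∈ V := (V.mem_or_inv_mem a).resolve_left h
  refine ⟨h1, by_contra fun h2 => h ?_⟩
  simpa using inv_mem_of_res h2

lemma range_eq_res (φ : V →+* Ω) : Set.range φ = res φ '' (V : Set K) := by
  ext x; constructor
  · rintro ⟨a, rfl⟩; exact ⟨a, a.2, res_of_mem a.2⟩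
  · rintro ⟨a, ha, rfl⟩; exact ⟨⟨a, ha⟩, (res_of_mem ha).symm⟩

end Residue

section Place

variable {K Ω ι κ : Type*} [Field K] [Algebra ℂ K] [Field Ω] [Algebra ℂ Ω] {V : ValuationSubring K}
  {φ : V →+* Ω}

/-- A place over `ℂ`. -/
structure IsPlace (φ : V →+* Ω) : Prop where
  isLocalHom : IsLocalHom φ
  const : ∀ c : ℂ, algebraMap ℂ K c ∈ V ∧ res φ (algebraMap ℂ K c) = algebraMap ℂ Ω c

lemma IsPlace.aeval (hφ : IsPlace φ) {x : ι → K} (hx : ∀ i, x i ∈ V) (p : MvPolynomial ι ℂ) :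
    aeval x p ∈ V ∧ res φ (aeval x p) = aeval (fun i => res φ (x i)) p := by
  induction p using MvPolynomial.induction_on with
  | C a => rw [algHom_C, algHom_C]; exact hφ.const a
  | add p q hp hq =>
    rw [map_add, map_add, res_add hp.1 hq.1, hp.2, hq.2]; exact ⟨add_mem hp.1 hq.1, rfl⟩
  | mul_X p i hp =>
    rw [map_mul, map_mul, aeval_X, aeval_X, res_mul hp.1 (hx i), hp.2]
    exact ⟨mul_mem hp.1 (hx i), rfl⟩

/-- The residue field is a subfield. -/
lemma IsPlace.exists_subfield (hφ : IsPlace φ) : ∃ F : Subfield Ω, (F : Set Ω) = Set.range φ ∧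
    ∀ c : ℂ, algebraMap ℂ Ω c ∈ F := by
  have := hφ.isLocalHom
  refine ⟨{ φ.range with inv_mem' := ?_ }, rfl, fun c => ?_⟩
  · rintro _ ⟨a, rfl⟩
    by_cases h : φ a = 0
    · exact ⟨0, by simp [h]⟩
    · rw [← res_of_mem (φ := φ) a.2] at h ⊢
      exact ⟨⟨_, inv_mem_of_res h⟩, by rw [← res_inv h, res_of_mem]⟩
  · exact ⟨⟨_, (hφ.const c).1⟩, (res_of_mem _).symm.trans (hφ.const c).2⟩

lemma IsPlace.cadj_le_range (hφ : IsPlace φ) {s : Set Ω} (hs : s ⊆ Set.range φ) :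
    (cadj s : Set Ω) ⊆ Set.range φ := by
  obtain ⟨F, hF, hC⟩ := hφ.exists_subfield
  rw [← hF] at hs ⊢
  exact cadj_le hC hs

/-- Places trivial on a free family are trivial on everything algebraic over it. -/
lemma acl_le_valuationSubring {x : ι → K} (hx : ∀ p : MvPolynomial ι ℂ, aeval x p ∈ V)
    (hx' : ∀ p : MvPolynomial ι ℂ, (aeval x p)⁻¹ ∈ V) : (acl (Set.range x) : Set K) ⊆ V := by
  have hF : (cadj (Set.range x) : Set K) ⊆ V := fun f hf => by
    obtain ⟨p, q, -, rfl⟩ := exists_aeval_div hf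
    rw [div_eq_mul_inv]; exact mul_mem (hx p) (hx' q)
  intro y hy
  have halg : IsAlgebraic (cadj (Set.range x)) y := isAlgebraic_of_mem_acl Subtype.val_injective
    (fun c => ⟨⟨_, algebraMap_mem_cadj c⟩, rfl⟩) (fun a ha => ⟨⟨a, subset_cadj _ ha⟩, rfl⟩) hy
  have hint : IsIntegral V y := by
    obtain ⟨P, hP, h0⟩ := halg.isIntegral
    refine ⟨P.map ((cadj (Set.range x)).subtype.codRestrict V.toSubring fun a => hF a.2), hP.map _, ?_⟩
    rw [Polynomial.eval₂_map]; exact h0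
  obtain ⟨z, hz⟩ := IsIntegrallyClosed.isIntegral_iff.1 hint
  exact hz ▸ z.2

lemma IsPlace.acl_le (hφ : IsPlace φ) {x : ι → K} (hx : ∀ i, x i ∈ V)
    (hf : Free fun i => res φ (x i)) : (acl (Set.range x) : Set K) ⊆ V := by
  have := hφ.isLocalHom
  refine acl_le_valuationSubring (fun p => (hφ.aeval hx p).1) fun p => ?_
  by_cases hp : p = 0
  · aesop
  · refine inv_mem_of_res (φ := φ) ?_
    rw [(hφ.aeval hx p).2]
    exact fun h => hp ((injective_iff_map_eq_zero _).1 hf.algebraicIndependent p h)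

/-- Lifts of free residues are free. -/
lemma IsPlace.free (hφ : IsPlace φ) {x : ι → K} (hx : ∀ i, x i ∈ V)
    (hf : Free fun i => res φ (x i)) : Free x := by
  refine free_of_algebraicIndependent ((injective_iff_map_eq_zero _).2 fun p hp => ?_)
  refine (injective_iff_map_eq_zero _).1 hf.algebraicIndependent p ?_
  rw [← (hφ.aeval hx p).2, hp, res_zero]

/-- `φ` is a place of codimension one which is finite on the coordinates `x` and whose center is a
divisor. -/
structure IsDiv [Fintype ι] (φ : V →+* Ω) (x : ι → K) : Prop where
  ne_top : V ≠ ⊤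
  mem : ∀ i, x i ∈ V
  card_le : ∀ t : Set Ω, (∀ i, res φ (x i) ∈ acl t) → (Fintype.card ι : ℕ∞) ≤ t.encard + 1

omit [Algebra ℂ K] in
lemma IsDiv.span [Fintype ι] {x y : ι → K} (h : IsDiv φ x) (hy : ∀ i, y i ∈ V)
    (hxy : ∀ i, res φ (x i) ∈ acl (Set.range fun i => res φ (y i))) : IsDiv φ y :=
  ⟨h.ne_top, hy, fun t ht => h.card_le t fun i => Cremona.acl_le (Set.range_subset_iff.2 ht) (hxy i)⟩

/-- A system of coordinates. -/
structure IsGen (x : ι → K) : Prop where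
  free : Free x
  mem : ∀ f : K, f ∈ cadj (Set.range x)

/-- In lowest terms. -/
lemma IsGen.exists_div {x : ι → K} (hx : IsGen x) (f : K) : ∃ p q : MvPolynomial ι ℂ,
    q ≠ 0 ∧ aeval x q ≠ 0 ∧ f = aeval x p / aeval x q ∧ IsRelPrime p q := by
  obtain ⟨p, q, h0, rfl⟩ := exists_aeval_div (hx.mem f)
  have hq : q ≠ 0 := by grind
  obtain ⟨p', q', c, hrel, rfl, rfl⟩ :=
    UniqueFactorizationMonoid.exists_reduced_factors' p q hq
  grind

lemma IsDiv.not_free [Fintype ι] (hφ : IsPlace φ) {x : ι → K} (hx : IsGen x) (h : IsDiv φ x) :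
    ¬ Free fun i => res φ (x i) := fun hf => by
  refine h.ne_top (top_unique fun f _ => ?_)
  exact hφ.acl_le h.mem hf (cadj_le_acl (hx.mem f))

end Place

section Divisor

variable {K Ω ι κ : Type*} [Field K] [Algebra ℂ K] [Field Ω] [Algebra ℂ Ω] {V : ValuationSubring K}
  {φ : V →+* Ω}

/-- A divisorial center is the zero set of a prime polynomial. -/
lemma exists_prime_ker [Fintype ι] {r : ι → Ω} (hr : ¬ Free r)
    (hc : ∀ t : Set Ω, (∀ i, r i ∈ acl t) → (Fintype.card ι : ℕ∞) ≤ t.encard + 1) :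
    ∃ u : MvPolynomial ι ℂ, Prime u ∧ ∀ p, aeval r p = 0 ↔ u ∣ p := by
  classical
  have hP : RingHom.ker (aeval (R := ℂ) r) ≠ ⊥ := fun h => hr (free_of_algebraicIndependent
    ((RingHom.injective_iff_ker_eq_bot _).2 h))
  obtain ⟨u, huP, hu⟩ := (RingHom.ker_isPrime (aeval (R := ℂ) r)).exists_mem_prime_of_ne_bot hP
  rw [RingHom.mem_ker] at huP
  refine ⟨u, hu, fun p => ⟨fun hp => by_contra fun hnd => ?_, ?_⟩⟩
  swap
  · rintro ⟨q, rfl⟩; rw [map_mul, huP, zero_mul]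
  have hprime : (Ideal.span {u}).IsPrime := (Ideal.span_singleton_prime hu.ne_zero).2 hu
  set B := MvPolynomial ι ℂ ⧸ Ideal.span {u} with hB
  set L := FractionRing B
  set y : ι → L := fun i => algebraMap B L (Ideal.Quotient.mk _ (X i))
  have hy : ∀ q, aeval y q = algebraMap B L (Ideal.Quotient.mk _ q) := fun q => by
    have : aeval (R := ℂ) y = (Algebra.algHom ℂ B L).comp (Ideal.Quotient.mkₐ ℂ (Ideal.span {u})) :=
      MvPolynomial.algHom_ext fun i => by simp [y]; rfl
    rw [this]; rfl
  have hinj : Function.Injective (algebraMap B L) := IsFractionRing.injective B L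
  have hy0 : ∀ q, aeval y q = 0 ↔ u ∣ q := fun q => by
    rw [hy, map_eq_zero_iff _ hinj, Ideal.Quotient.eq_zero_iff_mem, Ideal.mem_span_singleton]
  set f : B →+* Ω := Ideal.Quotient.lift (Ideal.span {u}) (aeval (R := ℂ) r).toRingHom (fun a ha => by
    obtain ⟨c, rfl⟩ := Ideal.mem_span_singleton.1 ha
    simp [huP])
  have := RingHom.ker_isPrime f
  obtain ⟨W, hW⟩ := exists_valuationSubring hinj (RingHom.ker f)
  have hWy : ∀ q, aeval y q ∈ W ∧ (W.valuation (aeval y q) = 1 ↔ aeval r q ≠ 0) := fun q => by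
    rw [hy]
    refine ⟨(hW _).1, (hW _).2.trans (not_congr ?_)⟩
    rw [RingHom.mem_ker]; rfl
  obtain ⟨i, hi, hri⟩ := exists_free_ne hc hr
  have hren : ∀ q, aeval (R := ℂ) (fun j : {j // j ≠ i} => y j) q = aeval y (rename Subtype.val q) := fun q => by
    rw [aeval_rename]; rfl
  have hne : ∀ q : MvPolynomial {j // j ≠ i} ℂ, q ≠ 0 → aeval r (rename Subtype.val q) ≠ 0 := fun q hq h => by
    rw [aeval_rename] at h
    exact hq ((injective_iff_map_eq_zero _).1 hi.algebraicIndependent q h)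
  have hsub := acl_le_valuationSubring (V := W) (x := fun j : {j // j ≠ i} => y j)
    (fun q => hren q ▸ (hWy _).1) fun q => by
      by_cases hq : q = 0
      · simp [hq, W.zero_mem]
      · rw [hren, ← W.valuation_le_one_iff, map_inv₀, (hWy _).2.2 (hne q hq), inv_one]
  have hfree : Free fun j : {j // j ≠ i} => y j := by
    refine free_of_algebraicIndependent ((injective_iff_map_eq_zero _).2 fun q hq => by_contra fun h => ?_)
    rw [hren, hy0] at hq
    obtain ⟨c, hc⟩ := hq
    exact hne q h (by rw [hc, map_mul, huP, zero_mul])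
  have hyi : y i ∈ acl (Set.range fun j : {j // j ≠ i} => y j) := by
    by_contra h
    have h1 := (hfree.elim h).comp (f := fun j => if h : j = i then none else some ⟨j, h⟩) (by
      intro a b hab
      by_cases ha : a = i <;> by_cases hb : b = i <;> simp_all)
    have h2 : Free y := by
      convert h1 using 1
      ext j
      by_cases hj : j = i <;> simp [hj]
    exact hu.ne_zero ((injective_iff_map_eq_zero _).1 h2.algebraicIndependent u ((hy0 u).2 dvd_rfl))
  have hall : ∀ j, y j ∈ acl (Set.range fun j : {j // j ≠ i} => y j) := fun j => by
    by_cases hj : j = i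
    · rw [hj]; exact hyi
    · exact subset_acl _ ⟨⟨j, hj⟩, rfl⟩
  have hpin : aeval y p ∈ acl (Set.range fun j : {j // j ≠ i} => y j) :=
    Cremona.acl_le (Set.range_subset_iff.2 hall)
      (cadj_le_acl (aeval_mem_cadj (fun j => subset_cadj _ (Set.mem_range_self j)) p))
  have h1 := hsub (inv_mem hpin)
  refine (hWy p).2.1 (le_antisymm ?_ ?_) hp
  · exact (W.valuation_le_one_iff _).2 (hsub hpin)
  · have h2 := (W.valuation_le_one_iff _).2 h1
    rw [map_inv₀] at h2
    have h0 : aeval y p ≠ 0 := fun h => hnd ((hy0 p).1 h)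
    exact (inv_le_one₀ (zero_lt_iff.2 (by simpa using h0))).1 h2

lemma IsDiv.exists_prime [Fintype ι] (hφ : IsPlace φ) {x : ι → K} (hx : IsGen x) (h : IsDiv φ x) :
    ∃ u : MvPolynomial ι ℂ, Prime u ∧ ∀ p, res φ (aeval x p) = 0 ↔ u ∣ p := by
  obtain ⟨u, hu, hp⟩ := exists_prime_ker (h.not_free hφ hx) h.card_le
  exact ⟨u, hu, fun p => by rw [(hφ.aeval h.mem p).2, hp]⟩

/-- Elements of the local ring of a divisor. -/
lemma mem_iff_of_prime {x : ι → K} (hx : IsGen x) (hφ : IsPlace φ) (hV : ∀ i, x i ∈ V)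
    {u : MvPolynomial ι ℂ} (hu : Prime u) (h : ∀ p, res φ (aeval x p) = 0 ↔ u ∣ p) (f : K) :
    f ∈ V ↔ ∃ p q : MvPolynomial ι ℂ, ¬ u ∣ q ∧ f = aeval x p / aeval x q := by
  have := hφ.isLocalHom
  constructor
  · intro hf
    obtain ⟨p, q, -, hq, e, hrel⟩ := hx.exists_div f
    refine ⟨p, q, fun huq => hu.not_isUnit (hrel ?_ huq), e⟩
    rw [← h]
    rw [eq_div_iff hq] at e
    rw [← e, res_mul hf (hφ.aeval hV q).1, (h q).2 huq, mul_zero]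
  · rintro ⟨p, q, hq, rfl⟩
    exact div_mem_of_res (hφ.aeval hV p).1 (mt (h q).1 hq)

lemma IsDiv.range_eq [Fintype ι] (hφ : IsPlace φ) {x : ι → K} (hx : IsGen x) (h : IsDiv φ x) :
    Set.range φ = cadj (Set.range fun i => res φ (x i)) := by
  have := hφ.isLocalHom
  obtain ⟨u, hu, hp⟩ := h.exists_prime hφ hx
  refine Set.Subset.antisymm ?_ (hφ.cadj_le_range ?_)
  · rw [range_eq_res]
    rintro _ ⟨f, hf, rfl⟩
    obtain ⟨p, q, hq, rfl⟩ := (mem_iff_of_prime hx hφ h.mem hu hp f).1 hf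
    rw [res_div (hφ.aeval h.mem p).1 (mt (hp q).1 hq), (hφ.aeval h.mem p).2, (hφ.aeval h.mem q).2]
    have hm : ∀ i, res φ (x i) ∈ cadj (Set.range fun i => res φ (x i)) :=
      fun i => subset_cadj _ (Set.mem_range_self i)
    exact div_mem (aeval_mem_cadj hm p) (aeval_mem_cadj hm q)
  · rintro _ ⟨i, rfl⟩
    exact ⟨⟨_, h.mem i⟩, (res_of_mem _).symm⟩

/-- Only finitely many divisors contain a given element in their center. -/
lemma finite_isDiv [Fintype ι] {x : ι → K} (hx : IsGen x) {f : MvPolynomial ι ℂ} (hf : f ≠ 0) :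
    {V : ValuationSubring K | ∃ φ : V →+* Ω, IsPlace φ ∧ IsDiv φ x ∧ res φ (aeval x f) = 0}.Finite := by
  classical
  set W : MvPolynomial ι ℂ → Set K := fun u => {g | ∃ p q : MvPolynomial ι ℂ, ¬ u ∣ q ∧
    g = aeval x p / aeval x q}
  refine Set.Finite.of_finite_image (f := fun V : ValuationSubring K => (V : Set K)) ?_
    SetLike.coe_injective.injOn
  refine ((UniqueFactorizationMonoid.factors f).toFinset.finite_toSet.image W).subset ?_
  rintro _ ⟨V, ⟨φ, hφ, h, h0⟩, rfl⟩
  obtain ⟨u, hu, hp⟩ := h.exists_prime hφ hx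
  obtain ⟨q, hq, hass⟩ := UniqueFactorizationMonoid.exists_mem_factors_of_dvd hf
    hu.irreducible ((hp f).1 h0)
  refine ⟨q, by grind, ?_⟩
  ext g
  refine Iff.trans ?_ (mem_iff_of_prime hx hφ h.mem hu hp g).symm
  simp only [W, Set.mem_ofPred_eq, hass.dvd_iff_dvd_left]

/-- Being divisorial depends only on the valuation ring. -/
lemma IsDiv.congr [Fintype ι] {x : ι → K} (hx : IsGen x) {φ' : V →+* Ω} (hφ : IsPlace φ)
    (hφ' : IsPlace φ') (h : IsDiv φ x) : IsDiv φ' x := by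
  have := hφ.isLocalHom
  have := hφ'.isLocalHom
  refine ⟨h.ne_top, h.mem, fun t ht => ?_⟩
  obtain ⟨i, hi, -⟩ := exists_free_ne h.card_le (h.not_free hφ hx)
  have h1 : Free fun j : {j // j ≠ i} => res φ' (x j) := by
    refine free_of_algebraicIndependent ((injective_iff_map_eq_zero _).2 fun p hp => ?_)
    refine (injective_iff_map_eq_zero _).1 hi.algebraicIndependent p ?_
    rw [← (hφ.aeval (fun j : {j // j ≠ i} => h.mem j) p).2]
    rw [← (hφ'.aeval (fun j : {j // j ≠ i} => h.mem j) p).2] at hp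
    by_contra h2
    exact (res_ne_zero_iff (φ := φ')).2 (res_ne_zero_iff.1 h2) hp
  classical
  have h2 := h1.card_le (t := t) fun j => ht j
  aesop

/-- Almost all divisors of one model are divisors of another. -/
lemma finite_not_isDiv [Fintype ι] [Finite κ] {x : ι → K} (hx : IsGen x) {y : κ → K} [Fintype κ]
    (hy : IsGen y) (e : ι ≃ κ) :
    {V : ValuationSubring K | ∃ φ : V →+* Ω, IsPlace φ ∧ IsDiv φ x ∧ ¬ IsDiv φ y}.Finite := by
  choose a b hb0 hb hab _ using fun i => hx.exists_div (y i)
  choose c d hd0 hd hcd _ using fun i => hy.exists_div (x i)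
  choose a' b' hb0' hb' hab' _ using fun i => hx.exists_div (aeval y (d i))
  have ha' : ∀ i, a' i ≠ 0 := fun i h => hd i (by grind)
  set f : MvPolynomial ι ℂ := (∏ i, b i) * ((∏ i, b' i) * ∏ i, a' i)
  have hf : f ≠ 0 := mul_ne_zero (Finset.prod_ne_zero_iff.2 fun i _ => hb0 i)
    (mul_ne_zero (Finset.prod_ne_zero_iff.2 fun i _ => hb0' i) (Finset.prod_ne_zero_iff.2 fun i _ => ha' i))
  refine (finite_isDiv (Ω := Ω) hx hf).subset ?_
  rintro V ⟨φ, hφ, h, hny⟩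
  have := hφ.isLocalHom
  refine ⟨φ, hφ, h, by_contra fun hne => hny ?_⟩
  have hdvd : ∀ g, g ∣ f → res φ (aeval x g) ≠ 0 := by
    rintro g ⟨k, hk⟩ h0
    refine hne ?_
    rw [hk, map_mul, res_mul (hφ.aeval h.mem g).1 (hφ.aeval h.mem k).1, h0, zero_mul]
  have h1 : ∀ i, res φ (aeval x (b i)) ≠ 0 := fun i =>
    hdvd _ (dvd_mul_of_dvd_left (Finset.dvd_prod_of_mem _ (Finset.mem_univ i)) _)
  have h2 : ∀ i, res φ (aeval x (b' i)) ≠ 0 := fun i =>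
    hdvd _ (dvd_mul_of_dvd_right (dvd_mul_of_dvd_left (Finset.dvd_prod_of_mem _ (Finset.mem_univ i)) _) _)
  have h3 : ∀ i, res φ (aeval x (a' i)) ≠ 0 := fun i =>
    hdvd _ (dvd_mul_of_dvd_right (dvd_mul_of_dvd_right (Finset.dvd_prod_of_mem _ (Finset.mem_univ i)) _) _)
  have hyV : ∀ i, y i ∈ V := fun i => hab i ▸ div_mem_of_res (hφ.aeval h.mem _).1 (h1 i)
  have h4 : ∀ i, res φ (aeval y (d i)) ≠ 0 := fun i => by
    rw [hab' i, res_div (hφ.aeval h.mem _).1 (h2 i)]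
    grind
  refine IsDiv.mk h.ne_top hyV fun t ht => ?_
  rw [← Fintype.card_congr e]
  refine h.card_le t fun i => ?_
  rw [hcd i, res_div (hφ.aeval hyV _).1 (h4 i), (hφ.aeval hyV _).2, (hφ.aeval hyV _).2]
  have hm : ∀ p : MvPolynomial κ ℂ, aeval (fun i => res φ (y i)) p ∈ acl t := fun p =>
    Cremona.acl_le (Set.range_subset_iff.2 ht)
      (cadj_le_acl (aeval_mem_cadj (fun j => subset_cadj _ (Set.mem_range_self j)) p))
  exact div_mem (hm _) (hm _)

end Divisor

section Count

/-- A set moved by a finite amount under each element of a group defines a homomorphism to `ℤ`. -/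
lemma exists_hom {G S : Type*} [Group G] (σ : G → S ≃ S) (hσ : ∀ g h v, σ (g * h) v = σ h (σ g v))
    (D : Set S) (hfin : ∀ g, {v | v ∈ D ∧ σ g v ∉ D}.Finite) :
    ∃ χ : G →* Multiplicative ℤ, (∀ g, (∀ v, v ∈ D ↔ σ g v ∈ D) → χ g = 1) ∧
      ∀ g, (∀ v, σ g v ∈ D → v ∈ D) → (∃ v ∈ D, σ g v ∉ D) → χ g ≠ 1 := by
  classical
  have h1 : ∀ v, σ 1 v = v := fun v => (σ 1).injective (by grind)
  set d : G → S → ℤ := fun g v => (if v ∈ D then 1 else 0) - if σ g v ∈ D then 1 else 0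
  have hd : ∀ g, (Function.support (d g)).Finite := fun g => by
    refine ((hfin g).union ((hfin g⁻¹).preimage (f := σ g) (σ g).injective.injOn)).subset fun v hv => ?_
    rw [Function.mem_support] at hv
    have h2 : σ g⁻¹ (σ g v) = v := by rw [← hσ, mul_inv_cancel, h1]
    grind
  have hmul : ∀ g h, ∑ᶠ v, d (g * h) v = ∑ᶠ v, d g v + ∑ᶠ v, d h v := fun g h => by
    rw [← finsum_comp_equiv (σ g) (f := d h), ← finsum_add_distrib (hd g)
      ((hd h).preimage (f := σ g) (σ g).injective.injOn)]
    grind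
  refine ⟨MonoidHom.mk' (fun g => Multiplicative.ofAdd (∑ᶠ v, d g v)) fun g h => by
    aesop, fun g hg => ?_, fun g hg ⟨v, hv, hv'⟩ => ?_⟩
  · rw [MonoidHom.mk'_apply, ofAdd_eq_one]
    exact finsum_eq_zero_of_forall_eq_zero fun v => by grind
  · rw [MonoidHom.mk'_apply, Ne, ofAdd_eq_one]
    refine ne_of_gt ?_
    refine finsum_pos (fun w => ?_) ⟨v, by grind⟩ (hd g)
    grind

end Count

section Comap

variable {K K' Ω ι κ : Type*} [Field K] [Algebra ℂ K] [Field K'] [Algebra ℂ K'] [Field Ω] [Algebra ℂ Ω]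
  {V : ValuationSubring K} {φ : V →+* Ω}

/-- The restriction of a place along a field homomorphism. -/
def comapPlace (g : K' →ₐ[ℂ] K) (φ : V →+* Ω) : V.comap (g : K' →+* K) →+* Ω :=
  φ.comp ((g : K' →+* K).restrict (V.comap (g : K' →+* K)).toSubring V.toSubring fun _ h => h)

omit [Algebra ℂ Ω] in
lemma res_comapPlace (g : K' →ₐ[ℂ] K) (φ : V →+* Ω) (a : K') :
    res (comapPlace g φ) a = res φ (g a) := by
  aesop

omit [Algebra ℂ K] [Algebra ℂ Ω] in
lemma isLocalHom_of_res (h : ∀ a ∈ V, res φ a ≠ 0 → a⁻¹ ∈ V) : IsLocalHom φ := by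
  refine ⟨fun a ha => ?_⟩
  have h0 : res φ a ≠ 0 := by rw [res_of_mem a.2]; aesop
  exact IsUnit.of_mul_eq_one ⟨_, h a a.2 h0⟩ (Subtype.ext (mul_inv_cancel₀ (ne_zero_of_res h0)))

lemma IsPlace.comap (hφ : IsPlace φ) (g : K' →ₐ[ℂ] K) : IsPlace (comapPlace g φ) := by
  have := hφ.isLocalHom
  refine ⟨isLocalHom_of_res fun a _ h => ?_, fun c => ?_⟩
  · rw [res_comapPlace] at h
    rw [ValuationSubring.mem_comap, RingHom.coe_coe, map_inv₀]
    exact inv_mem_of_res h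
  · rw [res_comapPlace, ValuationSubring.mem_comap, RingHom.coe_coe, g.commutes]
    exact hφ.const c

omit [Algebra ℂ Ω] in
lemma range_comapPlace (g : K' ≃ₐ[ℂ] K) (φ : V →+* Ω) :
    Set.range (comapPlace (g : K' →ₐ[ℂ] K) φ) = Set.range φ := by
  rw [range_eq_res, range_eq_res]
  ext y; constructor
  · rintro ⟨a, ha, rfl⟩; exact ⟨g a, ha, (res_comapPlace (g : K' →ₐ[ℂ] K) φ a).symm⟩
  · rintro ⟨a, ha, rfl⟩
    exact ⟨g.symm a, by aesop, by
      rw [res_comapPlace (g : K' →ₐ[ℂ] K) φ]; simp⟩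

lemma IsDiv.comap [Fintype ι] {x : ι → K'} (g : K' ≃ₐ[ℂ] K) (h : IsDiv φ (g ∘ x)) :
    IsDiv (comapPlace (g : K' →ₐ[ℂ] K) φ) x := by
  refine ⟨fun htop => h.ne_top (top_unique fun a _ => ?_), h.mem, fun t ht => h.card_le t fun i => ?_⟩
  · have : g.symm a ∈ V.comap ((g : K' →ₐ[ℂ] K) : K' →+* K) := htop ▸ ValuationSubring.mem_top _
    simpa using this
  · have := ht i
    rwa [res_comapPlace] at this

lemma IsGen.comp {x : ι → K'} (hx : IsGen x) (g : K' ≃ₐ[ℂ] K) : IsGen (g ∘ x) := by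
  refine ⟨free_of_algebraicIndependent ?_, fun f => ?_⟩
  · exact hx.free.algebraicIndependent.map' (f := (g : K' →ₐ[ℂ] K)) g.injective
  · have h1 : cadj (Set.range x) ≤ (cadj (Set.range (g ∘ x))).comap ((g : K' →ₐ[ℂ] K) : K' →+* K) := by
      refine cadj_le (fun c => ?_) ?_
      · rw [Subfield.mem_comap, RingHom.coe_coe, AlgHom.commutes]; exact algebraMap_mem_cadj c
      · rintro _ ⟨i, rfl⟩; exact subset_cadj _ ⟨i, rfl⟩
    simpa using h1 (hx.mem (g.symm f))

/-- The residue field is generated over a type-one tuple field by a transcendental element. -/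
def Good (m : ℕ) (φ : V →+* Ω) : Prop :=
  ∃ (T : Fin m → Ω) (X : ZMod 5 → Ω) (ρ s : Ω), IsTuple 1 T X ρ ∧
    (Free fun i : Option (Option (Fin m)) => i.elim s fun i => i.elim (X 0) T) ∧
    Set.range φ = Subfield.closure (insert s (tupleField T X ρ : Set Ω))

variable (Ω) in
/-- The divisors of a model with the prescribed residue field. -/
def DivSet (m : ℕ) [Fintype ι] (x : ι → K) : Set (ValuationSubring K) :=
  {V | ∃ φ : V →+* Ω, IsPlace φ ∧ Good m φ ∧ IsDiv φ x}

lemma mem_divSet_of_comp {m : ℕ} [Fintype ι] {x : ι → K'} (g : K' ≃ₐ[ℂ] K)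
    (h : V ∈ DivSet Ω m (g ∘ x)) : V.comap ((g : K' →ₐ[ℂ] K) : K' →+* K) ∈ DivSet Ω m x := by
  obtain ⟨φ, h1, h2, h3⟩ := h
  refine ⟨comapPlace (g : K' →ₐ[ℂ] K) φ, h1.comap (g : K' →ₐ[ℂ] K), ?_, h3.comap g⟩
  unfold Good
  rw [range_comapPlace]
  exact h2

lemma comap_mem_divSet {m : ℕ} [Fintype ι] {x : ι → K'} (g : K' ≃ₐ[ℂ] K) :
    V.comap ((g : K' →ₐ[ℂ] K) : K' →+* K) ∈ DivSet Ω m x ↔ V ∈ DivSet Ω m (g ∘ x) := by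
  refine ⟨fun h => ?_, mem_divSet_of_comp g⟩
  have h1 : x = g.symm ∘ (g ∘ x) := by ext i; simp
  rw [h1] at h
  have := mem_divSet_of_comp g.symm h
  convert this using 1
  ext a
  simp [ValuationSubring.mem_comap]

end Comap

/-- The action of automorphisms on valuation rings. -/
def comapEquiv {K : Type*} [Field K] [Algebra ℂ K] (g : K ≃ₐ[ℂ] K) :
    ValuationSubring K ≃ ValuationSubring K where
  toFun V := V.comap ((g : K →ₐ[ℂ] K) : K →+* K)
  invFun V := V.comap ((g.symm : K →ₐ[ℂ] K) : K →+* K)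
  left_inv V := by ext; simp
  right_inv V := by ext; simp

/-- Counting divisors with a given residue field obstructs surjectivity on abelianizations. -/
theorem not_surjective_of_divSet {K : Type*} [Field K] [Algebra ℂ K] {G ι Ω : Type*} [Group G]
    [Field Ω] [Algebra ℂ Ω] [Fintype ι] (m : ℕ) {x : ι → K} (hx : IsGen x)
    (f : G →* (K ≃ₐ[ℂ] K))
    (hf : ∀ (g : G) (V : ValuationSubring K) (φ : V →+* Ω), IsPlace φ → Good m φ → IsDiv φ x →
      IsDiv φ (f g ∘ x))
    (ψ : K ≃ₐ[ℂ] K)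
    (h1 : ∃ V : ValuationSubring K, V ∈ DivSet Ω m x ∧ V ∉ DivSet Ω m (ψ ∘ x))
    (h2 : ∀ (V : ValuationSubring K) (φ : V →+* Ω), IsPlace φ → Good m φ → IsDiv φ x →
      IsDiv φ (ψ.symm ∘ x)) :
    ¬ Function.Surjective (Abelianization.map f) := by
  obtain ⟨χ, hχ, hχ'⟩ := exists_hom (comapEquiv (K := K)) (fun g h V => by
    aesop) (DivSet Ω m x) (fun g => by
    refine (finite_not_isDiv (Ω := Ω) hx (hx.comp g) (Equiv.refl _)).subset ?_
    rintro V ⟨⟨φ, ha, hb, hc⟩, hn⟩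
    exact ⟨φ, ha, hc, fun hd => hn ((comap_mem_divSet g).2 ⟨φ, ha, hb, hd⟩)⟩)
  intro hsurj
  obtain ⟨a, ha⟩ := hsurj (Abelianization.of ψ)
  obtain ⟨g, rfl⟩ := QuotientGroup.mk'_surjective _ a
  have h3 : χ (f g) = χ ψ := by
    have := congrArg (Abelianization.lift χ) ha
    rw [Abelianization.lift_apply_of] at this
    rw [← this, ← Abelianization.lift_apply_of χ (f g), ← Abelianization.map_of f g]
    rfl
  refine hχ' ψ (fun V hV => ?_) ?_ (h3 ▸ hχ (f g) fun V => ?_)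
  · obtain ⟨φ, ha, hb, hc⟩ := hV
    have h4 : comapEquiv ψ V ∈ DivSet Ω m (ψ.symm ∘ x) := ⟨φ, ha, hb, h2 _ φ ha hb hc⟩
    have := (comap_mem_divSet ψ.symm).2 h4
    convert this using 1
    ext; simp [comapEquiv]
  · obtain ⟨V, hV, hV'⟩ := h1
    exact ⟨V, hV, fun h => hV' ((comap_mem_divSet ψ).1 h)⟩
  · have key : ∀ (g : G) V, V ∈ DivSet Ω m x → V ∈ DivSet Ω m (f g ∘ x) :=
      fun g V ⟨φ, ha, hb, hc⟩ => ⟨φ, ha, hb, hf g V φ ha hb hc⟩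
    refine (show _ ↔ V ∈ DivSet Ω m (f g ∘ x) from ⟨key g V, fun h => ?_⟩).trans (comap_mem_divSet _).symm
    have h4 := key g⁻¹ _ ((comap_mem_divSet (f g)).2 h)
    have h5 := (comap_mem_divSet (f g)).1 h4
    rwa [show f g ∘ f g⁻¹ ∘ x = x by ext i; simp] at h5

section Extend

variable {K L Ω : Type*} [Field K] [Algebra ℂ K] [Field L] [Algebra ℂ L] [Algebra K L]
  [IsScalarTower ℂ K L] [Field Ω] [Algebra ℂ Ω] {V : ValuationSubring K} {φ : V →+* Ω}

omit [Algebra ℂ K] in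
lemma exists_smul_mem {P : Polynomial K} (hP : P ≠ 0) :
    ∃ i, P.coeff i ≠ 0 ∧ ∀ j, P.coeff j / P.coeff i ∈ V := by
  obtain ⟨i, hi, hmax⟩ := P.support.exists_max_image (fun i => V.valuation (P.coeff i))
    (Polynomial.support_nonempty.2 hP)
  have h0 := Polynomial.mem_support_iff.1 hi
  refine ⟨i, h0, fun j => ?_⟩
  rw [← V.valuation_le_one_iff, map_div₀]
  refine div_le_one_of_le₀ ?_ zero_le
  by_cases hj : P.coeff j = 0
  · simp [hj]
  grind

omit [Algebra ℂ K] [Algebra ℂ L] [IsScalarTower ℂ K L] in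
lemma residue_isAlgebraic [Algebra.IsAlgebraic K L] {W : ValuationSubring L} {f : V →+* W}
    (hf : ∀ a, (f a : L) = algebraMap K L a) [IsLocalHom f] (b : W) :
    ∃ Q : Polynomial (IsLocalRing.ResidueField V), Q ≠ 0 ∧
      Q.eval₂ (IsLocalRing.ResidueField.map f) (IsLocalRing.residue W b) = 0 := by
  obtain ⟨P, hP, h0⟩ := Algebra.IsAlgebraic.isAlgebraic (R := K) (b : L)
  obtain ⟨i, hi, hV⟩ := exists_smul_mem (V := V) hP
  set R : Polynomial V := ∑ j ∈ P.support, Polynomial.monomial j ⟨_, hV j⟩ with hR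
  have hcoeff : ∀ j, R.coeff j = ⟨_, hV j⟩ := fun j => by
    simp only [hR, Polynomial.finsetSum_coeff, Polynomial.coeff_monomial, Finset.sum_ite_eq']
    split_ifs with h
    · rfl
    · rw [Polynomial.notMem_support_iff] at h
      exact Subtype.ext (by simp [h])
  have hRP : R.map V.subtype = Polynomial.C (P.coeff i)⁻¹ * P := by
    ext j
    rw [Polynomial.coeff_map, hcoeff, Polynomial.coeff_C_mul, inv_mul_eq_div]; rfl
  refine ⟨R.map (IsLocalRing.residue V), fun h => ?_, ?_⟩
  · have := congrArg (Polynomial.coeff · i) h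
    simp only [Polynomial.coeff_map, hcoeff, Polynomial.coeff_zero] at this
    rw [show (⟨_, hV i⟩ : V) = 1 from Subtype.ext (div_self hi), map_one] at this
    grind
  · rw [Polynomial.eval₂_map, IsLocalRing.ResidueField.map_comp_residue, ← Polynomial.hom_eval₂]
    have : R.eval₂ f b = 0 := by
      apply Subtype.val_injective
      change W.subtype (R.eval₂ f b) = 0
      rw [Polynomial.hom_eval₂]
      have h1 : W.subtype.comp f = (algebraMap K L).comp V.subtype := RingHom.ext hf
      rw [h1, ← Polynomial.eval₂_map, hRP, Polynomial.eval₂_mul]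
      rw [Polynomial.aeval_def] at h0
      aesop
    grind

/-- Places extend to algebraic extensions. -/
lemma IsPlace.exists_extend [Algebra.IsAlgebraic K L] [IsAlgClosed Ω] (hφ : IsPlace φ) :
    ∃ (W : ValuationSubring L) (θ : W →+* Ω), IsPlace θ ∧
      ∀ a ∈ V, algebraMap K L a ∈ W ∧ res θ (algebraMap K L a) = res φ a := by
  have := hφ.isLocalHom
  obtain ⟨W, h, hl⟩ := IsLocalRing.exists_factor_valuationRing ((algebraMap K L).comp V.subtype)
  set f : V →+* W := ((algebraMap K L).comp V.subtype).codRestrict W.toSubring h with hf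
  have : IsLocalHom f := hl
  let _ : Algebra (IsLocalRing.ResidueField V) (IsLocalRing.ResidueField W) :=
    (IsLocalRing.ResidueField.map f).toAlgebra
  let _ : Algebra (IsLocalRing.ResidueField V) Ω := (IsLocalRing.ResidueField.lift φ).toAlgebra
  have halg : Algebra.IsAlgebraic (IsLocalRing.ResidueField V) (IsLocalRing.ResidueField W) := by
    refine ⟨fun b => ?_⟩
    obtain ⟨b, rfl⟩ := IsLocalRing.residue_surjective b
    exact residue_isAlgebraic (f := f) (fun a => rfl) b
  let g : IsLocalRing.ResidueField W →ₐ[IsLocalRing.ResidueField V] Ω := IsAlgClosed.lift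
  set θ : W →+* Ω := (g : IsLocalRing.ResidueField W →+* Ω).comp (IsLocalRing.residue W) with hθ
  have hres : ∀ a ∈ V, algebraMap K L a ∈ W ∧ res θ (algebraMap K L a) = res φ a := fun a ha => by
    refine ⟨h ⟨a, ha⟩, ?_⟩
    rw [res_of_mem ha]
    refine (res_of_mem (V := W) (a := algebraMap K L a) (h ⟨a, ha⟩)).trans ?_
    exact g.commutes (IsLocalRing.residue V ⟨a, ha⟩)
  refine ⟨W, θ, ⟨RingHom.isLocalHom_comp _ _, fun c => ?_⟩, hres⟩
  have := hres _ (hφ.const c).1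
  rwa [← IsScalarTower.algebraMap_apply, (hφ.const c).2] at this

end Extend

section Rank

variable {L Ω : Type*} [Field L] [Algebra ℂ L] [Field Ω] [Algebra ℂ Ω] {W : ValuationSubring L}
  {θ : W →+* Ω}

open AlgebraicIndependent (matroid)

/-- A place nontrivial on an algebraically closed subfield drops its transcendence degree. -/
lemma IsPlace.exists_encard_le (hθ : IsPlace θ) {S : Set L} {d : ℕ} (hS : S.encard ≤ d + 1)
    (hW : ¬ (acl S : Set L) ⊆ W) :
    ∃ t : Set Ω, t.encard ≤ d ∧ ∀ a ∈ acl S, a ∈ W → res θ a ∈ acl t := by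
  classical
  obtain ⟨B, hB⟩ := (matroid ℂ Ω).exists_isBasis (res θ '' {a | a ∈ acl S ∧ a ∈ W}) (Set.subset_univ _)
  refine ⟨B, by_contra fun h => hW ?_, fun a ha haW => hB.subset_closure ⟨a, ⟨ha, haW⟩, rfl⟩⟩
  obtain ⟨B', hB', hcard⟩ := Set.exists_subset_encard_eq (s := B) (k := (d + 1 : ℕ)) (by
    push_cast; exact Order.add_one_le_of_lt (not_le.1 h))
  choose l hl hl' using fun b : B' => hB.subset (hB' b.2)
  have hind : (matroid ℂ Ω).Indep B' := hB.indep.subset hB'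
  have hfree : Free fun b : B' => res θ (l b) := by
    refine free_of_algebraicIndependent ?_
    have h1 := AlgebraicIndependent.matroid_indep_iff.1 hind
    grind
  have hfin : B'.Finite := Set.finite_of_encard_eq_coe hcard
  have : Fintype B' := hfin.fintype
  have hsub := hθ.acl_le (fun b => (hl b).2) hfree
  refine subset_trans (Cremona.acl_le fun s hs => ?_) hsub
  by_contra hns
  have h2 := ((hθ.free (fun b => (hl b).2) hfree).elim hns).card_le (t := S) (by
    rintro (_ | b)
    · exact subset_acl _ hs
    grind)
  rw [Fintype.card_option, ← Set.toFinset_card] at h2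
  rw [Set.encard_eq_coe_toFinset_card] at hcard
  have h3 := h2.trans hS
  norm_cast at h3 hcard
  omega

end Rank

section Ruled

variable {L Ω : Type*} [Field L] [Field Ω] {W : ValuationSubring L} {θ : W →+* Ω} {k : Subfield L}
  {F F' : Subfield Ω} {y : L}

lemma closure_insert_induction [IsAlgClosed k] {P : L → Prop} (hk : ∀ c ∈ k, c ≠ 0 → P c)
    (hy : ∀ a ∈ k, P (y - a)) (hmul : ∀ f g, P f → P g → P (f * g)) (hinv : ∀ f, P f → P f⁻¹)
    {f : L} (hf : f ∈ Subfield.closure (insert y (k : Set L))) (h0 : f ≠ 0) : P f := by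
  have hle : Subring.closure (insert y (k : Set L)) ≤ (Polynomial.aeval (R := k) y).range.toSubring := by
    refine Subring.closure_le.2 (Set.insert_subset ⟨Polynomial.X, Polynomial.aeval_X _⟩ fun a ha => ?_)
    exact ⟨Polynomial.C ⟨a, ha⟩, Polynomial.aeval_C _ _⟩
  have hpoly : ∀ p : Polynomial k, p ≠ 0 → P (p.aeval y) := fun p hp => by
    rw [(IsAlgClosed.splits p).eq_prod_roots, map_mul, Polynomial.aeval_C, map_multiset_prod]
    have hm : ∀ s : Multiset k, P (((s.map fun a => Polynomial.X - Polynomial.C a).map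
        (Polynomial.aeval y)).prod) := fun s => by
      induction s using Multiset.induction_on with
      | empty => aesop
      | cons a s ih =>
        rw [Multiset.map_cons, Multiset.map_cons, Multiset.prod_cons]
        refine hmul _ _ ?_ ih
        have := hy a a.2
        simp only [map_sub, Polynomial.aeval_X, Polynomial.aeval_C]
        exact this
    exact hmul _ _ (hk _ (SetLike.coe_mem _) (by aesop)) (hm _)
  obtain ⟨a, ha, b, hb, rfl⟩ := Subfield.mem_closure_iff.1 hf
  obtain ⟨p, rfl⟩ := hle ha
  obtain ⟨q, rfl⟩ := hle hb
  have hne := div_ne_zero_iff.1 h0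
  rw [div_eq_mul_inv]
  exact hmul _ _ (hpoly p fun h => hne.1 (by simp [h])) (hinv _ (hpoly q fun h => hne.2 (by simp [h])))

/-- Up to a scalar and a power of `π`, a unit with residue in `F`. -/
def UpTo (θ : W →+* Ω) (k : Subfield L) (F : Subfield Ω) (π f : L) : Prop :=
  ∃ c ∈ k, c ≠ 0 ∧ ∃ n : ℤ, res θ (f / (c * π ^ n)) ≠ 0 ∧ res θ (f / (c * π ^ n)) ∈ F

lemma UpTo.mul {π f g : L} (hπ : π ≠ 0) (hf : UpTo θ k F π f) (hg : UpTo θ k F π g) :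
    UpTo θ k F π (f * g) := by
  obtain ⟨c, hc, c0, n, h1, h2⟩ := hf
  obtain ⟨d, hd, d0, m, h3, h4⟩ := hg
  refine ⟨c * d, mul_mem hc hd, mul_ne_zero c0 d0, n + m, ?_⟩
  have : f * g / (c * d * π ^ (n + m)) = f / (c * π ^ n) * (g / (d * π ^ m)) := by
    rw [zpow_add₀ hπ]; field_simp
  rw [this, res_mul (mem_of_res_ne h1) (mem_of_res_ne h3)]
  exact ⟨mul_ne_zero h1 h3, mul_mem h2 h4⟩

lemma UpTo.inv [IsLocalHom θ] {π f : L} (hf : UpTo θ k F π f) : UpTo θ k F π f⁻¹ := by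
  obtain ⟨c, hc, c0, n, h1, h2⟩ := hf
  refine ⟨c⁻¹, inv_mem hc, inv_ne_zero c0, -n, ?_⟩
  have : f⁻¹ / (c⁻¹ * π ^ (-n)) = (f / (c * π ^ n))⁻¹ := by
    rw [zpow_neg, ← mul_inv, inv_div_inv, inv_div]
  rw [this, res_inv h1]
  aesop

lemma upTo_of_res {π c f : L} (hc : c ∈ k) (c0 : c ≠ 0) (h1 : res θ (f / c) ≠ 0) (h2 : res θ (f / c) ∈ F) :
    UpTo θ k F π f := ⟨c, hc, c0, 0, by aesop⟩

lemma upTo_closure [IsAlgClosed k] [IsLocalHom θ] {π : L} (hπ : π ≠ 0)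
    (hy : ∀ a ∈ k, UpTo θ k F π (y - a)) {f : L}
    (hf : f ∈ Subfield.closure (insert y (k : Set L))) (h0 : f ≠ 0) : UpTo θ k F π f := by
  refine closure_insert_induction (P := UpTo θ k F π) (fun c hc c0 => ?_) hy
    (fun f g => UpTo.mul hπ) (fun f => UpTo.inv) hf h0
  refine upTo_of_res hc c0 ?_ ?_ <;> rw [div_self c0, res_one]
  · grind
  aesop

/-- Elements of `k` times units have residues in `F`. -/
lemma res_mem_of_res [IsLocalHom θ] (hkF : ∀ a ∈ k, a ∈ W → res θ a ∈ F) (hF : F ≤ F') {f c : L}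
    (hf : f ∈ W) (hc : c ∈ k) (c0 : c ≠ 0) (h1 : res θ (f / c) ≠ 0) (h2 : res θ (f / c) ∈ F') :
    res θ f ∈ F' := by
  have hcW : c ∈ W := by
    have h := div_mem_of_res hf h1
    have f0 : f ≠ 0 := by rintro rfl; simp [res_zero] at h1
    grind
  rw [← mul_div_cancel₀ f c0, res_mul hcW (mem_of_res_ne h1)]
  exact mul_mem (hF (hkF c hc hcW)) h2

lemma res_one_add [IsLocalHom θ] {a : L} (h : a⁻¹ ∉ W) : res θ (1 + a) = 1 := by
  obtain ⟨h1, h2⟩ := res_inv_of_notMem (φ := θ) h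
  rw [inv_inv] at h1 h2
  rw [res_add W.one_mem h1, h2, res_one, add_zero]

/-- Ruled residue fields: over an algebraically closed base the residue field of a simple
transcendental extension is algebraic over, or purely transcendental over, that of the base. -/
lemma exists_ruled [IsAlgClosed k] [IsLocalHom θ] (hkF : ∀ a ∈ k, a ∈ W → res θ a ∈ F) {u : L}
    (hu : u ∈ Subfield.closure (insert y (k : Set L))) (huW : u ∈ W) (huF : res θ u ∉ F) :
    ∃ ξ : Ω, ∀ f ∈ Subfield.closure (insert y (k : Set L)), f ∈ W →
      res θ f ∈ Subfield.closure (insert ξ (F : Set Ω)) := by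
  have hyk : y ∉ k := fun h => huF (hkF u (Subfield.closure_le.2 (Set.insert_subset h subset_rfl) hu) huW)
  have hya : ∀ a ∈ k, y - a ≠ 0 := fun a ha h => hyk (sub_eq_zero.1 h ▸ ha)
  have hu0 : u ≠ 0 := by rintro rfl; aesop
  have hru : res θ u ≠ 0 := fun h => huF (h ▸ F.zero_mem)
  obtain ⟨a, ha, c, hc, c0, hr⟩ : ∃ a ∈ k, ∃ c ∈ k, c ≠ 0 ∧ res θ ((y - a) / c) ∉ F := by
    by_contra! H
    by_cases hex : ∃ a ∈ k, ∀ c ∈ k, c ≠ 0 → res θ ((y - a) / c) = 0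
    · obtain ⟨a, ha, hac⟩ := hex
      set π := y - a with hπ
      have hπ0 : π ≠ 0 := hya a ha
      obtain ⟨c, hc, c0, n, h1, h2⟩ := upTo_closure (θ := θ) (F := F) hπ0 (fun b hb => by
        by_cases hab : a - b = 0
        · rw [show y - b = π by grind]
          refine ⟨1, k.one_mem, one_ne_zero, 1, ?_⟩
          rw [zpow_one, one_mul, div_self hπ0, res_one]
          aesop
        · have e : y - b = π + (a - b) := by grind
          have hz : res θ (π / (a - b)) = 0 := hac _ (sub_mem ha hb) hab
          by_cases hW : π / (a - b) ∈ W
          · have h3 : res θ ((y - b) / (a - b)) = 1 := by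
              rw [e, add_div, div_self hab, res_add hW W.one_mem, hz, res_one, zero_add]
            refine upTo_of_res (sub_mem ha hb) hab ?_ ?_ <;> rw [h3]
            · grind
            aesop
          · have h3 : res θ ((y - b) / π) = 1 := by
              rw [e, add_div, div_self hπ0]
              refine res_one_add ?_
              aesop
            refine ⟨1, k.one_mem, one_ne_zero, 1, ?_⟩
            aesop) hu hu0
      by_cases hn : n = 0
      · rw [hn, zpow_zero, mul_one] at h1 h2
        exact huF (res_mem_of_res hkF le_rfl huW hc c0 h1 h2)
      · obtain ⟨d, hd⟩ := IsAlgClosed.exists_pow_nat_eq (⟨c, hc⟩ : k) (Int.natAbs_pos.2 hn)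
        have hd' : (d : L) ^ n.natAbs = c := congrArg Subtype.val hd
        have d0 : (d : L) ≠ 0 := by
          intro h
          aesop
        have hval : W.valuation (c * π ^ n) = 1 := by
          rw [res_ne_zero_iff, map_div₀, (res_ne_zero_iff (φ := θ)).1 hru, one_div, inv_eq_one] at h1
          exact h1
        obtain ⟨e, he, e0, hval'⟩ : ∃ e ∈ k, e ≠ 0 ∧ W.valuation (π / e) ^ n = 1 := by
          rcases Int.natAbs_eq n with h | h
          · refine ⟨(d : L)⁻¹, inv_mem d.2, inv_ne_zero d0, ?_⟩
            rw [← map_zpow₀, div_inv_eq_mul, mul_zpow, mul_comm]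
            nth_rw 1 [h]
            rwa [zpow_natCast, hd']
          · refine ⟨d, d.2, d0, ?_⟩
            rw [← map_zpow₀, div_zpow, div_eq_inv_mul, ← zpow_neg]
            have h5 : -n = n.natAbs := by omega
            rwa [h5, zpow_natCast, hd']
        have h6 : W.valuation (π / e) = 1 := by
          have h7 : W.valuation (π / e) ^ n.natAbs = 1 := by
            rcases Int.natAbs_eq n with h | h <;> rw [h] at hval'
            · rwa [zpow_natCast] at hval'
            · rwa [zpow_neg, zpow_natCast, inv_eq_one] at hval'
          aesop
        exact (res_ne_zero_iff (φ := θ)).2 h6 (hac e he e0)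
    · push Not at hex
      obtain ⟨c, hc, c0, n, h1, h2⟩ := upTo_closure (θ := θ) (F := F) (π := 1) one_ne_zero (fun b hb => by
        obtain ⟨c, hc, c0, h⟩ := hex b hb
        exact upTo_of_res hc c0 h (H b hb c hc c0)) hu hu0
      rw [one_zpow, mul_one] at h1 h2
      exact huF (res_mem_of_res hkF le_rfl huW hc c0 h1 h2)
  set w := (y - a) / c with hw
  set ξ := res θ w with hξ
  have hF : F ≤ Subfield.closure (insert ξ (F : Set Ω)) := fun z hz => Subfield.subset_closure (.inr hz)
  have hξF : ξ ∈ Subfield.closure (insert ξ (F : Set Ω)) := Subfield.subset_closure (.inl rfl)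
  have hwW : w ∈ W := mem_of_res_ne (φ := θ) fun h => hr (by aesop)
  refine ⟨ξ, fun f hf hfW => ?_⟩
  by_cases f0 : f = 0
  · rw [f0, res_zero]; aesop
  obtain ⟨d, hd, d0, n, h1, h2⟩ := upTo_closure (θ := θ) (F := Subfield.closure (insert ξ (F : Set Ω)))
    (π := 1) one_ne_zero (fun b hb => by
      have e : y - b = c * (w - (b - a) / c) := by grind
      have hbk : (b - a) / c ∈ k := div_mem (sub_mem hb ha) hc
      by_cases hbW : (b - a) / c ∈ W
      · have h3 : res θ ((y - b) / c) = ξ - res θ ((b - a) / c) := by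
          rw [e, mul_div_cancel_left₀ _ c0, res_sub hwW hbW]
        refine upTo_of_res hc c0 ?_ ?_ <;> rw [h3]
        · grind
        · exact sub_mem hξF (hF (hkF _ hbk hbW))
      · have hba : (b - a) / c ≠ 0 := fun h => hbW (h ▸ W.zero_mem)
        have h3 : res θ ((y - b) / (- (b - a))) = 1 := by
          have hba' : b - a ≠ 0 := fun h => hba (by grind)
          obtain ⟨h4, h5⟩ := res_inv_of_notMem (φ := θ) hbW
          have e2 : (y - b) / (- (b - a)) = 1 - w * ((b - a) / c)⁻¹ := by
            grind
          rw [e2, res_sub W.one_mem (mul_mem hwW h4), res_mul hwW h4, h5, mul_zero, sub_zero, res_one]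
        refine upTo_of_res (neg_mem (sub_mem hb ha)) (neg_ne_zero.2 fun h => hba (by grind)) ?_ ?_
          <;> rw [h3]
        · grind
        aesop) hf f0
  rw [one_zpow, mul_one] at h1 h2
  exact res_mem_of_res hkF hF hfW hd d0 h1 h2

end Ruled

section Stab

variable {K K' Ω ι : Type*} [Field K] [Algebra ℂ K] [Field K'] [Algebra ℂ K'] [Field Ω] [Algebra ℂ Ω]
  {V : ValuationSubring K} {φ : V →+* Ω}

omit [Algebra ℂ K] in
/-- A good residue field is not purely transcendental over a field of transcendence degree `m`. -/
lemma Good.not_subset [IsAlgClosed Ω] {m : ℕ} (h : Good m φ) {t : Set Ω} (ht : t.encard ≤ m) {α β : Ω}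
    (hL : Set.range φ ⊆ Subfield.closure (insert β (insert α (acl t : Set Ω)))) : False := by
  obtain ⟨T, X, ρ, s, h1, h2, h3⟩ := h
  rw [h3] at hL
  refine h1.not_mem_plane (t := t) (by simpa using ht) isCoprime_one_left h2 (α := α) (β := β)
    fun y hy => hL ?_
  have hsub : (tupleField T X ρ : Set Ω) ⊆ Subfield.closure (insert s (tupleField T X ρ : Set Ω)) :=
    fun y hy => Subfield.subset_closure (.inr hy)
  obtain ⟨-, hT, hX, hρ⟩ := subset_tupleField (T := T) (X := X) (ρ := ρ)
  rcases hy with rfl | rfl | ⟨i, rfl⟩ | ⟨i, rfl⟩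
  exacts [Subfield.subset_closure (.inl rfl), hsub hρ, hsub (hT i), hsub (hX i)]

lemma IsPlace.res_div_mem_cadj (hφ : IsPlace φ) {x : ι → K} (hx : ∀ i, x i ∈ V) (p q : MvPolynomial ι ℂ)
    (hq : res φ (MvPolynomial.aeval x q) ≠ 0) :
    res φ (MvPolynomial.aeval x p / MvPolynomial.aeval x q) ∈ cadj (Set.range fun i => res φ (x i)) := by
  have := hφ.isLocalHom
  rw [res_div (hφ.aeval hx p).1 hq, (hφ.aeval hx p).2, (hφ.aeval hx q).2]
  have h : ∀ i, res φ (x i) ∈ cadj (Set.range fun i => res φ (x i)) := fun i => subset_cadj _ ⟨i, rfl⟩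
  exact div_mem (aeval_mem_cadj h p) (aeval_mem_cadj h q)

/-- A place trivial on the field generated by a free family has free residues. -/
lemma IsPlace.free_res (hφ : IsPlace φ) {x : ι → K} (hx : Free x)
    (h : (cadj (Set.range x) : Set K) ⊆ V) : Free fun i => res φ (x i) := by
  have := hφ.isLocalHom
  refine free_of_algebraicIndependent ((injective_iff_map_eq_zero _).2 fun p hp => ?_)
  by_contra hp0
  have hm := aeval_mem_cadj (s := Set.range x) (fun i => subset_cadj _ ⟨i, rfl⟩) p
  refine res_ne_zero (φ := φ) (h hm) (h (inv_mem hm)) (fun h0 => hp0 ?_)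
    ((hφ.aeval (fun i => h (subset_cadj _ ⟨i, rfl⟩)) p).2.trans hp)
  exact (injective_iff_map_eq_zero _).1 hx.algebraicIndependent p h0

lemma map_mem_cadj (e : K' →ₐ[ℂ] K) {s : Set K'} {F : Subfield K} (hC : ∀ c, algebraMap ℂ K c ∈ F)
    (hs : ∀ a ∈ s, e a ∈ F) {f : K'} (hf : f ∈ cadj s) : e f ∈ F := by
  have h : cadj s ≤ F.comap (e : K' →+* K) := cadj_le (fun c => by
    rw [Subfield.mem_comap, RingHom.coe_coe, e.commutes]; exact hC c) hs
  exact h hf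

/-- A divisor with good residue field remains a divisor after a change of the first coordinates. -/
theorem IsDiv.stab [IsAlgClosed Ω] [Fintype ι] {m : ℕ} (hm : Fintype.card ι = m + 2) {x y : ι → K'}
    (hy : IsGen y) (e : K' →ₐ[ℂ] K) {z : K}
    (hz : IsGen fun i : Option ι => i.elim z (e ∘ x)) (hφ : IsPlace φ) (hG : Good m φ)
    (h : IsDiv φ fun i : Option ι => i.elim z (e ∘ x)) :
    IsDiv φ fun i : Option ι => i.elim z (e ∘ y) := by
  classical
  have := hφ.isLocalHom
  have hspan : (∀ i, e (y i) ∈ V) →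
      (∀ i, res φ (e (x i)) ∈ cadj (Set.range fun i => res φ (e (y i)))) →
      IsDiv φ fun i : Option ι => i.elim z (e ∘ y) := fun hV hxy => by
    refine h.span ?_ ?_
    · rintro (_ | i)
      exacts [h.mem none, hV i]
    · rintro (_ | i)
      · exact subset_acl _ ⟨none, rfl⟩
      · refine acl_mono ?_ (cadj_le_acl (hxy i))
        rintro _ ⟨i, rfl⟩
        exact ⟨some i, rfl⟩
  by_cases hA : ∀ f, e f ∈ V
  · refine hspan (fun i => hA _) fun i => ?_
    obtain ⟨p, q, hq, hpq⟩ := exists_aeval_div (hy.mem (x i))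
    have he : ∀ p, e (aeval y p) = aeval (e ∘ y) p := fun p => comp_aeval_apply y e p
    rw [hpq, map_div₀, he, he]
    refine hφ.res_div_mem_cadj (x := e ∘ y) (fun i => hA _) p q (res_ne_zero ?_ ?_ ?_)
    · rw [← he]; exact hA _
    · rw [← he, ← map_inv₀]; exact hA _
    · rw [← he]; exact (map_ne_zero e).2 hq
  push Not at hA
  obtain ⟨f0, hf0⟩ := hA
  have hxd : IsDiv (comapPlace e φ) x := by
    refine ⟨fun htop => hf0 ?_, fun i => h.mem (some i), fun t ht => ?_⟩
    · exact (htop ▸ ValuationSubring.mem_top f0 : f0 ∈ V.comap (e : K' →+* K))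
    · have h1 := h.card_le (insert (res φ z) t) (by
        rintro (_ | i)
        · exact subset_acl _ (.inl rfl)
        · have := ht i
          rw [res_comapPlace] at this
          exact acl_mono (Set.subset_insert _ _) this)
      have h2 := h1.trans (add_le_add_left (Set.encard_insert_le t (res φ z)) 1)
      rw [Fintype.card_option, Nat.cast_add, Nat.cast_one] at h2
      exact (ENat.add_le_add_iff_right ENat.one_ne_top).1 h2
  by_cases hyd : IsDiv (comapPlace e φ) y
  · refine hspan hyd.mem fun i => ?_
    have h1 := hyd.range_eq (hφ.comap e) hy
    simp only [res_comapPlace] at h1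
    rw [← SetLike.mem_coe, ← h1, range_eq_res]
    exact ⟨x i, h.mem (some i), res_comapPlace e φ _⟩
  exfalso
  obtain ⟨j, f, hf, hfV⟩ : ∃ j, ∃ f ∈ cadj (y '' {j}ᶜ), e f ∉ V := by
    by_contra! H
    have hmem : ∀ i, e (y i) ∈ V := fun i => by
      have : Nontrivial ι := Fintype.one_lt_card_iff_nontrivial.1 (by omega)
      obtain ⟨j, hj⟩ := exists_ne i
      exact H j _ (subset_cadj _ ⟨i, hj.symm, rfl⟩)
    refine hyd ⟨fun htop => hf0 ?_, hmem, fun t ht => ?_⟩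
    · exact (htop ▸ ValuationSubring.mem_top f0 : f0 ∈ V.comap (e : K' →+* K))
    have : Nonempty ι := Fintype.card_pos_iff.1 (by omega)
    obtain ⟨j⟩ := this
    have hfree := (hφ.comap e).free_res (hy.free.comp (f := Subtype.val (p := fun i => i ≠ j))
      Subtype.val_injective) (fun g hg => H j g (by
        refine cadj_mono ?_ hg
        rintro _ ⟨i, rfl⟩
        exact ⟨i, i.2, rfl⟩))
    have h3 := hfree.card_le (t := t) fun i => ht i
    rw [Fintype.card_subtype_compl, Fintype.card_subtype_eq] at h3
    refine le_trans ?_ (add_le_add_left h3 1)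
    norm_cast
    omega
  let L := AlgebraicClosure K
  obtain ⟨W, θ, hθ, hext⟩ := hφ.exists_extend (L := L)
  have := hθ.isLocalHom
  let E : K' →ₐ[ℂ] L := (IsScalarTower.toAlgHom ℂ K L).comp e
  have hE : ∀ f, E f = algebraMap K L (e f) := fun f => rfl
  set S : Set L := E ∘ y '' {j}ᶜ with hS
  have hScard : S.encard ≤ m + 1 := by
    refine (Set.encard_image_le _ _).trans ?_
    rw [Set.encard_eq_coe_toFinset_card]
    norm_cast
    simp [Finset.card_compl, hm]
  have hcl : ∀ g ∈ cadj (y '' {j}ᶜ), E g ∈ acl S := fun g hg =>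
    map_mem_cadj E algebraMap_mem_acl (by rintro _ ⟨i, hi, rfl⟩; exact subset_acl _ ⟨i, hi, rfl⟩) hg
  have hcl' : ∀ g, E g ∈ Subfield.closure (insert (E (y j)) (acl S : Set L)) := fun g =>
    map_mem_cadj E (fun c => Subfield.subset_closure (.inr (algebraMap_mem_acl c))) (by
      rintro _ ⟨i, rfl⟩
      by_cases hi : i = j
      · exact hi ▸ Subfield.subset_closure (.inl rfl)
      · exact Subfield.subset_closure (.inr (subset_acl _ ⟨i, hi, rfl⟩))) (hy.mem g)
  obtain ⟨t, ht, htS⟩ := hθ.exists_encard_le hScard fun hW => by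
    obtain ⟨h1, h2⟩ := res_inv_of_notMem (φ := φ) hfV
    obtain ⟨h3, h4⟩ := hext _ h1
    have h5 : E f ∈ W := hW (hcl f hf)
    have h6 : E f * algebraMap K L (e f)⁻¹ = 1 := by
      rw [hE, ← map_mul, mul_inv_cancel₀ (fun h0 => hfV (by rw [h0]; exact V.zero_mem)), map_one]
    have h7 := res_mul (φ := θ) h5 h3
    rw [h6, h4, h2, mul_zero, res_one] at h7
    exact one_ne_zero h7
  obtain ⟨i, hi⟩ : ∃ i, res φ (e (x i)) ∉ acl t := by
    by_contra! H
    have h1 := (hxd.card_le t fun i => by rw [res_comapPlace]; exact H i).trans (add_le_add_left ht 1)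
    rw [hm] at h1
    norm_cast at h1
    omega
  have hxW : ∀ i, E (x i) ∈ W ∧ res θ (E (x i)) = res φ (e (x i)) := fun i => hext _ (h.mem (some i))
  have := AlgClosedIn.isAlgClosed (algClosedIn_acl S)
  obtain ⟨ξ, hξ⟩ := exists_ruled (F := acl t) htS (hcl' (x i)) (hxW i).1 ((hxW i).2 ▸ hi)
  refine hG.not_subset ht (α := ξ) (β := res φ z) ?_
  rw [h.range_eq hφ hz]
  refine cadj_le (fun c => Subfield.subset_closure (.inr (.inr (algebraMap_mem_acl c)))) ?_
  rintro _ ⟨_ | i, rfl⟩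
  · exact Subfield.subset_closure (.inl rfl)
  · exact Subfield.closure_mono (Set.subset_insert _ _) (by
      have h1 := hξ _ (hcl' _) (hxW i).1
      rwa [(hxW i).2] at h1)

end Stab

/-- The graph of the birational map in the affine coordinates `x`, `y`. -/
structure IsCorr {R : Type*} [CommRing R] (p x₁ x₂ x₃ y₀ y₂ y₃ : R) : Prop where
  eq₃ : (x₁ * x₂ * x₃ + x₁ ^ 2 - p * x₃ - x₂ ^ 3) * y₃ = x₁ * x₃ ^ 2 + x₁ * x₂ - x₂ ^ 2 * x₃ - p
  eq₀ : p * y₀ = x₃ - y₃ * x₂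
  eq₂ : p * y₂ = p * y₀ * x₂ - x₁

lemma IsCorr.map {R S : Type*} [CommRing R] [CommRing S] {p x₁ x₂ x₃ y₀ y₂ y₃ : R}
    (h : IsCorr p x₁ x₂ x₃ y₀ y₂ y₃) (f : R →+* S) :
    IsCorr (f p) (f x₁) (f x₂) (f x₃) (f y₀) (f y₂) (f y₃) := by
  obtain ⟨h1, h2, h3⟩ := h
  refine ⟨?_, ?_, ?_⟩
  · simpa using congrArg f h1
  · simpa using congrArg f h2
  · simpa using congrArg f h3

section

variable {K : Type*} [Field K] {p x₁ x₂ x₃ y₀ y₂ y₃ : K}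

lemma IsCorr.x₁_eq (h : IsCorr p x₁ x₂ x₃ y₀ y₂ y₃) : x₁ = p * y₀ * x₂ - p * y₂ := by
  linear_combination h.eq₂

lemma IsCorr.x₃_eq (h : IsCorr p x₁ x₂ x₃ y₀ y₂ y₃) : x₃ = p * y₀ + y₃ * x₂ := by
  linear_combination -h.eq₀

lemma IsCorr.x₂_eq (h : IsCorr p x₁ x₂ x₃ y₀ y₂ y₃) (hp : p ≠ 0) :
    (p * y₀ * (y₂ * y₃ + p * y₀ ^ 2) - y₂ + y₃ ^ 2) * x₂ =
      1 + p * (y₂ * y₃ + p * y₀ ^ 2) * y₂ - p * y₀ * y₃ := by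
  have h3 := h.eq₃
  rw [h.x₁_eq, h.x₃_eq] at h3
  grind

/-- The forward map. -/
lemma isCorr_of_ne (hp : p ≠ 0) (hA : x₁ * x₂ * x₃ + x₁ ^ 2 - p * x₃ - x₂ ^ 3 ≠ 0) :
    ∃ y₀ y₂ y₃, IsCorr p x₁ x₂ x₃ y₀ y₂ y₃ := by
  refine ⟨_, _, _, mul_div_cancel₀ _ hA, mul_div_cancel₀ _ hp, mul_div_cancel₀ _ hp⟩

/-- The backward map. -/
lemma IsCorr.x_mem (h : IsCorr p x₁ x₂ x₃ y₀ y₂ y₃) (hp : p ≠ 0)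
    (hX : p * y₀ * (y₂ * y₃ + p * y₀ ^ 2) - y₂ + y₃ ^ 2 ≠ 0) {F : Subring K} (hF : p ∈ F) (h0 : y₀ ∈ F)
    (h2 : y₂ ∈ F) (h3 : y₃ ∈ F) (hXF : (p * y₀ * (y₂ * y₃ + p * y₀ ^ 2) - y₂ + y₃ ^ 2)⁻¹ ∈ F) :
    x₁ ∈ F ∧ x₂ ∈ F ∧ x₃ ∈ F := by
  have e2 := h.x₂_eq hp
  have hx2 : x₂ ∈ F := by
    rw [← eq_inv_mul_iff_mul_eq₀ hX] at e2
    rw [e2]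
    exact mul_mem hXF (sub_mem (add_mem F.one_mem (mul_mem (mul_mem hF (add_mem (mul_mem h2 h3)
      (mul_mem hF (pow_mem h0 2)))) h2)) (mul_mem (mul_mem hF h0) h3))
  refine ⟨?_, hx2, ?_⟩
  · rw [h.x₁_eq]; exact sub_mem (mul_mem (mul_mem hF h0) hx2) (mul_mem hF h2)
  · rw [h.x₃_eq]; exact add_mem (mul_mem hF h0) (mul_mem h3 hx2)

lemma IsCorr.y_mem' (h : IsCorr p x₁ x₂ x₃ y₀ y₂ y₃) (hp : p ≠ 0) {F : Subfield K} (hF : p ∈ F)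
    (h1 : x₁ ∈ F) (h2 : x₂ ∈ F) (h3 : x₃ ∈ F) (hy : y₃ ∈ F) : y₀ ∈ F ∧ y₂ ∈ F := by
  have e0 : y₀ ∈ F := by
    rw [eq_div_of_mul_eq hp ((mul_comm _ _).trans h.eq₀)]
    exact div_mem (sub_mem h3 (mul_mem hy h2)) hF
  refine ⟨e0, ?_⟩
  rw [eq_div_of_mul_eq hp ((mul_comm _ _).trans h.eq₂)]
  exact div_mem (sub_mem (mul_mem (mul_mem hF e0) h2) h1) hF

lemma IsCorr.y_mem (h : IsCorr p x₁ x₂ x₃ y₀ y₂ y₃) (hp : p ≠ 0)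
    (hA : x₁ * x₂ * x₃ + x₁ ^ 2 - p * x₃ - x₂ ^ 3 ≠ 0) {F : Subfield K} (hF : p ∈ F)
    (h1 : x₁ ∈ F) (h2 : x₂ ∈ F) (h3 : x₃ ∈ F) : y₀ ∈ F ∧ y₂ ∈ F ∧ y₃ ∈ F := by
  have e3 : y₃ ∈ F := by
    rw [eq_div_of_mul_eq hA ((mul_comm _ _).trans h.eq₃)]
    exact div_mem (sub_mem (sub_mem (add_mem (mul_mem h1 (pow_mem h3 2)) (mul_mem h1 h2))
      (mul_mem (pow_mem h2 2) h3)) hF) (sub_mem (sub_mem (add_mem (mul_mem (mul_mem h1 h2) h3)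
      (pow_mem h1 2)) (mul_mem hF h3)) (pow_mem h2 3))
  have := h.y_mem' hp hF h1 h2 h3 e3
  grind

/-- A pure power relation gives membership in an algebraically closed subfield. -/
lemma AlgClosedIn.mem_of_curve {k : Subfield K} (hk : AlgClosedIn k) (hp : p ≠ 0) (hpk : p ∈ k)
    (hA : x₁ * x₂ * x₃ + x₁ ^ 2 - p * x₃ - x₂ ^ 3 = 0)
    (hB : x₁ * x₃ ^ 2 + x₁ * x₂ - x₂ ^ 2 * x₃ - p = 0)
    (hz : (x₂ ^ 2 - x₁ * x₃) * x₁ * x₂ * x₃ = 0) : x₁ ∈ k ∧ x₂ ∈ k ∧ x₃ ∈ k := by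
  have hr5 {f : K} (h : f ^ 5 ∈ k) : f ∈ k := hk.of_pow (by norm_num) h
  have hd {f c : K} (h : p * f = c) (hc : c ∈ k) : f ∈ k := by
    rw [eq_div_of_mul_eq hp ((mul_comm _ _).trans h)]; exact div_mem hc hpk
  simp only [mul_eq_zero, sub_eq_zero] at hz
  obtain ((hz | rfl) | rfl) | rfl := hz
  · have h1 : x₁ ∈ k := hr5 (by
      rw [show x₁ ^ 5 = p ^ 3 by
        grind]
      exact pow_mem hpk 3)
    have h3 : x₃ ∈ k := hd (c := x₁ ^ 2) (by grind) (pow_mem h1 2)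
    refine ⟨h1, hk.of_pow two_ne_zero ?_, h3⟩
    rw [hz]
    exact mul_mem h1 h3
  · have h2 : x₂ ∈ k := hr5 (by
      rw [show x₂ ^ 5 = p ^ 2 by grind]
      exact pow_mem hpk 2)
    exact ⟨k.zero_mem, h2, hd (by grind) (neg_mem (pow_mem h2 3))⟩
  · have h1 : x₁ ∈ k := hr5 (by
      rw [show x₁ ^ 5 = p ^ 3 by grind]
      exact pow_mem hpk 3)
    exact ⟨h1, k.zero_mem, hd (by grind) (pow_mem h1 2)⟩
  · have h2 : x₂ ∈ k := hr5 (by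
      rw [show x₂ ^ 5 = p ^ 2 by grind]
      exact pow_mem hpk 2)
    refine ⟨hk.of_pow two_ne_zero ?_, h2, k.zero_mem⟩
    rw [show x₁ ^ 2 = x₂ ^ 3 by grind]
    exact pow_mem h2 3

end

variable {K : Type*} [Field K] {p x₁ x₂ x₃ y₀ y₂ y₃ : K}

lemma isLyness_vec {l a b c d e : K} (ha : a ≠ 0) (hb : b ≠ 0) (hc : c ≠ 0) (hd : d ≠ 0) (he : e ≠ 0)
    (h0 : b * e = 1 + a) (h1 : c * a = 1 + b) (h2 : d * b = 1 + c) (h3 : e * c = 1 + d)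
    (h4 : a * d = 1 + e) (hl : a * b * c * d * e = l) :
    ∃ X : ZMod 5 → K, IsLyness l X ∧ X 0 = a ∧ X 1 = b ∧ X 2 = c ∧ X 3 = d ∧ X 4 = e := by
  let X : ZMod 5 → K := (![a, b, c, d, e] : Fin 5 → K)
  refine ⟨X, ⟨fun k => ?_, fun k => ?_, hl⟩, rfl, rfl, rfl, rfl, rfl⟩
  · fin_cases k
    exacts [ha, hb, hc, hd, he]
  · fin_cases k
    exacts [h0, h1, h2, h3, h4]

/-- The curve contracted by the backward map. -/
lemma exists_isLyness_of_curve (hp : p ≠ 0) (hA : x₁ * x₂ * x₃ + x₁ ^ 2 - p * x₃ - x₂ ^ 3 = 0)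
    (hB : x₁ * x₃ ^ 2 + x₁ * x₂ - x₂ ^ 2 * x₃ - p = 0)
    (hz : (x₂ ^ 2 - x₁ * x₃) * x₁ * x₂ * x₃ ≠ 0) : ∃ (X : ZMod 5 → K) (ρ : K), IsLyness 1 X ∧
      ρ ^ 5 = p ^ (-2 : ℤ) * hfun X ∧ ∀ F : Subfield K, p ∈ F →
        ((ρ ∈ F ∧ ∀ i, X i ∈ F) ↔ x₁ ∈ F ∧ x₂ ∈ F ∧ x₃ ∈ F) := by
  obtain ⟨w, hw⟩ : ∃ w, w = x₂ ^ 2 - x₁ * x₃ := ⟨_, rfl⟩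
  rw [← hw] at hz
  obtain ⟨⟨⟨w0, h1⟩, h2⟩, h3⟩ : ((w ≠ 0 ∧ x₁ ≠ 0) ∧ x₂ ≠ 0) ∧ x₃ ≠ 0 := by
    grind
  have qB : x₃ * w = x₁ * x₂ - p := by grind
  have qA : x₂ * w = x₁ ^ 2 - p * x₃ := by grind
  have q4 : w * x₁ = p * x₂ - p * x₃ ^ 2 := by grind
  have q5 : w ^ 2 = p * x₁ - p * x₂ * x₃ := by
    grind
  obtain ⟨X, hX, e0, e1, e2, e3, e4⟩ := isLyness_vec (l := (1 : K)) (a := -(w ^ 2 / (p * x₁)))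
    (b := -(x₂ ^ 2 / (x₁ * x₃))) (c := p / (x₃ * w)) (d := -(x₁ ^ 2 / (w * x₂))) (e := -(x₃ ^ 2 / x₂))
    (by simp [w0, hp, h1]) (by aesop) (by simp [w0, hp, h3]) (by aesop)
    (by grind)
    (by field_simp; grind) (by field_simp; grind)
    (by field_simp; grind) (by field_simp; grind)
    (by field_simp; grind) (by field_simp)
  refine ⟨X, -(x₂ / w), hX, ?_, fun F hF => ⟨fun ⟨hρ, hi⟩ => ?_, fun ⟨m1, m2, m3⟩ => ?_⟩⟩
  · rw [hfun, e0, e1, e2, e4, zpow_neg]; field_simp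
  · have mw : w ∈ F := by
      rw [show w = X 1 / (X 2 * X 0 * (-(x₂ / w)) ^ 2) by rw [e0, e1, e2]; field_simp]
      exact div_mem (hi 1) (mul_mem (mul_mem (hi 2) (hi 0)) (pow_mem hρ 2))
    refine ⟨?_, ?_, ?_⟩
    · rw [show x₁ = -(w ^ 2 / (p * X 0)) by rw [e0]; field_simp]
      exact neg_mem (div_mem (pow_mem mw 2) (mul_mem hF (hi 0)))
    · rw [show x₂ = -(-(x₂ / w) * w) by field_simp]
      exact neg_mem (mul_mem hρ mw)
    · rw [show x₃ = p / (X 2 * w) by rw [e2]; field_simp]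
      exact div_mem hF (mul_mem (hi 2) mw)
  · have mw : w ∈ F := hw ▸ sub_mem (pow_mem m2 2) (mul_mem m1 m3)
    refine ⟨neg_mem (div_mem m2 mw), fun i => ?_⟩
    fin_cases i
    · exact e0 ▸ neg_mem (div_mem (pow_mem mw 2) (mul_mem hF m1))
    · exact e1 ▸ neg_mem (div_mem (pow_mem m2 2) (mul_mem m1 m3))
    · exact e2 ▸ div_mem hF (mul_mem m3 mw)
    · exact e3 ▸ neg_mem (div_mem (pow_mem m1 2) (mul_mem mw m2))
    · exact e4 ▸ neg_mem (div_mem (pow_mem m3 2) m2)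

/-- The curve contracted by the forward map. -/
lemma IsLyness.exists_curve {X : ZMod 5 → K} (hX : IsLyness 1 X) (hp : p ≠ 0) {ρ : K}
    (hρ : ρ ^ 5 = p * hfun X) : ∃ y₀ y₂ y₃ : K, p * y₀ * (y₂ * y₃ + p * y₀ ^ 2) - y₂ + y₃ ^ 2 = 0 ∧
      1 + p * (y₂ * y₃ + p * y₀ ^ 2) * y₂ - p * y₀ * y₃ = 0 ∧ y₃ ≠ 0 ∧ 1 - p * y₀ * y₃ ≠ 0 ∧
      ∀ F : Subfield K, p ∈ F → ((ρ ∈ F ∧ ∀ i, X i ∈ F) ↔ y₀ ∈ F ∧ y₂ ∈ F ∧ y₃ ∈ F) := by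
  obtain ⟨r0, r1, r2, r3, r4⟩ := hX.rels
  have hprod := hX.prod
  have n0 := hX.ne 0
  have n1 := hX.ne 1
  have n2 := hX.ne 2
  have n3 := hX.ne 3
  have n4 := hX.ne 4
  have nρ : ρ ≠ 0 := by
    rintro rfl
    rw [hfun, zero_pow (by norm_num)] at hρ
    grind
  have hρ' : ρ ^ 5 * (X 0 ^ 3 * X 2) = p * (X 1 ^ 3 * X 4) := by
    rw [hρ, hfun]; field_simp
  obtain ⟨y₀, h0⟩ : ∃ y₀, y₀ = X 1 ^ 2 / (X 2 * X 0 ^ 2 * ρ ^ 4) := ⟨_, rfl⟩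
  obtain ⟨y₂, h2⟩ : ∃ y₂, y₂ = X 2 * X 0 * ρ ^ 2 / X 1 * y₀ := ⟨_, rfl⟩
  obtain ⟨y₃, h3⟩ : ∃ y₃, y₃ = p * X 1 / (X 0 ^ 2 * X 2 * ρ ^ 2) * y₀ := ⟨_, rfl⟩
  obtain ⟨y₁, h1⟩ : ∃ y₁, y₁ = ρ * y₀ := ⟨_, rfl⟩
  have m0 : y₀ ≠ 0 := by aesop
  have m1 : y₁ ≠ 0 := by grind
  have m2 : y₂ ≠ 0 := by grind
  have m3 : y₃ ≠ 0 := by aesop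
  have q0 : X 0 * (y₂ * y₃) = p * y₀ ^ 2 := by rw [h2, h3]; field_simp
  have q1 : X 1 * y₃ = p * y₁ ^ 2 := by rw [h3, h1, h0]; field_simp
  have q2 : X 2 * y₀ = y₂ ^ 2 := by rw [h2, h0]; field_simp
  have q3 : X 3 * (p * y₀ * y₁) = y₃ ^ 2 := by
    rw [h3, h1]; field_simp
    linear_combination X 3 * X 0 * X 2 * hρ' + p * X 1 ^ 2 * hprod
  have q4 : X 4 * (p * y₁ * y₂) = 1 := by
    rw [h2, h1, h0]; field_simp
    linear_combination -hρ'
  have hy1 : y₁ = y₂ * y₃ + p * y₀ ^ 2 := by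
    linear_combination q0 + y₂ * y₃ * r0 - X 4 * y₂ * q1 - y₁ * q4
  have e : X 0 * X 3 * (y₁ * y₂) = y₀ * y₃ := by
    refine mul_left_cancel₀ (mul_ne_zero (mul_ne_zero hp m0) m3) ?_
    linear_combination X 3 * p * y₀ * y₁ * q0 + p * y₀ ^ 2 * q3
  refine ⟨y₀, y₂, y₃, ?_, ?_, m3, ?_, fun F hF => ⟨fun ⟨hr, hi⟩ => ?_, fun ⟨k0, k2, k3⟩ => ?_⟩⟩
  · rw [← hy1]
    grind
  · rw [← hy1]
    grind
  · grind
  · have k0 : y₀ ∈ F :=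
      h0 ▸ div_mem (pow_mem (hi 1) 2) (mul_mem (mul_mem (hi 2) (pow_mem (hi 0) 2)) (pow_mem hr 4))
    exact ⟨k0, h2 ▸ mul_mem (div_mem (mul_mem (mul_mem (hi 2) (hi 0)) (pow_mem hr 2)) (hi 1)) k0,
      h3 ▸ mul_mem (div_mem (mul_mem hF (hi 1)) (mul_mem (mul_mem (pow_mem (hi 0) 2) (hi 2))
        (pow_mem hr 2))) k0⟩
  · have k1 : y₁ ∈ F := hy1 ▸ add_mem (mul_mem k2 k3) (mul_mem hF (pow_mem k0 2))
    refine ⟨(eq_div_of_mul_eq m0 h1.symm) ▸ div_mem k1 k0, fun i => ?_⟩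
    fin_cases i
    · exact (eq_div_of_mul_eq (mul_ne_zero m2 m3) q0) ▸
        div_mem (mul_mem hF (pow_mem k0 2)) (mul_mem k2 k3)
    · exact (eq_div_of_mul_eq m3 q1) ▸ div_mem (mul_mem hF (pow_mem k1 2)) k3
    · exact (eq_div_of_mul_eq m0 q2) ▸ div_mem (pow_mem k2 2) k0
    · exact (eq_div_of_mul_eq (mul_ne_zero (mul_ne_zero hp m0) m1) q3) ▸
        div_mem (pow_mem k3 2) (mul_mem (mul_mem hF k0) k1)
    · exact (eq_div_of_mul_eq (mul_ne_zero (mul_ne_zero hp m1) m2) q4) ▸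
        div_mem F.one_mem (mul_mem (mul_mem hF k1) k2)

lemma AlgClosedIn.cubic {k : Subfield K} (hk : AlgClosedIn k) {t : K} (ht : t ∉ k) {a b c d : k}
    (h : a * t ^ 3 + b * t ^ 2 + c * t + d = (0 : K)) : a = 0 := by
  have hP := hk.eq_zero_of_aeval ht (P := (⟨a, b, c, d⟩ : Cubic k).toPoly) (by
    simp only [Cubic.toPoly, map_add, map_mul, map_pow, Polynomial.aeval_C, Polynomial.aeval_X]
    exact h)
  simpa using congrArg (Polynomial.coeff · 3) hP

lemma exists_isCorr_of_curve {k : Subfield K} (hk : AlgClosedIn k) (hpk : p ∈ k) (h0 : y₀ ∈ k)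
    (h2 : y₂ ∈ k) (h3 : y₃ ∈ k) (hX : p * y₀ * (y₂ * y₃ + p * y₀ ^ 2) - y₂ + y₃ ^ 2 = 0)
    (hY : 1 + p * (y₂ * y₃ + p * y₀ ^ 2) * y₂ - p * y₀ * y₃ = 0) (hy : y₃ ≠ 0)
    (hd : 1 - p * y₀ * y₃ ≠ 0) {s : K} (hs : s ∉ k) : ∃ x₁ x₂, IsCorr p x₁ x₂ s y₀ y₂ y₃ ∧
      x₁ * x₂ * s + x₁ ^ 2 - p * s - x₂ ^ 3 ≠ 0 := by
  obtain ⟨t, ht⟩ : ∃ t, t = (s - p * y₀) / y₃ := ⟨_, rfl⟩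
  obtain rfl : s = p * y₀ + y₃ * t := by grind
  clear ht
  have htk : t ∉ k := fun h => hs (add_mem (mul_mem hpk h0) (mul_mem h3 h))
  refine ⟨p * y₀ * t - p * y₂, t, ⟨?_, by ring, by ring⟩, fun hA => ?_⟩
  · grind
  · lift p to k using hpk
    lift y₀ to k using h0
    lift y₂ to k using h2
    lift y₃ to k using h3
    have h := hk.cubic (a := p * y₀ * y₃ - 1) (b := p ^ 2 * y₀ ^ 2 + p ^ 2 * y₀ ^ 2 - p * y₂ * y₃)
      (c := -(p ^ 2 * y₀ * y₂ + p ^ 2 * y₀ * y₂ + p ^ 2 * y₀ * y₂) - p * y₃) (d := p ^ 2 * y₂ ^ 2 - p ^ 2 * y₀) htk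
      (by push_cast; grind)
    have h' := congrArg (fun a : k => (a : K)) h
    push_cast at h'
    grind

section

variable {K Ω ι κ : Type*} [Field K] [Algebra ℂ K] [Field Ω] [Algebra ℂ Ω] {V : ValuationSubring K}
  {φ : V →+* Ω}

omit [Algebra ℂ K] in
lemma free_of_card_le [Fintype κ] {b : κ → Ω}
    (h : ∀ t : Set Ω, (∀ i, b i ∈ acl t) → (Fintype.card κ : ℕ∞) ≤ t.encard) : Free b := by
  classical
  intro i hi
  have h1 := h (b '' {i}ᶜ) fun j => by
    by_cases hj : j = i
    · exact hj ▸ hi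
    · exact subset_acl _ ⟨j, hj, rfl⟩
  have h2 := h1.trans (Set.encard_image_le _ _)
  rw [Set.encard_eq_coe_toFinset_card, Set.toFinset_compl, Finset.card_compl] at h2
  simp only [Set.toFinset_singleton, Finset.card_singleton, Nat.cast_le] at h2
  have := Fintype.card_pos_iff.2 ⟨i⟩
  omega

/-- A divisorial family of residues is realized by a place. -/
lemma exists_place [Fintype ι] {x : ι → K} (hx : IsGen x) {r : ι → Ω} (hr : ¬ Free r)
    (hc : ∀ t : Set Ω, (∀ i, r i ∈ acl t) → (Fintype.card ι : ℕ∞) ≤ t.encard + 1) :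
    ∃ (V : ValuationSubring K) (φ : V →+* Ω), IsPlace φ ∧ IsDiv φ x ∧ ∀ i, res φ (x i) = r i := by
  obtain ⟨u, hu, hker⟩ := exists_prime_ker hr hc
  have hinj : ∀ p : MvPolynomial ι ℂ, aeval x p = 0 → p = 0 :=
    (injective_iff_map_eq_zero _).1 hx.free.algebraicIndependent
  have h0 : ∀ q : MvPolynomial ι ℂ, ¬ u ∣ q → aeval x q ≠ 0 := fun q hq h =>
    hq (hinj q h ▸ dvd_zero u)
  have hr0 : ∀ q : MvPolynomial ι ℂ, ¬ u ∣ q → aeval r q ≠ 0 := fun q hq h => hq ((hker q).1 h)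
  have hmul : ∀ q q' : MvPolynomial ι ℂ, ¬ u ∣ q → ¬ u ∣ q' → ¬ u ∣ q * q' := fun q q' h h' hqq =>
    (hu.dvd_or_dvd hqq).elim h h'
  have h1 : ¬ u ∣ 1 := fun h => hu.not_isUnit (isUnit_of_dvd_one h)
  let V : ValuationSubring K :=
    { carrier := {f | ∃ p q : MvPolynomial ι ℂ, ¬ u ∣ q ∧ f * aeval x q = aeval x p}
      mul_mem' := by
        rintro f g ⟨p, q, hq, e⟩ ⟨p', q', hq', e'⟩
        exact ⟨p * p', q * q', hmul _ _ hq hq', by rw [map_mul, map_mul, ← e, ← e']; ring⟩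
      one_mem' := ⟨1, 1, h1, by simp⟩
      add_mem' := by
        rintro f g ⟨p, q, hq, e⟩ ⟨p', q', hq', e'⟩
        exact ⟨p * q' + p' * q, q * q', hmul _ _ hq hq', by
          rw [map_mul, map_add, map_mul, map_mul, ← e, ← e']; ring⟩
      zero_mem' := ⟨0, 1, h1, by simp⟩
      neg_mem' := by
        rintro f ⟨p, q, hq, e⟩
        exact ⟨-p, q, hq, by rw [map_neg, ← e]; ring⟩
      mem_or_inv_mem' := fun f => by
        obtain ⟨p, q, -, hq, rfl, hrel⟩ := hx.exists_div f
        by_cases h : u ∣ q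
        · have hp : ¬ u ∣ p := fun hp => hu.not_isUnit (hrel hp h)
          exact .inr ⟨q, p, hp, by have := h0 p hp; field_simp⟩
        · exact .inl ⟨p, q, h, by field_simp⟩ }
  choose P Q hQ hPQ using fun f : V => f.2
  have key : ∀ (f : V) (p q : MvPolynomial ι ℂ), (f : K) * aeval x q = aeval x p →
      aeval r (P f) / aeval r (Q f) * aeval r q = aeval r p := fun f p q e => by
    have e1 : P f * q = p * Q f := by
      rw [← sub_eq_zero]
      refine hinj _ ?_
      rw [map_sub, map_mul, map_mul, ← hPQ f, ← e]; ring
    have e2 := congrArg (aeval r) e1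
    rw [map_mul, map_mul] at e2
    have := hr0 _ (hQ f)
    field_simp
    exact e2.trans (mul_comm _ _)
  let φ : V →+* Ω :=
    { toFun := fun f => aeval r (P f) / aeval r (Q f)
      map_one' := by simpa using key 1 1 1 (by simp)
      map_zero' := by simpa using key 0 0 1 (by simp)
      map_mul' := fun f g => by
        have h := key (f * g) (P f * P g) (Q f * Q g) (by
          rw [map_mul, map_mul, ← hPQ, ← hPQ]; push_cast; ring)
        have := hr0 _ (hQ f)
        have := hr0 _ (hQ g)
        rw [map_mul, map_mul, ← eq_div_iff (by simp [*])] at h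
        rw [h]; field_simp
      map_add' := fun f g => by
        have h := key (f + g) (P f * Q g + P g * Q f) (Q f * Q g) (by
          rw [map_mul, map_add, map_mul, map_mul, ← hPQ, ← hPQ]; push_cast; ring)
        have := hr0 _ (hQ f)
        have := hr0 _ (hQ g)
        rw [map_mul, map_add, map_mul, map_mul, ← eq_div_iff (by simp [*])] at h
        rw [h]; field_simp }
  have hφ : ∀ (f : V) (p q : MvPolynomial ι ℂ), (f : K) * aeval x q = aeval x p →
      φ f * aeval r q = aeval r p := key
  have hpoly : ∀ p : MvPolynomial ι ℂ, ∃ h : aeval x p ∈ V, φ ⟨aeval x p, h⟩ = aeval r p := fun p => by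
    have e : aeval x p * aeval x (1 : MvPolynomial ι ℂ) = aeval x p := by simp
    exact ⟨⟨p, 1, h1, e⟩, by simpa using hφ ⟨_, ⟨p, 1, h1, e⟩⟩ p 1 e⟩
  have hX : ∀ i, x i ∈ V ∧ res φ (x i) = r i := fun i => by
    obtain ⟨h, e⟩ := hpoly (X i)
    rw [aeval_X] at h
    simp only [aeval_X] at e
    exact ⟨h, by rw [res_of_mem h, e]⟩
  refine ⟨V, φ, ⟨isLocalHom_of_res fun a ha h => ?_, fun c => ?_⟩, ⟨fun htop => ?_, fun i => (hX i).1, fun t ht =>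
    hc t fun i => (hX i).2 ▸ ht i⟩, fun i => (hX i).2⟩
  · have hm := ha
    obtain ⟨p, q, hq, e⟩ := ha
    have ha0 : a ≠ 0 := ne_zero_of_res h
    rw [res_of_mem hm] at h
    have h2 := hφ ⟨a, p, q, hq, e⟩ p q e
    refine ⟨q, p, fun hp => mul_ne_zero h (hr0 q hq) (h2.trans ((hker p).2 hp)), ?_⟩
    rw [← e, inv_mul_cancel_left₀ ha0]
  · obtain ⟨h, e⟩ := hpoly (C c)
    rw [algHom_C] at h
    simp only [algHom_C] at e
    exact ⟨h, by rw [res_of_mem h, e]⟩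
  · have hu0 : aeval x u ≠ 0 := fun h => hu.ne_zero (hinj u h)
    obtain ⟨p, q, hq, e⟩ : (aeval x u)⁻¹ ∈ V := htop ▸ ValuationSubring.mem_top _
    rw [inv_mul_eq_iff_eq_mul₀ hu0, ← map_mul, ← sub_eq_zero, ← map_sub] at e
    exact hq ⟨p, sub_eq_zero.1 (hinj _ e)⟩

end

section

variable {K Ω ι κ : Type*} [Field K] [Algebra ℂ K] [Field Ω] [Algebra ℂ Ω] {V : ValuationSubring K}
  {φ : V →+* Ω} {m : ℕ}

/-- A family of coordinates beginning with three distinguished ones. -/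
def coord {R : Type*} (T : Fin m → R) (a b c : R) : Option (Option (Option (Fin m))) → R :=
  fun i => i.elim a fun i => i.elim b fun i => i.elim c T

/-- The coefficient of the correspondence. -/
def powProd {R : Type*} [CommRing R] (T : Fin m → R) : R := ∏ i, (T i ^ 5 - 1)

lemma coord_mem_iff {R : Type*} {S : Set R} {T : Fin m → R} {a b c : R} :
    (∀ i, coord T a b c i ∈ S) ↔ a ∈ S ∧ b ∈ S ∧ c ∈ S ∧ ∀ i, T i ∈ S := by
  simp only [Option.forall, coord, Option.elim]

lemma comp_coord {R S : Type*} (f : R → S) (T : Fin m → R) (a b c : R) :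
    (fun i => f (coord T a b c i)) = coord (fun i => f (T i)) (f a) (f b) (f c) := by
  funext i
  rcases i with _ | _ | _ | i <;> rfl

lemma card_coord : Fintype.card (Option (Option (Option (Fin m)))) = m + 3 := by simp

lemma powProd_mem {R : Type*} [Field R] {F : Subfield R} {T : Fin m → R} (hT : ∀ i, T i ∈ F) :
    powProd T ∈ F :=
  prod_mem fun i _ => sub_mem (pow_mem (hT i) 5) (one_mem F)

lemma map_powProd {R S : Type*} [CommRing R] [CommRing S] (f : R →+* S) (T : Fin m → R) :
    f (powProd T) = powProd fun i => f (T i) := by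
  simp [powProd, map_prod]

lemma IsPlace.res_powProd (hφ : IsPlace φ) {T : Fin m → K} (hT : ∀ i, T i ∈ V) :
    powProd T ∈ V ∧ res φ (powProd T) = powProd fun i => res φ (T i) := by
  have h := hφ.aeval hT (powProd MvPolynomial.X)
  rw [← AlgHom.coe_toRingHom, ← AlgHom.coe_toRingHom, map_powProd, map_powProd] at h
  aesop

omit [Algebra ℂ K] [Algebra ℂ Ω] in
/-- Residues of corresponding points correspond. -/
lemma IsCorr.res {p x₁ x₂ x₃ y₀ y₂ y₃ : K} (h : IsCorr p x₁ x₂ x₃ y₀ y₂ y₃) (hp : p ∈ V)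
    (h1 : x₁ ∈ V) (h2 : x₂ ∈ V) (h3 : x₃ ∈ V) (k0 : y₀ ∈ V) (k2 : y₂ ∈ V) (k3 : y₃ ∈ V) :
    IsCorr (res φ p) (res φ x₁) (res φ x₂) (res φ x₃) (res φ y₀) (res φ y₂) (res φ y₃) := by
  have h' : IsCorr (⟨p, hp⟩ : V) ⟨x₁, h1⟩ ⟨x₂, h2⟩ ⟨x₃, h3⟩ ⟨y₀, k0⟩ ⟨y₂, k2⟩ ⟨y₃, k3⟩ :=
    ⟨Subtype.ext h.eq₃, Subtype.ext h.eq₀, Subtype.ext h.eq₂⟩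
  simpa only [res_of_mem hp, res_of_mem h1, res_of_mem h2, res_of_mem h3, res_of_mem k0, res_of_mem k2,
    res_of_mem k3] using h'.map φ

omit [Algebra ℂ K] in
lemma IsCorr.unique {p x₁ x₂ x₃ y₀ y₂ y₃ y₀' y₂' y₃' : K} (h : IsCorr p x₁ x₂ x₃ y₀ y₂ y₃)
    (h' : IsCorr p x₁ x₂ x₃ y₀' y₂' y₃') (hp : p ≠ 0)
    (hA : x₁ * x₂ * x₃ + x₁ ^ 2 - p * x₃ - x₂ ^ 3 ≠ 0) : y₀' = y₀ ∧ y₂' = y₂ ∧ y₃' = y₃ := by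
  have e3 := mul_left_cancel₀ hA (h'.eq₃.trans h.eq₃.symm)
  subst e3
  have e0 := mul_left_cancel₀ hp (h'.eq₀.trans h.eq₀.symm)
  subst e0
  exact ⟨rfl, mul_left_cancel₀ hp (h'.eq₂.trans h.eq₂.symm), rfl⟩

lemma encard_range_le [Fintype κ] {α : Type*} (f : κ → α) : (Set.range f).encard ≤ Fintype.card κ := by
  rw [← Set.image_univ]
  refine (Set.encard_image_le _ _).trans ?_
  simp

lemma powProd_ne_zero {T : Fin m → Ω} (h : ∀ i, T i ∉ acl (∅ : Set Ω)) : ∀ i, T i ^ 5 - 1 ≠ 0 :=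
  fun i h0 => h i ((algClosedIn_acl _).of_pow (n := 5) (by norm_num) (by
    rw [sub_eq_zero.1 h0]; aesop))

variable [IsAlgClosed Ω]

/-- The forward map contracts a divisor with the prescribed residue field. -/
theorem exists_mem_divSet {T : Fin m → K} {x₁ x₂ x₃ y₀ y₂ y₃ : K} (hx : IsGen (coord T x₁ x₂ x₃))
    (hy : IsGen (coord T y₀ y₂ y₃)) (h : IsCorr (powProd T) x₁ x₂ x₃ y₀ y₂ y₃)
    {b : Option (Option (Fin m)) → Ω} (hb : Free b) :
    ∃ V, V ∈ DivSet Ω m (coord T x₁ x₂ x₃) ∧ V ∉ DivSet Ω m (coord T y₀ y₂ y₃) := by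
  set s := b none with hs
  set R : Fin m → Ω := fun i => b (some (some i)) with hR
  have hRf : ∀ i, R i ∉ acl (∅ : Set Ω) := fun i => hb.notMem_empty _
  obtain ⟨X, hX, hX0⟩ := IsLyness.exists_of_zero (s := b (some none)) (l := (1 : Ω))
    (fun h0 => hb.notMem_empty (some none) (h0 ▸ zero_mem _))
    (fun h0 => hb.notMem_empty (some none)
      (by rw [eq_neg_of_add_eq_zero_right h0]; aesop)) one_ne_zero
  have hb' : b = fun i : Option (Option (Fin m)) => i.elim s fun i => i.elim (X 0) R := by
    funext i
    rcases i with _ | _ | i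
    exacts [rfl, hX0.symm, rfl]
  have hp : powProd R ≠ 0 := Finset.prod_ne_zero_iff.2 fun i _ => powProd_ne_zero hRf i
  obtain ⟨ρ, hρ⟩ := IsAlgClosed.exists_pow_nat_eq (powProd R * hfun X) (n := 5) (by norm_num)
  have hT : IsTuple 1 R X ρ := ⟨hX, hX0 ▸ hb.notMem_empty _, powProd_ne_zero hRf, by
    rw [hρ, zpow_one]; rfl⟩
  obtain ⟨c₀, c₂, c₃, hcX, hcY, hc3, hcd, hciff⟩ := hX.exists_curve hp hρ
  set t : Set Ω := insert (X 0) (Set.range R) with ht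
  have hk := algClosedIn_acl t
  have hpk : ∀ {t : Set Ω}, (∀ i, R i ∈ acl t) → powProd R ∈ acl t := powProd_mem
  have hRt : ∀ i, R i ∈ acl t := fun i => subset_acl _ (.inr ⟨i, rfl⟩)
  obtain ⟨a1, a2⟩ := hT.mem_all hk (subset_acl _ (.inl rfl)) hRt
  obtain ⟨hc0k, hc2k, hc3k⟩ := (hciff _ (hpk hRt)).1 ⟨a2, a1⟩
  have hsk : s ∉ acl t := by
    refine fun hst => hb none (acl_mono ?_ hst)
    grind
  obtain ⟨u₁, u₂, hu, hA⟩ := exists_isCorr_of_curve hk (hpk hRt) hc0k hc2k hc3k hcX hcY hc3 hcd hsk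
  have hu2 : u₂ = (s - powProd R * c₀) / c₃ := by
    rw [eq_div_iff hc3]; linear_combination hu.eq₀
  have hmem : ∀ F : Subfield Ω, (∀ i, R i ∈ F) → (∀ i, X i ∈ F) → ρ ∈ F → s ∈ F →
      ∀ i, coord R u₁ u₂ s i ∈ (F : Set Ω) := fun F f1 f2 f3 f4 => by
    have fp : powProd R ∈ F := powProd_mem f1
    obtain ⟨g0, g2, g3⟩ := (hciff F fp).1 ⟨f3, f2⟩
    have gu : u₂ ∈ F := hu2 ▸ div_mem (sub_mem f4 (mul_mem fp g0)) g3
    exact coord_mem_iff.2 ⟨hu.x₁_eq ▸ sub_mem (mul_mem (mul_mem fp g0) gu) (mul_mem fp g2), gu, f4, f1⟩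
  have hmem' : ∀ F : Subfield Ω, (∀ i, coord R u₁ u₂ s i ∈ (F : Set Ω)) →
      (∀ i, R i ∈ F) ∧ (∀ i, X i ∈ F) ∧ ρ ∈ F ∧ s ∈ F := fun F f => by
    obtain ⟨f1, f2, f3, f4⟩ := coord_mem_iff.1 f
    have fp : powProd R ∈ F := powProd_mem f4
    obtain ⟨g1, g2⟩ := (hciff F fp).2 (hu.y_mem hp hA fp f1 f2 f3)
    exact ⟨f4, g2, g1, f3⟩
  have hrc : ∀ t : Set Ω, (∀ i, coord R u₁ u₂ s i ∈ acl t) →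
      (Fintype.card (Option (Option (Option (Fin m)))) : ℕ∞) ≤ t.encard + 1 := fun t h => by
    obtain ⟨f1, f2, f3, f4⟩ := hmem' (acl t) h
    have := hb.card_le (t := t) (by
      rintro (_ | _ | i)
      exacts [f4, hX0 ▸ f2 0, f1 i])
    refine le_trans ?_ (add_le_add_left this 1)
    simp
  have hle : ∀ t : Set Ω, t.encard ≤ (m + 2 : ℕ) →
      ¬ (Fintype.card (Option (Option (Option (Fin m)))) : ℕ∞) ≤ t.encard := fun t h h' => by
    have := h'.trans h
    rw [card_coord, Nat.cast_le] at this
    omega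
  have hrf : ¬ Free (coord R u₁ u₂ s) := fun hf => by
    refine hle (Set.range b) ((encard_range_le b).trans (by rw [show Fintype.card (Option (Option (Fin m))) = m + 2 by simp])) (hf.card_le ?_)
    have hRb : ∀ i, R i ∈ acl (Set.range b) := fun i => subset_acl _ ⟨_, rfl⟩
    obtain ⟨a1, a2⟩ := hT.mem_all (algClosedIn_acl (Set.range b)) (subset_acl _ ⟨some none, hX0.symm⟩) hRb
    exact hmem _ hRb a1 a2 (subset_acl _ ⟨none, rfl⟩)
  obtain ⟨V, φ, hφ, hdiv, hres⟩ := exists_place hx hrf hrc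
  refine ⟨V, ⟨φ, hφ, ⟨R, X, ρ, s, hT, hb' ▸ hb, ?_⟩, hdiv⟩, ?_⟩
  · rw [hdiv.range_eq hφ hx]
    simp only [hres]
    refine congrArg _ (le_antisymm (cadj_le ?_ ?_) (Subfield.closure_le.2 (Set.insert_subset ?_ ?_)))
    · exact fun c => Subfield.subset_closure (.inr (subset_tupleField.1 (algebraMap_mem_cadj c)))
    · obtain ⟨-, i1, i2, i3⟩ := subset_tupleField (T := R) (X := X) (ρ := ρ)
      exact Set.range_subset_iff.2 (hmem _ (fun i => Subfield.subset_closure (.inr (i1 i)))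
        (fun i => Subfield.subset_closure (.inr (i2 i))) (Subfield.subset_closure (.inr i3))
        (Subfield.subset_closure (.inl rfl)))
    · exact (hmem' (cadj (Set.range (coord R u₁ u₂ s))) fun i => subset_cadj _ (Set.mem_range_self i)).2.2.2
    · obtain ⟨f1, f2, f3, -⟩ := hmem' (cadj (Set.range (coord R u₁ u₂ s))) fun i => subset_cadj _ (Set.mem_range_self i)
      exact tupleField_le algebraMap_mem_cadj f1 f2 f3
  · rintro ⟨φ', hφ', -, hd'⟩
    have hd := hd'.congr hy hφ' hφ
    obtain ⟨v1, v2, v3, vT⟩ := coord_mem_iff.1 hdiv.mem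
    obtain ⟨w0, w2, w3, -⟩ := coord_mem_iff.1 hd.mem
    have hr := h.res (φ := φ) (hφ.res_powProd vT).1 v1 v2 v3 w0 w2 w3
    have hTR : ∀ i, res φ (T i) = R i := fun i => hres (some (some (some i)))
    have r1 : res φ x₁ = u₁ := hres none
    have r2 : res φ x₂ = u₂ := hres (some none)
    have r3 : res φ x₃ = s := hres (some (some none))
    rw [(hφ.res_powProd vT).2, funext hTR, r1, r2, r3] at hr
    obtain ⟨e0, e2, e3⟩ := hu.unique hr hp hA
    have := hd.card_le t (by
      refine coord_mem_iff (S := {a | res φ a ∈ acl t}).2 ⟨?_, ?_, ?_, fun i => ?_⟩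
      · grind
      · grind
      · grind
      grind)
    rw [card_coord, Nat.cast_add] at this
    have ht1 : t.encard ≤ (m + 1 : ℕ) := (Set.encard_insert_le _ _).trans (by
      simpa using add_le_add_left (encard_range_le R) 1)
    have := this.trans (add_le_add_left ht1 1)
    norm_cast at this
    omega

end

section

variable {K Ω : Type*} [Field K] [Algebra ℂ K] [Field Ω] [Algebra ℂ Ω] {V : ValuationSubring K}
  {φ : V →+* Ω} {m : ℕ}

omit [Algebra ℂ K] [Algebra ℂ Ω] in
lemma res_coe (a : V) : res φ a = φ a := res_of_mem a.2

variable [IsAlgClosed Ω] [Nonempty (Fin m)]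

/-- The backward map contracts no good divisor. -/
theorem IsDiv.of_isCorr {T : Fin m → K} {x₁ x₂ x₃ y₀ y₂ y₃ : K} (hy : IsGen (coord T y₀ y₂ y₃))
    (h : IsCorr (powProd T) x₁ x₂ x₃ y₀ y₂ y₃)
    (hX : powProd T * y₀ * (y₂ * y₃ + powProd T * y₀ ^ 2) - y₂ + y₃ ^ 2 ≠ 0) (hp0 : powProd T ≠ 0)
    (hφ : IsPlace φ) (hG : Good m φ) (hd : IsDiv φ (coord T y₀ y₂ y₃)) :
    IsDiv φ (coord T x₁ x₂ x₃) := by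
  have hloc := hφ.isLocalHom
  have hΔ := hd.range_eq hφ hy
  rw [comp_coord] at hΔ
  obtain ⟨w0, w2, w3, wT⟩ := coord_mem_iff.1 hd.mem
  obtain ⟨wp, hpR⟩ := hφ.res_powProd wT
  set R : Fin m → Ω := fun i => res φ (T i) with hR
  obtain ⟨p, hp⟩ : ∃ p, p = powProd T := ⟨_, rfl⟩
  rw [← hp] at h hX wp hpR hp0
  obtain ⟨q, hq⟩ : ∃ q, q = powProd R := ⟨_, rfl⟩
  rw [← hq] at hpR
  obtain ⟨c₀, h0⟩ : ∃ c, c = res φ y₀ := ⟨_, rfl⟩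
  obtain ⟨c₂, h2⟩ : ∃ c, c = res φ y₂ := ⟨_, rfl⟩
  obtain ⟨c₃, h3⟩ : ∃ c, c = res φ y₃ := ⟨_, rfl⟩
  rw [← h0, ← h2, ← h3] at hΔ
  have hno : ∀ {t : Set Ω} (α β : Ω), t.encard ≤ m → (∀ i, R i ∈ acl t) → ∀ F : Subfield Ω,
      F = Subfield.closure (insert β (insert α (acl t : Set Ω))) → c₀ ∈ F → c₂ ∈ F → c₃ ∈ F →
      False := by
    rintro t α β ht f1 _ rfl g0 g2 g3
    refine hG.not_subset ht (α := α) (β := β) (hΔ ▸ cadj_le (fun c => ?_)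
      (Set.range_subset_iff.2 (coord_mem_iff.2 ⟨g0, g2, g3, fun i => ?_⟩)))
    exacts [Subfield.subset_closure (.inr (.inr (algebraMap_mem_acl c))),
      Subfield.subset_closure (.inr (.inr (f1 i)))]
  have hRf : Free R := fun i hi => by
    refine hno (t := insert c₀ (R '' {i}ᶜ)) c₂ c₃ ?_ (fun j => ?_) _ rfl
      (Subfield.subset_closure (.inr (.inr (subset_acl _ (.inl rfl)))))
      (Subfield.subset_closure (.inr (.inl rfl))) (Subfield.subset_closure (.inl rfl))
    · refine (Set.encard_insert_le _ _).trans ((add_le_add_left (Set.encard_image_le _ _) 1).trans ?_)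
      rw [← Set.encard_singleton i, add_comm, Set.encard_add_encard_compl]
      simp
    · refine acl_mono (Set.subset_insert _ _) ?_
      by_cases hj : j = i
      exacts [hj ▸ hi, subset_acl _ ⟨j, hj, rfl⟩]
  have hRn := powProd_ne_zero hRf.notMem_empty
  have hq0 : q ≠ 0 := hq ▸ Finset.prod_ne_zero_iff.2 fun i _ => hRn i
  set t : Set Ω := Set.range R with ht
  have htm : t.encard ≤ m := by simpa using encard_range_le R
  have hRt : ∀ i, R i ∈ acl t := fun i => subset_acl _ ⟨i, rfl⟩
  have hqt : ∀ {F : Subfield Ω}, (∀ i, R i ∈ F) → q ∈ F := fun f => hq ▸ powProd_mem f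
  have hk := algClosedIn_acl t
  have hmt : ∀ {α β a : Ω}, a ∈ acl t → a ∈ Subfield.closure (insert β (insert α (acl t : Set Ω))) :=
    fun ha => Subfield.subset_closure (.inr (.inr ha))
  have hXr : res φ (p * y₀ * (y₂ * y₃ + p * y₀ ^ 2) - y₂ + y₃ ^ 2) =
      q * c₀ * (c₂ * c₃ + q * c₀ ^ 2) - c₂ + c₃ ^ 2 := by
    rw [h0, h2, h3, ← hpR]
    lift y₀ to V using w0
    lift y₂ to V using w2
    lift y₃ to V using w3
    lift p to V using wp
    norm_cast
    simp only [res_coe, map_add, map_sub, map_mul, map_pow]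
  have hXn : q * c₀ * (c₂ * c₃ + q * c₀ ^ 2) - c₂ + c₃ ^ 2 ≠ 0 := fun e => by
    by_cases hd0 : 1 - q * c₀ * c₃ = 0
    · have e5 : q * c₀ ^ 3 * q + c₃ ^ 2 = 0 := by grind
      have e4 : (q ^ 4) * c₀ ^ 5 = -1 := by
        grind
      have m0 : c₀ ∈ acl t := hk.of_pow (n := 5) (by norm_num) (by
        rw [eq_div_of_mul_eq (pow_ne_zero 4 hq0) ((mul_comm _ _).trans e4)]
        exact div_mem (neg_mem (one_mem _)) (pow_mem (hqt hRt) 4))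
      have m3 : c₃ ∈ acl t := hk.of_pow (n := 2) (by norm_num) (by
        rw [eq_neg_of_add_eq_zero_right e5]
        exact neg_mem (mul_mem (mul_mem (hqt hRt) (pow_mem m0 3)) (hqt hRt)))
      exact hno c₂ c₂ htm hRt _ rfl (hmt m0) (Subfield.subset_closure (.inl rfl)) (hmt m3)
    · have e2 : c₂ * (1 - q * c₀ * c₃) = q * c₀ ^ 3 * q + c₃ ^ 2 := by grind
      have g0 : c₀ ∈ Subfield.closure (insert c₃ (insert c₀ (acl t : Set Ω))) :=
        Subfield.subset_closure (.inr (.inl rfl))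
      have g3 : c₃ ∈ Subfield.closure (insert c₃ (insert c₀ (acl t : Set Ω))) :=
        Subfield.subset_closure (.inl rfl)
      refine hno c₀ c₃ htm hRt _ rfl g0 ?_ g3
      rw [eq_div_of_mul_eq hd0 e2]
      have gq := hmt (α := c₀) (β := c₃) (hqt hRt)
      exact div_mem (add_mem (mul_mem (mul_mem gq (pow_mem g0 3)) gq) (pow_mem g3 2))
        (sub_mem (one_mem _) (mul_mem (mul_mem gq g0) g3))
  obtain ⟨v1, v2, v3⟩ := h.x_mem hp0 hX (F := V.toSubring) wp w0 w2 w3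
    (inv_mem_of_res (φ := φ) (hXr ▸ hXn))
  have hc := h.res (φ := φ) wp v1 v2 v3 w0 w2 w3
  rw [hpR, ← h0, ← h2, ← h3] at hc
  have hv := coord_mem_iff.2 ⟨v1, v2, v3, wT⟩
  obtain ⟨u₁, hu1⟩ : ∃ c, c = res φ x₁ := ⟨_, rfl⟩
  obtain ⟨u₂, hu2⟩ : ∃ c, c = res φ x₂ := ⟨_, rfl⟩
  obtain ⟨u₃, hu3⟩ : ∃ c, c = res φ x₃ := ⟨_, rfl⟩
  rw [← hu1, ← hu2, ← hu3] at hc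
  by_cases hA : u₁ * u₂ * u₃ + u₁ ^ 2 - q * u₃ - u₂ ^ 3 = 0
  · exfalso
    have hB := hc.eq₃
    rw [hA, zero_mul] at hB
    have hB' := hB.symm
    by_cases hz : (u₂ ^ 2 - u₁ * u₃) * u₁ * u₂ * u₃ = 0
    · obtain ⟨m1, m2, m3⟩ := hk.mem_of_curve hq0 (hqt hRt) hA hB' hz
      have g3 : c₃ ∈ Subfield.closure (insert c₃ (insert c₃ (acl t : Set Ω))) :=
        Subfield.subset_closure (.inl rfl)
      obtain ⟨g0, g2⟩ := hc.y_mem' hq0 (hmt (hqt hRt)) (hmt m1) (hmt m2) (hmt m3) g3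
      grind
    · obtain ⟨X, ρ, hL, hρ, hiff⟩ := exists_isLyness_of_curve hq0 hA hB' hz
      have hcl : ∀ F : Subfield Ω, (∀ i, R i ∈ F) → (∀ i, X i ∈ F) → ρ ∈ F → c₃ ∈ F →
          ∀ i, coord R c₀ c₂ c₃ i ∈ (F : Set Ω) := fun F f1 f2 f3 f4 => by
        obtain ⟨g1, g2, g3⟩ := (hiff F (hqt f1)).1 ⟨f3, f2⟩
        obtain ⟨g0, g2⟩ := hc.y_mem' hq0 (hqt f1) g1 g2 g3 f4
        exact coord_mem_iff.2 ⟨g0, g2, f4, f1⟩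
      have hbase : ∀ {t : Set Ω}, (∀ i, R i ∈ acl t) → X 0 ∈ acl t → (∀ i, X i ∈ acl t) ∧ ρ ∈ acl t :=
        fun {t} f1 f2 => by
          have := hL.mem_all (algClosedIn_acl t) (one_mem _) f2
          refine ⟨this, (algClosedIn_acl t).of_pow (n := 5) (by norm_num) ?_⟩
          rw [hρ]
          exact mul_mem (zpow_mem (hqt f1) _) (div_mem (mul_mem (pow_mem (this 1) 3) (this 4))
            (mul_mem (pow_mem (this 0) 3) (this 2)))
      have hf : Free fun i : Option (Option (Fin m)) => i.elim c₃ fun i => i.elim (X 0) R := by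
        refine free_of_card_le fun t f => ?_
        have f1 : ∀ i, R i ∈ acl t := fun i => f (some (some i))
        obtain ⟨f2, f3⟩ := hbase f1 (f (some none))
        have := hd.card_le t (by
          have := hcl _ f1 f2 f3 (f none)
          rw [h0, h2, h3] at this
          intro i
          have hi := this i
          rwa [← comp_coord (res φ)] at hi)
        aesop
      have hT : IsTuple (-2) R X ρ := ⟨hL, hf.notMem_empty (some none), hRn, by rw [hρ, hq]; rfl⟩
      obtain ⟨T', X', ρ', s', h1', h2', h3'⟩ := hG
      refine h1'.closure_ne h2' hT hf (SetLike.coe_injective ?_)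
      rw [← h3', hΔ]
      set Δ := cadj (Set.range (coord R c₀ c₂ c₃))
      obtain ⟨g0, g2, g3, gR⟩ := coord_mem_iff (S := (Δ : Set Ω)).1
        fun i => subset_cadj _ (Set.mem_range_self i)
      refine congrArg _ (le_antisymm (Subfield.closure_le.2 (Set.insert_subset ?_ ?_)) (cadj_le ?_ ?_))
      · exact g3
      · obtain ⟨m1, m2, m3⟩ := hc.x_mem hq0 hXn (F := Δ.toSubring) (hqt gR) g0 g2 g3
          (inv_mem (s := Δ) (add_mem (sub_mem (mul_mem (mul_mem (hqt gR) g0) (add_mem (mul_mem g2 g3)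
            (mul_mem (hqt gR) (pow_mem g0 2)))) g2) (pow_mem g3 2)))
        obtain ⟨f3, f2⟩ := (hiff Δ (hqt gR)).2 ⟨m1, m2, m3⟩
        exact tupleField_le algebraMap_mem_cadj gR f2 f3
      · exact fun c => Subfield.subset_closure (.inr (subset_tupleField.1 (algebraMap_mem_cadj c)))
      · obtain ⟨-, i1, i2, i3⟩ := subset_tupleField (T := R) (X := X) (ρ := ρ)
        exact Set.range_subset_iff.2 (hcl _ (fun i => Subfield.subset_closure (.inr (i1 i)))
          (fun i => Subfield.subset_closure (.inr (i2 i))) (Subfield.subset_closure (.inr i3))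
          (Subfield.subset_closure (.inl rfl)))
  · refine hd.span hv (coord_mem_iff (S := {a | res φ a ∈ acl _}).2 ?_)
    have hr : ∀ i, res φ (coord T x₁ x₂ x₃ i) ∈ acl (Set.range fun i => res φ (coord T x₁ x₂ x₃ i)) :=
      fun i => subset_acl _ (Set.mem_range_self i)
    have r4 : ∀ i, R i ∈ acl (Set.range fun i => res φ (coord T x₁ x₂ x₃ i)) :=
      fun i => hr (some (some (some i)))
    obtain ⟨g0, g2, g3⟩ := hc.y_mem hq0 hA (hqt r4) (hu1 ▸ hr none) (hu2 ▸ hr (some none))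
      (hu3 ▸ hr (some (some none)))
    grind

end

section

variable {K ι κ : Type*} [Field K] [Algebra ℂ K] {m : ℕ}

lemma isGen_X (ι : Type*) :
    IsGen fun i : ι => algebraMap (MvPolynomial ι ℂ) (FractionRing (MvPolynomial ι ℂ)) (X i) := by
  have hae : ∀ p : MvPolynomial ι ℂ, MvPolynomial.aeval (fun i : ι => algebraMap (MvPolynomial ι ℂ)
      (FractionRing (MvPolynomial ι ℂ)) (X i)) p = algebraMap _ _ p := fun p => by
    exact (MvPolynomial.aeval_algebraMap_apply _ X p).trans (by aesop)
  refine ⟨free_of_algebraicIndependent ((injective_iff_map_eq_zero _).2 fun p hp => ?_), fun f => ?_⟩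
  · aesop
  · obtain ⟨p, q, -, rfl⟩ := IsFractionRing.div_surjective (A := MvPolynomial ι ℂ) f
    rw [← hae, ← hae]
    exact div_mem (aeval_mem_cadj (fun i => subset_cadj _ (Set.mem_range_self i)) p)
      (aeval_mem_cadj (fun i => subset_cadj _ (Set.mem_range_self i)) q)

lemma IsGen.comp_equiv {x : ι → K} (hx : IsGen x) (e : κ ≃ ι) : IsGen (x ∘ e) :=
  ⟨hx.free.comp e.injective, by rw [e.surjective.range_comp]; exact hx.mem⟩

lemma IsGen.exists_frac {x : ι → K} (hx : IsGen x) :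
    ∃ θ : FractionRing (MvPolynomial ι ℂ) ≃ₐ[ℂ] K, ∀ i, θ (algebraMap (MvPolynomial ι ℂ) _ (X i)) = x i := by
  let θ : FractionRing (MvPolynomial ι ℂ) →ₐ[ℂ] K :=
    IsFractionRing.liftAlgHom (g := MvPolynomial.aeval x) hx.free.algebraicIndependent
  have hθ : ∀ i, θ (algebraMap (MvPolynomial ι ℂ) _ (X i)) = x i := fun i => by
    have h : Function.Injective (MvPolynomial.aeval x : MvPolynomial ι ℂ →ₐ[ℂ] K).toRingHom :=
      hx.free.algebraicIndependent
    refine (IsFractionRing.lift_algebraMap (K := FractionRing (MvPolynomial ι ℂ)) h (X i)).trans ?_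
    aesop
  refine ⟨AlgEquiv.ofBijective θ ⟨θ.toRingHom.injective, fun f => ?_⟩, hθ⟩
  have h : cadj (Set.range x) ≤ θ.toRingHom.fieldRange :=
    cadj_le (fun c => ⟨algebraMap ℂ _ c, θ.commutes c⟩) (Set.range_subset_iff.2 fun i => ⟨_, hθ i⟩)
  exact h (hx.mem f)

lemma IsGen.exists_algEquiv {x y : ι → K} (hx : IsGen x) (hy : IsGen y) :
    ∃ ψ : K ≃ₐ[ℂ] K, ψ ∘ x = y := by
  obtain ⟨θ, hθ⟩ := hx.exists_frac
  obtain ⟨η, hη⟩ := hy.exists_frac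
  exact ⟨θ.symm.trans η, funext fun i => by simp [← hθ i, hη i]⟩

/-- Nonvanishing of a polynomial expression may be tested at a point. -/
lemma ne_zero_of_eval {x : ι → K} (hx : Free x) (P : MvPolynomial ι ℂ) (c : ι → ℂ)
    (h : MvPolynomial.aeval c P ≠ 0) : MvPolynomial.aeval x P ≠ 0 := fun h0 =>
  h (by rw [(injective_iff_map_eq_zero _).1 hx.algebraicIndependent P h0, map_zero])

lemma aeval_powProd {R : Type*} [CommRing R] [Algebra ℂ R] (T : Fin m → R) (a b c : R) :
    MvPolynomial.aeval (coord T a b c) (powProd fun i =>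
      (X (some (some (some i))) : MvPolynomial _ ℂ)) = powProd T := by
  rw [← AlgHom.coe_toRingHom, map_powProd]
  simp [coord]

/-- The forward map is defined and dominant at the generic point. -/
lemma IsGen.exists_isCorr {T : Fin m → K} {x₁ x₂ x₃ : K} (hx : IsGen (coord T x₁ x₂ x₃)) :
    powProd T ≠ 0 ∧ ∃ y₀ y₂ y₃, IsCorr (powProd T) x₁ x₂ x₃ y₀ y₂ y₃ ∧
      powProd T * y₀ * (y₂ * y₃ + powProd T * y₀ ^ 2) - y₂ + y₃ ^ 2 ≠ 0 := by
  obtain ⟨r, hr⟩ := IsAlgClosed.exists_pow_nat_eq (2 : ℂ) (n := 5) (by norm_num)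
  have hr1 : powProd (fun _ : Fin m => r) = 1 := by
    simp only [powProd, hr]; norm_num
  set q : MvPolynomial (Option (Option (Option (Fin m)))) ℂ := powProd fun i => X (some (some (some i)))
  set a : MvPolynomial (Option (Option (Option (Fin m)))) ℂ := X none
  set b : MvPolynomial (Option (Option (Option (Fin m)))) ℂ := X (some none)
  set c : MvPolynomial (Option (Option (Option (Fin m)))) ℂ := X (some (some none))
  have ht := fun P => ne_zero_of_eval hx.free P (coord (fun _ => r) 1 0 0)
  have e1 : MvPolynomial.aeval (coord T x₁ x₂ x₃) q = powProd T := aeval_powProd _ _ _ _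
  have e2 : MvPolynomial.aeval (coord (fun _ => r) (1 : ℂ) 0 0) q = 1 := (aeval_powProd _ _ _ _).trans hr1
  have f1 : MvPolynomial.aeval (coord T x₁ x₂ x₃) a = x₁ := MvPolynomial.aeval_X _ _
  have f2 : MvPolynomial.aeval (coord T x₁ x₂ x₃) b = x₂ := MvPolynomial.aeval_X _ _
  have f3 : MvPolynomial.aeval (coord T x₁ x₂ x₃) c = x₃ := MvPolynomial.aeval_X _ _
  have g1 : MvPolynomial.aeval (coord (fun _ : Fin m => r) (1 : ℂ) 0 0) a = 1 := MvPolynomial.aeval_X _ _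
  have g2 : MvPolynomial.aeval (coord (fun _ : Fin m => r) (1 : ℂ) 0 0) b = 0 := MvPolynomial.aeval_X _ _
  have g3 : MvPolynomial.aeval (coord (fun _ : Fin m => r) (1 : ℂ) 0 0) c = 0 := MvPolynomial.aeval_X _ _
  have hp := ht q (by grind)
  have hA := ht (a * b * c + a ^ 2 - q * c - b ^ 3) (by
    grind)
  have hQ := ht (
    let A := a * b * c + a ^ 2 - q * c - b ^ 3
    let B := a * c ^ 2 + a * b - b ^ 2 * c - q
    let u := A * c - B * b
    u * ((u * b - A * a) * B + u ^ 2) - A ^ 2 * (u * b - A * a) + A * q * B ^ 2) (by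
    aesop)
  simp only [map_add, map_sub, map_mul, map_pow, e1, f1, f2, f3] at hp hA hQ
  obtain ⟨y₀, y₂, y₃, h⟩ := isCorr_of_ne hp hA
  refine ⟨hp, y₀, y₂, y₃, h, fun h0 => hQ ?_⟩
  have h3 := h.eq₃
  set A := x₁ * x₂ * x₃ + x₁ ^ 2 - powProd T * x₃ - x₂ ^ 3
  set B := x₁ * x₃ ^ 2 + x₁ * x₂ - x₂ ^ 2 * x₃ - powProd T
  have hu : A * x₃ - B * x₂ = A * (powProd T * y₀) := by linear_combination x₂ * h3 - A * h.eq₀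
  rw [hu, show A * (powProd T * y₀) * x₂ - A * x₁ = A * (powProd T * y₂) by
    linear_combination -A * h.eq₂, ← h3]
  linear_combination A ^ 3 * powProd T * h0

lemma IsGen.of_isCorr {T : Fin m → K} {x₁ x₂ x₃ y₀ y₂ y₃ : K} (hx : IsGen (coord T x₁ x₂ x₃))
    (hp : powProd T ≠ 0) (h : IsCorr (powProd T) x₁ x₂ x₃ y₀ y₂ y₃)
    (hX : powProd T * y₀ * (y₂ * y₃ + powProd T * y₀ ^ 2) - y₂ + y₃ ^ 2 ≠ 0) :
    IsGen (coord T y₀ y₂ y₃) := by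
  have key : ∀ F : Subfield K, (∀ i, coord T y₀ y₂ y₃ i ∈ (F : Set K)) →
      ∀ i, coord T x₁ x₂ x₃ i ∈ (F : Set K) := fun F f => by
    obtain ⟨f0, f2, f3, fT⟩ := coord_mem_iff.1 f
    have fp : powProd T ∈ F := powProd_mem fT
    obtain ⟨m1, m2, m3⟩ := h.x_mem hp hX (F := F.toSubring) fp f0 f2 f3
      (inv_mem (s := F) (add_mem (sub_mem (mul_mem (mul_mem fp f0) (add_mem (mul_mem f2 f3)
        (mul_mem fp (pow_mem f0 2)))) f2) (pow_mem f3 2)))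
    exact coord_mem_iff.2 ⟨m1, m2, m3, fT⟩
  refine ⟨free_of_card_le fun t ht => hx.free.card_le (key _ ht), fun f => ?_⟩
  exact cadj_le algebraMap_mem_cadj (Set.range_subset_iff.2 (key _ fun i =>
    subset_cadj _ (Set.mem_range_self i))) (hx.mem f)

end

/-- Stabilization is not surjective on abelianizations, in a choice of coordinates. -/
theorem not_surjective_of_stab {K K' : Type*} [Field K] [Algebra ℂ K] [Field K'] [Algebra ℂ K'] {m : ℕ}
    [Nonempty (Fin m)] (e : K' →ₐ[ℂ] K) (z : K) {x : Option (Option (Fin m)) → K'} (hx : IsGen x)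
    (hz : IsGen fun i : Option (Option (Option (Fin m))) => i.elim z (e ∘ x))
    (f : (K' ≃ₐ[ℂ] K') →* (K ≃ₐ[ℂ] K)) (hf : ∀ g a, f g (e a) = e (g a)) (hfz : ∀ g, f g z = z) :
    ¬ Function.Surjective (Abelianization.map f) := by
  obtain ⟨T, x₁, x₂, x₃, hxc⟩ : ∃ T x₁ x₂ x₃,
      (fun i : Option (Option (Option (Fin m))) => i.elim z (e ∘ x)) = coord T x₁ x₂ x₃ :=
    ⟨fun i => e (x (some (some i))), z, e (x none), e (x (some none)), by
      funext i; rcases i with _ | _ | _ | i <;> rfl⟩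
  have hg := hz
  rw [hxc] at hg
  obtain ⟨hp, y₀, y₂, y₃, h, hX⟩ := hg.exists_isCorr
  have hy := hg.of_isCorr hp h hX
  obtain ⟨ψ, hψ⟩ := hg.exists_algEquiv hy
  have ψ0 : ψ x₁ = y₀ := congrFun hψ none
  have ψ2 : ψ x₂ = y₂ := congrFun hψ (some none)
  have ψ3 : ψ x₃ = y₃ := congrFun hψ (some (some none))
  have ψT : ∀ i, ψ (T i) = T i := fun i => congrFun hψ (some (some (some i)))
  have ψp : ψ (powProd T) = powProd T := by
    have := map_powProd (ψ : K →+* K) T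
    aesop
  refine not_surjective_of_divSet (Ω := AlgebraicClosure K) m hz f (fun g V φ hφ hG hd => ?_) ψ ?_
    fun V φ hφ hG hd => ?_
  · have h1 := hd.stab (by simp) (hx.comp g) e hz hφ hG
    convert h1 using 1
    funext i
    rcases i with _ | i
    exacts [hfz g, hf g (x i)]
  · rw [hxc, hψ]
    have hb := (hg.free.algebraicIndependent.map' (f := IsScalarTower.toAlgHom ℂ K (AlgebraicClosure K))
      (algebraMap K (AlgebraicClosure K)).injective)
    exact exists_mem_divSet hg hy h ((free_of_algebraicIndependent hb).comp (Option.some_injective _))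
  · rw [hxc] at hd ⊢
    have hT : ψ.symm ∘ T = T := funext fun i => ψ.symm_apply_eq.2 (ψT i).symm
    have hco : ψ.symm ∘ coord T x₁ x₂ x₃ = coord T (ψ.symm x₁) (ψ.symm x₂) (ψ.symm x₃) :=
      (comp_coord ψ.symm T x₁ x₂ x₃).trans (by rw [show (fun i => ψ.symm (T i)) = T from hT])
    rw [hco]
    have hc := h.map (ψ.symm : K →+* K)
    rw [← ψ0, ← ψ2, ← ψ3] at hc
    simp only [RingHom.coe_coe, AlgEquiv.symm_apply_apply] at hc
    rw [ψ.symm_apply_eq.2 ψp.symm] at hc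
    refine hd.of_isCorr hg hc (fun h0 => hX ?_) hp hφ hG
    have := congrArg ψ h0
    simpa only [map_add, map_sub, map_mul, map_pow, map_zero, ψ0, ψ2, ψ3, ψp] using this

end Cremona

/-- For any integer `n ≥ 3`, the map induced on abelianizations (first integral homology) by the
stabilization homomorphism `ι_n : Cr_n(ℂ) → Cr_{n+1}(ℂ)` is not surjective. -/
theorem stabilization_not_surjective_on_H1 (n : ℕ) (hn : 3 ≤ n)
    (ι : (RatFun ℂ n ≃ₐ[ℂ] RatFun ℂ n) →* (RatFun ℂ (n+1) ≃ₐ[ℂ] RatFun ℂ (n+1)))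
    (hι : ∀ σ, IsStabilizationOf (ι σ) σ) :
    ¬ Function.Surjective (Abelianization.map ι) := by
  obtain ⟨m, rfl⟩ : ∃ m, n = m + 2 := ⟨n - 2, by omega⟩
  have : Nonempty (Fin m) := ⟨⟨0, by omega⟩⟩
  let ε : Option (Option (Fin m)) ≃ Fin (m + 2) := Fintype.equivOfCardEq (by simp)
  have hz := (Cremona.isGen_X (Fin (m + 2 + 1))).comp_equiv
    ((Equiv.optionCongr ε).trans finSuccEquivLast.symm)
  refine Cremona.not_surjective_of_stab (stabAlg ℂ (m + 2))
    (algebraMap (MvPolynomial (Fin (m + 2 + 1)) ℂ) _ (X (Fin.last (m + 2))))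
    ((Cremona.isGen_X (Fin (m + 2))).comp_equiv ε) ?_ ι (fun σ => (hι σ).1) fun σ => (hι σ).2
  convert hz using 1
  funext i
  rcases i with _ | i
  · simp
  · have h : ∀ j, stabAlg ℂ (m + 2) (algebraMap (MvPolynomial (Fin (m + 2)) ℂ) _ (X j)) =
        algebraMap (MvPolynomial (Fin (m + 2 + 1)) ℂ) _ (X j.castSucc) := fun j => by
      have hinj : Function.Injective ((IsScalarTower.toAlgHom ℂ (MvPolynomial (Fin (m + 2 + 1)) ℂ)
          (RatFun ℂ (m + 2 + 1))).comp (rename Fin.castSucc)).toRingHom :=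
        (IsFractionRing.injective (MvPolynomial (Fin (m + 2 + 1)) ℂ) (RatFun ℂ (m + 2 + 1))).comp
          (rename_injective _ (Fin.castSucc_injective _))
      exact (IsFractionRing.lift_algebraMap (K := RatFun ℂ (m + 2)) hinj (X j)).trans (by simp)
    simp [h]
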